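/- Fix D > 0 and τ > 0. Then there exists d₀ such that for every integer d ≥ d₀ and every integer N with 2d ≤ N ≤ d^{3/2−τ} and dN even, the uniform random d-regular graph on N vertices satisfies ℙ( max{|λ_N|, λ₂} < 2√(d−1) ) ≥ 1 − N^{−D}. -/

import Mathlib

open MeasureTheory Filter Matrix
open scoped ENNReal NNReal

noncomputable section

/-- `A` is the adjacency matrix of a `d`-regular graph on `N` vertices:
a symmetric `{0,1}`-matrix with zero diagonal and all row sums equal to `d`. -/
def IsAdjMat (N d : ℕ) (A : Matrix (Fin N) (Fin N) ℝ) : Prop :=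
  A.IsSymm ∧ (∀ i, A i i = 0) ∧ (∀ i j, A i j = 0 ∨ A i j = 1) ∧ ∀ i, ∑ j, A i j = d

/-- probability of an event under the uniform measure on `d`-regular graphs on `N` vertices. -/
def PrReg (N d : ℕ) (E : Matrix (Fin N) (Fin N) ℝ → Prop) : ℝ :=
  (Nat.card {A : Matrix (Fin N) (Fin N) ℝ // IsAdjMat N d A ∧ E A} : ℝ) /
    (Nat.card {A : Matrix (Fin N) (Fin N) ℝ // IsAdjMat N d A} : ℝ)

/-- expectation of `F` under the uniform measure on `d`-regular graphs on `N` vertices. -/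
def Ereg (N d : ℕ) (F : Matrix (Fin N) (Fin N) ℝ → ℝ) : ℝ :=
  (∑ᶠ A : {A : Matrix (Fin N) (Fin N) ℝ // IsAdjMat N d A}, F A.1) /
    (Nat.card {A : Matrix (Fin N) (Fin N) ℝ // IsAdjMat N d A} : ℝ)

/-- the `k`-th largest eigenvalue (`1`-based indexing) of a symmetric matrix. -/
def eigval {N : ℕ} (A : Matrix (Fin N) (Fin N) ℝ) (k : ℕ) : ℝ :=
  if hA : A.IsHermitian then
    if h : k - 1 < N then
      hA.eigenvalues (Tuple.sort hA.eigenvalues (Fin.rev ⟨k - 1, h⟩))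
    else 0
  else 0

/-- `q = √(d(N-d)/N)`. -/
def qval (N d : ℕ) : ℝ := Real.sqrt ((d : ℝ) * ((N : ℝ) - (d : ℝ)) / (N : ℝ))

/-- the projection `P⊥ = I - e eᵀ` (complex version). -/
def Pperp (N : ℕ) : Matrix (Fin N) (Fin N) ℂ := 1 - Matrix.of fun _ _ => (N : ℂ)⁻¹

/-- the projection `P⊥ = I - e eᵀ` (real version). -/
def PperpR (N : ℕ) : Matrix (Fin N) (Fin N) ℝ := 1 - Matrix.of fun _ _ => (N : ℝ)⁻¹

/-- the Green function `G(z) = P⊥ (q⁻¹𝒜 - z)⁻¹ P⊥`. -/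
def greenM (N d : ℕ) (A : Matrix (Fin N) (Fin N) ℝ) (z : ℂ) : Matrix (Fin N) (Fin N) ℂ :=
  Pperp N * (((qval N d : ℝ) : ℂ)⁻¹ • A.map Complex.ofReal - z • 1)⁻¹ * Pperp N

/-- the normalized trace `Ḡ(z) = N⁻¹ Tr G(z)`. -/
def gbar (N d : ℕ) (A : Matrix (Fin N) (Fin N) ℝ) (z : ℂ) : ℂ :=
  (N : ℂ)⁻¹ * (greenM N d A z).trace

/-- the Stieltjes transform of the semicircle density `ϱ(x) = (2π)⁻¹ √((4-x²)₊)`. -/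
def mSC (z : ℂ) : ℂ :=
  ∫ x in (-2 : ℝ)..2, ((Real.sqrt (4 - x ^ 2) / (2 * Real.pi) : ℝ) : ℂ) / ((x : ℂ) - z)

/-- `(Δ_{ij})_{xy} = δ_{ix}δ_{jy} + δ_{iy}δ_{jx}`. -/
def Dmat (N : ℕ) (i j : Fin N) : Matrix (Fin N) (Fin N) ℝ :=
  Matrix.of fun x y =>
    (if i = x ∧ j = y then (1 : ℝ) else 0) + (if i = y ∧ j = x then (1 : ℝ) else 0)

/-- `ξ_{ij}^{kl} = Δ_{ij} + Δ_{kl} - Δ_{ik} - Δ_{jl}`. -/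
def xiMat (N : ℕ) (i j k l : Fin N) : Matrix (Fin N) (Fin N) ℝ :=
  Dmat N i j + Dmat N k l - Dmat N i k - Dmat N j l

/-- `χ_{ij}^{kl}(𝒜) = 𝒜_{ij}(1-𝒜_{ik})𝒜_{kl}(1-𝒜_{jl})`. -/
def chi (N : ℕ) (A : Matrix (Fin N) (Fin N) ℝ) (i j k l : Fin N) : ℝ :=
  A i j * (1 - A i k) * A k l * (1 - A j l)

/-- `𝓜_{ij}(F(𝒜)) = max_{k,l} |F(𝒜 + ξ_{ij}^{kl})|`. -/
def Mmax (N : ℕ) (i j : Fin N) (F : Matrix (Fin N) (Fin N) ℝ → ℝ)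
    (A : Matrix (Fin N) (Fin N) ℝ) : ℝ :=
  ⨆ p : Fin N × Fin N, |F (A + xiMat N i j p.1 p.2)|

instance matMS (N : ℕ) : MeasurableSpace (Matrix (Fin N) (Fin N) ℝ) :=
  show MeasurableSpace (Fin N → Fin N → ℝ) from inferInstance

/-- the GOE: push-forward of independent centered Gaussians with variance `(1+δ_{ij})/N`
on the upper triangle under the symmetrization map. -/
def goeMeasure (N : ℕ) : Measure (Matrix (Fin N) (Fin N) ℝ) :=
  Measure.map (fun f => Matrix.of fun i j => if i ≤ j then f (i, j) else f (j, i))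
    (Measure.pi fun p : Fin N × Fin N =>
      ProbabilityTheory.gaussianReal 0 (if p.1 = p.2 then 2 / N else 1 / N))

/-- the uniform probability measure on `d`-regular graphs on `N` vertices, as a measure. -/
def uniformReg (N d : ℕ) : Measure (Matrix (Fin N) (Fin N) ℝ) :=
  (Nat.card {A : Matrix (Fin N) (Fin N) ℝ // IsAdjMat N d A} : ℝ≥0∞)⁻¹ •
    Measure.sum fun A : {A : Matrix (Fin N) (Fin N) ℝ // IsAdjMat N d A} =>
      Measure.dirac A.1

/-- the matrix flow `A(t) = e^{-t/2} q⁻¹𝒜 + √(1-e^{-t}) W`, where `W = P⊥ H P⊥`. -/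
def flowMat (N d : ℕ) (A H : Matrix (Fin N) (Fin N) ℝ) (t : ℝ) : Matrix (Fin N) (Fin N) ℝ :=
  Real.exp (-t / 2) • ((qval N d)⁻¹ • A) +
    Real.sqrt (1 - Real.exp (-t)) • (PperpR N * H * PperpR N)

/-- the Green function of the matrix flow, `G(t;z) = P⊥ (A(t) - z)⁻¹ P⊥`. -/
def greenFlow (N d : ℕ) (A H : Matrix (Fin N) (Fin N) ℝ) (t : ℝ) (z : ℂ) :
    Matrix (Fin N) (Fin N) ℂ :=
  Pperp N * ((flowMat N d A H t).map Complex.ofReal - z • 1)⁻¹ * Pperp N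

/-- the normalized trace of the Green function of the flow. -/
def gbarFlow (N d : ℕ) (A H : Matrix (Fin N) (Fin N) ℝ) (t : ℝ) (z : ℂ) : ℂ :=
  (N : ℂ)⁻¹ * (greenFlow N d A H t z).trace

namespace RR
variable {N : ℕ}
/-- squared norm -/
def ns (v : Fin N → ℂ) : ℝ := ∑ x, ‖v x‖ ^ 2
/-- norm -/
def nm (v : Fin N → ℂ) : ℝ := ‖WithLp.toLp 2 v‖
lemma nm_sq (v : Fin N → ℂ) : nm v ^ 2 = ns v := by
  unfold nm ns; rw [EuclideanSpace.norm_sq_eq]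
lemma nm_nonneg (v : Fin N → ℂ) : 0 ≤ nm v := norm_nonneg _
lemma nm_add (v w : Fin N → ℂ) : nm (v + w) ≤ nm v + nm w := by
  unfold nm; rw [WithLp.toLp_add]; exact norm_add_le _ _
lemma nm_smul (c : ℂ) (v : Fin N → ℂ) : nm (c • v) = ‖c‖ * nm v := by
  unfold nm; rw [WithLp.toLp_smul]; exact norm_smul _ _
lemma nm_dot (v w : Fin N → ℂ) : ‖v ⬝ᵥ w‖ ≤ nm v * nm w := by
  have h := Finset.sum_mul_sq_le_sq_mul_sq Finset.univ (fun x => ‖v x‖) (fun x => ‖w x‖)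
  have h1 : ‖v ⬝ᵥ w‖ ≤ ∑ x, ‖v x‖ * ‖w x‖ := by
    unfold dotProduct
    exact (norm_sum_le _ _).trans (by simp)
  refine h1.trans (abs_le_of_sq_le_sq' ?_ (mul_nonneg (nm_nonneg _) (nm_nonneg _))).2
  rw [mul_pow, nm_sq, nm_sq]; exact h
/-- resolvent of a real matrix -/
def R (M : Matrix (Fin N) (Fin N) ℝ) (z : ℂ) : Matrix (Fin N) (Fin N) ℂ :=
  (M.map Complex.ofReal - z • 1)⁻¹
lemma ward_aux {M : Matrix (Fin N) (Fin N) ℝ} (hM : M.IsSymm) (z : ℂ) (v : Fin N → ℂ) :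
    (star v ⬝ᵥ ((M.map Complex.ofReal - z • 1) *ᵥ v)).im = - z.im * ns v := by
  have e : star v ⬝ᵥ ((M.map Complex.ofReal - z • 1) *ᵥ v)
      = star v ⬝ᵥ (M.map Complex.ofReal *ᵥ v) - z * (star v ⬝ᵥ v) := by
    rw [sub_mulVec, dotProduct_sub, smul_mulVec, one_mulVec, dotProduct_smul, smul_eq_mul]
  have h1 : (star v ⬝ᵥ (M.map Complex.ofReal *ᵥ v)).im = 0 := by
    have hh : (M.map Complex.ofReal).IsHermitian := by
      ext x y; simp [Matrix.conjTranspose_apply, hM.apply x y]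
    simpa using hh.im_star_dotProduct_mulVec_self v
  have h2 : star v ⬝ᵥ v = ((ns v : ℝ) : ℂ) := by
    unfold ns dotProduct
    push_cast
    refine Finset.sum_congr rfl fun x _ => ?_
    simp [Complex.conj_mul']
  rw [e, Complex.sub_im, h1, h2, Complex.mul_im]; simp
section
variable {M : Matrix (Fin N) (Fin N) ℝ} (hM : M.IsSymm) {z : ℂ} (hz : 0 < z.im)
include hM hz
lemma R_unit : IsUnit (M.map Complex.ofReal - z • 1).det := by
  rw [isUnit_iff_ne_zero]
  intro h
  obtain ⟨v, hv, h0⟩ := Matrix.exists_mulVec_eq_zero_iff.mpr h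
  have := ward_aux hM z v
  rw [h0] at this
  have h3 : ns v = 0 := by
    simp at this
    rcases this with h | h
    · exact absurd h hz.ne'
    · exact h
  apply hv
  unfold ns at h3
  rw [Finset.sum_eq_zero_iff_of_nonneg (fun _ _ => by positivity)] at h3
  ext x; simpa using h3 x (Finset.mem_univ _)
lemma mul_R : (M.map Complex.ofReal - z • 1) * R M z = 1 := Matrix.mul_nonsing_inv _ (R_unit hM hz)
lemma R_mul : R M z * (M.map Complex.ofReal - z • 1) = 1 := Matrix.nonsing_inv_mul _ (R_unit hM hz)
lemma R_apply_mul (v : Fin N → ℂ) : (M.map Complex.ofReal - z • 1) *ᵥ (R M z *ᵥ v) = v := by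
  rw [mulVec_mulVec, mul_R hM hz, one_mulVec]
lemma R_of_eq {v w : Fin N → ℂ} (h : (M.map Complex.ofReal - z • 1) *ᵥ v = w) :
    R M z *ᵥ w = v := by
  rw [← h, mulVec_mulVec, R_mul hM hz, one_mulVec]
lemma R_ward (v : Fin N → ℂ) : (star v ⬝ᵥ (R M z *ᵥ v)).im = z.im * ns (R M z *ᵥ v) := by
  have h := ward_aux hM z (R M z *ᵥ v)
  rw [R_apply_mul hM hz] at h
  have : star (R M z *ᵥ v) ⬝ᵥ v = star (star v ⬝ᵥ (R M z *ᵥ v)) := by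
    rw [← star_dotProduct_star, star_star]
  rw [this] at h
  simp at h
  linarith
lemma R_nm (v : Fin N → ℂ) : z.im * nm (R M z *ᵥ v) ≤ nm v := by
  have h := R_ward hM hz v
  have h2 := (Complex.abs_im_le_norm _).trans (nm_dot (star v) (R M z *ᵥ v))
  have h3 : nm (star v) = nm v := by
    rw [← sq_eq_sq₀ (nm_nonneg _) (nm_nonneg _), nm_sq, nm_sq]; simp [ns]
  rw [h3] at h2
  have h4 := (le_abs_self _).trans h2
  rw [h, ← nm_sq] at h4
  rcases (nm_nonneg (R M z *ᵥ v)).eq_or_lt with h5 | h5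
  · rw [← h5]; simpa using nm_nonneg v
  · nlinarith
lemma R_ward_col (x : Fin N) : z.im * ∑ y, ‖R M z y x‖ ^ 2 = (R M z x x).im := by
  have h := R_ward hM hz (Pi.single x 1)
  simpa [ns, ← Pi.single_star] using h.symm
lemma R_im_nonneg (x : Fin N) : 0 ≤ (R M z x x).im := by
  rw [← R_ward_col hM hz]; positivity
lemma R_ward_tr : z.im * ∑ x, ∑ y, ‖R M z x y‖ ^ 2 = (R M z).trace.im := by
  rw [Finset.sum_comm, Finset.mul_sum, Matrix.trace, Complex.im_sum]
  exact Finset.sum_congr rfl fun x _ => R_ward_col hM hz x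
lemma R_entry (x y : Fin N) : ‖R M z x y‖ ≤ 1 / z.im := by
  have h := R_nm hM hz (Pi.single y 1)
  have e : ∀ v : Fin N → ℂ, ∀ x, ‖v x‖ ≤ nm v := fun v x => by
    apply (abs_le_of_sq_le_sq' _ (nm_nonneg _)).2
    rw [nm_sq]; exact Finset.single_le_sum (f := fun x => ‖v x‖ ^ 2) (fun _ _ => by positivity) (Finset.mem_univ x)
  have e1 : nm (Pi.single y (1:ℂ) : Fin N → ℂ) = 1 := by
    rw [← sq_eq_sq₀ (nm_nonneg _) zero_le_one, nm_sq]
    simp [ns, Pi.single_apply, apply_ite (fun t : ℂ => ‖t‖^2)]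
  have := e (R M z *ᵥ Pi.single y 1) x
  rw [e1] at h
  rw [mulVec_single_one] at this h
  rw [le_div_iff₀ hz]
  have h' : ‖R M z x y‖ ≤ nm ((R M z).col y) := this
  nlinarith
lemma R_symm : (R M z)ᵀ = R M z := by
  unfold R
  rw [Matrix.transpose_nonsing_inv, transpose_sub, transpose_smul, transpose_one, ← transpose_map, hM.eq]
lemma R_sym (x y : Fin N) : R M z x y = R M z y x := by
  conv_lhs => rw [← R_symm hM hz]
  rfl
lemma R_res {z' : ℂ} (hz' : 0 < z'.im) : R M z = R M z' + (z - z') • (R M z * R M z') := by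
  have h : R M z * ((M.map Complex.ofReal - z' • 1) - (M.map Complex.ofReal - z • 1)) * R M z' =
      R M z - R M z' := by
    rw [mul_sub, sub_mul, mul_assoc, mul_R hM hz', R_mul hM hz, mul_one, one_mul]
  have h2 : (M.map Complex.ofReal - z' • 1) - (M.map Complex.ofReal - z • 1)
      = (z - z') • (1 : Matrix (Fin N) (Fin N) ℂ) := by rw [sub_smul]; abel
  rw [h2] at h
  simp only [mul_smul_comm, smul_mul_assoc, mul_one] at h
  rw [h]; abel
/-- quantitative Lipschitz bound in quadratic form -/
lemma R_lip {z' : ℂ} (hz' : 0 < z'.im) (v : Fin N → ℂ) :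
    ‖v ⬝ᵥ (R M z *ᵥ v) - v ⬝ᵥ (R M z' *ᵥ v)‖ ≤ ‖z - z'‖ / (z.im * z'.im) * ns v := by
  conv_lhs => rw [R_res hM hz hz']
  rw [add_mulVec, dotProduct_add, add_sub_cancel_left, smul_mulVec, dotProduct_smul, smul_eq_mul,
    norm_mul, ← mulVec_mulVec, ← nm_sq]
  have h1 := nm_dot v (R M z *ᵥ (R M z' *ᵥ v))
  have h2 := R_nm hM hz (R M z' *ᵥ v)
  have h3 := R_nm hM hz' v
  rw [div_mul_eq_mul_div, le_div_iff₀ (mul_pos hz hz'), mul_assoc]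
  refine mul_le_mul_of_nonneg_left ?_ (norm_nonneg _)
  have := nm_nonneg v
  calc _ ≤ nm v * nm (R M z *ᵥ (R M z' *ᵥ v)) * (z.im * z'.im) := by gcongr
    _ = nm v * (z'.im * (z.im * nm (R M z *ᵥ (R M z' *ᵥ v)))) := by ring
    _ ≤ nm v * (z'.im * nm (R M z' *ᵥ v)) := by gcongr
    _ ≤ nm v * nm v := by gcongr
    _ = _ := by ring
lemma R_quad (v : Fin N → ℂ) : ‖v ⬝ᵥ (R M z *ᵥ v)‖ ≤ ns v / z.im := by
  have h1 := nm_dot v (R M z *ᵥ v)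
  have h2 := R_nm hM hz v
  have := nm_nonneg v
  rw [le_div_iff₀ hz, ← nm_sq]
  calc _ ≤ nm v * nm (R M z *ᵥ v) * z.im := by gcongr
    _ = nm v * (z.im * nm (R M z *ᵥ v)) := by ring
    _ ≤ nm v * nm v := by gcongr
    _ = _ := by ring
end
lemma R_mono {M : Matrix (Fin N) (Fin N) ℝ} (hM : M.IsSymm) {x a b : ℝ} (ha : 0 < a) (hab : a ≤ b) :
    a * (R M ⟨x, a⟩).trace.im ≤ b * (R M ⟨x, b⟩).trace.im := by
  have hb : 0 < b := ha.trans_le hab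
  have hz : 0 < (⟨x, a⟩ : ℂ).im := ha
  have hz' : 0 < (⟨x, b⟩ : ℂ).im := hb
  simp only [Matrix.trace, Complex.im_sum, Finset.mul_sum, diag_apply]
  refine Finset.sum_le_sum fun y _ => ?_
  have h1 := R_ward_col hM hz y
  have h2 := R_ward_col hM hz' y
  have e1 : ∀ z, ∑ w, ‖R M z w y‖ ^ 2 = nm (R M z *ᵥ Pi.single y 1) ^ 2 := fun z => by
    rw [nm_sq]; simp [ns]
  rw [e1] at h1 h2
  rw [← h1, ← h2]
  set v := (Pi.single y 1 : Fin N → ℂ)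
  have key : a * nm (R M ⟨x, a⟩ *ᵥ v) ≤ b * nm (R M ⟨x, b⟩ *ᵥ v) := by
    rw [R_res hM hz hz', add_mulVec, smul_mulVec, ← mulVec_mulVec]
    set t := R M ⟨x, b⟩ *ᵥ v
    have h3 := R_nm hM hz t
    have h4 := nm_add t (((⟨x, a⟩ : ℂ) - ⟨x, b⟩) • (R M ⟨x, a⟩ *ᵥ t))
    rw [nm_smul] at h4
    have h5 : ‖(⟨x, a⟩ : ℂ) - ⟨x, b⟩‖ = b - a := by
      have : (⟨x, a⟩ : ℂ) - ⟨x, b⟩ = ((a - b : ℝ) : ℂ) * Complex.I := by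
        apply Complex.ext <;> simp
      rw [this]; simp [abs_of_nonpos (sub_nonpos.mpr hab), -Complex.ofReal_sub]
    rw [h5] at h4
    simp only at h3
    nlinarith [nm_nonneg (R M ⟨x, a⟩ *ᵥ t), nm_nonneg t]
  have := mul_nonneg ha.le (nm_nonneg (R M ⟨x, a⟩ *ᵥ v))
  simp only
  nlinarith [mul_self_le_mul_self this key]
end RR
namespace RR
variable {N : ℕ}
/-- `e_i - e_k` -/
def uu (i k : Fin N) (x : Fin N) : ℝ := (if x = i then 1 else 0) - (if x = k then 1 else 0)
/-- difference of rows -/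
def ww (A : Matrix (Fin N) (Fin N) ℝ) (i k x : Fin N) : ℝ := A x i - A x k + A i k * uu i k x
/-- the part of `A` frozen by the resampling -/
def BB (i k : Fin N) (A : Matrix (Fin N) (Fin N) ℝ) : Matrix (Fin N) (Fin N) ℝ :=
  .of fun x y => A x y - (uu i k x * ww A i k y + ww A i k x * uu i k y) / 2
    + A i k / 2 * uu i k x * uu i k y
/-- normalised centred matrix -/
def HH (p q : ℝ) (A : Matrix (Fin N) (Fin N) ℝ) : Matrix (Fin N) (Fin N) ℝ :=
  .of fun x y => (A x y - p) / q
/-- Green function -/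
def GG (p q : ℝ) (z : ℂ) (A : Matrix (Fin N) (Fin N) ℝ) : Matrix (Fin N) (Fin N) ℂ := R (HH p q A) z
/-- complexified vector -/
def cc (v : Fin N → ℝ) : Fin N → ℂ := fun x => (v x : ℂ)
/-- `G^u w` -/
def gw (p q : ℝ) (z : ℂ) (i k : Fin N) (A : Matrix (Fin N) (Fin N) ℝ) : Fin N → ℂ :=
  GG p q z (BB i k A) *ᵥ cc (ww A i k)
/-- `Y` -/
def YY (p q : ℝ) (z : ℂ) (i k : Fin N) (A : Matrix (Fin N) (Fin N) ℝ) : ℂ :=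
  (cc (ww A i k) ⬝ᵥ gw p q z i k A) / (2 * (q : ℂ) ^ 2)
/-- `ζ` -/
def ze (p q : ℝ) (z : ℂ) (i k : Fin N) (A : Matrix (Fin N) (Fin N) ℝ) : ℂ :=
  (cc (uu i k) ⬝ᵥ (GG p q z A *ᵥ cc (uu i k))) / 2
/-- `y` -/
def yy (p q : ℝ) (z : ℂ) (i k : Fin N) (A : Matrix (Fin N) (Fin N) ℝ) : Fin N → ℂ :=
  cc (uu i k) - (q : ℂ)⁻¹ • gw p q z i k A
lemma HH_symm {A : Matrix (Fin N) (Fin N) ℝ} (p q : ℝ) (hA : A.IsSymm) : (HH p q A).IsSymm := by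
  ext x y; simp [HH, hA.apply x y]
lemma BB_symm {A : Matrix (Fin N) (Fin N) ℝ} (i k : Fin N) (hA : A.IsSymm) : (BB i k A).IsSymm := by
  ext x y; simp only [BB, transpose_apply, of_apply, hA.apply x y]; ring
lemma cdot_u (i k : Fin N) (v : Fin N → ℂ) : cc (uu i k) ⬝ᵥ v = v i - v k := by
  simp [dotProduct, cc, uu, sub_mul, apply_ite Complex.ofReal]
lemma ze_eq {A : Matrix (Fin N) (Fin N) ℝ} (hA : A.IsSymm) (p q : ℝ) {z : ℂ} (hz : 0 < z.im) (i k : Fin N) :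
    ze p q z i k A = (GG p q z A i i + GG p q z A k k) / 2 - GG p q z A i k := by
  have h : ∀ x, (GG p q z A *ᵥ cc (uu i k)) x = GG p q z A x i - GG p q z A x k := fun x => by
    rw [mulVec, dotProduct_comm, cdot_u]
  rw [ze, cdot_u, h, h, GG, R_sym (HH_symm p q hA) hz k i]; ring
section
variable {A : Matrix (Fin N) (Fin N) ℝ} (hA : A.IsSymm) (h0 : ∀ x, A x x = 0) {i k : Fin N} (hik : i ≠ k)
  {p q : ℝ} (hq : q ≠ 0) {z : ℂ} (hz : 0 < z.im)
include hA h0 hik in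
lemma ww_ik : ww A i k i = 0 ∧ ww A i k k = 0 := by
  simp [ww, uu, h0, hik, hik.symm, hA.apply i k]
include hik in
lemma u_dot_u : cc (uu i k) ⬝ᵥ cc (uu i k) = 2 := by
  rw [cdot_u]; simp [cc, uu, hik, hik.symm]; norm_num
include hA h0 hik in
lemma u_dot_w : cc (uu i k) ⬝ᵥ cc (ww A i k) = 0 := by
  rw [cdot_u]; simp [cc, ww_ik hA h0 hik]
include hq in
lemma HH_split (v : Fin N → ℂ) : (HH p q A).map Complex.ofReal *ᵥ v
    = (HH p q (BB i k A)).map Complex.ofReal *ᵥ v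
      + ((cc (ww A i k) ⬝ᵥ v) / (2 * q) - A i k / (2 * q) * (cc (uu i k) ⬝ᵥ v)) • cc (uu i k)
      + ((cc (uu i k) ⬝ᵥ v) / (2 * q)) • cc (ww A i k) := by
  have hq' : (q : ℂ) ≠ 0 := by exact_mod_cast hq
  ext x
  simp only [mulVec, dotProduct, Pi.add_apply, Pi.smul_apply, smul_eq_mul, Finset.sum_div,
    Finset.mul_sum, ← Finset.sum_sub_distrib, Finset.sum_mul, ← Finset.sum_add_distrib]
  refine Finset.sum_congr rfl fun y _ => ?_
  simp only [map_apply, HH, BB, of_apply, cc]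
  push_cast
  field_simp
  ring
include hA h0 hik hq in
lemma HB_u : (HH p q (BB i k A)).map Complex.ofReal *ᵥ cc (uu i k) = 0 := by
  have hq' : (q : ℂ) ≠ 0 := by exact_mod_cast hq
  have h := HH_split (i := i) (k := k) (p := p) (A := A) hq (cc (uu i k))
  rw [u_dot_u hik, dotProduct_comm, u_dot_w hA h0 hik] at h
  have e : (HH p q A).map Complex.ofReal *ᵥ cc (uu i k)
      = (q : ℂ)⁻¹ • (cc (ww A i k) - (A i k : ℂ) • cc (uu i k)) := by
    ext x
    rw [mulVec, dotProduct_comm, cdot_u]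
    simp [HH, cc, ww]; field_simp; ring
  rw [e] at h
  ext x
  have hx := congrFun h x
  simp only [Pi.add_apply, Pi.smul_apply, Pi.sub_apply, smul_eq_mul] at hx
  field_simp at hx
  rw [Pi.zero_apply]
  have : (q : ℂ) * 2 * ((HH p q (BB i k A)).map Complex.ofReal *ᵥ cc (uu i k)) x = 0 := by
    linear_combination -hx
  simpa [hq'] using this
include hA h0 hik hq hz in
lemma GB_u : GG p q z (BB i k A) *ᵥ cc (uu i k) = (-z⁻¹) • cc (uu i k) := by
  have hz0 : z ≠ 0 := by rintro rfl; simp at hz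
  apply R_of_eq (HH_symm p q (BB_symm i k hA)) hz
  rw [sub_mulVec, mulVec_smul, HB_u hA h0 hik hq, smul_mulVec, one_mulVec, smul_smul]
  simp [hz0]
include hA hz in
lemma GB_dot (v w : Fin N → ℂ) :
    v ⬝ᵥ (GG p q z (BB i k A) *ᵥ w) = (GG p q z (BB i k A) *ᵥ v) ⬝ᵥ w := by
  rw [dotProduct_mulVec, ← mulVec_transpose, GG, R_symm (HH_symm p q (BB_symm i k hA)) hz]
include hA h0 hik hq hz in
lemma schur_dots : cc (uu i k) ⬝ᵥ gw p q z i k A = 0 ∧ cc (uu i k) ⬝ᵥ yy p q z i k A = 2 ∧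
    cc (ww A i k) ⬝ᵥ yy p q z i k A = -2 * q * YY p q z i k A := by
  have hq' : (q : ℂ) ≠ 0 := by exact_mod_cast hq
  have h1 : cc (uu i k) ⬝ᵥ gw p q z i k A = 0 := by
    rw [gw, GB_dot hA hz, GB_u hA h0 hik hq hz, smul_dotProduct, u_dot_w hA h0 hik, smul_zero]
  refine ⟨h1, ?_, ?_⟩
  · rw [yy, dotProduct_sub, dotProduct_smul, h1, u_dot_u hik]; simp
  · rw [yy, dotProduct_sub, dotProduct_smul, dotProduct_comm, u_dot_w hA h0 hik, YY, smul_eq_mul]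
    field_simp; ring
include hA h0 hik hq hz in
lemma schur_y : ((HH p q A).map Complex.ofReal - z • 1) *ᵥ yy p q z i k A
    = (-z - YY p q z i k A - A i k / q) • cc (uu i k) := by
  have hq' : (q : ℂ) ≠ 0 := by exact_mod_cast hq
  obtain ⟨h1, h2, h3⟩ := schur_dots hA h0 hik hq hz (p := p)
  have h4 := R_apply_mul (HH_symm p q (BB_symm i k hA)) hz (cc (ww A i k))
  rw [sub_mulVec, smul_mulVec, one_mulVec] at h4 ⊢
  rw [HH_split (i := i) (k := k) hq, h2, h3]
  have h5 : (HH p q (BB i k A)).map Complex.ofReal *ᵥ yy p q z i k A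
      = - (q : ℂ)⁻¹ • (cc (ww A i k) + z • gw p q z i k A) := by
    rw [yy, mulVec_sub, mulVec_smul, HB_u hA h0 hik hq]
    have : (HH p q (BB i k A)).map Complex.ofReal *ᵥ gw p q z i k A
      = cc (ww A i k) + z • gw p q z i k A := eq_add_of_sub_eq h4
    rw [this]; simp [add_comm]
  rw [h5]
  ext x
  simp only [yy, Pi.add_apply, Pi.sub_apply, Pi.smul_apply, smul_eq_mul]
  field_simp; ring
include hA h0 hik hq hz in
lemma schur_z : ze p q z i k A * (-z - YY p q z i k A - A i k / q) = 1 := by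
  have h := R_of_eq (HH_symm p q hA) hz (schur_y hA h0 hik hq hz (p := p))
  rw [mulVec_smul] at h
  have h2 := congrArg (fun v => cc (uu i k) ⬝ᵥ v) h
  simp only [dotProduct_smul, (schur_dots hA h0 hik hq hz (p := p)).2.1, smul_eq_mul] at h2
  rw [ze, GG]; linear_combination h2 / 2
include hA h0 hik hq hz in
lemma schur_Gu : GG p q z A *ᵥ cc (uu i k) = ze p q z i k A • yy p q z i k A := by
  have h := R_of_eq (HH_symm p q hA) hz (schur_y hA h0 hik hq hz (p := p))
  rw [← h, mulVec_smul, smul_smul, schur_z hA h0 hik hq hz, one_smul]; rfl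
include hA h0 hik hq hz in
lemma schur_G (x y : Fin N) : GG p q z A x y = GG p q z (BB i k A) x y
    + (uu i k x * uu i k y : ℝ) / (2 * z)
    + ze p q z i k A / 2 * (yy p q z i k A x * yy p q z i k A y) := by
  have hq' : (q : ℂ) ≠ 0 := by exact_mod_cast hq
  have hz0 : z ≠ 0 := by rintro rfl; simp at hz
  have key : ∀ v : Fin N → ℂ, GG p q z A *ᵥ v = GG p q z (BB i k A) *ᵥ v
      + ((cc (uu i k) ⬝ᵥ v) / (2 * z)) • cc (uu i k)
      + (ze p q z i k A / 2 * (yy p q z i k A ⬝ᵥ v)) • yy p q z i k A := by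
    intro v
    obtain ⟨h1, h2, h3⟩ := schur_dots hA h0 hik hq hz (p := p)
    apply R_of_eq (HH_symm p q hA) hz
    rw [mulVec_add, mulVec_add, mulVec_smul, mulVec_smul, schur_y hA h0 hik hq hz, smul_smul]
    have e1 : ze p q z i k A / 2 * (yy p q z i k A ⬝ᵥ v) * (-z - YY p q z i k A - A i k / q)
      = (yy p q z i k A ⬝ᵥ v) / 2 := by
      linear_combination (yy p q z i k A ⬝ᵥ v) / 2 * schur_z hA h0 hik hq hz (p := p)
    rw [e1]
    have h4 := R_apply_mul (HH_symm p q (BB_symm i k hA)) hz v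
    rw [sub_mulVec, smul_mulVec, one_mulVec] at h4
    have h4' := eq_add_of_sub_eq h4
    simp only [sub_mulVec, smul_mulVec, one_mulVec]
    rw [HH_split (i := i) (k := k) hq (GG _ _ _ _ *ᵥ v), HH_split (i := i) (k := k) hq (cc (uu i k)),
      HB_u hA h0 hik hq, u_dot_u hik, dotProduct_comm (cc (ww A i k)) (cc (uu i k)), u_dot_w hA h0 hik,
      GB_dot hA hz, GB_dot hA hz, GB_u hA h0 hik hq hz]
    change (HH p q (BB i k A)).map Complex.ofReal *ᵥ (GG p q z (BB i k A) *ᵥ v) = _ at h4'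
    rw [h4']
    have e2 : yy p q z i k A ⬝ᵥ v = cc (uu i k) ⬝ᵥ v - (q : ℂ)⁻¹ * (gw p q z i k A ⬝ᵥ v) := by
      rw [yy, sub_dotProduct, smul_dotProduct, smul_eq_mul]
    rw [e2]
    change v + z • (GG p q z (BB i k A) *ᵥ v) + ((gw p q z i k A ⬝ᵥ v) / _ - _) • _ + _ - _ + _ + _ = v
    simp only [smul_dotProduct, smul_eq_mul]
    ext x
    simp only [Pi.add_apply, Pi.sub_apply, Pi.smul_apply, smul_eq_mul, Pi.zero_apply]
    field_simp; ring
  have := congrFun (key (Pi.single y 1)) x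
  simp [cc] at this
  rw [this]; push_cast; ring
end
end RR
namespace RR
variable {N : ℕ}
open Function (update)
/-- signs -/
def sg (S T : Finset (Fin N)) (x : Fin N) : ℝ := if x ∈ S then (if x ∈ T then 1 else -1) else 0
/-- sum over all sign configurations on `S` -/
def Es (S : Finset (Fin N)) (f : (Fin N → ℝ) → ℝ) : ℝ := ∑ T ∈ S.powerset, f (sg S T)
lemma Es_insert {S : Finset (Fin N)} {x : Fin N} (hx : x ∉ S) (f : (Fin N → ℝ) → ℝ) :
    Es (insert x S) f = Es S (fun w => f (update w x 1)) + Es S (fun w => f (update w x (-1))) := by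
  unfold Es
  rw [Finset.sum_powerset_insert hx, add_comm]
  congr 1 <;> refine Finset.sum_congr rfl fun T hT => congrArg f ?_ <;> ext y <;>
    rcases eq_or_ne y x with rfl | h
  · simp [sg]
  · simp [sg, h]
  · have : y ∉ T := fun h => hx (Finset.mem_powerset.mp hT h)
    simp [sg, this]
  · simp [sg, h]
/-- degree `< k` in the coordinates of the list -/
def Dg : List (Fin N) → ℕ → ((Fin N → ℝ) → ℝ) → Prop
  | _, 0, f => ∀ w, f w = 0
  | [], _ + 1, _ => True
  | x :: l, k + 1, f => ∃ a b, Dg l (k + 1) a ∧ Dg l k b ∧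
      ∀ w, f (update w x 1) = a w + b w ∧ f (update w x (-1)) = a w - b w
lemma Dg_zero (l : List (Fin N)) (k : ℕ) : Dg l k (fun _ => 0) := by
  induction l generalizing k with
  | nil => cases k <;> simp [Dg]
  | cons x l ih => cases k with
    | zero => simp [Dg]
    | succ k => exact ⟨_, _, ih _, ih _, by simp⟩
lemma Dg_of_zero {l : List (Fin N)} {f} (k : ℕ) (h : Dg l 0 f) : Dg l k f := by
  have : f = fun _ => 0 := funext fun w => by cases l <;> exact h w
  rw [this]; exact Dg_zero l k
lemma Dg_mono {l : List (Fin N)} {k : ℕ} {f} (h : Dg l k f) : Dg l (k + 1) f := by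
  induction l generalizing k f with
  | nil => simp [Dg]
  | cons x l ih => cases k with
    | zero => exact Dg_of_zero _ h
    | succ k => obtain ⟨a, b, ha, hb, hf⟩ := h; exact ⟨a, b, ih ha, ih hb, hf⟩
lemma Dg_add {l : List (Fin N)} {k : ℕ} {f g} (hf : Dg l k f) (hg : Dg l k g) :
    Dg l k (fun w => f w + g w) := by
  induction l generalizing k f g with
  | nil => cases k with
    | zero => intro w; simp [hf w, hg w]
    | succ k => simp [Dg]
  | cons x l ih => cases k with
    | zero => intro w; simp [hf w, hg w]
    | succ k =>
      obtain ⟨a, b, ha, hb, h⟩ := hf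
      obtain ⟨a', b', ha', hb', h'⟩ := hg
      refine ⟨_, _, ih ha ha', ih hb hb', fun w => ⟨?_, ?_⟩⟩
      · simp only [(h w).1, (h' w).1]; ring
      · simp only [(h w).2, (h' w).2]; ring
lemma Dg_mul {l : List (Fin N)} {j k : ℕ} {f g} (hf : Dg l (j + 1) f) (hg : Dg l (k + 1) g) :
    Dg l (j + k + 1) (fun w => f w * g w) := by
  induction l generalizing j k f g with
  | nil => simp [Dg]
  | cons x l ih =>
    obtain ⟨a, b, ha, hb, h⟩ := hf
    obtain ⟨a', b', ha', hb', h'⟩ := hg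
    have z1 : ∀ {u v : (Fin N → ℝ) → ℝ} {m}, Dg l 0 u → Dg l m (fun w => u w * v w) := fun {u v m} hu => by
      apply Dg_of_zero; cases l <;> (intro w; have := hu w; simp [this])
    have z2 : ∀ {u v : (Fin N → ℝ) → ℝ} {m}, Dg l 0 u → Dg l m (fun w => v w * u w) := fun {u v m} hu => by
      apply Dg_of_zero; cases l <;> (intro w; have := hu w; simp [this])
    refine ⟨fun w => a w * a' w + b w * b' w, fun w => a w * b' w + b w * a' w,
      Dg_add (ih ha ha') ?_, Dg_add ?_ ?_, fun w => ⟨?_, ?_⟩⟩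
    · cases j with
      | zero => exact z1 hb
      | succ j => cases k with
        | zero => exact z2 hb'
        | succ k =>
          have := Dg_mono (Dg_mono (ih hb hb'))
          convert this using 1; ring
    · cases k with
      | zero => exact z2 hb'
      | succ k => exact ih ha hb'
    · cases j with
      | zero => exact z1 hb
      | succ j => have := ih hb ha'; convert this using 1; ring
    · simp only [(h w).1, (h' w).1]; ring
    · simp only [(h w).2, (h' w).2]; ring
lemma Dg_const (l : List (Fin N)) (c : ℝ) : Dg l 1 (fun _ => c) := by
  induction l with
  | nil => simp [Dg]
  | cons x l ih => exact ⟨_, _, ih, Dg_zero l 0, by simp⟩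
lemma Dg_coord (l : List (Fin N)) (y : Fin N) : Dg l 2 (fun w => w y) := by
  induction l with
  | nil => simp [Dg]
  | cons x l ih =>
    rcases eq_or_ne y x with rfl | h
    · exact ⟨_, _, Dg_zero l 2, Dg_const l 1, by simp⟩
    · exact ⟨_, _, ih, Dg_zero l 1, by simp [h]⟩
lemma Dg_sum {ι : Type} (s : Finset ι) (l : List (Fin N)) (k : ℕ) (f : ι → (Fin N → ℝ) → ℝ)
    (h : ∀ i ∈ s, Dg l k (f i)) : Dg l k (fun w => ∑ i ∈ s, f i w) := by
  classical
  induction s using Finset.induction_on with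
  | empty => simpa using Dg_zero l k
  | insert a s ha ih =>
    simp only [Finset.sum_insert ha]
    exact Dg_add (h a (by simp)) (ih fun i hi => h i (by simp [hi]))
lemma Dg_pow {l : List (Fin N)} {k : ℕ} {f} (hf : Dg l (k + 1) f) (n : ℕ) :
    Dg l (k * n + 1) (fun w => f w ^ n) := by
  induction n with
  | zero => simpa using Dg_const l 1
  | succ n ih => simp only [pow_succ]; exact Dg_mul ih hf
lemma bonami (l : List (Fin N)) (hl : l.Nodup) (k : ℕ) (f) (hf : Dg l (k + 1) f) :
    2 ^ l.length * Es l.toFinset (fun w => f w ^ 4) ≤ 9 ^ k * Es l.toFinset (fun w => f w ^ 2) ^ 2 := by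
  induction l generalizing k f with
  | nil =>
    simp only [List.toFinset_nil, Es, Finset.powerset_empty, Finset.sum_singleton, List.length_nil, pow_zero, one_mul]
    have : (1 : ℝ) ≤ 9 ^ k := one_le_pow₀ (by norm_num)
    nlinarith [sq_nonneg (f (sg ∅ ∅) ^ 2)]
  | cons x l ih =>
    obtain ⟨a, b, ha, hb, h⟩ := hf
    rw [List.nodup_cons] at hl
    have hx : x ∉ l.toFinset := by simpa using hl.1
    rw [List.toFinset_cons, Es_insert hx, Es_insert hx]
    simp only [(h _).1, (h _).2]
    have e4 : Es l.toFinset (fun w => (a w + b w) ^ 4) + Es l.toFinset (fun w => (a w - b w) ^ 4)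
      = 2 * (Es l.toFinset (fun w => a w ^ 4) + 6 * Es l.toFinset (fun w => a w ^ 2 * b w ^ 2)
        + Es l.toFinset (fun w => b w ^ 4)) := by
      simp only [Es, Finset.mul_sum, ← Finset.sum_add_distrib]
      exact Finset.sum_congr rfl fun T _ => by ring
    have e2 : Es l.toFinset (fun w => (a w + b w) ^ 2) + Es l.toFinset (fun w => (a w - b w) ^ 2)
      = 2 * (Es l.toFinset (fun w => a w ^ 2) + Es l.toFinset (fun w => b w ^ 2)) := by
      simp only [Es, Finset.mul_sum, ← Finset.sum_add_distrib]
      exact Finset.sum_congr rfl fun T _ => by ring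
    rw [e4, e2, List.length_cons]
    have cs : Es l.toFinset (fun w => a w ^ 2 * b w ^ 2) ^ 2 ≤
        Es l.toFinset (fun w => a w ^ 4) * Es l.toFinset (fun w => b w ^ 4) := by
      have := Finset.sum_mul_sq_le_sq_mul_sq l.toFinset.powerset
        (fun T => a (sg l.toFinset T) ^ 2) (fun T => b (sg l.toFinset T) ^ 2)
      simpa [Es, ← pow_mul] using this
    have n1 : 0 ≤ Es l.toFinset (fun w => a w ^ 2) := Finset.sum_nonneg fun _ _ => by positivity
    have n2 : 0 ≤ Es l.toFinset (fun w => b w ^ 2) := Finset.sum_nonneg fun _ _ => by positivity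
    have n3 : 0 ≤ Es l.toFinset (fun w => a w ^ 2 * b w ^ 2) := Finset.sum_nonneg fun _ _ => by positivity
    have n4 : 0 ≤ Es l.toFinset (fun w => a w ^ 4) := Finset.sum_nonneg fun _ _ => by positivity
    have n5 : 0 ≤ Es l.toFinset (fun w => b w ^ 4) := Finset.sum_nonneg fun _ _ => by positivity
    have i1 := ih hl.2 k a ha
    have i2 : 9 * (2 ^ l.length * Es l.toFinset (fun w => b w ^ 4)) ≤
        9 ^ k * Es l.toFinset (fun w => b w ^ 2) ^ 2 := by
      cases k with
      | zero =>
        have hb0 : ∀ w, b w = 0 := by cases l <;> exact hb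
        simp [Es, hb0]
      | succ k =>
        have := ih hl.2 k b hb
        rw [pow_succ]; linarith
    generalize Es l.toFinset (fun w => a w ^ 2) = a2 at *
    generalize Es l.toFinset (fun w => b w ^ 2) = b2 at *
    generalize Es l.toFinset (fun w => a w ^ 4) = a4 at *
    generalize Es l.toFinset (fun w => b w ^ 4) = b4 at *
    generalize Es l.toFinset (fun w => a w ^ 2 * b w ^ 2) = ab at *
    have hn : (0 : ℝ) < 2 ^ l.length := by positivity
    have h9 : (0 : ℝ) < 9 ^ k := by positivity
    have i3 : 3 * (2 ^ l.length * ab) ≤ 9 ^ k * (a2 * b2) := by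
      apply (abs_le_of_sq_le_sq' _ (by positivity)).2
      calc (3 * (2 ^ l.length * ab)) ^ 2 = 9 * (2 ^ l.length) ^ 2 * ab ^ 2 := by ring
        _ ≤ 9 * (2 ^ l.length) ^ 2 * (a4 * b4) := by gcongr
        _ = (2 ^ l.length * a4) * (9 * (2 ^ l.length * b4)) := by ring
        _ ≤ (9 ^ k * a2 ^ 2) * (9 ^ k * b2 ^ 2) := by gcongr
        _ = _ := by ring
    rw [pow_succ]
    have : 0 ≤ 2 ^ l.length * b4 := by positivity
    linarith [i1, i2, i3]
lemma Es_lin (S : Finset (Fin N)) (c : Fin N → ℝ) :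
    Es S (fun w => (∑ y ∈ S, c y * w y) ^ 2) = 2 ^ S.card * ∑ y ∈ S, c y ^ 2 := by
  induction S using Finset.induction_on with
  | empty => simp [Es]
  | insert x S hx ih =>
    rw [Es_insert hx, Finset.card_insert_of_notMem hx, Finset.sum_insert hx, pow_succ]
    have h : ∀ (w : Fin N → ℝ) t, ∑ y ∈ S, c y * update w x t y = ∑ y ∈ S, c y * w y := fun w t =>
      Finset.sum_congr rfl fun y hy => by
        rw [Function.update_of_ne (by rintro rfl; exact hx hy)]
    simp only [Finset.sum_insert hx, h, Function.update_self]
    have : Es S (fun w => (c x * 1 + ∑ y ∈ S, c y * w y) ^ 2) + Es S (fun w => (c x * (-1) + ∑ y ∈ S, c y * w y) ^ 2)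
      = 2 * (Es S (fun w => (∑ y ∈ S, c y * w y) ^ 2) + ∑ T ∈ S.powerset, c x ^ 2) := by
      simp only [Es, Finset.mul_sum, ← Finset.sum_add_distrib]
      exact Finset.sum_congr rfl fun T _ => by ring
    rw [this, ih]; simp; ring
/-- quadratic form -/
def Qf (S : Finset (Fin N)) (M : Fin N → Fin N → ℝ) (w : Fin N → ℝ) : ℝ :=
  ∑ x ∈ S, ∑ y ∈ S, M x y * (w x * w y)
lemma Es_quad (S : Finset (Fin N)) (M : Fin N → Fin N → ℝ) (hM : ∀ x, M x x = 0) :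
    Es S (fun w => Qf S M w ^ 2) ≤ 2 * 2 ^ S.card * ∑ x ∈ S, ∑ y ∈ S, M x y ^ 2 := by
  induction S using Finset.induction_on with
  | empty => simp [Es, Qf]
  | insert x S hx ih =>
    rw [Es_insert hx, Finset.card_insert_of_notMem hx, pow_succ]
    have h : ∀ (w : Fin N → ℝ) t, Qf (insert x S) M (update w x t) =
        Qf S M w + t * ∑ y ∈ S, (M x y + M y x) * w y := fun w t => by
      have e : ∀ y ∈ S, update w x t y = w y := fun y hy =>
        Function.update_of_ne (by rintro rfl; exact hx hy) _ _
      simp only [Qf, Finset.sum_insert hx, hM, Function.update_self]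
      have e1 : ∑ y ∈ S, M x y * (t * update w x t y) = t * ∑ y ∈ S, M x y * w y := by
        rw [Finset.mul_sum]; exact Finset.sum_congr rfl fun y hy => by rw [e y hy]; ring
      have e2 : ∑ y ∈ S, (M y x * (update w x t y * t) + ∑ v ∈ S, M y v * (update w x t y * update w x t v))
        = t * ∑ y ∈ S, M y x * w y + ∑ y ∈ S, ∑ v ∈ S, M y v * (w y * w v) := by
        rw [Finset.mul_sum, ← Finset.sum_add_distrib]
        refine Finset.sum_congr rfl fun y hy => ?_
        rw [e y hy]; congr 1
        · ring
        · exact Finset.sum_congr rfl fun v hv => by rw [e v hv]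
      rw [e1, e2]; simp only [add_mul, Finset.sum_add_distrib]; ring
    simp only [h]
    have : Es S (fun w => (Qf S M w + 1 * ∑ y ∈ S, (M x y + M y x) * w y) ^ 2)
        + Es S (fun w => (Qf S M w + (-1) * ∑ y ∈ S, (M x y + M y x) * w y) ^ 2)
      = 2 * (Es S (fun w => Qf S M w ^ 2) + Es S (fun w => (∑ y ∈ S, (M x y + M y x) * w y) ^ 2)) := by
      unfold Es; rw [← Finset.sum_add_distrib, ← Finset.sum_add_distrib, Finset.mul_sum]
      exact Finset.sum_congr rfl fun T _ => by ring
    rw [this, Es_lin]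
    have h2 : ∑ y ∈ S, (M x y + M y x) ^ 2 ≤ 2 * (∑ y ∈ S, M x y ^ 2 + ∑ y ∈ S, M y x ^ 2) := by
      rw [← Finset.sum_add_distrib, Finset.mul_sum]
      exact Finset.sum_le_sum fun y _ => by nlinarith [sq_nonneg (M x y - M y x)]
    simp only [Finset.sum_insert hx, hM, Finset.sum_add_distrib]
    have hn : (0 : ℝ) < 2 ^ S.card := by positivity
    nlinarith [mul_le_mul_of_nonneg_left h2 hn.le]
lemma chaos (j : ℕ) : ∃ C : ℝ, 0 < C ∧ ∀ (N : ℕ) (S : Finset (Fin N)) (M : Fin N → Fin N → ℝ),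
    (∀ x, M x x = 0) → Es S (fun w => Qf S M w ^ (2 ^ (j + 1))) ≤
      C * 2 ^ S.card * (∑ x ∈ S, ∑ y ∈ S, M x y ^ 2) ^ (2 ^ j) := by
  induction j with
  | zero => exact ⟨2, by norm_num, fun N S M hM => by simpa using Es_quad S M hM⟩
  | succ j ih =>
    obtain ⟨C, hC, h⟩ := ih
    refine ⟨9 ^ (2 * 2 ^ j) * C ^ 2, by positivity, fun N S M hM => ?_⟩
    have hd : Dg S.toList 3 (Qf S M) := by
      apply Dg_sum; intro x _; apply Dg_sum; intro y _
      exact Dg_mul (j := 0) (Dg_const _ _) (Dg_mul (j := 1) (k := 1) (Dg_coord _ x) (Dg_coord _ y))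
    have hb := bonami S.toList S.nodup_toList _ _ (Dg_pow (k := 2) hd (2 ^ j))
    simp only [Finset.toList_toFinset, Finset.length_toList, ← pow_mul] at hb
    have h1 := h N S M hM
    have n1 : 0 ≤ Es S (fun w => Qf S M w ^ (2 ^ (j + 1))) :=
      Finset.sum_nonneg fun _ _ => Even.pow_nonneg (by simp [pow_succ]) _
    rw [show 2 ^ j * 4 = 2 ^ (j + 1 + 1) by ring, show 2 ^ j * 2 = 2 ^ (j + 1) by ring] at hb
    have hn : (0 : ℝ) < 2 ^ S.card := by positivity
    refine le_of_mul_le_mul_left (hb.trans ?_) hn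
    calc _ ≤ (9 : ℝ) ^ (2 * 2 ^ j) * (C * 2 ^ S.card * (∑ x ∈ S, ∑ y ∈ S, M x y ^ 2) ^ (2 ^ j)) ^ 2 := by gcongr
      _ = _ := by rw [mul_pow, mul_pow, ← pow_mul, ← pow_mul, ← pow_succ]; ring
end RR
namespace RR
variable {N : ℕ}
lemma adj_finite (N d : ℕ) : {A : Matrix (Fin N) (Fin N) ℝ | IsAdjMat N d A}.Finite := by
  have h : {A : Fin N → Fin N → ℝ | ∀ i, A i ∈ {v : Fin N → ℝ | ∀ j, v j ∈ ({0, 1} : Set ℝ)}}.Finite :=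
    Set.Finite.pi' fun _ => Set.Finite.pi' fun _ => Set.toFinite _
  exact h.subset fun A hA i j => hA.2.2.1 i j
/-- the set of graphs -/
def Gr (N d : ℕ) : Finset (Matrix (Fin N) (Fin N) ℝ) := (adj_finite N d).toFinset
lemma mem_Gr {d : ℕ} {A : Matrix (Fin N) (Fin N) ℝ} : A ∈ Gr N d ↔ IsAdjMat N d A := by simp [Gr]
/-- the resampled set -/
def SS (i k : Fin N) (B : Matrix (Fin N) (Fin N) ℝ) : Finset (Fin N) :=
  Finset.univ.filter fun x => x ≠ i ∧ x ≠ k ∧ B x i = 1 / 2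
lemma uu_ne {i k x : Fin N} (h1 : x ≠ i) (h2 : x ≠ k) : uu i k x = 0 := by simp [uu, h1, h2]
lemma uu_sum (i k : Fin N) : ∑ x, uu i k x = 0 := by simp [uu]
section
variable {d : ℕ} {A : Matrix (Fin N) (Fin N) ℝ} (hA : IsAdjMat N d A) {i k : Fin N} (hik : i ≠ k)
include hA
lemma mem_SS {x : Fin N} : x ∈ SS i k (BB i k A) ↔ x ≠ i ∧ x ≠ k ∧ A x i ≠ A x k := by
  simp only [SS, Finset.mem_filter, Finset.mem_univ, true_and]
  refine and_congr_right fun h1 => and_congr_right fun h2 => ?_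
  simp only [BB, of_apply, uu_ne h1 h2, ww]
  have hik : i = k ∨ i ≠ k := eq_or_ne _ _
  rcases hik with rfl | hik
  · simp [uu]; rcases hA.2.2.1 x i with h | h <;> rw [h] <;> norm_num
  · simp only [uu]; rcases hA.2.2.1 x i with h | h <;> rcases hA.2.2.1 x k with h' | h' <;>
      simp [h, h', hik] <;> norm_num
include hik in
lemma ww_S {x : Fin N} (hx : x ∈ SS i k (BB i k A)) : ww A i k x = 1 ∨ ww A i k x = -1 := by
  obtain ⟨h1, h2, h3⟩ := (mem_SS hA).1 hx
  simp only [ww, uu_ne h1 h2]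
  rcases hA.2.2.1 x i with h | h <;> rcases hA.2.2.1 x k with h' | h' <;> simp [h, h'] at h3 ⊢
include hik in
lemma ww_nS {x : Fin N} (hx : x ∉ SS i k (BB i k A)) : ww A i k x = 0 := by
  rw [mem_SS hA] at hx
  by_cases h1 : x = i
  · subst h1; exact (ww_ik hA.1 hA.2.1 hik).1
  by_cases h2 : x = k
  · subst h2; exact (ww_ik hA.1 hA.2.1 hik).2
  have : A x i = A x k := by tauto
  simp [ww, uu_ne h1 h2, this]
lemma ww_sum : ∑ x, ww A i k x = 0 := by
  simp only [ww, Finset.sum_add_distrib, Finset.sum_sub_distrib, ← Finset.mul_sum, uu_sum]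
  have h : ∀ j, ∑ x, A x j = d := fun j => by
    rw [← hA.2.2.2 j]; exact Finset.sum_congr rfl fun x _ => hA.1.apply j x
  simp [h]
include hik in
lemma ww_sg : ww A i k = sg (SS i k (BB i k A)) ((SS i k (BB i k A)).filter fun x => ww A i k x = 1) := by
  ext x
  by_cases hx : x ∈ SS i k (BB i k A)
  · rcases ww_S hA hik hx with h | h <;> simp [sg, hx, h]
  · rw [ww_nS hA hik hx]; simp [sg, hx]
include hik in
lemma alpha_BB : A i k = 2 * BB i k A i i := by
  simp [BB, (ww_ik hA.1 hA.2.1 hik).1, hA.2.1, uu, hik]; ring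
include hik in
lemma recon (x y : Fin N) : A x y = BB i k A x y + (uu i k x * ww A i k y + ww A i k x * uu i k y) / 2
    - BB i k A i i * uu i k x * uu i k y := by
  have := alpha_BB hA hik
  have e : BB i k A x y = A x y - (uu i k x * ww A i k y + ww A i k x * uu i k y) / 2
    + A i k / 2 * uu i k x * uu i k y := rfl
  rw [e, show BB i k A i i = A i k / 2 by linarith]; ring
include hik in
lemma flip_mem {T : Finset (Fin N)} (hc : 2 * T.card = (SS i k (BB i k A)).card)
    (hT : T ⊆ SS i k (BB i k A)) :
    ∃ A', IsAdjMat N d A' ∧ BB i k A' = BB i k A ∧ ww A' i k = sg (SS i k (BB i k A)) T := by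
  set S := SS i k (BB i k A) with hS
  set δ : Fin N → ℝ := fun x => sg S T x - ww A i k x with hδ
  have hi : i ∉ S := by rw [mem_SS hA]; tauto
  have hk : k ∉ S := by rw [mem_SS hA]; tauto
  have di : δ i = 0 := by simp [hδ, sg, hi, (ww_ik hA.1 hA.2.1 hik).1]
  have dk : δ k = 0 := by simp [hδ, sg, hk, (ww_ik hA.1 hA.2.1 hik).2]
  have dn : ∀ x, x ∉ S → δ x = 0 := fun x hx => by simp [hδ, sg, hx, ww_nS hA hik hx]
  have ui : uu i k i = 1 := by simp [uu, hik]
  have uk : uu i k k = -1 := by simp [uu, hik.symm]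
  have ssum : ∑ x, sg S T x = 0 := by
    simp only [sg, Finset.sum_ite_mem, Finset.univ_inter]
    have : ∀ x, (if x ∈ T then (1 : ℝ) else -1) = 2 * (if x ∈ T then 1 else 0) - 1 := fun x => by
      split_ifs <;> norm_num
    simp only [this, Finset.sum_sub_distrib, ← Finset.mul_sum, Finset.sum_ite_mem, Finset.inter_eq_right.mpr hT]
    have : (2 * T.card : ℝ) = S.card := by exact_mod_cast hc
    simp [this]
  have dsum : ∑ x, δ x = 0 := by simp [hδ, Finset.sum_sub_distrib, ssum, ww_sum hA]
  set A' : Matrix (Fin N) (Fin N) ℝ := .of fun x y => A x y + (uu i k x * δ y + δ x * uu i k y) / 2 with hA'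
  have e' : ∀ x y, A' x y = A x y + (uu i k x * δ y + δ x * uu i k y) / 2 := fun x y => rfl
  have ho : ∀ x, x ≠ i → x ≠ k → (A x i + δ x / 2 = 0 ∨ A x i + δ x / 2 = 1) ∧
      (A x k - δ x / 2 = 0 ∨ A x k - δ x / 2 = 1) := by
    intro x h1 h2
    by_cases hx : x ∈ S
    · have h3 := ((mem_SS hA).1 hx).2.2
      simp only [hδ, ww, uu_ne h1 h2, sg, hx, if_true]
      rcases hA.2.2.1 x i with h | h <;> rcases hA.2.2.1 x k with h' | h' <;> simp [h, h'] at h3 ⊢ <;>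
        split_ifs <;> norm_num
    · simp only [dn x hx]; simpa using ⟨hA.2.2.1 x i, hA.2.2.1 x k⟩
  have adj : IsAdjMat N d A' := by
    refine ⟨?_, ?_, ?_, ?_⟩
    · ext x y; rw [transpose_apply, e', e', hA.1.apply x y]; ring
    · intro x; rw [e', hA.2.1]
      by_cases h1 : x = i
      · subst h1; simp [di]
      by_cases h2 : x = k
      · subst h2; simp [dk]
      simp [uu_ne h1 h2]
    · have h2 : ∀ x y, x ≠ i → x ≠ k → A' x y = 0 ∨ A' x y = 1 := by
        intro x y h1 h2
        rw [e', uu_ne h1 h2]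
        by_cases h3 : y = i
        · subst h3; rw [ui]; simpa using (ho x h1 h2).1
        by_cases h4 : y = k
        · subst h4; rw [uk]
          have := (ho x h1 h2).2
          rwa [show A x y + (0 * δ y + δ x * -1) / 2 = A x y - δ x / 2 by ring]
        rw [uu_ne h3 h4]; simpa using hA.2.2.1 x y
      have sym : ∀ x y, A' x y = A' y x := fun x y => by rw [e', e', hA.1.apply x y]; ring
      intro x y
      by_cases hx : x ≠ i ∧ x ≠ k
      · exact h2 x y hx.1 hx.2
      by_cases hy : y ≠ i ∧ y ≠ k
      · rw [sym]; exact h2 y x hy.1 hy.2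
      have dx : δ x = 0 := by
        rcases not_and_or.mp hx with h | h <;> rw [not_not.mp h] <;> assumption
      have dy : δ y = 0 := by
        rcases not_and_or.mp hy with h | h <;> rw [not_not.mp h] <;> assumption
      rw [e', dx, dy]; simpa using hA.2.2.1 x y
    · intro x
      simp only [e', Finset.sum_add_distrib, ← Finset.sum_div, ← Finset.mul_sum, dsum, uu_sum]
      simpa using hA.2.2.2 x
  have hw : ww A' i k = sg S T := by
    ext x
    simp only [ww, e', di, dk, ui, uk]
    have : δ x = sg S T x - (A x i - A x k + A i k * uu i k x) := rfl
    linear_combination this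
  have ha : A' i k = A i k := by rw [e', di, dk]; simp
  refine ⟨A', adj, ?_, hw⟩
  ext x y
  simp only [BB, of_apply, hw, ha]
  have : ∀ x, δ x = sg S T x - ww A i k x := fun x => rfl
  rw [e', this, this]; ring
include hik in
lemma fibre_sum {E : Type} [AddCommMonoid E] : ∃ h, (SS i k (BB i k A)).card = 2 * h ∧
    ∀ φ : (Fin N → ℝ) → E, ∑ A' ∈ (Gr N d).filter (fun A' => BB i k A' = BB i k A), φ (ww A' i k)
      = ∑ T ∈ (SS i k (BB i k A)).powersetCard h, φ (sg (SS i k (BB i k A)) T) := by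
  set S := SS i k (BB i k A) with hS
  have card : ∀ A', IsAdjMat N d A' → BB i k A' = BB i k A →
      2 * (S.filter fun x => ww A' i k x = 1).card = S.card := by
    intro A' h1 h2
    have h3 := ww_sum h1 (i := i) (k := k)
    rw [ww_sg h1 hik, h2, ← hS] at h3
    simp only [sg, Finset.sum_ite_mem, Finset.univ_inter] at h3
    have : ∀ x, (if x ∈ S.filter (fun x => ww A' i k x = 1) then (1 : ℝ) else -1)
      = 2 * (if x ∈ S.filter (fun x => ww A' i k x = 1) then 1 else 0) - 1 := fun x => by
      split_ifs <;> norm_num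
    simp only [this, Finset.sum_sub_distrib, ← Finset.mul_sum, Finset.sum_ite_mem,
      Finset.inter_eq_right.mpr (Finset.filter_subset _ S)] at h3
    simp at h3
    exact_mod_cast sub_eq_zero.mp h3
  refine ⟨(S.filter fun x => ww A i k x = 1).card, (card A hA rfl).symm, fun φ => ?_⟩
  refine Finset.sum_bij (fun A' _ => S.filter fun x => ww A' i k x = 1) ?_ ?_ ?_ ?_
  · intro A' h
    rw [Finset.mem_filter, mem_Gr] at h
    rw [Finset.mem_powersetCard]
    refine ⟨Finset.filter_subset _ _, ?_⟩
    have h1 := card A' h.1 h.2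
    have h2 := card A hA rfl
    omega
  · intro A1 h1 A2 h2 h12
    rw [Finset.mem_filter, mem_Gr] at h1 h2
    have e1 := ww_sg h1.1 hik
    have e2 := ww_sg h2.1 hik
    rw [h1.2, ← hS] at e1
    rw [h2.2, ← hS] at e2
    rw [h12, ← e2] at e1
    ext x y
    rw [recon h1.1 hik, recon h2.1 hik, e1, h1.2, h2.2]
  · intro T hT
    rw [Finset.mem_powersetCard] at hT
    obtain ⟨A', h1, h2, h3⟩ := flip_mem hA hik (by rw [hT.2]; exact card A hA rfl) hT.1
    refine ⟨A', by rw [Finset.mem_filter, mem_Gr]; exact ⟨h1, h2⟩, ?_⟩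
    rw [h3, ← hS]
    ext x
    by_cases hx : x ∈ S
    · rw [Finset.mem_filter]; by_cases hxT : x ∈ T <;> simp [sg, hx, hxT]; norm_num
    · have : x ∉ T := fun h => hx (hT.1 h)
      simp [hx, this]
  · intro A' h
    rw [Finset.mem_filter, mem_Gr] at h
    have e1 := ww_sg h.1 hik
    rw [h.2, ← hS] at e1
    rw [← e1]
end
end RR
namespace RR
variable {N : ℕ}
open Classical in
lemma hw_real (j : ℕ) : ∃ C : ℝ, 0 < C ∧ ∀ (N d : ℕ) (i k : Fin N), i ≠ k →
    ∀ M : Matrix (Fin N) (Fin N) ℝ → Fin N → Fin N → ℝ, (∀ B x, M B x x = 0) → ∀ K : ℝ, 0 < K →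
    (((Gr N d).filter fun A => K ^ 2 * (∑ x ∈ SS i k (BB i k A), ∑ y ∈ SS i k (BB i k A), M (BB i k A) x y ^ 2)
      < Qf (SS i k (BB i k A)) (M (BB i k A)) (ww A i k) ^ 2).card : ℝ) * K ^ (2 ^ (j + 1))
      ≤ C * (N + 1) * (Gr N d).card := by
  obtain ⟨C, hC, hch⟩ := chaos j
  refine ⟨C, hC, fun N d i k hik M hM K hK => ?_⟩
  have hfib := Finset.card_eq_sum_card_image (BB i k) (Gr N d)
  set bad := (Gr N d).filter fun A => K ^ 2 * (∑ x ∈ SS i k (BB i k A), ∑ y ∈ SS i k (BB i k A), M (BB i k A) x y ^ 2)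
      < Qf (SS i k (BB i k A)) (M (BB i k A)) (ww A i k) ^ 2 with hbad
  have hb := Finset.card_eq_sum_card_fiberwise (f := BB i k) (s := bad) (t := (Gr N d).image (BB i k))
    (fun A hA => Finset.mem_image_of_mem _ (Finset.mem_filter.mp hA).1)
  rw [hfib, hb]
  push_cast
  rw [Finset.sum_mul, Finset.mul_sum]
  refine Finset.sum_le_sum fun B hB => ?_
  obtain ⟨A, hA, rfl⟩ := Finset.mem_image.mp hB
  rw [mem_Gr] at hA
  obtain ⟨h, hS, hsum⟩ := fibre_sum hA hik (E := ℝ)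
  set S := SS i k (BB i k A) with hSdef
  set m := M (BB i k A)
  set Fr := ∑ x ∈ S, ∑ y ∈ S, m x y ^ 2 with hFr
  have hFr0 : 0 ≤ Fr := by positivity
  have c1 := hsum fun _ => 1
  simp only [Finset.sum_const, nsmul_eq_mul, mul_one, Finset.card_powersetCard, hS] at c1
  have c2 := hsum fun w => Qf S m w ^ (2 ^ (j + 1))
  have c3 : ∑ T ∈ S.powersetCard h, Qf S m (sg S T) ^ (2 ^ (j + 1)) ≤ C * 2 ^ S.card * Fr ^ (2 ^ j) := by
    refine le_trans ?_ (hch N S m (hM _))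
    refine Finset.sum_le_sum_of_subset_of_nonneg ?_ fun _ _ _ => Even.pow_nonneg (by simp [pow_succ]) _
    exact fun T hT => Finset.mem_powerset.mpr (Finset.mem_powersetCard.mp hT).1
  have c4 : (2 : ℝ) ^ S.card ≤ (N + 1) * ((2 * h).choose h : ℝ) := by
    rw [hS, pow_mul]
    norm_num
    have h2 : 2 * h ≤ N := by
      rw [← hS]; simpa using Finset.card_le_univ S
    rcases Nat.eq_zero_or_pos h with rfl | hp
    · simp
    · have := Nat.four_pow_le_two_mul_self_mul_centralBinom h hp
      rw [Nat.centralBinom_eq_two_mul_choose] at this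
      have h3 : (4 : ℝ) ^ h ≤ 2 * h * ((2 * h).choose h : ℝ) := by exact_mod_cast this
      refine h3.trans ?_
      have : (2 * h : ℝ) ≤ N := by exact_mod_cast h2
      gcongr; linarith
  have sub : bad.filter (fun A' => BB i k A' = BB i k A) ⊆ (Gr N d).filter (fun A' => BB i k A' = BB i k A) :=
    fun A' h => by
      rw [Finset.mem_filter] at h ⊢; exact ⟨(Finset.mem_filter.mp h.1).1, h.2⟩
  have bd : ∀ A' ∈ bad.filter (fun A' => BB i k A' = BB i k A), K ^ 2 * Fr < Qf S m (ww A' i k) ^ 2 := by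
    intro A' h
    rw [Finset.mem_filter, hbad, Finset.mem_filter] at h
    have := h.1.2
    rwa [h.2] at this
  rcases hFr0.eq_or_lt with h0 | h0
  · have : bad.filter (fun A' => BB i k A' = BB i k A) = ∅ := by
      apply Finset.eq_empty_of_forall_notMem
      intro A' h'
      have h1 := bd A' h'
      have z : ∀ x ∈ S, ∀ y ∈ S, m x y = 0 := by
        rw [hFr] at h0
        intro x hx y hy
        have h2 := (Finset.sum_eq_zero_iff_of_nonneg (fun _ _ => by positivity)).mp h0.symm x hx
        have h3 := (Finset.sum_eq_zero_iff_of_nonneg (fun _ _ => by positivity)).mp h2 y hy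
        simpa using h3
      have : Qf S m (ww A' i k) = 0 :=
        Finset.sum_eq_zero fun x hx => Finset.sum_eq_zero fun y hy => by rw [z x hx y hy, zero_mul]
      rw [this, ← h0] at h1; simp at h1
    rw [this]; simp; positivity
  have key : ((bad.filter (fun A' => BB i k A' = BB i k A)).card : ℝ) * (K ^ 2 * Fr) ^ (2 ^ j)
      ≤ C * 2 ^ S.card * Fr ^ (2 ^ j) := by
    refine le_trans ?_ c3
    rw [← c2, ← nsmul_eq_mul, ← Finset.sum_const]
    refine le_trans (Finset.sum_le_sum fun A' h' => ?_)
      (Finset.sum_le_sum_of_subset_of_nonneg sub fun _ _ _ => Even.pow_nonneg (by simp [pow_succ]) _)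
    rw [show 2 ^ (j + 1) = 2 * 2 ^ j by ring, pow_mul]
    exact pow_le_pow_left₀ (by positivity) (bd A' h').le _
  have hp : 0 < Fr ^ (2 ^ j) := by positivity
  refine le_of_mul_le_mul_right (le_trans (le_of_eq ?_) (key.trans ?_)) hp
  · rw [mul_pow, ← pow_mul, show 2 ^ (j + 1) = 2 * 2 ^ j by ring]; ring
  · have : (((Gr N d).filter (fun A' => BB i k A' = BB i k A)).card : ℝ) = ((2 * h).choose h : ℝ) := by
      exact_mod_cast c1
    rw [this]
    refine mul_le_mul_of_nonneg_right ?_ hp.le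
    calc C * 2 ^ S.card ≤ C * ((N + 1) * ((2 * h).choose h : ℝ)) := by gcongr
      _ = _ := by ring
/-- complex quadratic form -/
def Qc (S : Finset (Fin N)) (M : Fin N → Fin N → ℂ) (w : Fin N → ℝ) : ℂ :=
  ∑ x ∈ S, ∑ y ∈ S, M x y * (w x * w y : ℝ)
/-- Frobenius -/
def Fs (S : Finset (Fin N)) (M : Fin N → Fin N → ℂ) : ℝ := ∑ x ∈ S, ∑ y ∈ S, ‖M x y‖ ^ 2
open Classical in
lemma hw_complex (j : ℕ) : ∃ C : ℝ, 0 < C ∧ ∀ (N d : ℕ) (i k : Fin N), i ≠ k →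
    ∀ M : Matrix (Fin N) (Fin N) ℝ → Fin N → Fin N → ℂ, (∀ B x, M B x x = 0) → ∀ K : ℝ, 0 < K →
    (((Gr N d).filter fun A => K ^ 2 * Fs (SS i k (BB i k A)) (M (BB i k A))
      < ‖Qc (SS i k (BB i k A)) (M (BB i k A)) (ww A i k)‖ ^ 2).card : ℝ) * K ^ (2 ^ (j + 1))
      ≤ C * (N + 1) * (Gr N d).card := by
  obtain ⟨C, hC, h⟩ := hw_real j
  refine ⟨2 * C, by positivity, fun N d i k hik M hM K hK => ?_⟩
  have h1 := h N d i k hik (fun B x y => (M B x y).re) (by simp [hM]) K hK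
  have h2 := h N d i k hik (fun B x y => (M B x y).im) (by simp [hM]) K hK
  have sub : ((Gr N d).filter fun A => K ^ 2 * Fs (SS i k (BB i k A)) (M (BB i k A))
      < ‖Qc (SS i k (BB i k A)) (M (BB i k A)) (ww A i k)‖ ^ 2) ⊆
      ((Gr N d).filter fun A => K ^ 2 * (∑ x ∈ SS i k (BB i k A), ∑ y ∈ SS i k (BB i k A), (M (BB i k A) x y).re ^ 2)
      < Qf (SS i k (BB i k A)) (fun x y => (M (BB i k A) x y).re) (ww A i k) ^ 2) ∪
      ((Gr N d).filter fun A => K ^ 2 * (∑ x ∈ SS i k (BB i k A), ∑ y ∈ SS i k (BB i k A), (M (BB i k A) x y).im ^ 2)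
      < Qf (SS i k (BB i k A)) (fun x y => (M (BB i k A) x y).im) (ww A i k) ^ 2) := by
    intro A hA
    rw [Finset.mem_union, Finset.mem_filter, Finset.mem_filter]
    rw [Finset.mem_filter] at hA
    by_contra hn
    have hn1 := not_or.mp hn
    have a1 := not_lt.mp (fun hh => hn1.1 ⟨hA.1, hh⟩)
    have a2 := not_lt.mp (fun hh => hn1.2 ⟨hA.1, hh⟩)
    refine absurd hA.2 (not_lt.mpr ?_)
    have e1 : ∀ w : ℂ, ‖w‖ ^ 2 = w.re ^ 2 + w.im ^ 2 := fun w => by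
      rw [Complex.sq_norm, Complex.normSq_apply]; ring
    have e2 : (Qc (SS i k (BB i k A)) (M (BB i k A)) (ww A i k)).re =
        Qf (SS i k (BB i k A)) (fun x y => (M (BB i k A) x y).re) (ww A i k) := by
      simp only [Qc, Qf, Complex.re_sum, Complex.re_mul_ofReal]
    have e3 : (Qc (SS i k (BB i k A)) (M (BB i k A)) (ww A i k)).im =
        Qf (SS i k (BB i k A)) (fun x y => (M (BB i k A) x y).im) (ww A i k) := by
      simp only [Qc, Qf, Complex.im_sum, Complex.im_mul_ofReal]
    rw [e1, e2, e3]
    simp only [Fs, e1, Finset.sum_add_distrib]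
    linarith
  have h3 := (Finset.card_le_card sub).trans (Finset.card_union_le _ _)
  have h4 : (((Gr N d).filter fun A => K ^ 2 * Fs (SS i k (BB i k A)) (M (BB i k A))
      < ‖Qc (SS i k (BB i k A)) (M (BB i k A)) (ww A i k)‖ ^ 2).card : ℝ) ≤ _ := Nat.cast_le.mpr h3
  rw [Nat.cast_add] at h4
  calc _ ≤ _ := mul_le_mul_of_nonneg_right h4 (by positivity)
    _ ≤ _ := by rw [add_mul]; linarith
lemma sg_sum {S T : Finset (Fin N)} (hT : T ⊆ S) : ∑ x ∈ S, sg S T x = 2 * T.card - S.card := by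
  have : ∀ x ∈ S, sg S T x = 2 * (if x ∈ T then 1 else 0) - 1 := fun x hx => by
    simp only [sg, hx, if_true]; split_ifs <;> norm_num
  rw [Finset.sum_congr rfl this, Finset.sum_sub_distrib, ← Finset.mul_sum, Finset.sum_ite_mem,
    Finset.inter_eq_right.mpr hT]
  simp
/-- pair correlation of balanced signs -/
lemma corr {S : Finset (Fin N)} {h : ℕ} (hS : S.card = 2 * h) {x y : Fin N} (hx : x ∈ S) (hy : y ∈ S)
    (hxy : x ≠ y) : ∑ T ∈ S.powersetCard h, (sg S T x * sg S T y + 1 / ((S.card : ℝ) - 1)) = 0 := by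
  have swap : ∀ y', y' ∈ S → y' ≠ x → ∑ T ∈ S.powersetCard h, sg S T x * sg S T y'
      = ∑ T ∈ S.powersetCard h, sg S T x * sg S T y := by
    intro y' hy' hxy'
    have sw : ∀ v, v ∈ S → Equiv.swap y y' v ∈ S := fun v hv => by
      rw [Equiv.swap_apply_def]; split_ifs <;> assumption
    have sm : ∀ (T : Finset (Fin N)) (v : Fin N), v ∈ T.map (Equiv.swap y y').toEmbedding ↔ Equiv.swap y y' v ∈ T := fun T v => by
      simp only [Finset.mem_map_equiv, Equiv.symm_swap]
    refine Finset.sum_bij' (fun T _ => T.map (Equiv.swap y y').toEmbedding)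
      (fun T _ => T.map (Equiv.swap y y').toEmbedding) ?_ ?_ ?_ ?_ ?_
    · intro T hT
      rw [Finset.mem_powersetCard] at hT ⊢
      refine ⟨fun v hv => ?_, by simp [hT.2]⟩
      rw [sm] at hv
      simpa using sw _ (hT.1 hv)
    · intro T hT
      rw [Finset.mem_powersetCard] at hT ⊢
      refine ⟨fun v hv => ?_, by simp [hT.2]⟩
      rw [sm] at hv
      simpa using sw _ (hT.1 hv)
    · intro T _; ext v; simp
    · intro T _; ext v; simp
    · intro T _
      simp only [sg, hx, hy, hy', if_true, sm, Equiv.swap_apply_left, Equiv.swap_apply_of_ne_of_ne hxy hxy'.symm]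
  have tot : ∑ y' ∈ S, ∑ T ∈ S.powersetCard h, sg S T x * sg S T y' = 0 := by
    rw [Finset.sum_comm]
    refine Finset.sum_eq_zero fun T hT => ?_
    rw [Finset.mem_powersetCard] at hT
    rw [← Finset.mul_sum, sg_sum hT.1, hT.2, hS]; push_cast; ring
  rw [← Finset.add_sum_erase _ _ hx, Finset.sum_congr rfl (fun y' hy' =>
    swap y' (Finset.mem_of_mem_erase hy') (Finset.ne_of_mem_erase hy'))] at tot
  have d1 : ∑ T ∈ S.powersetCard h, sg S T x * sg S T x = ((S.powersetCard h).card : ℝ) := by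
    rw [Finset.cast_card]
    refine Finset.sum_congr rfl fun T _ => ?_
    simp only [sg, hx, if_true]; split_ifs <;> norm_num
  have h1 : 1 < S.card := Finset.one_lt_card.mpr ⟨x, hx, y, hy, hxy⟩
  have h2 : (0 : ℝ) < (S.card : ℝ) - 1 := by
    have : (1 : ℝ) < S.card := by exact_mod_cast h1
    linarith
  rw [d1, Finset.sum_const, Finset.card_erase_of_mem hx, nsmul_eq_mul, Nat.cast_sub h1.le] at tot
  rw [Finset.sum_add_distrib, Finset.sum_const, nsmul_eq_mul]
  field_simp
  push_cast at tot
  linarith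
/-- centred quadratic form has mean zero -/
lemma zero_mean (d : ℕ) {i k : Fin N} (hik : i ≠ k)
    (M : Matrix (Fin N) (Fin N) ℝ → Fin N → Fin N → ℂ) (hM : ∀ B x, M B x x = 0)
    (c : Matrix (Fin N) (Fin N) ℝ → ℂ) :
    ∑ A ∈ Gr N d, (Qc (SS i k (BB i k A)) (M (BB i k A)) (ww A i k)
      + (∑ x ∈ SS i k (BB i k A), ∑ y ∈ SS i k (BB i k A), M (BB i k A) x y)
        * ((1 / (((SS i k (BB i k A)).card : ℝ) - 1) : ℝ) : ℂ)) * c (BB i k A) = 0 := by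
  classical
  rw [← Finset.sum_fiberwise_of_maps_to (g := BB i k) (t := (Gr N d).image (BB i k))
    (fun A hA => Finset.mem_image_of_mem _ hA)]
  refine Finset.sum_eq_zero fun B hB => ?_
  obtain ⟨A, hA, rfl⟩ := Finset.mem_image.mp hB
  rw [mem_Gr] at hA
  obtain ⟨h, hS, hsum⟩ := fibre_sum hA hik (E := ℂ)
  rw [Finset.sum_congr rfl (g := fun A' => (fun w => (Qc (SS i k (BB i k A)) (M (BB i k A)) w
      + (∑ x ∈ SS i k (BB i k A), ∑ y ∈ SS i k (BB i k A), M (BB i k A) x y)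
        * ((1 / (((SS i k (BB i k A)).card : ℝ) - 1) : ℝ) : ℂ)) * c (BB i k A)) (ww A' i k)) (fun A' h' => by
      rw [(Finset.mem_filter.mp h').2])]
  refine Eq.trans (by congr!) ((hsum fun w => (Qc (SS i k (BB i k A)) (M (BB i k A)) w
      + (∑ x ∈ SS i k (BB i k A), ∑ y ∈ SS i k (BB i k A), M (BB i k A) x y)
        * ((1 / (((SS i k (BB i k A)).card : ℝ) - 1) : ℝ) : ℂ)) * c (BB i k A)).trans ?_)
  set S := SS i k (BB i k A)
  rw [← Finset.sum_mul]
  refine mul_eq_zero_of_left ?_ _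
  simp only [Qc, Finset.sum_mul, ← Finset.sum_add_distrib, ← mul_add]
  rw [Finset.sum_comm]
  refine Finset.sum_eq_zero fun x hx => ?_
  rw [Finset.sum_comm]
  refine Finset.sum_eq_zero fun y hy => ?_
  rcases eq_or_ne x y with rfl | hxy
  · simp [hM]
  · rw [← Finset.mul_sum]
    have := corr hS hx hy hxy
    have h2 : ((∑ T ∈ S.powersetCard h, (sg S T x * sg S T y + 1 / ((S.card : ℝ) - 1)) : ℝ) : ℂ) = 0 := by
      rw [this]; simp
    rw [Complex.ofReal_sum] at h2
    simp only [Complex.ofReal_add] at h2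
    rw [h2, mul_zero]
end RR
namespace RR
variable {N : ℕ}
/-- averaged trace -/
def gg (p q : ℝ) (z : ℂ) (A : Matrix (Fin N) (Fin N) ℝ) : ℂ := ((GG p q z A).trace + z⁻¹) / (N - 1)
/-- diagonal fluctuation -/
def DD (p q : ℝ) (z : ℂ) (A : Matrix (Fin N) (Fin N) ℝ) (x : Fin N) : ℂ := GG p q z A x x - gg p q z A
/-- mean square of `DD` -/
def WW (p q : ℝ) (z : ℂ) (A : Matrix (Fin N) (Fin N) ℝ) : ℝ := (∑ x, ‖DD p q z A x‖ ^ 2) / N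
/-- self-consistent polynomial -/
def PP (p q : ℝ) (z : ℂ) (A : Matrix (Fin N) (Fin N) ℝ) : ℂ := 1 + z * gg p q z A + gg p q z A ^ 2
/-- centred codegree -/
def X2 (d : ℕ) (A : Matrix (Fin N) (Fin N) ℝ) (x y : Fin N) : ℝ := ∑ v, A x v * A y v - d ^ 2 / N
/-- error -/
def ep (p q : ℝ) (z : ℂ) (i k : Fin N) (A : Matrix (Fin N) (Fin N) ℝ) : ℂ :=
  YY p q z i k A + A i k / q - gg p q z A
/-- pair indicator -/
def Sp (A : Matrix (Fin N) (Fin N) ℝ) (i k x : Fin N) : ℝ := (A x i - A x k) ^ 2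
/-- average over ordered pairs -/
def av {E : Type} [AddCommGroup E] [Module ℝ E] (f : Fin N → Fin N → E) : E :=
  ((N : ℝ) * (N - 1))⁻¹ • ∑ e ∈ (Finset.univ : Finset (Fin N)).offDiag, f e.1 e.2
/-- standing assumptions -/
structure Ctx (N d : ℕ) (A : Matrix (Fin N) (Fin N) ℝ) (p q : ℝ) (z : ℂ) : Prop where
  adj : IsAdjMat N d A
  hN : 4 ≤ N
  hd : 1 ≤ d
  h2d : 2 * d ≤ N
  hp : p = d / N
  hq : 0 < q
  hq2 : q ^ 2 = d * (1 - p)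
  hz : 0 < z.im
  hz2 : 2 ≤ ‖z‖
section av
variable {E : Type} [AddCommGroup E] [Module ℝ E]
lemma av_add (f g : Fin N → Fin N → E) : av (fun i k => f i k + g i k) = av f + av g := by
  simp [av, Finset.sum_add_distrib]
lemma av_sub (f g : Fin N → Fin N → E) : av (fun i k => f i k - g i k) = av f - av g := by
  simp [av, Finset.sum_sub_distrib, smul_sub]
lemma av_neg (f : Fin N → Fin N → E) : av (fun i k => - f i k) = - av f := by
  simp [av]
lemma av_const (hN : 4 ≤ N) (c : E) : av (N := N) (fun _ _ => c) = c := by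
  have hN' : (4 : ℝ) ≤ N := by exact_mod_cast hN
  simp only [av, Finset.sum_const, Finset.offDiag_card, Finset.card_univ, Fintype.card_fin]
  rw [← Nat.cast_smul_eq_nsmul ℝ, smul_smul, Nat.cast_sub (by nlinarith)]
  push_cast
  rw [show ((N : ℝ) * N - N) = N * (N - 1) by ring, inv_mul_cancel₀, one_smul]
  have : (N : ℝ) - 1 ≠ 0 := by linarith
  positivity
lemma av_smul_r (c : ℝ) (f : Fin N → Fin N → ℝ) : av (fun i k => c * f i k) = c * av f := by
  simp [av, Finset.mul_sum]; exact Finset.sum_congr rfl fun _ _ => by ring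
lemma av_smul_c (c : ℂ) (f : Fin N → Fin N → ℂ) : av (fun i k => c * f i k) = c * av f := by
  simp [av, Finset.mul_sum]; exact Finset.sum_congr rfl fun _ _ => by ring
lemma av_congr {f g : Fin N → Fin N → E} (h : ∀ i k, i ≠ k → f i k = g i k) : av f = av g := by
  unfold av; congr 1
  refine Finset.sum_congr rfl fun e he => h _ _ ?_
  simpa using he
lemma av_pos (hN : 4 ≤ N) : 0 < ((N : ℝ) * (N - 1)) := by
  have hN' : (4 : ℝ) ≤ N := by exact_mod_cast hN
  have : 0 < (N : ℝ) - 1 := by linarith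
  positivity
lemma av_mono (hN : 4 ≤ N) {f g : Fin N → Fin N → ℝ} (h : ∀ i k, i ≠ k → f i k ≤ g i k) : av f ≤ av g := by
  unfold av
  have := av_pos hN
  refine smul_le_smul_of_nonneg_left (Finset.sum_le_sum fun e he => h _ _ ?_) (by positivity)
  simpa using he
lemma av_norm (hN : 4 ≤ N) (f : Fin N → Fin N → ℂ) : ‖av f‖ ≤ av fun i k => ‖f i k‖ := by
  unfold av
  have := av_pos hN
  rw [norm_smul, Real.norm_of_nonneg (by positivity), smul_eq_mul]
  gcongr
  exact norm_sum_le _ _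
lemma av_nonneg (hN : 4 ≤ N) {f : Fin N → Fin N → ℝ} (h : ∀ i k, i ≠ k → 0 ≤ f i k) : 0 ≤ av f := by
  have := av_mono hN h; simpa [av] using this
lemma av_sq (hN : 4 ≤ N) (f : Fin N → Fin N → ℝ) : (av f) ^ 2 ≤ av fun i k => f i k ^ 2 := by
  have h1 : 0 ≤ av fun i k => (f i k - av f) ^ 2 := av_nonneg hN fun _ _ _ => sq_nonneg _
  have h2 : (av fun i k => (f i k - av f) ^ 2) = av fun i k => (f i k ^ 2 - 2 * av f * f i k) + av f ^ 2 :=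
    av_congr fun _ _ _ => by ring
  rw [h2, av_add, av_sub, av_smul_r, av_const hN] at h1
  nlinarith
lemma av_cs (hN : 4 ≤ N) (f g : Fin N → Fin N → ℝ) :
    (av fun i k => f i k * g i k) ^ 2 ≤ (av fun i k => f i k ^ 2) * av fun i k => g i k ^ 2 := by
  have h := Finset.sum_mul_sq_le_sq_mul_sq (Finset.univ : Finset (Fin N)).offDiag
    (fun e => f e.1 e.2) (fun e => g e.1 e.2)
  have := av_pos hN
  simp only [av, smul_eq_mul, mul_pow]
  calc _ ≤ ((N : ℝ) * (N - 1))⁻¹ ^ 2 * _ := mul_le_mul_of_nonneg_left h (by positivity)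
    _ = _ := by ring
lemma av_eq {f : Fin N → Fin N → E} (h : ∀ i, f i i = 0) :
    av f = ((N : ℝ) * (N - 1))⁻¹ • ∑ i, ∑ k, f i k := by
  unfold av; congr 1
  rw [← Finset.sum_product', Finset.univ_product_univ, ← Finset.univ_product_univ, ← Finset.diag_union_offDiag,
    Finset.sum_union (Finset.disjoint_diag_offDiag _), Finset.sum_diag]
  simp [h]
lemma av_le (hN : 4 ≤ N) {f : Fin N → Fin N → ℝ} (h : ∀ i k, 0 ≤ f i k) :
    av f ≤ 2 / N ^ 2 * ∑ i, ∑ k, f i k := by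
  have hN' : (4 : ℝ) ≤ N := by exact_mod_cast hN
  have hp := av_pos hN
  have h1 : ∑ e ∈ (Finset.univ : Finset (Fin N)).offDiag, f e.1 e.2 ≤ ∑ i, ∑ k, f i k := by
    rw [← Finset.sum_product', Finset.univ_product_univ]
    exact Finset.sum_le_sum_of_subset_of_nonneg (Finset.subset_univ _) fun _ _ _ => h _ _
  have h2 : 0 ≤ ∑ i, ∑ k, f i k := Finset.sum_nonneg fun i _ => Finset.sum_nonneg fun k _ => h i k
  unfold av
  rw [smul_eq_mul]
  refine mul_le_mul ?_ h1 (Finset.sum_nonneg fun _ _ => h _ _) (by positivity)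
  rw [inv_eq_one_div, div_le_div_iff₀ hp (by positivity)]
  nlinarith
lemma av_swap {n : ℕ} (c : Fin n → E) (f : Fin N → Fin N → Fin n → ℝ) :
    av (fun i k => ∑ x, f i k x • c x) = ∑ x, av (fun i k => f i k x) • c x := by
  simp only [av]
  rw [Finset.sum_comm, Finset.smul_sum]
  refine Finset.sum_congr rfl fun x _ => ?_
  rw [← Finset.sum_smul, smul_eq_mul, ← smul_smul]
end av
section ctx
variable {d : ℕ} {A : Matrix (Fin N) (Fin N) ℝ} {p q : ℝ} {z : ℂ} (c : Ctx N d A p q z)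
include c
lemma Ctx.N4 : (4 : ℝ) ≤ N := by exact_mod_cast c.hN
lemma Ctx.d1 : (1 : ℝ) ≤ d := by exact_mod_cast c.hd
lemma Ctx.dN : 2 * (d : ℝ) ≤ N := by exact_mod_cast c.h2d
lemma Ctx.pN : p * N = d := by rw [c.hp]; have := c.N4; field_simp
lemma Ctx.p0 : 0 < p := by rw [c.hp]; have := c.N4; have := c.d1; positivity
lemma Ctx.p1 : p ≤ 1 / 2 := by
  have := c.pN; have := c.N4; have := c.dN; by_contra h; push Not at h; nlinarith
lemma Ctx.q_le : q ^ 2 ≤ d := by rw [c.hq2]; have := c.p0; have := c.d1; nlinarith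
lemma Ctx.le_q : (d : ℝ) / 2 ≤ q ^ 2 := by rw [c.hq2]; have := c.p1; have := c.d1; nlinarith
lemma Ctx.z0 : z ≠ 0 := by have := c.hz; rintro rfl; simp at this
lemma Ctx.zi : ‖z⁻¹‖ ≤ 1 / 2 := by
  rw [norm_inv, one_div]; exact inv_anti₀ (by norm_num) c.hz2
lemma Ctx.sH : (HH p q A).IsSymm := HH_symm p q c.adj.1
lemma Ctx.Acol (j : Fin N) : ∑ x, A x j = d := by
  rw [← c.adj.2.2.2 j]; exact Finset.sum_congr rfl fun x _ => c.adj.1.apply j x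
lemma Ctx.Asq (x y : Fin N) : A x y ^ 2 = A x y := by rcases c.adj.2.2.1 x y with h | h <;> rw [h] <;> norm_num
lemma Ctx.A01 (x y : Fin N) : 0 ≤ A x y ∧ A x y ≤ 1 := by rcases c.adj.2.2.1 x y with h | h <;> rw [h] <;> norm_num
lemma Ctx.As (x y : Fin N) : A x y = A y x := c.adj.1.apply y x
lemma Ctx.G1 : GG p q z A *ᵥ (fun _ => 1) = fun _ => - z⁻¹ := by
  apply R_of_eq c.sH c.hz
  rw [sub_mulVec, smul_mulVec, one_mulVec]
  ext x
  simp only [mulVec, dotProduct, Pi.sub_apply, Pi.smul_apply, smul_eq_mul, map_apply, HH, of_apply]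
  rw [← Finset.sum_mul, ← Complex.ofReal_sum, ← Finset.sum_div, Finset.sum_sub_distrib, c.adj.2.2.2]
  have := c.pN
  have h2 : (d : ℝ) - N * p = 0 := by linarith
  have := c.z0
  simp; field_simp
  rw [show (d : ℂ) - N * p = 0 by exact_mod_cast h2]
  simp
lemma Ctx.Grow (x : Fin N) : ∑ y, GG p q z A x y = - z⁻¹ := by
  have := congrFun c.G1 x
  simpa [mulVec, dotProduct] using this
lemma Ctx.ze_row (i : Fin N) : ∑ k, ze p q z i k A = (N * GG p q z A i i + (GG p q z A).trace) / 2 + z⁻¹ := by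
  simp only [ze_eq c.adj.1 p q c.hz, Finset.sum_sub_distrib, c.Grow, ← Finset.sum_div, Finset.sum_add_distrib]
  simp [trace]
lemma Ctx.ze_diag (i : Fin N) : ze p q z i i A = 0 := by rw [ze_eq c.adj.1 p q c.hz]; ring
lemma Ctx.N1 : (N : ℂ) - 1 ≠ 0 := by
  have := c.N4
  have h : (N : ℝ) - 1 ≠ 0 := by linarith
  exact_mod_cast h
lemma Ctx.N0 : (N : ℂ) ≠ 0 := by
  have := c.hN
  exact_mod_cast (by omega : N ≠ 0)
lemma Ctx.tr : (GG p q z A).trace = (N - 1) * gg p q z A - z⁻¹ := by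
  have := c.N1; have := c.z0; unfold gg; field_simp; ring
lemma Ctx.av_ze : av (fun i k => ze p q z i k A) = gg p q z A := by
  rw [av_eq c.ze_diag]
  simp only [c.ze_row]
  rw [Finset.sum_add_distrib, ← Finset.sum_div, Finset.sum_add_distrib, ← Finset.mul_sum]
  have e : ∑ x, GG p q z A x x = (GG p q z A).trace := rfl
  rw [e]
  have := c.N1; have := c.z0; have := c.N0
  simp [gg]
  field_simp
lemma Ctx.D_sum : ∑ x, DD p q z A x = - gg p q z A - z⁻¹ := by
  simp only [DD, Finset.sum_sub_distrib]
  have e : ∑ x, GG p q z A x x = (GG p q z A).trace := rfl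
  rw [e, c.tr]; simp; ring
lemma Ctx.ze_im (i k : Fin N) : 0 ≤ (ze p q z i k A).im := by
  have h := R_ward c.sH c.hz (cc (uu i k))
  have e : star (cc (uu i k)) = cc (uu i k) := by ext x; simp [cc]
  rw [e] at h
  have h2 : (ze p q z i k A).im = (cc (uu i k) ⬝ᵥ (R (HH p q A) z *ᵥ cc (uu i k))).im / 2 := by
    rw [ze]; exact Complex.div_ofNat_im _ 2
  rw [h2, h]
  have := c.hz
  unfold ns; positivity
lemma Ctx.g_im : 0 ≤ (gg p q z A).im := by
  have h : (gg p q z A).im = av (fun i k => (ze p q z i k A).im) := by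
    rw [← c.av_ze, av, av, Complex.smul_im, Complex.im_sum]
  rw [h]; exact av_nonneg c.hN fun i k _ => c.ze_im i k
/-- Frobenius norm of the Green function -/
lemma Ctx.G_fro : ∑ x, ∑ y, ‖GG p q z A x y‖ ^ 2 ≤ N * ((gg p q z A).im / z.im) + 1 / 4 := by
  have h := R_ward_tr c.sH c.hz
  change z.im * ∑ x, ∑ y, ‖GG p q z A x y‖ ^ 2 = (GG p q z A).trace.im at h
  have e : (GG p q z A).trace.im = (N - 1) * (gg p q z A).im + z.im / ‖z‖ ^ 2 := by
    rw [c.tr, Complex.sub_im, Complex.inv_im, Complex.normSq_eq_norm_sq]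
    have : ((N : ℂ) - 1) = (((N : ℝ) - 1 : ℝ) : ℂ) := by push_cast; ring
    rw [this, Complex.im_ofReal_mul]; ring
  rw [e] at h
  have hz := c.hz
  have h3 : z.im / ‖z‖ ^ 2 ≤ z.im / 4 := by
    gcongr; have := c.hz2; nlinarith
  have := c.g_im
  refine le_of_mul_le_mul_left ?_ hz
  rw [h, mul_add, show z.im * (N * ((gg p q z A).im / z.im)) = N * (gg p q z A).im by field_simp]
  linarith
lemma Ctx.X2_eq (x y : Fin N) : ∑ v, A x v * A y v = X2 d A x y + d * p := by
  rw [X2, c.hp]; ring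
lemma Ctx.X2_diag (x : Fin N) : X2 d A x x = q ^ 2 := by
  have h : ∑ v, A x v * A x v = d := by
    rw [← c.adj.2.2.2 x]; exact Finset.sum_congr rfl fun v _ => by rw [← sq, c.Asq]
  rw [X2, h, c.hq2, c.hp]; ring
/-- two point function of the resampled set -/
lemma Ctx.Sp2 (x y : Fin N) : ∑ i, ∑ k, Sp A i k x * Sp A i k y
    = 4 * q ^ 4 + 2 * N * (1 - 2 * p) ^ 2 * X2 d A x y + 4 * X2 d A x y ^ 2 := by
  have e : ∀ i k, Sp A i k x * Sp A i k y = A x i * A y i + A x k * A y k + A x i * A y k + A x k * A y i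
      - 2 * (A x i * A y i) * A y k - 2 * (A x k * A y k) * A y i
      - 2 * (A x i * A y i) * A x k - 2 * (A x k * A y k) * A x i + 4 * (A x i * A y i) * (A x k * A y k) := fun i k => by
    have h1 := c.Asq x i; have h2 := c.Asq x k; have h3 := c.Asq y i; have h4 := c.Asq y k
    have e1 : Sp A i k x = A x i + A x k - 2 * A x i * A x k := by unfold Sp; linear_combination h1 + h2
    have e2 : Sp A i k y = A y i + A y k - 2 * A y i * A y k := by unfold Sp; linear_combination h3 + h4
    rw [e1, e2]; ring
  simp only [e, Finset.sum_add_distrib, Finset.sum_sub_distrib, ← Finset.mul_sum, ← Finset.sum_mul,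
    c.adj.2.2.2, Finset.sum_const, Finset.card_univ, Fintype.card_fin, nsmul_eq_mul, c.X2_eq]
  have h := c.pN
  have hq := c.hq2
  have e3 : ∑ i, A x i * (N * A y i) = N * (X2 d A x y + d * p) := by
    rw [← c.X2_eq, Finset.mul_sum]; exact Finset.sum_congr rfl fun _ _ => by ring
  rw [e3]
  rw [show q ^ 4 = (q ^ 2) ^ 2 by ring, hq, ← h]
  ring
lemma Ctx.Sp1 (x : Fin N) : ∑ i, ∑ k, Sp A i k x = 2 * N * q ^ 2 := by
  have e : ∀ i k, Sp A i k x = A x i + A x k - 2 * A x i * A x k := fun i k => by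
    have h1 := c.Asq x i; have h2 := c.Asq x k
    unfold Sp; linear_combination h1 + h2
  simp only [e, Finset.sum_add_distrib, Finset.sum_sub_distrib, ← Finset.mul_sum, ← Finset.sum_mul,
    c.adj.2.2.2, Finset.sum_const, Finset.card_univ, Fintype.card_fin, nsmul_eq_mul]
  rw [c.hq2, ← c.pN]; ring
omit c in
lemma Sp_nn (i k x : Fin N) : 0 ≤ Sp A i k x := sq_nonneg _
/-- `S'` versus `S` -/
lemma Ctx.Sp_S {i k x : Fin N} (hi : x ≠ i) (hk : x ≠ k) :
    Sp A i k x = if x ∈ SS i k (BB i k A) then 1 else 0 := by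
  simp only [mem_SS c.adj, hi, hk, ne_eq, not_false_eq_true, true_and]
  rcases c.adj.2.2.1 x i with h | h <;> rcases c.adj.2.2.1 x k with h' | h' <;> simp [Sp, h, h']
lemma Ctx.Sp_i {i k : Fin N} : Sp A i k i = A i k ∧ Sp A i k k = A i k := by
  simp [Sp, c.adj.2.1, c.Asq, c.As k i]
lemma Ctx.S_ind {i k : Fin N} (hik : i ≠ k) (x : Fin N) :
    (if x ∈ SS i k (BB i k A) then (1 : ℝ) else 0) = Sp A i k x - A i k * uu i k x ^ 2 := by
  by_cases h1 : x = i
  · subst h1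
    simp [mem_SS c.adj, c.Sp_i, uu, hik]
  by_cases h2 : x = k
  · subst h2
    simp [mem_SS c.adj, c.Sp_i, uu, hik.symm]
  rw [c.Sp_S h1 h2, uu_ne h1 h2]; simp
lemma Ctx.S_sum {i k : Fin N} (hik : i ≠ k) (f : Fin N → ℂ) :
    ∑ x ∈ SS i k (BB i k A), f x = ∑ x, Sp A i k x • f x - A i k * (f i + f k) := by
  rw [← Finset.sum_filter_add_sum_filter_not Finset.univ (· ∈ SS i k (BB i k A))]
  have e : ∑ x ∈ SS i k (BB i k A), f x = ∑ x, (Sp A i k x - A i k * uu i k x ^ 2 : ℝ) • f x := by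
    simp only [← c.S_ind hik, ite_smul, one_smul, zero_smul, Finset.sum_ite_mem, Finset.univ_inter]
  rw [e, Finset.sum_filter_add_sum_filter_not]
  simp only [sub_smul, Finset.sum_sub_distrib]
  congr 1
  have : ∀ x, uu i k x ^ 2 = (if x = i then 1 else 0) + (if x = k then 1 else 0) := fun x => by
    unfold uu; split_ifs <;> simp_all
  simp [this, mul_add, add_mul, Finset.sum_add_distrib, apply_ite Complex.ofReal, ite_mul]
lemma Ctx.S_card {i k : Fin N} (hik : i ≠ k) :
    ((SS i k (BB i k A)).card : ℝ) = 2 * (q ^ 2 - X2 d A i k - A i k) := by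
  have h := c.S_sum hik fun _ => 1
  have h2 : ((SS i k (BB i k A)).card : ℝ) = ∑ x, Sp A i k x - A i k * 2 := by
    have : (((SS i k (BB i k A)).card : ℝ) : ℂ) = ((∑ x, Sp A i k x - A i k * 2 : ℝ) : ℂ) := by
      simp at h; push_cast; rw [h]; ring
    exact_mod_cast this
  have e : ∀ x, Sp A i k x = A x i + A x k - 2 * (A i x * A k x) := fun x => by
    have h1 := c.Asq x i; have h2 := c.Asq x k
    rw [c.As i x, c.As k x]
    unfold Sp; linear_combination h1 + h2
  rw [h2]
  simp only [e, Finset.sum_sub_distrib, Finset.sum_add_distrib, ← Finset.mul_sum, c.Acol, c.X2_eq]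
  rw [c.hq2]; ring
lemma Ctx.S_card_le {i k : Fin N} (hik : i ≠ k) : ((SS i k (BB i k A)).card : ℝ) ≤ 2 * d := by
  rw [c.S_card hik]
  have h := c.X2_eq i k
  have h0 : 0 ≤ ∑ v, A i v * A k v := Finset.sum_nonneg fun v _ => mul_nonneg (c.A01 i v).1 (c.A01 k v).1
  have := (c.A01 i k).1
  rw [c.hq2]; nlinarith
end ctx
end RR
namespace RR
variable {N : ℕ}
/-- local Frobenius norm squared -/
def F2 (p q : ℝ) (z : ℂ) (i k : Fin N) (A : Matrix (Fin N) (Fin N) ℝ) : ℝ :=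
  Fs (SS i k (BB i k A)) (GG p q z (BB i k A))
/-- control parameter -/
def VV (d : ℕ) (p q : ℝ) (z : ℂ) (A : Matrix (Fin N) (Fin N) ℝ) : ℝ := (gg p q z A).im / (N * z.im) + 1 / d
/-- the good event at `z` -/
structure Om (N d : ℕ) (A : Matrix (Fin N) (Fin N) ℝ) (p q : ℝ) (z : ℂ) (K : ℝ) : Prop where
  o1 : ∀ x y, x ≠ y → |X2 d A x y| ≤ K * √d
  o2 : ∀ i k, i ≠ k → ‖cc (ww A i k) ⬝ᵥ gw p q z i k A
    - ∑ x ∈ SS i k (BB i k A), GG p q z (BB i k A) x x‖ ≤ K * √(F2 p q z i k A)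
  o3 : ∀ i k, i ≠ k → ∑ x ∈ SS i k (BB i k A), ‖gw p q z i k A x‖ ^ 2 ≤ 2 * K * F2 p q z i k A
/-- weak a priori bounds -/
structure Ap (N d : ℕ) (A : Matrix (Fin N) (Fin N) ℝ) (p q : ℝ) (z : ℂ) (K : ℝ) : Prop extends Ctx N d A p q z where
  om : Om N d A p q z K
  ze2 : ∀ i k, ‖ze p q z i k A‖ ≤ 2
  g1 : ‖gg p q z A‖ ≤ 1
  K6 : 10 ^ 6 ≤ K
  Kη20 : K ^ 20 ≤ d * z.im
  KN : N * K ^ 10 ≤ d * √d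
lemma F2_nn (p q : ℝ) (z : ℂ) (i k : Fin N) (A : Matrix (Fin N) (Fin N) ℝ) : 0 ≤ F2 p q z i k A := by
  unfold F2 Fs; positivity
section
variable {d : ℕ} {A : Matrix (Fin N) (Fin N) ℝ} {p q : ℝ} {z : ℂ} {K : ℝ} (a : Ap N d A p q z K)
include a
lemma Ap.q4_le : q ^ 4 ≤ d ^ 2 := by
  have := a.q_le
  calc q ^ 4 = (q ^ 2) ^ 2 := by ring
    _ ≤ _ := by gcongr
lemma Ap.le_q4 : (d : ℝ) ^ 2 / 4 ≤ q ^ 4 := by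
  have := a.le_q
  calc (d : ℝ) ^ 2 / 4 = (d / 2) ^ 2 := by ring
    _ ≤ (q ^ 2) ^ 2 := by gcongr
    _ = _ := by ring
lemma Ap.V_nn : 0 ≤ (gg p q z A).im / (N * z.im) := by
  have := a.g_im; have := a.hz; positivity
lemma Ap.K0 : 0 < K := lt_of_lt_of_le (by norm_num) a.K6
lemma Ap.Kη : K ^ 4 ≤ d * z.im := by
  refine le_trans ?_ a.Kη20
  exact pow_le_pow_right₀ (by have := a.K6; linarith) (by norm_num)
lemma Ap.Gd (x : Fin N) : ‖GG p q z A x x‖ ≤ 6 := by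
  have h := a.ze_row x
  have hN := a.N4
  have e : GG p q z A x x = (2 / N : ℂ) * ∑ k, ze p q z x k A - (1 - 1 / N : ℂ) * gg p q z A - (1 / N : ℂ) * z⁻¹ := by
    rw [h, a.tr]
    have := a.N0; have := a.z0
    field_simp; ring
  have h1 : ‖∑ k, ze p q z x k A‖ ≤ N * 2 := by
    refine (norm_sum_le _ _).trans ((Finset.sum_le_sum fun k _ => a.ze2 x k).trans ?_)
    simp
  have h2 : ‖(2 / N : ℂ) * ∑ k, ze p q z x k A‖ ≤ 4 := by
    rw [norm_mul, norm_div, Complex.norm_natCast, Complex.norm_ofNat]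
    calc _ ≤ 2 / (N : ℝ) * (N * 2) := by gcongr
      _ = 4 := by field_simp; norm_num
  have h4 : (1 : ℝ) / N ≤ 1 := by rw [div_le_one (by linarith)]; linarith
  have h5 : (0 : ℝ) ≤ 1 / N := by positivity
  have h3 : ‖(1 - 1 / N : ℂ) * gg p q z A‖ ≤ 1 := by
    have : (1 - 1 / N : ℂ) = ((1 - 1 / N : ℝ) : ℂ) := by push_cast; ring
    rw [norm_mul, this, Complex.norm_real, Real.norm_of_nonneg (by linarith)]
    have := a.g1
    have := norm_nonneg (gg p q z A)
    nlinarith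
  have h6 : ‖(1 / N : ℂ) * z⁻¹‖ ≤ 1 := by
    rw [norm_mul, norm_div, Complex.norm_natCast, norm_one]
    have := a.zi
    have := norm_nonneg (z⁻¹)
    nlinarith
  rw [e]
  have := norm_sub_le ((2 / N : ℂ) * ∑ k, ze p q z x k A - (1 - 1 / N : ℂ) * gg p q z A) ((1 / N : ℂ) * z⁻¹)
  have := norm_sub_le ((2 / N : ℂ) * ∑ k, ze p q z x k A) ((1 - 1 / N : ℂ) * gg p q z A)
  linarith
lemma Ap.Dd (x : Fin N) : ‖DD p q z A x‖ ≤ 7 := by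
  have := norm_sub_le (GG p q z A x x) (gg p q z A)
  have := a.Gd x; have := a.g1
  unfold DD; linarith
lemma Ap.GS {i k : Fin N} (hik : i ≠ k) {x y : Fin N} (hx : x ∈ SS i k (BB i k A)) (hy : y ∈ SS i k (BB i k A)) :
    GG p q z A x y = GG p q z (BB i k A) x y
      + ze p q z i k A / (2 * q ^ 2) * (gw p q z i k A x * gw p q z i k A y) := by
  have h := schur_G a.adj.1 a.adj.2.1 hik a.hq.ne' a.hz (p := p) x y
  rw [mem_SS a.adj] at hx hy
  rw [h, yy]
  simp only [Pi.sub_apply, Pi.smul_apply, smul_eq_mul, cc, uu_ne hx.1 hx.2.1, uu_ne hy.1 hy.2.1]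
  have : (q : ℂ) ≠ 0 := by exact_mod_cast a.hq.ne'
  simp; field_simp
lemma Ap.zq (i k : Fin N) : ‖ze p q z i k A / (2 * q ^ 2)‖ ≤ 1 / q ^ 2 := by
  rw [norm_div, norm_mul, norm_pow, Complex.norm_real, Real.norm_of_nonneg a.hq.le, Complex.norm_ofNat]
  have := a.ze2 i k
  have := a.hq
  rw [div_le_div_iff₀ (by positivity) (by positivity)]
  nlinarith [sq_nonneg q]
lemma Ap.dη : 0 < d * z.im := by have := a.hz; have := a.d1; positivity
lemma Ap.F_le {i k : Fin N} (hik : i ≠ k) : F2 p q z i k A ≤ 24 * d / z.im := by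
  have hη := a.hz
  have hd := a.d1
  have hsB := HH_symm p q (BB_symm i k a.adj.1)
  have hK := a.K0
  have h1 : F2 p q z i k A ≤ ∑ y ∈ SS i k (BB i k A), ∑ x, ‖GG p q z (BB i k A) x y‖ ^ 2 := by
    unfold F2 Fs
    rw [Finset.sum_comm]
    exact Finset.sum_le_sum fun y _ => Finset.sum_le_sum_of_subset_of_nonneg (Finset.subset_univ _) fun _ _ _ => by positivity
  have h2 : ∀ y ∈ SS i k (BB i k A), z.im * ∑ x, ‖GG p q z (BB i k A) x y‖ ^ 2
      ≤ 6 + 1 / q ^ 2 * ‖gw p q z i k A y‖ ^ 2 := by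
    intro y hy
    have := R_ward_col hsB a.hz y
    change z.im * ∑ x, ‖GG p q z (BB i k A) x y‖ ^ 2 = (GG p q z (BB i k A) y y).im at this
    rw [this]
    refine (le_abs_self _).trans ((Complex.abs_im_le_norm _).trans ?_)
    have e : GG p q z (BB i k A) y y = GG p q z A y y - ze p q z i k A / (2 * q ^ 2) * (gw p q z i k A y * gw p q z i k A y) := by
      rw [a.GS hik hy hy]; ring
    rw [e]
    refine (norm_sub_le _ _).trans (add_le_add (a.Gd y) ?_)
    rw [norm_mul, norm_mul, ← sq, norm_div]
    rw [← norm_div]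
    exact mul_le_mul_of_nonneg_right (a.zq i k) (by positivity)
  have h3 : z.im * F2 p q z i k A ≤ 6 * (2 * d) + 1 / q ^ 2 * (2 * K * F2 p q z i k A) := by
    calc _ ≤ z.im * ∑ y ∈ SS i k (BB i k A), ∑ x, ‖GG p q z (BB i k A) x y‖ ^ 2 := by gcongr
      _ ≤ ∑ y ∈ SS i k (BB i k A), (6 + 1 / q ^ 2 * ‖gw p q z i k A y‖ ^ 2) := by
        rw [Finset.mul_sum]; exact Finset.sum_le_sum h2
      _ = 6 * (SS i k (BB i k A)).card + 1 / q ^ 2 * ∑ y ∈ SS i k (BB i k A), ‖gw p q z i k A y‖ ^ 2 := by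
        rw [Finset.sum_add_distrib, ← Finset.mul_sum]; simp; ring
      _ ≤ _ := by
        have := a.S_card_le hik
        have := a.om.o3 i k hik
        have := a.hq
        gcongr
  have h4 : 1 / q ^ 2 * (2 * K * F2 p q z i k A) ≤ z.im / 2 * F2 p q z i k A := by
    have := F2_nn p q z i k A
    rw [show 1 / q ^ 2 * (2 * K * F2 p q z i k A) = (2 * K / q ^ 2) * F2 p q z i k A by ring]
    refine mul_le_mul_of_nonneg_right ?_ this
    rw [div_le_iff₀ (by have := a.hq; positivity)]
    have h1 := a.le_q
    have h2 := a.Kη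
    have h3 := a.K6
    have h5 : 8 * K ≤ K ^ 4 := by
      have : (8 : ℝ) ≤ K ^ 3 := by
        calc (8 : ℝ) ≤ (10 ^ 6) ^ 3 := by norm_num
          _ ≤ K ^ 3 := by gcongr
      nlinarith
    nlinarith
  rw [le_div_iff₀ hη]
  linarith
/-- relative size -/
lemma Ap.F_q {i k : Fin N} (hik : i ≠ k) : F2 p q z i k A * K ^ 20 ≤ 96 * q ^ 4 := by
  have h := a.F_le hik
  rw [le_div_iff₀ a.hz] at h
  have h1 := a.le_q
  have h2 := a.Kη20
  have h0 := F2_nn p q z i k A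
  have hd := a.d1
  calc F2 p q z i k A * K ^ 20 ≤ F2 p q z i k A * (d * z.im) := by gcongr
    _ = (F2 p q z i k A * z.im) * d := by ring
    _ ≤ 24 * d * d := by gcongr
    _ = 96 * (d / 2) ^ 2 := by ring
    _ ≤ 96 * (q ^ 2) ^ 2 := by gcongr
    _ = _ := by ring
lemma Ap.F_q4 {i k : Fin N} (hik : i ≠ k) : F2 p q z i k A * K ^ 4 ≤ 96 * q ^ 4 := by
  refine le_trans ?_ (a.F_q hik)
  have := F2_nn p q z i k A
  gcongr 2
  · have := a.K6; linarith
  · norm_num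
/-- Frobenius norm of `G` on `S` -/
lemma Ap.F_G {i k : Fin N} (hik : i ≠ k) : F2 p q z i k A ≤ 4 * ∑ x, ∑ y, Sp A i k x * Sp A i k y * ‖GG p q z A x y‖ ^ 2 := by
  have hK := a.K0
  have hF := F2_nn p q z i k A
  set S := SS i k (BB i k A) with hS
  have hq := a.hq
  have h1 : ∀ x ∈ S, ∀ y ∈ S, ‖GG p q z (BB i k A) x y‖ ^ 2 ≤ 2 * ‖GG p q z A x y‖ ^ 2
      + 2 / q ^ 4 * (‖gw p q z i k A x‖ ^ 2 * ‖gw p q z i k A y‖ ^ 2) := by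
    intro x hx y hy
    have e : GG p q z (BB i k A) x y = GG p q z A x y - ze p q z i k A / (2 * q ^ 2) * (gw p q z i k A x * gw p q z i k A y) := by
      rw [a.GS hik hx hy]; ring
    have b : ‖ze p q z i k A / (2 * q ^ 2) * (gw p q z i k A x * gw p q z i k A y)‖ ≤
        1 / q ^ 2 * (‖gw p q z i k A x‖ * ‖gw p q z i k A y‖) := by
      rw [norm_mul, norm_mul, norm_div]
      rw [← norm_div]
      exact mul_le_mul_of_nonneg_right (a.zq i k) (by positivity)
    have t : ‖GG p q z (BB i k A) x y‖ ≤ ‖GG p q z A x y‖ + 1 / q ^ 2 * (‖gw p q z i k A x‖ * ‖gw p q z i k A y‖) := by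
      rw [e]; exact (norm_sub_le _ _).trans (by gcongr)
    calc _ ≤ (‖GG p q z A x y‖ + 1 / q ^ 2 * (‖gw p q z i k A x‖ * ‖gw p q z i k A y‖)) ^ 2 := by gcongr
      _ ≤ 2 * ‖GG p q z A x y‖ ^ 2 + 2 * (1 / q ^ 2 * (‖gw p q z i k A x‖ * ‖gw p q z i k A y‖)) ^ 2 := by
        nlinarith [sq_nonneg (‖GG p q z A x y‖ - 1 / q ^ 2 * (‖gw p q z i k A x‖ * ‖gw p q z i k A y‖))]
      _ = _ := by field_simp
  have h2 : F2 p q z i k A ≤ 2 * ∑ x ∈ S, ∑ y ∈ S, ‖GG p q z A x y‖ ^ 2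
      + 2 / q ^ 4 * (2 * K * F2 p q z i k A) ^ 2 := by
    calc F2 p q z i k A ≤ ∑ x ∈ S, ∑ y ∈ S, (2 * ‖GG p q z A x y‖ ^ 2
      + 2 / q ^ 4 * (‖gw p q z i k A x‖ ^ 2 * ‖gw p q z i k A y‖ ^ 2)) :=
          Finset.sum_le_sum fun x hx => Finset.sum_le_sum fun y hy => h1 x hx y hy
      _ = 2 * ∑ x ∈ S, ∑ y ∈ S, ‖GG p q z A x y‖ ^ 2 + 2 / q ^ 4 * (∑ x ∈ S, ‖gw p q z i k A x‖ ^ 2) ^ 2 := by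
          simp only [Finset.sum_add_distrib, ← Finset.mul_sum, sq (∑ x ∈ S, ‖gw p q z i k A x‖ ^ 2), Finset.sum_mul]
      _ ≤ _ := by
          have := a.om.o3 i k hik
          gcongr
  have h3 : 2 / q ^ 4 * (2 * K * F2 p q z i k A) ^ 2 ≤ F2 p q z i k A / 2 := by
    have h4 := a.F_q4 hik
    have h5 : F2 p q z i k A * K ^ 2 * (10 ^ 6) ^ 2 ≤ 96 * q ^ 4 := by
      refine le_trans ?_ h4
      rw [show F2 p q z i k A * K ^ 4 = F2 p q z i k A * K ^ 2 * K ^ 2 by ring]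
      have := a.K6
      gcongr
    rw [show 2 / q ^ 4 * (2 * K * F2 p q z i k A) ^ 2 = (8 * (F2 p q z i k A * K ^ 2) / q ^ 4) * F2 p q z i k A by ring,
      div_eq_mul_one_div _ (2 : ℝ), mul_comm (F2 p q z i k A) (1 / 2)]
    refine mul_le_mul_of_nonneg_right ?_ hF
    rw [div_le_div_iff₀ (by positivity) (by norm_num)]
    nlinarith [pow_pos hq 4]
  have h4 : ∑ x ∈ S, ∑ y ∈ S, ‖GG p q z A x y‖ ^ 2 ≤ ∑ x, ∑ y, Sp A i k x * Sp A i k y * ‖GG p q z A x y‖ ^ 2 := by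
    have s1 : ∀ x ∈ S, Sp A i k x = 1 := fun x hx => by
      have hh := (mem_SS a.adj).1 hx
      rw [a.Sp_S hh.1 hh.2.1, if_pos hx]
    calc _ = ∑ x ∈ S, ∑ y ∈ S, Sp A i k x * Sp A i k y * ‖GG p q z A x y‖ ^ 2 :=
          Finset.sum_congr rfl fun x hx => Finset.sum_congr rfl fun y hy => by rw [s1 x hx, s1 y hy]; ring
      _ ≤ ∑ x ∈ S, ∑ y, Sp A i k x * Sp A i k y * ‖GG p q z A x y‖ ^ 2 :=
          Finset.sum_le_sum fun x hx => Finset.sum_le_sum_of_subset_of_nonneg (Finset.subset_univ _) fun y _ _ => by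
            have := Sp_nn (A := A) i k x; have := Sp_nn (A := A) i k y; positivity
      _ ≤ _ := Finset.sum_le_sum_of_subset_of_nonneg (Finset.subset_univ _) fun x _ _ => Finset.sum_nonneg fun y _ => by
            have := Sp_nn (A := A) i k x; have := Sp_nn (A := A) i k y; positivity
  linarith
/-- off diagonal pair correlation -/
lemma Ap.Kd : K * √d ≤ d ∧ N * (K * √d) ≤ d ^ 2 ∧ N * K ^ 10 * √d ≤ d ^ 2 := by
  have h := a.KN
  have hd := a.d1
  have hs : √(d : ℝ) * √d = d := Real.mul_self_sqrt (by linarith)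
  have hs0 : 0 < √(d : ℝ) := Real.sqrt_pos.mpr (by linarith)
  have hK := a.K6
  have hK0 := a.K0
  have hN := a.dN
  have h1 : K ≤ K ^ 10 := le_self_pow₀ (by linarith) (by norm_num)
  have h2 : (N : ℝ) * K ^ 10 * √d ≤ d ^ 2 := by
    calc _ ≤ d * √d * √d := by gcongr
      _ = d ^ 2 := by rw [mul_assoc, hs]; ring
  have h3 : N * (K * √d) ≤ d ^ 2 := by
    refine le_trans ?_ h2
    rw [← mul_assoc]; gcongr
  refine ⟨?_, h3, h2⟩
  have h4 : d * (K * √d) ≤ d * d := by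
    refine le_trans ?_ (h3.trans_eq (sq _))
    gcongr; have := a.h2d; omega
  exact le_of_mul_le_mul_left h4 (by linarith)
lemma Ap.SpB (x y : Fin N) : ∑ i, ∑ k, Sp A i k x * Sp A i k y ≤ 10 * d ^ 2 + (if x = y then (6 * N * d : ℝ) else 0) := by
  have hd := a.d1
  have hN := a.N4
  obtain ⟨k1, k2, _⟩ := a.Kd
  have hK := a.K0
  rw [a.Sp2]
  have q4 := a.q4_le
  have hp := a.p0
  have hp1 := a.p1
  have p2 : (1 - 2 * p) ^ 2 ≤ 1 := by nlinarith
  split_ifs with h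
  · subst h
    rw [a.X2_diag]
    have := a.q_le
    have : 2 * N * (1 - 2 * p) ^ 2 * q ^ 2 ≤ 2 * N * 1 * d := by gcongr
    nlinarith
  · have := a.om.o1 x y h
    have h1 : X2 d A x y ^ 2 ≤ d ^ 2 := by
      rw [← sq_abs]; exact pow_le_pow_left₀ (abs_nonneg _) (this.trans k1) 2
    have h2 : 2 * N * (1 - 2 * p) ^ 2 * X2 d A x y ≤ 2 * N * 1 * (K * √d) := by
      calc _ ≤ 2 * N * (1 - 2 * p) ^ 2 * |X2 d A x y| := by gcongr; exact le_abs_self _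
        _ ≤ _ := by gcongr
    nlinarith
lemma Ap.F_av : av (fun i k => F2 p q z i k A) ≤ 8000 * q ^ 4 * VV d p q z A := by
  have hd := a.d1
  have hN := a.N4
  have hq := a.hq
  obtain ⟨k1, k2, _⟩ := a.Kd
  have hK := a.K0
  have c1 := a.SpB
  have c2 : av (fun i k => F2 p q z i k A) ≤ 2 / N ^ 2 * ∑ i, ∑ k, 4 * ∑ x, ∑ y, Sp A i k x * Sp A i k y * ‖GG p q z A x y‖ ^ 2 := by
    refine (av_mono a.hN fun i k h => a.F_G h).trans (av_le a.hN fun i k => ?_)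
    exact mul_nonneg (by norm_num) (Finset.sum_nonneg fun x _ => Finset.sum_nonneg fun y _ => by
      have := Sp_nn (A := A) i k x; have := Sp_nn (A := A) i k y; positivity)
  have c3 : ∑ i, ∑ k, 4 * ∑ x, ∑ y, Sp A i k x * Sp A i k y * ‖GG p q z A x y‖ ^ 2
      = 4 * ∑ x, ∑ y, (∑ i, ∑ k, Sp A i k x * Sp A i k y) * ‖GG p q z A x y‖ ^ 2 := by
    simp only [← Finset.mul_sum, Finset.sum_mul]
    congr 1
    rw [Finset.sum_congr rfl fun i _ => Finset.sum_comm, Finset.sum_comm]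
    refine Finset.sum_congr rfl fun x _ => ?_
    rw [Finset.sum_congr rfl fun i _ => Finset.sum_comm, Finset.sum_comm]
  have c4 : ∑ x, ∑ y, (∑ i, ∑ k, Sp A i k x * Sp A i k y) * ‖GG p q z A x y‖ ^ 2 ≤
      10 * d ^ 2 * (N * ((gg p q z A).im / z.im) + 1 / 4) + 6 * N * d * (36 * N) := by
    calc _ ≤ ∑ x, ∑ y, (10 * (d : ℝ) ^ 2 + (if x = y then (6 * N * d : ℝ) else 0)) * ‖GG p q z A x y‖ ^ 2 := by
          gcongr with x _ y _; exact c1 x y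
      _ = 10 * d ^ 2 * ∑ x, ∑ y, ‖GG p q z A x y‖ ^ 2 + 6 * N * d * ∑ x, ‖GG p q z A x x‖ ^ 2 := by
          simp [add_mul, Finset.sum_add_distrib, Finset.mul_sum]
      _ ≤ _ := by
          have := a.G_fro
          have : ∑ x, ‖GG p q z A x x‖ ^ 2 ≤ 36 * N := by
            calc _ ≤ ∑ x : Fin N, (36 : ℝ) := Finset.sum_le_sum fun x _ => by
                  have := a.Gd x; have := norm_nonneg (GG p q z A x x); nlinarith
              _ = _ := by simp; ring
          gcongr
  rw [c3] at c2
  have hV := a.V_nn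
  have q4 := a.le_q4
  have hz := a.hz
  have hVp : 0 ≤ VV d p q z A := by unfold VV; positivity
  calc _ ≤ _ := c2
    _ ≤ 2 / N ^ 2 * (4 * (10 * d ^ 2 * (N * ((gg p q z A).im / z.im) + 1 / 4) + 6 * N * d * (36 * N))) := by gcongr
    _ = d ^ 2 * (80 * ((gg p q z A).im / (N * z.im)) + 20 / N ^ 2 + 1728 * (1 / d)) := by
        field_simp; ring
    _ ≤ d ^ 2 * (2000 * VV d p q z A) := by
        have : 20 / (N : ℝ) ^ 2 ≤ 20 * (1 / d) := by
          rw [← div_eq_mul_one_div]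
          gcongr; have := a.dN; nlinarith
        unfold VV
        gcongr
        have : 0 < 1 / (d : ℝ) := by positivity
        linarith
    _ ≤ (4 * q ^ 4) * (2000 * VV d p q z A) := by gcongr; linarith
    _ = _ := by ring
end
end RR
namespace RR
variable {N : ℕ}
section
variable {d : ℕ} {A : Matrix (Fin N) (Fin N) ℝ} {p q : ℝ} {z : ℂ} {K : ℝ} (a : Ap N d A p q z K)
include a
lemma Ap.sF {i k : Fin N} (hik : i ≠ k) : √(F2 p q z i k A) ≤ q ^ 2 / 2 := by
  rw [Real.sqrt_le_left (by positivity)]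
  have h := a.F_q4 hik
  have h0 := F2_nn p q z i k A
  have h1 : (10 ^ 6) ^ 4 ≤ K ^ 4 := by have := a.K6; gcongr
  have : F2 p q z i k A * (10 ^ 6) ^ 4 ≤ F2 p q z i k A * K ^ 4 := by gcongr
  nlinarith
lemma Ap.nq : ‖(2 * (q : ℂ) ^ 2)‖ = 2 * q ^ 2 := by
  rw [norm_mul, norm_pow, Complex.norm_real, Real.norm_of_nonneg a.hq.le, Complex.norm_ofNat]
lemma Ap.diff_tr {i k : Fin N} (hik : i ≠ k) : ‖∑ x ∈ SS i k (BB i k A), GG p q z (BB i k A) x x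
    - ∑ x ∈ SS i k (BB i k A), GG p q z A x x‖ ≤ 2 * K * F2 p q z i k A / q ^ 2 := by
  have e : ∑ x ∈ SS i k (BB i k A), GG p q z (BB i k A) x x - ∑ x ∈ SS i k (BB i k A), GG p q z A x x
      = - (ze p q z i k A / (2 * q ^ 2)) * ∑ x ∈ SS i k (BB i k A), gw p q z i k A x * gw p q z i k A x := by
    rw [← Finset.sum_sub_distrib, Finset.mul_sum]
    exact Finset.sum_congr rfl fun x hx => by rw [a.GS hik hx hx]; ring
  rw [e, norm_mul, norm_neg]
  have h1 : ‖∑ x ∈ SS i k (BB i k A), gw p q z i k A x * gw p q z i k A x‖ ≤ 2 * K * F2 p q z i k A := by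
    refine (norm_sum_le _ _).trans (le_trans (le_of_eq ?_) (a.om.o3 i k hik))
    exact Finset.sum_congr rfl fun x _ => by rw [norm_mul, sq]
  have h2 := a.zq i k
  calc _ ≤ 1 / q ^ 2 * (2 * K * F2 p q z i k A) := by
        have := a.hq; gcongr
    _ = _ := by ring
lemma Ap.ep_dec {i k : Fin N} (hik : i ≠ k) : ‖ep p q z i k A - (- gg p q z A * ((X2 d A i k + A i k) / q ^ 2 : ℝ)
      + ((A i k / q : ℝ) : ℂ) + (∑ x ∈ SS i k (BB i k A), DD p q z A x) / (2 * (q : ℂ) ^ 2))‖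
      ≤ K * √(F2 p q z i k A) / q ^ 2 := by
  have hq := a.hq
  have hqc : (q : ℂ) ≠ 0 := by exact_mod_cast hq.ne'
  have hF := F2_nn p q z i k A
  have hm : ((SS i k (BB i k A)).card : ℂ) = 2 * (q ^ 2 - X2 d A i k - A i k) := by
    have := a.S_card hik; exact_mod_cast this
  have e : ep p q z i k A - (- gg p q z A * ((X2 d A i k + A i k) / q ^ 2 : ℝ)
      + ((A i k / q : ℝ) : ℂ) + (∑ x ∈ SS i k (BB i k A), DD p q z A x) / (2 * (q : ℂ) ^ 2))
      = ((cc (ww A i k) ⬝ᵥ gw p q z i k A - ∑ x ∈ SS i k (BB i k A), GG p q z (BB i k A) x x)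
        + (∑ x ∈ SS i k (BB i k A), GG p q z (BB i k A) x x - ∑ x ∈ SS i k (BB i k A), GG p q z A x x)) / (2 * (q : ℂ) ^ 2) := by
    simp only [ep, YY, DD, Finset.sum_sub_distrib, Finset.sum_const, nsmul_eq_mul, hm]
    push_cast
    field_simp; ring
  rw [e, norm_div, a.nq]
  have h1 := a.om.o2 i k hik
  have h2 := a.diff_tr hik
  have h3 := a.sF hik
  have hK := a.K0
  have hs : √(F2 p q z i k A) * √(F2 p q z i k A) = F2 p q z i k A := Real.mul_self_sqrt hF
  have hs0 := Real.sqrt_nonneg (F2 p q z i k A)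
  have h4 : 2 * K * F2 p q z i k A / q ^ 2 ≤ K * √(F2 p q z i k A) := by
    rw [div_le_iff₀ (by positivity)]
    have : K * √(F2 p q z i k A) * √(F2 p q z i k A) ≤ K * √(F2 p q z i k A) * (q ^ 2 / 2) := by gcongr
    rw [mul_assoc K, hs] at this
    nlinarith
  have h5 := (norm_add_le _ _).trans (add_le_add h1 (h2.trans h4))
  rw [div_le_div_iff₀ (by positivity) (by positivity)]
  calc _ ≤ _ := mul_le_mul_of_nonneg_right h5 (by positivity)
    _ = _ := by ring
lemma Ap.ep_sq {i k : Fin N} (hik : i ≠ k) : ‖ep p q z i k A‖ ^ 2 ≤ 72 * K ^ 2 / d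
      + ‖∑ x ∈ SS i k (BB i k A), DD p q z A x‖ ^ 2 / q ^ 4 + 4 * K ^ 2 * (F2 p q z i k A / q ^ 4) := by
  have h := a.ep_dec hik
  have hq := a.hq
  have hd := a.d1
  have hK := a.K0
  have hF := F2_nn p q z i k A
  set r := ep p q z i k A - (- gg p q z A * ((X2 d A i k + A i k) / q ^ 2 : ℝ)
      + ((A i k / q : ℝ) : ℂ) + (∑ x ∈ SS i k (BB i k A), DD p q z A x) / (2 * (q : ℂ) ^ 2)) with hr
  have e : ep p q z i k A = - gg p q z A * ((X2 d A i k + A i k) / q ^ 2 : ℝ)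
      + ((A i k / q : ℝ) : ℂ) + (∑ x ∈ SS i k (BB i k A), DD p q z A x) / (2 * (q : ℂ) ^ 2) + r := by rw [hr]; ring
  have t1 : ‖- gg p q z A * ((X2 d A i k + A i k) / q ^ 2 : ℝ)‖ ^ 2 ≤ 16 * K ^ 2 / d := by
    have s : √(d : ℝ) ^ 2 = d := Real.sq_sqrt (by linarith)
    have s1 : 1 ≤ √(d : ℝ) := Real.one_le_sqrt.mpr hd
    have x := a.om.o1 i k hik
    have y := a.A01 i k
    have x1 : |X2 d A i k + A i k| ≤ 2 * (K * √d) := by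
      have : 1 ≤ K * √d := by have := a.K6; nlinarith
      have := abs_add_le (X2 d A i k) (A i k)
      rw [abs_of_nonneg y.1] at this
      linarith
    have x2 : ‖- gg p q z A * ((X2 d A i k + A i k) / q ^ 2 : ℝ)‖ ≤ 1 * (2 * (K * √d) / (d / 2)) := by
      rw [norm_mul, norm_neg, Complex.norm_real, norm_div, Real.norm_eq_abs, norm_pow, Real.norm_of_nonneg hq.le]
      have := a.g1; have := a.le_q
      gcongr
    calc _ ≤ (1 * (2 * (K * √d) / (d / 2))) ^ 2 := by gcongr
      _ = 16 * K ^ 2 * √(d : ℝ) ^ 2 / d ^ 2 := by field_simp; ring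
      _ = _ := by rw [s]; field_simp
  have t2 : ‖((A i k / q : ℝ) : ℂ)‖ ^ 2 ≤ 2 * K ^ 2 / d := by
    rw [Complex.norm_real, Real.norm_eq_abs, sq_abs, div_pow]
    have y := a.A01 i k
    have := a.le_q
    have : A i k ^ 2 ≤ K ^ 2 := pow_le_pow_left₀ y.1 (by have := a.K6; linarith) 2
    rw [div_le_div_iff₀ (by positivity) (by positivity)]
    nlinarith [sq_nonneg K]
  have t3 : ‖(∑ x ∈ SS i k (BB i k A), DD p q z A x) / (2 * (q : ℂ) ^ 2)‖ ^ 2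
      = ‖∑ x ∈ SS i k (BB i k A), DD p q z A x‖ ^ 2 / q ^ 4 / 4 := by
    rw [norm_div, a.nq]; field_simp; ring
  have t4 : ‖r‖ ^ 2 ≤ K ^ 2 * (F2 p q z i k A / q ^ 4) := by
    calc ‖r‖ ^ 2 ≤ (K * √(F2 p q z i k A) / q ^ 2) ^ 2 := by gcongr
      _ = K ^ 2 * (√(F2 p q z i k A) ^ 2 / q ^ 4) := by ring
      _ = _ := by rw [Real.sq_sqrt hF]
  have gen : ∀ w1 w2 w3 w4 : ℂ, ‖w1 + w2 + w3 + w4‖ ^ 2 ≤ 4 * (‖w1‖ ^ 2 + ‖w2‖ ^ 2 + ‖w3‖ ^ 2 + ‖w4‖ ^ 2) := by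
    intro w1 w2 w3 w4
    have := norm_add_le (w1 + w2 + w3) w4
    have := norm_add_le (w1 + w2) w3
    have := norm_add_le w1 w2
    have b : ‖w1 + w2 + w3 + w4‖ ≤ ‖w1‖ + ‖w2‖ + ‖w3‖ + ‖w4‖ := by linarith
    have := pow_le_pow_left₀ (norm_nonneg _) b 2
    nlinarith [sq_nonneg (‖w1‖ - ‖w2‖), sq_nonneg (‖w1‖ - ‖w3‖), sq_nonneg (‖w1‖ - ‖w4‖), sq_nonneg (‖w2‖ - ‖w3‖),
      sq_nonneg (‖w2‖ - ‖w4‖), sq_nonneg (‖w3‖ - ‖w4‖)]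
  rw [e]
  refine (gen _ _ _ _).trans ?_
  rw [t3]
  have : 72 * K ^ 2 / d = 4 * (16 * K ^ 2 / d) + 4 * (2 * K ^ 2 / d) := by ring
  rw [this]
  linarith
lemma Ap.W_sum : ∑ x, ‖DD p q z A x‖ ^ 2 = N * WW p q z A := by
  have := a.N4; unfold WW; field_simp
omit a in
lemma W_nn (p q : ℝ) (z : ℂ) (A : Matrix (Fin N) (Fin N) ℝ) : 0 ≤ WW p q z A := by unfold WW; positivity
lemma Ap.SpD : av (fun i k => ‖∑ x, Sp A i k x • DD p q z A x‖ ^ 2) ≤ q ^ 4 * (32 / N ^ 2 + 80 * (WW p q z A / K ^ 8)) := by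
  have hd := a.d1
  have hN := a.N4
  have hdN := a.dN
  have hq := a.hq
  have hK := a.K0
  obtain ⟨k1, k2, k3⟩ := a.Kd
  set D := DD p q z A with hD
  have s1 : 1 ≤ √(d : ℝ) := Real.one_le_sqrt.mpr hd
  have s2 : √(d : ℝ) * √d = d := Real.mul_self_sqrt (by linarith)
  have e0 : ∀ v : Fin N → ℝ, ‖∑ x, v x • D x‖ ^ 2 = ∑ x, ∑ y, v x * v y * (D x * star (D y)).re := by
    intro v
    rw [← Complex.normSq_eq_norm_sq, ← Complex.ofReal_re (Complex.normSq _), Complex.normSq_eq_conj_mul_self, map_sum,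
      Finset.sum_mul_sum, Complex.re_sum, Finset.sum_comm]
    refine Finset.sum_congr rfl fun x _ => ?_
    rw [Complex.re_sum]
    refine Finset.sum_congr rfl fun y _ => ?_
    simp; ring
  have e1 : ∑ i, ∑ k, ‖∑ x, Sp A i k x • D x‖ ^ 2 = ∑ x, ∑ y, (∑ i, ∑ k, Sp A i k x * Sp A i k y) * (D x * star (D y)).re := by
    simp only [e0, Finset.sum_mul]
    rw [Finset.sum_congr rfl fun i _ => Finset.sum_comm, Finset.sum_comm]
    refine Finset.sum_congr rfl fun x _ => ?_
    rw [Finset.sum_congr rfl fun i _ => Finset.sum_comm, Finset.sum_comm]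
  have e2 : ∑ x, ∑ y, (∑ i, ∑ k, Sp A i k x * Sp A i k y) * (D x * star (D y)).re
      = 4 * q ^ 4 * ‖∑ x, D x‖ ^ 2 + ∑ x, ∑ y, (2 * N * (1 - 2 * p) ^ 2 * X2 d A x y + 4 * X2 d A x y ^ 2) * (D x * star (D y)).re := by
    have := e0 fun _ => 1
    simp only [one_smul, one_mul] at this
    rw [this]
    simp only [a.Sp2, Finset.mul_sum, ← Finset.sum_add_distrib]
    exact Finset.sum_congr rfl fun x _ => Finset.sum_congr rfl fun y _ => by ring
  have hp := a.p0
  have hp1 := a.p1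
  have p2 : (1 - 2 * p) ^ 2 ≤ 1 := by nlinarith
  have c1 : ∀ x y, (2 * N * (1 - 2 * p) ^ 2 * X2 d A x y + 4 * X2 d A x y ^ 2) * (D x * star (D y)).re
      ≤ 6 * N * K ^ 2 * √d * (‖D x‖ * ‖D y‖) + if x = y then (4 * N * d : ℝ) * ‖D x‖ ^ 2 else 0 := by
    intro x y
    have nn : |(D x * star (D y)).re| ≤ ‖D x‖ * ‖D y‖ := by
      refine (Complex.abs_re_le_norm _).trans ?_
      rw [norm_mul, norm_star]
    have nd : 0 ≤ ‖D x‖ * ‖D y‖ := by positivity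
    refine (le_abs_self _).trans ?_
    rw [abs_mul]
    split_ifs with h
    · subst h
      have : |2 * N * (1 - 2 * p) ^ 2 * X2 d A x x + 4 * X2 d A x x ^ 2| ≤ (4 * N * d : ℝ) := by
        rw [a.X2_diag, abs_of_nonneg (by positivity)]
        have b1 := a.q_le; have b2 := a.q4_le
        have : 2 * N * (1 - 2 * p) ^ 2 * q ^ 2 ≤ 2 * N * 1 * d := by gcongr
        nlinarith
      have b3 : _ ≤ (4 * N * d : ℝ) * (‖D x‖ * ‖D x‖) := mul_le_mul this nn (abs_nonneg _) (by positivity)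
      have : 0 ≤ 6 * N * K ^ 2 * √d * (‖D x‖ * ‖D x‖) := by positivity
      nlinarith
    · have b1 := a.om.o1 x y h
      have b2 : X2 d A x y ^ 2 ≤ K ^ 2 * d := by
        rw [← sq_abs]
        calc _ ≤ (K * √d) ^ 2 := by gcongr
          _ = K ^ 2 * (√d * √d) := by ring
          _ = _ := by rw [s2]
      have : |2 * N * (1 - 2 * p) ^ 2 * X2 d A x y + 4 * X2 d A x y ^ 2| ≤ 6 * N * K ^ 2 * √d := by
        refine (abs_add_le _ _).trans ?_
        rw [abs_mul, abs_of_nonneg (by positivity : 0 ≤ 2 * (N : ℝ) * (1 - 2 * p) ^ 2), abs_of_nonneg (by positivity : 0 ≤ 4 * X2 d A x y ^ 2)]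
        have b3 : 2 * N * (1 - 2 * p) ^ 2 * |X2 d A x y| ≤ 2 * N * 1 * (K ^ 2 * √d) := by
          gcongr
          refine b1.trans ?_
          gcongr
          have := a.K6; nlinarith
        have b4 : K ^ 2 * d ≤ N * K ^ 2 * √d := by
          rw [mul_comm (N : ℝ), mul_assoc]
          gcongr
          nlinarith
        nlinarith
      rw [add_zero]
      exact mul_le_mul this nn (abs_nonneg _) (by positivity)
  have c2 : ∑ x, ∑ y, (2 * N * (1 - 2 * p) ^ 2 * X2 d A x y + 4 * X2 d A x y ^ 2) * (D x * star (D y)).re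
      ≤ 10 * N ^ 3 * K ^ 2 * √d * WW p q z A := by
    calc _ ≤ ∑ x, ∑ y, (6 * N * K ^ 2 * √d * (‖D x‖ * ‖D y‖) + if x = y then (4 * N * d : ℝ) * ‖D x‖ ^ 2 else 0) :=
          Finset.sum_le_sum fun x _ => Finset.sum_le_sum fun y _ => c1 x y
      _ = 6 * N * K ^ 2 * √d * (∑ x, ‖D x‖) ^ 2 + 4 * N * d * ∑ x, ‖D x‖ ^ 2 := by
          rw [sq (∑ x, ‖D x‖), Finset.sum_mul_sum]
          simp [Finset.sum_add_distrib, Finset.mul_sum]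
      _ ≤ 6 * N * K ^ 2 * √d * (N * ∑ x, ‖D x‖ ^ 2) + 4 * N * d * ∑ x, ‖D x‖ ^ 2 := by
          have := sq_sum_le_card_mul_sum_sq (s := Finset.univ) (f := fun x => ‖D x‖)
          simp only [Finset.card_univ, Fintype.card_fin] at this
          gcongr
      _ ≤ 6 * N * K ^ 2 * √d * (N * (N * WW p q z A)) + 4 * N * (N * K ^ 2 * √d) * (N * WW p q z A) := by
          rw [a.W_sum]
          have := W_nn p q z A
          gcongr
          have : 1 ≤ K ^ 2 := by have := a.K6; nlinarith
          have : (d : ℝ) ≤ N * 1 * 1 := by linarith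
          refine this.trans ?_
          gcongr
      _ = _ := by ring
  have c3 : ‖∑ x, D x‖ ^ 2 ≤ 4 := by
    have : ‖∑ x, D x‖ ≤ 2 := by
      rw [hD, a.D_sum]
      have := norm_sub_le (- gg p q z A) z⁻¹
      rw [norm_neg] at this
      have := a.g1; have := a.zi
      linarith
    have := norm_nonneg (∑ x, D x); nlinarith
  have hW := W_nn p q z A
  refine (av_le a.hN fun i k => by positivity).trans ?_
  rw [e1, e2]
  have c4 : N * K ^ 2 * √d * WW p q z A ≤ 4 * (q ^ 4 * (WW p q z A / K ^ 8)) := by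
    rw [← mul_div_assoc, ← mul_div_assoc, le_div_iff₀ (by positivity)]
    calc _ = (N * K ^ 10 * √d) * WW p q z A := by ring
      _ ≤ d ^ 2 * WW p q z A := by gcongr
      _ ≤ (4 * q ^ 4) * WW p q z A := by have := a.le_q4; gcongr; linarith
      _ = _ := by ring
  calc _ ≤ 2 / (N : ℝ) ^ 2 * (4 * q ^ 4 * 4 + 10 * N ^ 3 * K ^ 2 * √d * WW p q z A) := by gcongr
    _ = 32 * q ^ 4 / N ^ 2 + 20 * (N * K ^ 2 * √d * WW p q z A) := by field_simp; ring
    _ ≤ 32 * q ^ 4 / N ^ 2 + 20 * (4 * (q ^ 4 * (WW p q z A / K ^ 8))) := by gcongr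
    _ = _ := by ring
end
end RR
namespace RR
variable {N : ℕ}
lemma nsq_add (u v : ℂ) : ‖u + v‖ ^ 2 ≤ 2 * ‖u‖ ^ 2 + 2 * ‖v‖ ^ 2 := by
  have := pow_le_pow_left₀ (norm_nonneg _) (norm_add_le u v) 2
  nlinarith [sq_nonneg (‖u‖ - ‖v‖)]
/-- a priori bounds used in the stability step -/
structure Aq (N d : ℕ) (A : Matrix (Fin N) (Fin N) ℝ) (p q : ℝ) (z : ℂ) (K k : ℝ) : Prop extends Ap N d A p q z K where
  k0 : 0 < k
  k1 : k ≤ 1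
  kz : 2 + k ≤ ‖z‖
  P4 : ‖PP p q z A‖ ≤ k / 4
  NW : N * WW p q z A * K ^ 20 ≤ d
section
variable {d : ℕ} {A : Matrix (Fin N) (Fin N) ℝ} {p q : ℝ} {z : ℂ} {K : ℝ} (a : Ap N d A p q z K)
include a
lemma Ap.V1 : 1 / (d : ℝ) ≤ VV d p q z A := by have := a.V_nn; unfold VV; linarith
lemma Ap.V0 : 0 < VV d p q z A := lt_of_lt_of_le (by have := a.d1; positivity) a.V1
lemma Ap.Kd20 : K ^ 20 ≤ d := by
  have h := a.KN
  have hd := a.d1; have hdN := a.dN; have hK := a.K0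
  have s2 : √(d : ℝ) * √d = d := Real.mul_self_sqrt (by linarith)
  have s0 : 0 < √(d : ℝ) := Real.sqrt_pos.mpr (by linarith)
  have h1 : d * K ^ 10 ≤ d * √d := le_trans (mul_le_mul_of_nonneg_right (by linarith) (by positivity)) h
  have h2 : K ^ 10 ≤ √d := le_of_mul_le_mul_left h1 (by linarith)
  calc K ^ 20 = K ^ 10 * K ^ 10 := by ring
    _ ≤ √d * √d := by gcongr
    _ = d := s2
lemma Ap.ep_av : av (fun i k => ‖ep p q z i k A‖ ^ 2) ≤ K ^ 3 * VV d p q z A + 160 * (WW p q z A / K ^ 8) := by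
  have hd := a.d1; have hK := a.K0; have hq := a.hq
  have b1 : ∀ i k, i ≠ k → ‖ep p q z i k A‖ ^ 2 ≤ (72 * K ^ 2 / d + 392 / q ^ 4)
      + ((2 / q ^ 4) * ‖∑ x, Sp A i k x • DD p q z A x‖ ^ 2 + (4 * K ^ 2 / q ^ 4) * F2 p q z i k A) := by
    intro i k hik
    have h1 := a.ep_sq hik
    have h2 : ‖∑ x ∈ SS i k (BB i k A), DD p q z A x‖ ^ 2 ≤ 2 * ‖∑ x, Sp A i k x • DD p q z A x‖ ^ 2 + 392 := by
      rw [a.S_sum hik, sub_eq_add_neg]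
      refine (nsq_add _ _).trans ?_
      have : ‖-((A i k : ℂ) * (DD p q z A i + DD p q z A k))‖ ≤ 1 * (7 + 7) := by
        rw [norm_neg, norm_mul, Complex.norm_real, Real.norm_of_nonneg (a.A01 i k).1]
        have := (norm_add_le (DD p q z A i) (DD p q z A k)).trans (add_le_add (a.Dd i) (a.Dd k))
        have := (a.A01 i k).2
        gcongr
      have := pow_le_pow_left₀ (norm_nonneg _) this 2
      linarith
    have h3 := div_le_div_of_nonneg_right h2 (by positivity : 0 ≤ q ^ 4)
    refine h1.trans ?_
    calc _ ≤ 72 * K ^ 2 / d + (2 * ‖∑ x, Sp A i k x • DD p q z A x‖ ^ 2 + 392) / q ^ 4 + 4 * K ^ 2 * (F2 p q z i k A / q ^ 4) := by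
          linarith
      _ = _ := by ring
  refine (av_mono a.hN b1).trans ?_
  rw [av_add, av_const a.hN, av_add, av_smul_r, av_smul_r]
  have s1 : 2 / q ^ 4 * av (fun i k => ‖∑ x, Sp A i k x • DD p q z A x‖ ^ 2) ≤ 64 / N ^ 2 + 160 * (WW p q z A / K ^ 8) := by
    calc _ ≤ 2 / q ^ 4 * (q ^ 4 * (32 / N ^ 2 + 80 * (WW p q z A / K ^ 8))) := by gcongr; exact a.SpD
      _ = _ := by field_simp; ring
  have s2 : 4 * K ^ 2 / q ^ 4 * av (fun i k => F2 p q z i k A) ≤ 32000 * K ^ 2 * VV d p q z A := by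
    calc _ ≤ 4 * K ^ 2 / q ^ 4 * (8000 * q ^ 4 * VV d p q z A) := by gcongr; exact a.F_av
      _ = _ := by field_simp; ring
  have hV := a.V1
  have s3 : 392 / q ^ 4 ≤ 1568 * (1 / (d : ℝ)) := by
    have := a.le_q4
    rw [← mul_div_assoc, div_le_div_iff₀ (by positivity) (by positivity)]
    nlinarith
  have s4 : 64 / (N : ℝ) ^ 2 ≤ 64 * (1 / (d : ℝ)) := by
    have := a.dN; have := a.N4
    rw [← mul_div_assoc]
    rw [div_le_div_iff₀ (by positivity) (by positivity)]
    nlinarith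
  have s5 : 72 * K ^ 2 / d ≤ 72 * K ^ 2 * VV d p q z A := by
    rw [div_eq_mul_one_div]; gcongr
  have s6 : (72 * K ^ 2 + 1632 + 32000 * K ^ 2) * VV d p q z A ≤ K ^ 3 * VV d p q z A := by
    have := a.V0.le
    gcongr
    have := a.K6
    nlinarith
  nlinarith
end
section
variable {d : ℕ} {A : Matrix (Fin N) (Fin N) ℝ} {p q : ℝ} {z : ℂ} {K k : ℝ} (a : Aq N d A p q z K k)
include a
lemma Aq.ep_le {i k : Fin N} (hik : i ≠ k) : ‖ep p q z i k A‖ * K ^ 8 ≤ 1 := by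
  have hd := a.d1; have hK := a.K0; have hq := a.hq; have hN := a.N4
  have h1 := a.ep_sq hik
  have hW := W_nn p q z A
  have h2 : ‖∑ x ∈ SS i k (BB i k A), DD p q z A x‖ ^ 2 ≤ 2 * d * (N * WW p q z A) := by
    calc _ ≤ (∑ x ∈ SS i k (BB i k A), ‖DD p q z A x‖) ^ 2 := by gcongr; exact norm_sum_le _ _
      _ ≤ (SS i k (BB i k A)).card * ∑ x ∈ SS i k (BB i k A), ‖DD p q z A x‖ ^ 2 := sq_sum_le_card_mul_sum_sq
      _ ≤ 2 * d * (N * WW p q z A) := by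
        rw [← a.W_sum]
        have := a.S_card_le hik
        gcongr
        exact Finset.subset_univ _
  have h3 : ‖∑ x ∈ SS i k (BB i k A), DD p q z A x‖ ^ 2 / q ^ 4 ≤ 8 / K ^ 20 := by
    have := a.le_q4
    rw [div_le_div_iff₀ (by positivity) (by positivity)]
    calc _ ≤ 2 * d * (N * WW p q z A) * K ^ 20 := by gcongr
      _ = 2 * d * (N * WW p q z A * K ^ 20) := by ring
      _ ≤ 2 * d * d := by have := a.NW; gcongr
      _ ≤ _ := by nlinarith
  have h4 : F2 p q z i k A / q ^ 4 ≤ 96 / K ^ 20 := by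
    rw [div_le_div_iff₀ (by positivity) (by positivity)]; exact a.F_q hik
  have h5 : 72 * K ^ 2 / d ≤ 72 * K ^ 2 / K ^ 20 := by have := a.Kd20; gcongr
  have h6 : ‖ep p q z i k A‖ ^ 2 ≤ (72 * K ^ 2 + 8 + 384 * K ^ 2) / K ^ 20 := by
    refine h1.trans ?_
    calc _ ≤ 72 * K ^ 2 / K ^ 20 + 8 / K ^ 20 + 4 * K ^ 2 * (96 / K ^ 20) := by gcongr
      _ = _ := by ring
  have h7 : (‖ep p q z i k A‖ * K ^ 8) ^ 2 ≤ 1 := by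
    calc _ = ‖ep p q z i k A‖ ^ 2 * K ^ 16 := by ring
      _ ≤ (72 * K ^ 2 + 8 + 384 * K ^ 2) / K ^ 20 * K ^ 16 := by gcongr
      _ = (456 * K ^ 2 + 8) / K ^ 4 := by field_simp; ring
      _ ≤ 1 := by
        rw [div_le_one (by positivity)]
        have := a.K6
        have h9 : 10 ^ 6 ≤ K ^ 2 := this.trans (le_self_pow₀ (by linarith) (by norm_num))
        nlinarith
  exact (sq_le_one_iff₀ (by positivity)).mp h7
lemma Aq.ep1 {i k : Fin N} (hik : i ≠ k) : ‖ep p q z i k A‖ ≤ 1 / 1000000 := by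
  have h := a.ep_le hik
  have := a.K6
  have h8 : (10 ^ 6) ^ 1 ≤ K ^ 8 := (pow_le_pow_left₀ (by norm_num) this 1).trans
    (pow_le_pow_right₀ (by linarith) (by norm_num))
  have : ‖ep p q z i k A‖ * (10 ^ 6) ^ 1 ≤ 1 := le_trans (by gcongr) h
  linarith
lemma Aq.zg : 3 / 4 ≤ ‖z + gg p q z A‖ := by
  have e : gg p q z A * (z + gg p q z A) = -(1 - PP p q z A) := by unfold PP; ring
  have h := congrArg norm e
  rw [norm_mul, norm_neg] at h
  have h2 := norm_sub_norm_le (1 : ℂ) (PP p q z A)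
  rw [norm_one] at h2
  have h3 : ‖gg p q z A‖ * ‖z + gg p q z A‖ ≤ 1 * ‖z + gg p q z A‖ := by have := a.g1; gcongr
  have := a.P4; have := a.k1
  linarith
lemma Aq.ze_rel {i k : Fin N} (hik : i ≠ k) : 1 + (z + gg p q z A) * ze p q z i k A = - ep p q z i k A * ze p q z i k A := by
  have h := schur_z a.adj.1 a.adj.2.1 hik a.hq.ne' a.hz (p := p)
  unfold ep
  linear_combination -h
lemma Aq.ze16 {i k : Fin N} (hik : i ≠ k) : ‖ze p q z i k A‖ ≤ 1.5 := by
  have h := a.ze_rel hik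
  have e : ze p q z i k A * (z + gg p q z A + ep p q z i k A) = -1 := by linear_combination h
  have h1 := congrArg norm e
  rw [norm_mul, norm_neg, norm_one] at h1
  have h2 := norm_sub_norm_le (z + gg p q z A) (- ep p q z i k A)
  rw [sub_neg_eq_add, norm_neg] at h2
  have := a.zg; have := a.ep1 hik
  have h3 : 0.7 ≤ ‖z + gg p q z A + ep p q z i k A‖ := by norm_num; linarith
  have := norm_nonneg (ze p q z i k A)
  nlinarith
lemma Aq.P_eq : PP p q z A = - av fun i k => ep p q z i k A * ze p q z i k A := by
  have h : av (fun i k => 1 + (z + gg p q z A) * ze p q z i k A) = PP p q z A := by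
    rw [av_add, av_const a.hN, av_smul_c, a.av_ze]; unfold PP; ring
  rw [← h, ← av_neg]
  exact av_congr fun i k hik => by rw [a.ze_rel hik]; ring
lemma Aq.P_sq : ‖PP p q z A‖ ^ 2 ≤ 2.25 * av fun i k => ‖ep p q z i k A‖ ^ 2 := by
  have h : ‖PP p q z A‖ ≤ 1.5 * av fun i k => ‖ep p q z i k A‖ := by
    rw [a.P_eq, norm_neg]
    refine (av_norm a.hN _).trans ?_
    rw [← av_smul_r]
    refine av_mono a.hN fun i k hik => ?_
    rw [norm_mul, mul_comm]
    exact mul_le_mul_of_nonneg_right (a.ze16 hik) (norm_nonneg _)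
  have h1 := pow_le_pow_left₀ (norm_nonneg _) h 2
  have h2 := av_sq a.hN fun i k => ‖ep p q z i k A‖
  refine h1.trans ?_
  rw [mul_pow]
  norm_num at *
  linarith
lemma Aq.W_le : WW p q z A ≤ 160 * av (fun i k => ‖ep p q z i k A‖ ^ 2) + 16 * VV d p q z A := by
  have hN := a.N4
  set E := av (fun i k => ‖ep p q z i k A‖ ^ 2) with hE
  have hzg := a.zg
  have b1 : ∀ i k, i ≠ k → ‖DD p q z A i + DD p q z A k‖ ^ 2
      ≤ 64 * ‖ep p q z i k A‖ ^ 2 + (32 * ‖PP p q z A‖ ^ 2 + 8 * (if i = k then 0 else ‖GG p q z A i k‖ ^ 2)) := by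
    intro i k hik
    rw [if_neg hik]
    have e1 : (z + gg p q z A) * (ze p q z i k A - gg p q z A) = - ep p q z i k A * ze p q z i k A + - PP p q z A := by
      rw [← a.ze_rel hik]; unfold PP; ring
    have e2 : DD p q z A i + DD p q z A k = 2 * (ze p q z i k A - gg p q z A) + 2 * GG p q z A i k := by
      rw [ze_eq a.adj.1 p q a.hz]; unfold DD; ring
    have h1 := congrArg (fun w => ‖w‖ ^ 2) e1
    beta_reduce at h1
    have h2 := nsq_add (- ep p q z i k A * ze p q z i k A) (- PP p q z A)
    rw [← h1, norm_mul, norm_mul, norm_neg, norm_neg, mul_pow, mul_pow] at h2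
    have h3 : ‖ep p q z i k A‖ ^ 2 * ‖ze p q z i k A‖ ^ 2 ≤ ‖ep p q z i k A‖ ^ 2 * 1.5 ^ 2 := by
      have := a.ze16 hik; gcongr
    have h4 : (3 / 4) ^ 2 * ‖ze p q z i k A - gg p q z A‖ ^ 2 ≤ ‖z + gg p q z A‖ ^ 2 * ‖ze p q z i k A - gg p q z A‖ ^ 2 := by
      gcongr
    rw [e2]
    refine (nsq_add _ _).trans ?_
    rw [norm_mul, norm_mul, Complex.norm_ofNat, mul_pow, mul_pow]
    norm_num at h3
    nlinarith [sq_nonneg ‖ep p q z i k A‖, sq_nonneg ‖PP p q z A‖]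
  have b2 := av_mono a.hN b1
  rw [av_add, av_smul_r, av_add, av_const a.hN, av_smul_r, ← hE] at b2
  have b3 : av (fun i k => if i = k then 0 else ‖GG p q z A i k‖ ^ 2) ≤ 2 * VV d p q z A := by
    refine (av_le a.hN fun i k => by positivity).trans ?_
    have h1 : ∑ i, ∑ k, (if i = k then 0 else ‖GG p q z A i k‖ ^ 2) ≤ ∑ i, ∑ k, ‖GG p q z A i k‖ ^ 2 :=
      Finset.sum_le_sum fun i _ => Finset.sum_le_sum fun k _ => by split_ifs <;> first | positivity | exact le_rfl
    calc _ ≤ 2 / (N : ℝ) ^ 2 * (N * ((gg p q z A).im / z.im) + 1 / 4) := by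
          gcongr; exact h1.trans a.G_fro
      _ = 2 * ((gg p q z A).im / (N * z.im)) + 1 / (2 * N ^ 2) := by have := a.hz; field_simp; ring
      _ ≤ _ := by
          unfold VV
          have h5 : 1 / (2 * (N : ℝ) ^ 2) ≤ 1 / d := by
            have := a.dN; have := a.d1
            apply one_div_le_one_div_of_le <;> nlinarith
          have : 0 < 1 / (d : ℝ) := by have := a.d1; positivity
          linarith
  have b4 := a.P_sq
  rw [← hE] at b4
  have b5 : WW p q z A ≤ av (fun i k => ‖DD p q z A i + DD p q z A k‖ ^ 2) := by
    set D := DD p q z A with hD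
    have e : av (fun i k => ‖D i + D k‖ ^ 2)
        = ((N : ℝ) * (N - 1))⁻¹ * (∑ i, ∑ k, ‖D i + D k‖ ^ 2 - ∑ i, 4 * ‖D i‖ ^ 2) := by
      unfold av
      rw [smul_eq_mul]
      congr 1
      rw [← Finset.sum_product', Finset.univ_product_univ, ← Finset.univ_product_univ, ← Finset.diag_union_offDiag,
        Finset.sum_union (Finset.disjoint_diag_offDiag _), Finset.sum_diag]
      have : ∀ i, ‖D i + D i‖ ^ 2 = 4 * ‖D i‖ ^ 2 := fun i => by
        rw [← two_mul, norm_mul, Complex.norm_ofNat]; ring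
      simp only [this]; ring
    have e2 : ∑ i, ∑ k, ‖D i + D k‖ ^ 2 = 2 * N * ∑ i, ‖D i‖ ^ 2 + 2 * ‖∑ i, D i‖ ^ 2 := by
      have : ∀ i k, ‖D i + D k‖ ^ 2 = ‖D i‖ ^ 2 + ‖D k‖ ^ 2 + 2 * (D i * star (D k)).re := by
        intro i k
        rw [← Complex.normSq_eq_norm_sq, Complex.normSq_add, Complex.normSq_eq_norm_sq, Complex.normSq_eq_norm_sq]; rfl
      simp only [this, Finset.sum_add_distrib, Finset.sum_const, Finset.card_univ, Fintype.card_fin, nsmul_eq_mul, ← Finset.mul_sum]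
      have : ‖∑ i, D i‖ ^ 2 = ∑ i, ∑ k, (D i * star (D k)).re := by
        rw [← Complex.normSq_eq_norm_sq, ← Complex.ofReal_re (Complex.normSq _), Complex.normSq_eq_conj_mul_self, map_sum,
          Finset.sum_mul_sum, Complex.re_sum, Finset.sum_comm]
        refine Finset.sum_congr rfl fun x _ => ?_
        rw [Complex.re_sum]
        refine Finset.sum_congr rfl fun y _ => ?_
        simp; ring
      rw [this]; ring
    rw [e, e2, ← Finset.mul_sum, a.W_sum]
    have hW := W_nn p q z A
    rw [inv_mul_eq_div, le_div_iff₀ (by nlinarith)]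
    have : 0 ≤ ‖∑ i, D i‖ ^ 2 := by positivity
    have : 0 ≤ WW p q z A * N * (N - 3) := by apply mul_nonneg (by positivity); linarith
    nlinarith
  norm_num at b4
  have hE0 : 0 ≤ E := av_nonneg a.hN fun i k _ => by positivity
  linarith
lemma Aq.stab : WW p q z A ≤ K ^ 4 * VV d p q z A ∧ av (fun i k => ‖ep p q z i k A‖ ^ 2) ≤ 2 * K ^ 3 * VV d p q z A
    ∧ ‖PP p q z A‖ ^ 2 ≤ K ^ 4 * VV d p q z A := by
  have h1 := a.ep_av; have h2 := a.W_le; have h3 := a.P_sq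
  have hV := a.V0; have hK := a.K6; have hW := W_nn p q z A
  set E := av (fun i k => ‖ep p q z i k A‖ ^ 2) with hE
  have hE0 : 0 ≤ E := av_nonneg a.hN fun i k _ => by positivity
  have k3 : 10 ^ 18 ≤ K ^ 3 := by
    calc (10 : ℝ) ^ 18 = (10 ^ 6) ^ 3 := by norm_num
      _ ≤ K ^ 3 := by gcongr
  have k8 : 10 ^ 6 ≤ K ^ 8 := hK.trans (le_self_pow₀ (by linarith) (by norm_num))
  have h4 : WW p q z A / K ^ 8 ≤ WW p q z A / 10 ^ 6 := by gcongr
  have k4 : 10 ^ 6 * (K ^ 3 * VV d p q z A) ≤ K ^ 4 * VV d p q z A := by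
    calc _ ≤ K * (K ^ 3 * VV d p q z A) := by gcongr
      _ = _ := by ring
  have k5 : 10 ^ 18 * VV d p q z A ≤ K ^ 3 * VV d p q z A := by gcongr
  have h5 : E ≤ 2 * K ^ 3 * VV d p q z A := by linarith
  norm_num at h3
  exact ⟨by linarith, h5, by linarith⟩
lemma Aq.g_le : ‖gg p q z A‖ ≤ 1 - √k / 2 := by
  have hk := a.k0; have hk1 := a.k1
  have s : √k * √k = k := Real.mul_self_sqrt hk.le
  have s0 := Real.sqrt_nonneg k
  have s1 : √k ≤ 1 := by rw [Real.sqrt_le_left (by norm_num)]; linarith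
  have e : z * gg p q z A = PP p q z A - 1 - gg p q z A ^ 2 := by unfold PP; ring
  have h := congrArg norm e
  rw [norm_mul] at h
  have h1 := norm_sub_le (PP p q z A - 1) (gg p q z A ^ 2)
  have h2 := norm_sub_le (PP p q z A) 1
  rw [norm_one] at h2
  rw [norm_pow] at h1
  have := a.P4; have g1 := a.g1
  have g0 := norm_nonneg (gg p q z A)
  set r := ‖gg p q z A‖
  have h3 : (2 + k) * r ≤ 1 + r ^ 2 + k / 4 := by
    have : (2 + k) * r ≤ ‖z‖ * r := by have := a.kz; gcongr
    linarith
  by_cases hr : r ≤ 1 / 2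
  · linarith
  · by_contra hc
    push Not at hc hr
    have : (1 - r) ^ 2 < (√k / 2) ^ 2 := by apply pow_lt_pow_left₀ <;> [linarith; linarith; norm_num]
    nlinarith
lemma Aq.im_g : (gg p q z A).im * √k ≤ 2 * (z.im + ‖gg p q z A‖ * ‖PP p q z A‖) := by
  have hk := a.k0
  have hg := a.g_le
  have g0 := norm_nonneg (gg p q z A)
  have hs : (gg p q z A).re * (gg p q z A).re + (gg p q z A).im * (gg p q z A).im = ‖gg p q z A‖ ^ 2 := by
    rw [← Complex.normSq_eq_norm_sq, Complex.normSq_apply]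
  have e : (star (gg p q z A) * PP p q z A).im = - (gg p q z A).im + ‖gg p q z A‖ ^ 2 * (z.im + (gg p q z A).im) := by
    rw [← hs]; unfold PP; simp [sq]; ring
  have h := Complex.abs_im_le_norm (star (gg p q z A) * PP p q z A)
  rw [norm_mul, norm_star, e] at h
  have h1 := (abs_le.mp h).1
  have hi := a.g_im
  have hz := a.hz
  have s0 := Real.sqrt_nonneg k
  have hr : ‖gg p q z A‖ ^ 2 ≤ 1 - √k / 2 := by nlinarith [a.g1]
  nlinarith
end
end RR
namespace RR
variable {N : ℕ}
/-- off-diagonal part -/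
def Mo (p q : ℝ) (z : ℂ) (B : Matrix (Fin N) (Fin N) ℝ) (x y : Fin N) : ℂ := if x = y then 0 else GG p q z B x y
/-- sum of off-diagonal part -/
def Ms (p q : ℝ) (z : ℂ) (i k : Fin N) (A : Matrix (Fin N) (Fin N) ℝ) : ℂ :=
  ∑ x ∈ SS i k (BB i k A), ∑ y ∈ SS i k (BB i k A), Mo p q z (BB i k A) x y
/-- centred fluctuation -/
def ZZ (p q : ℝ) (z : ℂ) (i k : Fin N) (A : Matrix (Fin N) (Fin N) ℝ) : ℂ :=
  (Qc (SS i k (BB i k A)) (Mo p q z (BB i k A)) (ww A i k)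
    + Ms p q z i k A * ((1 / (((SS i k (BB i k A)).card : ℝ) - 1) : ℝ) : ℂ)) / (2 * (q : ℂ) ^ 2)
/-- cubic -/
def fz (z s : ℂ) : ℂ := (z + s) * (1 + z * s + s ^ 2) / z ^ 2
/-- frozen trace -/
def g0 (p q : ℝ) (z : ℂ) (B : Matrix (Fin N) (Fin N) ℝ) : ℂ := ((GG p q z B).trace + 2 * z⁻¹) / (N - 1)
section
variable {d : ℕ} {A : Matrix (Fin N) (Fin N) ℝ} {p q : ℝ} {z : ℂ} (c : Ctx N d A p q z)
include c
lemma Ctx.Qc_eq {i k : Fin N} (hik : i ≠ k) : cc (ww A i k) ⬝ᵥ gw p q z i k A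
    - ∑ x ∈ SS i k (BB i k A), GG p q z (BB i k A) x x = Qc (SS i k (BB i k A)) (Mo p q z (BB i k A)) (ww A i k) := by
  set S := SS i k (BB i k A) with hS
  have r : ∀ f : Fin N → ℂ, ∑ x, cc (ww A i k) x * f x = ∑ x ∈ S, cc (ww A i k) x * f x := fun f =>
    (Finset.sum_subset (Finset.subset_univ S) fun x _ hx => by simp [cc, ww_nS c.adj hik hx]).symm
  have e : cc (ww A i k) ⬝ᵥ gw p q z i k A = ∑ x ∈ S, ∑ y ∈ S, GG p q z (BB i k A) x y * (ww A i k x * ww A i k y : ℝ) := by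
    unfold dotProduct
    rw [r]
    refine Finset.sum_congr rfl fun x _ => ?_
    simp only [gw, mulVec, dotProduct]
    rw [Finset.sum_congr rfl fun y _ => mul_comm _ _, r, Finset.mul_sum]
    refine Finset.sum_congr rfl fun y _ => ?_
    simp [cc]; ring
  rw [e]
  unfold Qc
  rw [← Finset.sum_sub_distrib]
  refine Finset.sum_congr rfl fun x hx => ?_
  have w1 : ww A i k x * ww A i k x = 1 := by rcases ww_S c.adj hik hx with h | h <;> rw [h] <;> norm_num
  rw [← Finset.add_sum_erase S _ hx, ← Finset.add_sum_erase S (fun y => Mo p q z (BB i k A) x y * _) hx, w1]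
  have : ∑ y ∈ S.erase x, Mo p q z (BB i k A) x y * ((ww A i k x * ww A i k y : ℝ) : ℂ)
      = ∑ y ∈ S.erase x, GG p q z (BB i k A) x y * ((ww A i k x * ww A i k y : ℝ) : ℂ) :=
    Finset.sum_congr rfl fun y hy => by rw [Mo, if_neg (Finset.ne_of_mem_erase hy).symm]
  rw [this]; simp [Mo]
lemma Ctx.Y_dec {i k : Fin N} (hik : i ≠ k) : YY p q z i k A = ZZ p q z i k A
    + (∑ x ∈ SS i k (BB i k A), GG p q z (BB i k A) x x
      - Ms p q z i k A * ((1 / (((SS i k (BB i k A)).card : ℝ) - 1) : ℝ) : ℂ)) / (2 * (q : ℂ) ^ 2) := by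
  unfold YY ZZ
  rw [← c.Qc_eq hik]; ring
lemma Ctx.g_sub {i k : Fin N} (hik : i ≠ k) : gg p q z A - g0 p q z (BB i k A)
    = ze p q z i k A / 2 * (∑ x, yy p q z i k A x * yy p q z i k A x) / (N - 1) := by
  have e : (GG p q z A).trace = (GG p q z (BB i k A)).trace + z⁻¹
      + ze p q z i k A / 2 * (∑ x, yy p q z i k A x * yy p q z i k A x) := by
    simp only [trace, diag]
    rw [Finset.sum_congr rfl fun x _ => schur_G c.adj.1 c.adj.2.1 hik c.hq.ne' c.hz x x, Finset.sum_add_distrib,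
      Finset.sum_add_distrib, ← Finset.mul_sum, ← Finset.sum_div]
    have : ∑ x, ((uu i k x * uu i k x : ℝ) : ℂ) = 2 := by
      have := u_dot_u hik
      simpa [dotProduct, cc] using this
    rw [this]
    have := c.z0
    field_simp
  unfold gg g0
  rw [e]; ring
lemma Ctx.g_sub_le {i k : Fin N} (hik : i ≠ k) : ‖gg p q z A - g0 p q z (BB i k A)‖ * (z.im * (N - 1)) * ‖ze p q z i k A‖
    ≤ (ze p q z i k A).im := by
  have hN := c.N4; have hz := c.hz
  have h1 : 2 * (ze p q z i k A).im = z.im * (‖ze p q z i k A‖ ^ 2 * ns (yy p q z i k A)) := by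
    have h := R_ward (HH_symm p q c.adj.1) c.hz (cc (uu i k))
    have e1 : R (HH p q A) z *ᵥ cc (uu i k) = ze p q z i k A • yy p q z i k A := schur_Gu c.adj.1 c.adj.2.1 hik c.hq.ne' c.hz (p := p)
    have e2 : ns (ze p q z i k A • yy p q z i k A) = ‖ze p q z i k A‖ ^ 2 * ns (yy p q z i k A) := by
      simp [ns, mul_pow, Finset.mul_sum]
    have e3 : star (cc (uu i k)) = cc (uu i k) := by ext x; simp [cc]
    rw [e3] at h
    have e4 : cc (uu i k) ⬝ᵥ (R (HH p q A) z *ᵥ cc (uu i k)) = 2 * ze p q z i k A := by unfold ze GG; ring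
    rw [e4, e1, e2] at h
    simpa using h
  have h2 : ‖∑ x, yy p q z i k A x * yy p q z i k A x‖ ≤ ns (yy p q z i k A) := by
    refine (norm_sum_le _ _).trans (le_of_eq ?_)
    unfold ns
    exact Finset.sum_congr rfl fun x _ => by rw [norm_mul, sq]
  have hn1 : ‖(N : ℂ) - 1‖ = N - 1 := by
    have : ((N : ℂ) - 1) = ((N - 1 : ℝ) : ℂ) := by push_cast; ring
    rw [this, Complex.norm_real, Real.norm_of_nonneg (by linarith)]
  rw [c.g_sub hik, norm_div, norm_mul, norm_div, hn1, Complex.norm_ofNat]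
  have hne : (N : ℝ) - 1 ≠ 0 := by linarith
  have := norm_nonneg (ze p q z i k A)
  calc _ = z.im * (‖ze p q z i k A‖ ^ 2 * ‖∑ x, yy p q z i k A x * yy p q z i k A x‖) / 2 := by field_simp
    _ ≤ z.im * (‖ze p q z i k A‖ ^ 2 * ns (yy p q z i k A)) / 2 := by gcongr
    _ = _ := by rw [← h1]; ring
end
section
variable {d : ℕ} {A : Matrix (Fin N) (Fin N) ℝ} {p q : ℝ} {z : ℂ} {K : ℝ} (a : Ap N d A p q z K)
include a
omit a in
lemma Ms_le (i k : Fin N) : ‖Ms p q z i k A‖ ≤ (SS i k (BB i k A)).card * √(F2 p q z i k A) := by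
  set S := SS i k (BB i k A) with hS
  have h1 : ‖Ms p q z i k A‖ ≤ ∑ e ∈ S ×ˢ S, ‖GG p q z (BB i k A) e.1 e.2‖ := by
    unfold Ms
    rw [← Finset.sum_product']
    refine (norm_sum_le _ _).trans (Finset.sum_le_sum fun e _ => ?_)
    unfold Mo; split_ifs <;> simp
  have h2 := sq_sum_le_card_mul_sum_sq (s := S ×ˢ S) (f := fun e => ‖GG p q z (BB i k A) e.1 e.2‖)
  rw [Finset.card_product, Finset.sum_product (f := fun e : Fin N × Fin N => ‖GG p q z (BB i k A) e.1 e.2‖ ^ 2)] at h2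
  have h3 : (∑ e ∈ S ×ˢ S, ‖GG p q z (BB i k A) e.1 e.2‖) ^ 2 ≤ (S.card * √(F2 p q z i k A)) ^ 2 := by
    refine h2.trans (le_of_eq ?_)
    rw [mul_pow, Real.sq_sqrt (F2_nn _ _ _ _ _ _)]
    unfold F2 Fs; push_cast; ring
  exact h1.trans (abs_le_of_sq_le_sq' h3 (by positivity)).2
lemma Ap.m2 {i k : Fin N} (hik : i ≠ k) : 2 ≤ ((SS i k (BB i k A)).card : ℝ) ∧ q ^ 2 ≤ (SS i k (BB i k A)).card := by
  have h := a.S_card hik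
  have h1 := (abs_le.mp (a.om.o1 i k hik)).2
  have h2 := (a.A01 i k).2
  have h3 := a.le_q; have h4 := a.d1; have hK := a.K6
  have h5 : √(d : ℝ) * √d = d := Real.mul_self_sqrt (by linarith)
  have h6 : K ^ 10 ≤ √(d : ℝ) := by
    have h := a.KN; have hdN := a.dN
    have s0 : 0 < √(d : ℝ) := Real.sqrt_pos.mpr (by linarith)
    have h1 : d * K ^ 10 ≤ d * √d := le_trans (mul_le_mul_of_nonneg_right (by linarith) (by positivity)) h
    exact le_of_mul_le_mul_left h1 (by linarith)
  have h7 : 8 * K ≤ √(d : ℝ) := by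
    refine le_trans ?_ h6
    have : K ^ 2 ≤ K ^ 10 := pow_le_pow_right₀ (by linarith) (by norm_num)
    nlinarith
  have h8 : 8 * K * √(d : ℝ) ≤ d := by nlinarith [Real.sqrt_nonneg (d : ℝ)]
  have h9 : 100 ≤ (d : ℝ) := by nlinarith
  constructor <;> nlinarith
lemma Ap.mi {i k : Fin N} (hik : i ≠ k) : (SS i k (BB i k A)).card * ‖((1 / (((SS i k (BB i k A)).card : ℝ) - 1) : ℝ) : ℂ)‖ ≤ 2 := by
  have h := (a.m2 hik).1
  rw [Complex.norm_real, Real.norm_of_nonneg (by apply one_div_nonneg.mpr; linarith), mul_one_div, div_le_iff₀ (by linarith)]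
  linarith
lemma Ap.ZZ_le {i k : Fin N} (hik : i ≠ k) : ‖ZZ p q z i k A‖ ≤ K * √(F2 p q z i k A) / q ^ 2 := by
  have h1 := a.om.o2 i k hik
  rw [a.Qc_eq hik] at h1
  have h2 := Ms_le (A := A) (p := p) (q := q) (z := z) i k; have h3 := a.mi hik; have hq := a.hq; have hK := a.K6
  have s0 := Real.sqrt_nonneg (F2 p q z i k A)
  unfold ZZ
  rw [norm_div, a.nq, div_le_div_iff₀ (by positivity) (by positivity)]
  set w := ((1 / (((SS i k (BB i k A)).card : ℝ) - 1) : ℝ) : ℂ)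
  have h4 : ‖Ms p q z i k A * w‖ ≤ 2 * √(F2 p q z i k A) := by
    rw [norm_mul]
    calc _ ≤ (SS i k (BB i k A)).card * √(F2 p q z i k A) * ‖w‖ := by gcongr
      _ = (SS i k (BB i k A)).card * ‖w‖ * √(F2 p q z i k A) := by ring
      _ ≤ _ := by gcongr
  have h5 := (norm_add_le _ _).trans (add_le_add h1 h4)
  calc _ ≤ (K * √(F2 p q z i k A) + 2 * √(F2 p q z i k A)) * q ^ 2 := by gcongr
    _ ≤ _ := by nlinarith [mul_nonneg s0 (sq_nonneg q)]
end
section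
variable {d : ℕ} {A : Matrix (Fin N) (Fin N) ℝ} {p q : ℝ} {z : ℂ} {K k : ℝ} (a : Aq N d A p q z K k)
include a
lemma Aq.h_le {i k : Fin N} (hik : i ≠ k) : ‖gg p q z A - g0 p q z (BB i k A)‖
    ≤ 2 * (VV d p q z A + ‖ep p q z i k A‖ / (N * z.im)) := by
  have hN := a.N4; have hz := a.hz; have hd := a.d1; have hdN := a.dN
  have h := a.g_sub_le hik
  have hr := a.ze_rel hik
  have z16 := a.ze16 hik
  have zn : ze p q z i k A ≠ 0 := by intro h0; rw [h0] at hr; simp at hr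
  have zp : 0 < ‖ze p q z i k A‖ := norm_pos_iff.mpr zn
  have e : (ze p q z i k A).im = ‖ze p q z i k A‖ ^ 2 * (z + gg p q z A + ep p q z i k A).im := by
    have h1 : star (ze p q z i k A) = - (‖ze p q z i k A‖ ^ 2 : ℝ) * (z + gg p q z A + ep p q z i k A) := by
      have h2 : star (ze p q z i k A) * ze p q z i k A = (‖ze p q z i k A‖ ^ 2 : ℝ) := by
        rw [← Complex.normSq_eq_norm_sq, Complex.normSq_eq_conj_mul_self]; rfl
      rw [← h2]; linear_combination (star (ze p q z i k A)) * hr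
    have h3 := congrArg Complex.im h1
    rw [← Complex.ofReal_neg, Complex.im_ofReal_mul] at h3
    have h4 : (star (ze p q z i k A)).im = - (ze p q z i k A).im := rfl
    rw [h4] at h3; linarith
  have h5 : (z + gg p q z A + ep p q z i k A).im ≤ z.im + (gg p q z A).im + ‖ep p q z i k A‖ := by
    simp only [Complex.add_im]
    have := (le_abs_self _).trans (Complex.abs_im_le_norm (ep p q z i k A)); linarith
  have hi := a.g_im
  have h6 : ‖gg p q z A - g0 p q z (BB i k A)‖ * (z.im * (N - 1)) ≤ 1.5 * (z.im + (gg p q z A).im + ‖ep p q z i k A‖) := by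
    have h7 : ‖gg p q z A - g0 p q z (BB i k A)‖ * (z.im * (N - 1)) * ‖ze p q z i k A‖
        ≤ (‖ze p q z i k A‖ * (z.im + (gg p q z A).im + ‖ep p q z i k A‖)) * ‖ze p q z i k A‖ := by
      refine h.trans ?_
      rw [e]
      calc _ ≤ ‖ze p q z i k A‖ ^ 2 * (z.im + (gg p q z A).im + ‖ep p q z i k A‖) := by gcongr
        _ = _ := by ring
    refine (le_of_mul_le_mul_right h7 zp).trans ?_
    gcongr
  have h8 : VV d p q z A + ‖ep p q z i k A‖ / (N * z.im) = ((gg p q z A).im + N * z.im / d + ‖ep p q z i k A‖) / (N * z.im) := by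
    unfold VV; field_simp
  rw [h8, ← mul_div_assoc, le_div_iff₀ (by positivity)]
  have h9 : z.im ≤ N * z.im / d := by rw [le_div_iff₀ (by linarith)]; nlinarith
  have hn := norm_nonneg (gg p q z A - g0 p q z (BB i k A))
  have : ‖gg p q z A - g0 p q z (BB i k A)‖ * (N * z.im) ≤ 4 / 3 * (‖gg p q z A - g0 p q z (BB i k A)‖ * (z.im * (N - 1))) := by
    have : 0 ≤ ‖gg p q z A - g0 p q z (BB i k A)‖ * z.im := by positivity
    nlinarith
  norm_num at h6
  linarith
lemma Aq.fz_le (hz4 : ‖z ^ 2 - 4‖ ≤ 3 * k * ‖z‖ ^ 2) (h : ℂ) (hh : ‖h‖ ≤ √k) :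
    ‖fz z (gg p q z A) - fz z (gg p q z A - h)‖ ≤ 6 * √k * ‖h‖ := by
  have hk := a.k0
  have s := Real.mul_self_sqrt hk.le
  have s0 := Real.sqrt_nonneg k
  have z2 := a.hz2
  have hz0 := a.z0
  have g1 := a.g1; have P4 := a.P4
  set g := gg p q z A
  have b1 : ‖z + 2 * g‖ ≤ 2 * √k * ‖z‖ := by
    have e : (z + 2 * g) ^ 2 = (z ^ 2 - 4) + 4 * PP p q z A := by unfold PP; ring
    have h1 : ‖z + 2 * g‖ ^ 2 ≤ (2 * √k * ‖z‖) ^ 2 := by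
      rw [← norm_pow, e]
      refine (norm_add_le _ _).trans ?_
      rw [norm_mul, Complex.norm_ofNat]
      have : (2 * √k * ‖z‖) ^ 2 = 4 * k * ‖z‖ ^ 2 := by rw [mul_pow, mul_pow, Real.sq_sqrt hk.le]; ring
      have z4 : 4 ≤ ‖z‖ ^ 2 := by nlinarith
      rw [this]; nlinarith [mul_nonneg hk.le (sub_nonneg.2 z4)]
    exact (abs_le_of_sq_le_sq' h1 (by positivity)).2
  have e : fz z g - fz z (g - h) = (h * ((z + 2 * g) * (z + g) + PP p q z A - h * (2 * z + 3 * g) + h ^ 2)) / z ^ 2 := by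
    unfold fz PP; field_simp; ring
  rw [e, norm_div, norm_mul, norm_pow, div_le_iff₀ (by positivity), mul_right_comm (6 * √k), mul_comm]
  gcongr
  have n1 : ‖(z + 2 * g) * (z + g)‖ ≤ 2 * √k * ‖z‖ * (‖z‖ + 1) := by
    rw [norm_mul]
    gcongr
    exact (norm_add_le _ _).trans (by linarith)
  have n2 : ‖h * (2 * z + 3 * g)‖ ≤ √k * (2 * ‖z‖ + 3) := by
    rw [norm_mul]
    gcongr
    refine (norm_add_le _ _).trans ?_
    rw [norm_mul, norm_mul, Complex.norm_ofNat, Complex.norm_ofNat]; linarith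
  have n3 : ‖h ^ 2‖ ≤ √k := by
    rw [norm_pow]
    have : √k ≤ 1 := by rw [Real.sqrt_le_left (by norm_num)]; linarith [a.k1]
    nlinarith [norm_nonneg h]
  have n4 : ‖PP p q z A‖ ≤ √k := by
    have : √k ≤ 1 := by rw [Real.sqrt_le_left (by norm_num)]; linarith [a.k1]
    nlinarith
  have t := norm_add_le ((z + 2 * g) * (z + g) + PP p q z A - h * (2 * z + 3 * g)) (h ^ 2)
  have t1 := norm_sub_le ((z + 2 * g) * (z + g) + PP p q z A) (h * (2 * z + 3 * g))
  have t2 := norm_add_le ((z + 2 * g) * (z + g)) (PP p q z A)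
  have : √k * (2 * ‖z‖ * (‖z‖ + 1) + 2 * ‖z‖ + 5) ≤ √k * (6 * ‖z‖ ^ 2) := by
    gcongr; nlinarith
  nlinarith
end
end RR
namespace RR
variable {N : ℕ}
section
variable {d : ℕ} {A : Matrix (Fin N) (Fin N) ℝ} {p q : ℝ} {z : ℂ} (c : Ctx N d A p q z)
include c
lemma Ctx.N1d : 1 / ((N : ℝ) - 1) ≤ 1 / d := by
  have := c.dN; have := c.d1
  exact one_div_le_one_div_of_le (by linarith) (by linarith)
lemma Ctx.av_A : av (fun i k => A i k) = d / (N - 1) := by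
  rw [av_eq c.adj.2.1, Finset.sum_congr rfl fun i _ => c.adj.2.2.2 i]
  have := c.N4
  have : (N : ℝ) - 1 ≠ 0 := by linarith
  simp; field_simp
lemma Ctx.av_Sp (x : Fin N) : av (fun i k => Sp A i k x) = 2 * q ^ 2 / (N - 1) := by
  rw [av_eq fun i => by simp [Sp], c.Sp1]
  have := c.N4
  have : (N : ℝ) - 1 ≠ 0 := by linarith
  rw [smul_eq_mul]; field_simp
lemma Ctx.HHG : ∑ x, ∑ y, (X2 d A x y : ℂ) * GG p q z A x y
    = q ^ 2 * ((HH p q A).trace + z * ((N - 1) * (PP p q z A - gg p q z A ^ 2))) := by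
  set H := (HH p q A).map Complex.ofReal with hH
  have hq : (q : ℂ) ≠ 0 := by exact_mod_cast c.hq.ne'
  have e1 : H * GG p q z A = 1 + z • GG p q z A := by
    have h := mul_R c.sH c.hz
    rw [sub_mul, Matrix.smul_mul, one_mul, sub_eq_iff_eq_add] at h
    exact h
  have e2 : ∀ x y, (X2 d A x y : ℂ) = q ^ 2 * (H * H) x y := by
    intro x y
    have : X2 d A x y = q ^ 2 * ∑ v, HH p q A x v * HH p q A v y := by
      have hq := c.hq.ne'
      have h1 : ∀ v, HH p q A x v * HH p q A v y = (A x v * A y v - p * A x v - p * A y v + p ^ 2) / q ^ 2 := by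
        intro v; simp only [HH, of_apply, c.As v y]; field_simp; ring
      rw [Finset.sum_congr rfl fun v _ => h1 v, ← Finset.sum_div, mul_div_cancel₀ _ (by positivity)]
      simp only [Finset.sum_add_distrib, Finset.sum_sub_distrib, ← Finset.mul_sum, c.adj.2.2.2]
      rw [X2, c.hp]
      have := c.N4
      simp; field_simp; ring
    rw [this]; simp [hH, mul_apply]
  have e3 : ∑ x, ∑ y, (X2 d A x y : ℂ) * GG p q z A x y = q ^ 2 * (H * H * GG p q z A).trace := by
    simp only [e2, trace, diag, Finset.mul_sum]
    refine Finset.sum_congr rfl fun x _ => ?_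
    rw [mul_apply (M := H * H), Finset.mul_sum]
    refine Finset.sum_congr rfl fun y _ => ?_
    rw [show GG p q z A x y = GG p q z A y x from R_sym c.sH c.hz x y]; ring
  rw [e3, Matrix.mul_assoc, e1, mul_add, Matrix.mul_smul, e1, mul_one, trace_add, trace_smul, trace_add, trace_smul, c.tr, trace_one]
  have : H.trace = ((HH p q A).trace : ℂ) := by simp [hH, trace]
  have hz := c.z0
  rw [this]; unfold PP
  simp only [Fintype.card_fin, smul_eq_mul]
  field_simp; ring
lemma Ctx.Sp_le (i k : Fin N) : ∑ y, Sp A i k y ≤ 2 * d ∧ ∀ y, Sp A i k y ≤ 1 := by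
  have : ∀ y, Sp A i k y ≤ A y i + A y k ∧ Sp A i k y ≤ 1 := by
    intro y; unfold Sp
    rcases c.adj.2.2.1 y i with h | h <;> rcases c.adj.2.2.1 y k with h' | h' <;> rw [h, h'] <;> norm_num
  refine ⟨(Finset.sum_le_sum fun y _ => (this y).1).trans (le_of_eq ?_), fun y => (this y).2⟩
  rw [Finset.sum_add_distrib, c.Acol, c.Acol]; ring
end
lemma Tb5_num {q d N K V Z : ℝ} (hq : 0 < q) (hd : 1 ≤ d) (hdN : 2 * d ≤ N) (hN : 4 ≤ N) (hK6 : 10 ^ 6 ≤ K) (hV : 1 / d ≤ V)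
    (ql : d / 2 ≤ q ^ 2) (ql4 : d ^ 2 / 4 ≤ q ^ 4) (hZ : 0 ≤ Z) :
    4 * q ^ 4 * (N * (1 / 2)) + 2 * N * 1 * (q ^ 2 * (d / q + Z * ((N - 1) * 4))) + (N * (24 * q ^ 4) + 2 * (K ^ 2 * d) * (N ^ 2 * (1 + V)))
    ≤ N * (N - 1) * ((40 * K ^ 2 * V + 4 * Z / d) * (4 * q ^ 4)) := by
  have hV0 : 0 < V := lt_of_lt_of_le (by positivity) hV
  have hN1 : 0 < N - 1 := by linarith
  have hdd : d / q ≤ 4 * q ^ 2 := by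
    rw [div_le_iff₀ hq]
    have : 1 ≤ 2 * q := by nlinarith
    nlinarith [mul_le_mul_of_nonneg_left this (sq_nonneg q)]
  have m3 : 1 ≤ V * d := by rwa [div_le_iff₀ (by linarith)] at hV
  have m1 : 1 ≤ V * (N - 1) := m3.trans (by gcongr; linarith)
  have m2 : d * (1 + V) ≤ 8 * q ^ 4 * V := by
    have h1 : d * 1 ≤ d * (V * d) := by gcongr
    have h2 : d * V ≤ d * d * V := by gcongr; nlinarith
    have := mul_le_mul_of_nonneg_right ql4 hV0.le
    linarith
  have m4 : 2 * q ^ 2 * Z ≤ 4 * Z / d * q ^ 4 := by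
    calc 2 * q ^ 2 * Z = q ^ 2 * (4 * Z / d * (d / 2)) := by field_simp; ring
      _ ≤ q ^ 2 * (4 * Z / d * q ^ 2) := by gcongr
      _ = _ := by ring
  have n1 : 4 * q ^ 4 * (N * (1 / 2)) + N * (24 * q ^ 4) + 2 * N * 1 * (q ^ 2 * (d / q)) ≤ 36 * (N * q ^ 4) * (V * (N - 1)) := by
    have : 2 * N * 1 * (q ^ 2 * (d / q)) ≤ 2 * N * 1 * (q ^ 2 * (4 * q ^ 2)) := by gcongr
    have := mul_le_mul_of_nonneg_left m1 (show 0 ≤ 36 * (N * q ^ 4) by positivity)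
    linarith [show 0 ≤ N * q ^ 4 by positivity]
  have n2 : 2 * (K ^ 2 * d) * (N ^ 2 * (1 + V)) ≤ 32 * K ^ 2 * q ^ 4 * V * (N * (N - 1)) := by
    have : (N : ℝ) ^ 2 ≤ 2 * (N * (N - 1)) := by nlinarith
    calc _ = 2 * K ^ 2 * (d * (1 + V)) * N ^ 2 := by ring
      _ ≤ 2 * K ^ 2 * (8 * q ^ 4 * V) * (2 * (N * (N - 1))) := by gcongr
      _ = _ := by ring
  have n3 := mul_le_mul_of_nonneg_right m4 (show 0 ≤ 4 * ((N : ℝ) * (N - 1)) by positivity)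
  have hB : 0 ≤ N * q ^ 4 * (V * (N - 1)) := by positivity
  have n4 : N * q ^ 4 * (V * (N - 1)) ≤ K ^ 2 * (N * q ^ 4 * (V * (N - 1))) := le_mul_of_one_le_left hB (by nlinarith)
  linarith [mul_nonneg (sq_nonneg K) hB]
section
variable {d : ℕ} {A : Matrix (Fin N) (Fin N) ℝ} {p q : ℝ} {z : ℂ} {K : ℝ} (a : Ap N d A p q z K)
include a
lemma Ap.Fq_av : av (fun i k => F2 p q z i k A / q ^ 4) ≤ 8000 * VV d p q z A := by
  have hq := a.hq
  have : av (fun i k => F2 p q z i k A / q ^ 4) = (q ^ 4)⁻¹ * av (fun i k => F2 p q z i k A) := by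
    rw [← av_smul_r]; exact av_congr fun i k _ => by ring
  rw [this]
  calc _ ≤ (q ^ 4)⁻¹ * (8000 * q ^ 4 * VV d p q z A) := by gcongr; exact a.F_av
    _ = _ := by field_simp
lemma Ap.dq : d / (2 * q ^ 2) ≤ 1 := by
  have := a.le_q; have := a.hq
  rw [div_le_one (by positivity)]; linarith
/-- diagonal part -/
lemma Ap.Ta : ‖av (fun i k => (∑ x ∈ SS i k (BB i k A), GG p q z (BB i k A) x x) / (2 * (q : ℂ) ^ 2)) - gg p q z A‖
    ≤ (8000 * K + 13) * VV d p q z A := by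
  have hq := a.hq; have hd := a.d1; have hdN := a.dN; have hN := a.N4
  have hq4 : ‖(2 * (q : ℂ) ^ 2)‖ = 2 * q ^ 2 := a.nq
  have hqc : (q : ℂ) ≠ 0 := by exact_mod_cast hq.ne'
  have hVd := a.V1
  have e : av (fun i k => (∑ x ∈ SS i k (BB i k A), GG p q z (BB i k A) x x) / (2 * (q : ℂ) ^ 2)) - gg p q z A
      = av (fun i k => (∑ x ∈ SS i k (BB i k A), GG p q z (BB i k A) x x - ∑ x ∈ SS i k (BB i k A), GG p q z A x x) / (2 * (q : ℂ) ^ 2))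
      + (- z⁻¹ / (N - 1) - av (fun i k => (A i k * (GG p q z A i i + GG p q z A k k)) / (2 * (q : ℂ) ^ 2))) := by
    have e1 : av (fun i k => ∑ x, Sp A i k x • (GG p q z A x x / (2 * (q : ℂ) ^ 2))) = gg p q z A - z⁻¹ / (N - 1) := by
      rw [av_swap]
      simp only [a.av_Sp, ← Finset.smul_sum, ← Finset.sum_div]
      have := a.tr
      simp only [trace, diag] at this
      rw [this]
      have := a.N1
      rw [Complex.real_smul]; push_cast; field_simp
    have e2 : av (fun i k => (∑ x ∈ SS i k (BB i k A), GG p q z (BB i k A) x x) / (2 * (q : ℂ) ^ 2))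
        = av (fun i k => (∑ x ∈ SS i k (BB i k A), GG p q z (BB i k A) x x - ∑ x ∈ SS i k (BB i k A), GG p q z A x x) / (2 * (q : ℂ) ^ 2)
          + (∑ x, Sp A i k x • (GG p q z A x x / (2 * (q : ℂ) ^ 2)) - (A i k * (GG p q z A i i + GG p q z A k k)) / (2 * (q : ℂ) ^ 2))) :=
      av_congr fun i k hik => by
        have : ∑ x, Sp A i k x • (GG p q z A x x / (2 * (q : ℂ) ^ 2)) = (∑ x, Sp A i k x • GG p q z A x x) / (2 * (q : ℂ) ^ 2) := by
          rw [Finset.sum_div]; exact Finset.sum_congr rfl fun x _ => by rw [Complex.real_smul, Complex.real_smul]; ring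
        rw [this, a.S_sum hik (fun x => GG p q z A x x)]; ring
    rw [e2, av_add, av_sub, e1]; ring
  rw [e]
  have t1 : ‖av (fun i k => (∑ x ∈ SS i k (BB i k A), GG p q z (BB i k A) x x - ∑ x ∈ SS i k (BB i k A), GG p q z A x x) / (2 * (q : ℂ) ^ 2))‖
      ≤ K * (8000 * VV d p q z A) := by
    refine (av_norm a.hN _).trans ?_
    have := a.Fq_av; have hK := a.K0
    calc _ ≤ av (fun i k => K * (F2 p q z i k A / q ^ 4)) := av_mono a.hN fun i k hik => by
          rw [norm_div, hq4]
          calc _ ≤ (2 * K * F2 p q z i k A / q ^ 2) / (2 * q ^ 2) := by gcongr; exact a.diff_tr hik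
            _ = _ := by field_simp
      _ ≤ _ := by rw [av_smul_r]; gcongr
  have t2 : ‖- z⁻¹ / ((N : ℂ) - 1)‖ ≤ 1 * (1 / ((N : ℝ) - 1)) := by
    have hn1 : ‖(N : ℂ) - 1‖ = N - 1 := by
      have : ((N : ℂ) - 1) = ((N - 1 : ℝ) : ℂ) := by push_cast; ring
      rw [this, Complex.norm_real, Real.norm_of_nonneg (by linarith)]
    rw [norm_div, norm_neg, hn1, ← mul_div_assoc, mul_one]
    have := a.zi
    gcongr
    · linarith
    · linarith
  have t3 : ‖av (fun i k => (A i k * (GG p q z A i i + GG p q z A k k)) / (2 * (q : ℂ) ^ 2))‖ ≤ 12 * (1 / ((N : ℝ) - 1)) := by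
    refine (av_norm a.hN _).trans ?_
    calc _ ≤ av (fun i k => (12 / (2 * q ^ 2)) * A i k) := av_mono a.hN fun i k hik => by
          rw [norm_div, hq4, norm_mul, Complex.norm_real, Real.norm_of_nonneg (a.A01 i k).1]
          have := (norm_add_le (GG p q z A i i) (GG p q z A k k)).trans (add_le_add (a.Gd i) (a.Gd k))
          have := (a.A01 i k).1
          calc _ ≤ A i k * (6 + 6) / (2 * q ^ 2) := by gcongr
            _ = _ := by ring
      _ = 12 * (d / (2 * q ^ 2)) * (1 / ((N : ℝ) - 1)) := by rw [av_smul_r (12 / (2 * q ^ 2)) (fun i k => A i k), a.av_A]; ring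
      _ ≤ 12 * 1 * (1 / ((N : ℝ) - 1)) := by
        have := a.dq
        have : 0 ≤ 1 / ((N : ℝ) - 1) := by apply one_div_nonneg.mpr; linarith
        gcongr
      _ = _ := by ring
  have := a.N1d
  have := norm_add_le (av (fun i k => (∑ x ∈ SS i k (BB i k A), GG p q z (BB i k A) x x - ∑ x ∈ SS i k (BB i k A), GG p q z A x x) / (2 * (q : ℂ) ^ 2)))
    (- z⁻¹ / (N - 1) - av (fun i k => (A i k * (GG p q z A i i + GG p q z A k k)) / (2 * (q : ℂ) ^ 2)))
  have := norm_sub_le (- z⁻¹ / ((N : ℂ) - 1)) (av (fun i k => (A i k * (GG p q z A i i + GG p q z A k k)) / (2 * (q : ℂ) ^ 2)))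
  linarith
/-- main part of the pair sum -/
lemma Ap.Tb5 (hP : ‖PP p q z A‖ ≤ 1) : ‖av (fun i k => ∑ x, ∑ y, ((Sp A i k x * Sp A i k y : ℝ) : ℂ) * GG p q z A x y)‖ / (4 * q ^ 4)
    ≤ 40 * K ^ 2 * VV d p q z A + 4 * ‖z‖ / d := by
  have hq := a.hq; have hd := a.d1; have hdN := a.dN; have hN := a.N4; have hK := a.K0; have hK6 := a.K6
  have hp := a.p0; have hp1 := a.p1; have hV := a.V1; have hV0 := a.V0; have g1 := a.g1; have hz2 := a.hz2
  have p2 : (1 - 2 * p) ^ 2 ≤ 1 := by nlinarith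
  have ql := a.le_q; have qu := a.q_le; have ql4 := a.le_q4
  have e : av (fun i k => ∑ x, ∑ y, ((Sp A i k x * Sp A i k y : ℝ) : ℂ) * GG p q z A x y)
      = ((N : ℝ) * (N - 1))⁻¹ • (((4 * q ^ 4 : ℝ) : ℂ) * (∑ x, ∑ y, GG p q z A x y)
        + ((2 * N * (1 - 2 * p) ^ 2 : ℝ) : ℂ) * (∑ x, ∑ y, (X2 d A x y : ℂ) * GG p q z A x y)
        + ∑ x, ∑ y, ((4 * X2 d A x y ^ 2 : ℝ) : ℂ) * GG p q z A x y) := by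
    rw [av_eq fun i => by simp [Sp]]
    congr 1
    have : ∑ i, ∑ k, ∑ x, ∑ y, ((Sp A i k x * Sp A i k y : ℝ) : ℂ) * GG p q z A x y
        = ∑ x, ∑ y, ((∑ i, ∑ k, Sp A i k x * Sp A i k y : ℝ) : ℂ) * GG p q z A x y := by
      rw [Finset.sum_congr rfl fun i _ => Finset.sum_comm, Finset.sum_comm]
      refine Finset.sum_congr rfl fun x _ => ?_
      rw [Finset.sum_congr rfl fun i _ => Finset.sum_comm, Finset.sum_comm]
      refine Finset.sum_congr rfl fun y _ => ?_
      push_cast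
      rw [Finset.sum_mul]
      exact Finset.sum_congr rfl fun i _ => by rw [Finset.sum_mul]
    rw [this]
    simp only [a.Sp2, Finset.mul_sum, ← Finset.sum_add_distrib]
    exact Finset.sum_congr rfl fun x _ => Finset.sum_congr rfl fun y _ => by push_cast; ring
  have t1 : ‖((4 * q ^ 4 : ℝ) : ℂ) * (∑ x, ∑ y, GG p q z A x y)‖ ≤ 4 * q ^ 4 * (N * (1 / 2)) := by
    rw [norm_mul, Complex.norm_real, Real.norm_of_nonneg (by positivity)]
    gcongr
    rw [Finset.sum_congr rfl fun x _ => a.Grow x]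
    have := a.zi
    simp only [Finset.sum_const, Finset.card_univ, Fintype.card_fin, nsmul_eq_mul, norm_mul, norm_neg, Complex.norm_natCast]
    gcongr
  have t2 : ‖((2 * N * (1 - 2 * p) ^ 2 : ℝ) : ℂ) * (∑ x, ∑ y, (X2 d A x y : ℂ) * GG p q z A x y)‖
      ≤ 2 * N * 1 * (q ^ 2 * (d / q + ‖z‖ * ((N - 1) * 4))) := by
    rw [norm_mul, Complex.norm_real, Real.norm_of_nonneg (by positivity), a.HHG, norm_mul, norm_pow, Complex.norm_real, Real.norm_of_nonneg hq.le]
    gcongr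
    refine (norm_add_le _ _).trans (add_le_add ?_ ?_)
    · have : (HH p q A).trace = - (d / q) := by
        simp only [trace, diag, HH, of_apply, a.adj.2.1]
        rw [Finset.sum_const, Finset.card_univ, Fintype.card_fin, nsmul_eq_mul, ← a.pN]; ring
      rw [this, Complex.norm_real, norm_neg, Real.norm_of_nonneg (by positivity)]
    · have hn1 : ‖(N : ℂ) - 1‖ = N - 1 := by
        have : ((N : ℂ) - 1) = ((N - 1 : ℝ) : ℂ) := by push_cast; ring
        rw [this, Complex.norm_real, Real.norm_of_nonneg (by linarith)]
      rw [norm_mul, norm_mul, hn1]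
      have : ‖PP p q z A - gg p q z A ^ 2‖ ≤ 4 := by
        have h := norm_sub_le (PP p q z A) (gg p q z A ^ 2)
        rw [norm_pow] at h
        have : ‖gg p q z A‖ ^ 2 ≤ 1 := pow_le_one₀ (norm_nonneg _) g1
        linarith
      have : 0 ≤ (N : ℝ) - 1 := by linarith
      gcongr
  have t3 : ‖∑ x, ∑ y, ((4 * X2 d A x y ^ 2 : ℝ) : ℂ) * GG p q z A x y‖
      ≤ N * (24 * q ^ 4) + 2 * (K ^ 2 * d) * (N ^ 2 * (1 + VV d p q z A)) := by
    have hp : ∀ x y, ‖((4 * X2 d A x y ^ 2 : ℝ) : ℂ) * GG p q z A x y‖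
        ≤ (if x = y then 24 * q ^ 4 else 0) + 2 * (K ^ 2 * d) * (1 + ‖GG p q z A x y‖ ^ 2) := by
      intro x y
      rw [norm_mul, Complex.norm_real, Real.norm_of_nonneg (by positivity)]
      have hg := norm_nonneg (GG p q z A x y)
      split_ifs with h
      · subst h
        rw [a.X2_diag x]
        have : 0 ≤ 2 * (K ^ 2 * d) * (1 + ‖GG p q z A x x‖ ^ 2) := by positivity
        nlinarith [a.Gd x, show 0 < q ^ 4 by positivity]
      · have h1 : X2 d A x y ^ 2 ≤ K ^ 2 * d := by
          rw [← sq_abs]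
          calc _ ≤ (K * √d) ^ 2 := by have := a.om.o1 x y h; gcongr
            _ = _ := by rw [mul_pow, Real.sq_sqrt (by linarith)]
        calc _ ≤ 4 * (K ^ 2 * d) * ((1 + ‖GG p q z A x y‖ ^ 2) / 2) := by
              gcongr; nlinarith [sq_nonneg (‖GG p q z A x y‖ - 1)]
          _ = _ := by ring
    have hs := (norm_sum_le Finset.univ fun x => ∑ y, ((4 * X2 d A x y ^ 2 : ℝ) : ℂ) * GG p q z A x y).trans
      (Finset.sum_le_sum fun x _ => (norm_sum_le _ _).trans (Finset.sum_le_sum fun y _ => hp x y))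
    simp only [Finset.sum_add_distrib, Finset.sum_ite_eq, Finset.mem_univ, if_true, ← Finset.mul_sum, mul_add (2 * (K ^ 2 * (d : ℝ))), Finset.sum_const, Finset.card_univ, Fintype.card_fin, nsmul_eq_mul, mul_one] at hs
    refine hs.trans ?_
    have hf := a.G_fro
    have hz := a.hz
    have : (N : ℝ) * ((gg p q z A).im / z.im) + 1 / 4 ≤ N ^ 2 * VV d p q z A := by
      unfold VV
      have e : (N : ℝ) ^ 2 * ((gg p q z A).im / (N * z.im) + 1 / d) = N * ((gg p q z A).im / z.im) + N ^ 2 / d := by field_simp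
      have : (1 : ℝ) / 4 ≤ N ^ 2 / d := by rw [div_le_div_iff₀ (by norm_num) (by linarith)]; nlinarith
      linarith
    have := mul_le_mul_of_nonneg_left (hf.trans this) (show 0 ≤ 2 * (K ^ 2 * (d : ℝ)) by positivity)
    linarith
  have hq4 : 0 < 4 * q ^ 4 := by positivity
  have hNN := av_pos a.hN
  rw [e, norm_smul, Real.norm_of_nonneg (by positivity), div_le_iff₀ hq4, inv_mul_le_iff₀ hNN]
  refine (norm_add₃_le.trans (add_le_add (add_le_add t1 t2) t3)).trans ?_
  exact Tb5_num hq hd hdN hN hK6 hV ql ql4 (norm_nonneg _)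
end
end RR
namespace RR
variable {N : ℕ}
section
variable {d : ℕ} {A : Matrix (Fin N) (Fin N) ℝ} {p q : ℝ} {z : ℂ} {K k : ℝ}
local notation "gA" => gg p q z A
local notation "GA" => GG p q z A
local notation "vA" => VV d p q z A
section
variable (a : Ap N d A p q z K) {i j : Fin N} (hij : i ≠ j)
local notation "sS" => SS i j (BB i j A)
local notation "GB" => GG p q z (BB i j A)
local notation "fF" => F2 p q z i j A
local notation "wm" => (((1 / ((Finset.card (SS i j (BB i j A)) : ℝ) - 1) : ℝ)) : ℂ)
include a
lemma Ap.col (x : Fin N) (w : Fin N → ℝ) (h0 : ∀ y, 0 ≤ w y) (h1 : ∀ y, w y ≤ 1) (h2 : ∑ y, w y ≤ 2 * d) : ∑ y, w y * ‖GA y x‖ ≤ 2 * d := by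
  have h := R_ward_col a.sH a.hz x
  change z.im * ∑ y, ‖GA y x‖ ^ 2 = (GA x x).im at h
  have h6 := (Complex.im_le_norm _).trans (a.Gd x)
  have hz := a.hz; have hη := a.Kη; have hK := a.K6; have hd := a.d1
  have h3 : ∑ y, ‖GA y x‖ ^ 2 ≤ d := by
    by_contra hc; push Not at hc
    have : 1 ≤ K ^ 3 := one_le_pow₀ (by linarith)
    nlinarith
  calc _ ≤ ∑ y, (w y + ‖GA y x‖ ^ 2) / 2 * 1 := Finset.sum_le_sum fun y _ => by
        nlinarith [h0 y, h1 y, sq_nonneg (‖GA y x‖ - w y), norm_nonneg (GA y x)]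
    _ = (∑ y, w y + ∑ y, ‖GA y x‖ ^ 2) / 2 := by rw [← Finset.sum_add_distrib, Finset.sum_div]; simp
    _ ≤ _ := by linarith
include hij
lemma Ap.b4 : ‖∑ x ∈ sS, ∑ y ∈ sS, GA x y - ∑ x, ∑ y, ((Sp A i j x * Sp A i j y : ℝ) : ℂ) * GA x y‖ ≤ 8 * d := by
  have hs : ∀ x y, GA x y = GA y x := R_sym a.sH a.hz
  have e : ∑ x ∈ sS, ∑ y ∈ sS, GA x y - ∑ x, ∑ y, ((Sp A i j x * Sp A i j y : ℝ) : ℂ) * GA x y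
      = - (A i j : ℂ) * ((∑ x ∈ sS, GA x i + ∑ x ∈ sS, GA x j) + (∑ y, Sp A i j y • GA y i + ∑ y, Sp A i j y • GA y j)) := by
    have e1 : ∑ x ∈ sS, ∑ y ∈ sS, GA x y = ∑ x ∈ sS, ∑ y, Sp A i j y • GA x y - A i j * (∑ x ∈ sS, GA x i + ∑ x ∈ sS, GA x j) := by
      rw [Finset.sum_congr rfl fun x _ => a.S_sum hij (fun y => GA x y), Finset.sum_sub_distrib, ← Finset.mul_sum, Finset.sum_add_distrib]
    rw [e1, a.S_sum hij fun x => ∑ y, Sp A i j y • GA x y]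
    have e2 : ∑ x, ∑ y, ((Sp A i j x * Sp A i j y : ℝ) : ℂ) * GA x y = ∑ x, Sp A i j x • ∑ y, Sp A i j y • GA x y := by
      refine Finset.sum_congr rfl fun x _ => ?_
      rw [Finset.smul_sum]; refine Finset.sum_congr rfl fun y _ => ?_
      simp only [Complex.real_smul]; push_cast; ring
    have e3 : ∀ t, ∑ y, Sp A i j y • GA t y = ∑ y, Sp A i j y • GA y t := fun t => Finset.sum_congr rfl fun y _ => by rw [hs t y]
    rw [e2, e3 i, e3 j]; ring
  have b1 : ∀ x, ‖∑ y, Sp A i j y • GA y x‖ ≤ 2 * d := fun x => by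
    refine (norm_sum_le _ _).trans (le_trans (le_of_eq (Finset.sum_congr rfl fun y _ => ?_)) (a.col x _ (Sp_nn i j) (a.Sp_le i j).2 (a.Sp_le i j).1))
    rw [norm_smul, Real.norm_of_nonneg (Sp_nn i j y)]
  have b2 : ∀ x, ‖∑ y ∈ sS, GA y x‖ ≤ 2 * d := fun x => by
    refine (norm_sum_le _ _).trans (le_trans (le_of_eq ?_) (a.col x (fun y => if y ∈ sS then 1 else 0)
      (fun y => by split_ifs <;> norm_num) (fun y => by split_ifs <;> norm_num) (by simpa using a.S_card_le hij)))
    simp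
  rw [e, norm_mul, norm_neg, Complex.norm_real, Real.norm_of_nonneg (a.A01 i j).1]
  have h1 := (norm_add_le (∑ x ∈ sS, GA x i + ∑ x ∈ sS, GA x j) (∑ y, Sp A i j y • GA y i + ∑ y, Sp A i j y • GA y j)).trans
    (add_le_add (norm_add_le _ _) (norm_add_le _ _))
  have := b1 i; have := b1 j; have := b2 i; have := b2 j
  calc _ ≤ 1 * (8 * (d : ℝ)) := mul_le_mul (a.A01 i j).2 (by linarith) (norm_nonneg _) zero_le_one
    _ = _ := one_mul _
lemma Ap.b23 : ‖Ms p q z i j A - ∑ x ∈ sS, ∑ y ∈ sS, GA x y‖ ≤ 10 * K * fF + 12 * d := by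
  have hq := a.hq; have hK := a.K6; have hd := a.d1; have hF := F2_nn p q z i j A; have hlq := a.le_q
  have e : Ms p q z i j A - ∑ x ∈ sS, ∑ y ∈ sS, GA x y = - (ze p q z i j A / (2 * q ^ 2)) * (∑ x ∈ sS, gw p q z i j A x) ^ 2
      - (∑ x ∈ sS, GB x x - ∑ x ∈ sS, GA x x) - ∑ x ∈ sS, GA x x := by
    have e1 : Ms p q z i j A = ∑ x ∈ sS, ∑ y ∈ sS, GB x y - ∑ x ∈ sS, GB x x := by
      unfold Ms; rw [← Finset.sum_sub_distrib]
      refine Finset.sum_congr rfl fun x hx => ?_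
      rw [← Finset.add_sum_erase sS _ hx, ← Finset.add_sum_erase sS (fun y => GB x y) hx, Finset.sum_congr rfl fun y hy => by
        rw [Mo, if_neg (Finset.ne_of_mem_erase hy).symm]]
      simp [Mo]
    have e2 : ∑ x ∈ sS, ∑ y ∈ sS, GA x y = ∑ x ∈ sS, ∑ y ∈ sS, GB x y + (ze p q z i j A / (2 * q ^ 2)) * (∑ x ∈ sS, gw p q z i j A x) ^ 2 := by
      rw [sq (∑ x ∈ sS, _), Finset.sum_mul_sum, Finset.mul_sum, ← Finset.sum_add_distrib]
      refine Finset.sum_congr rfl fun x hx => ?_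
      rw [Finset.mul_sum, ← Finset.sum_add_distrib]
      exact Finset.sum_congr rfl fun y hy => a.GS hij hx hy
    rw [e1, e2]; ring
  rw [e]
  have t1 : ‖- (ze p q z i j A / (2 * q ^ 2)) * (∑ x ∈ sS, gw p q z i j A x) ^ 2‖ ≤ 8 * K * fF := by
    rw [norm_mul, norm_neg, norm_pow]
    have h1 : ‖∑ x ∈ sS, gw p q z i j A x‖ ^ 2 ≤ 2 * d * (2 * K * fF) := by
      calc _ ≤ (∑ x ∈ sS, ‖gw p q z i j A x‖) ^ 2 := by gcongr; exact norm_sum_le _ _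
        _ ≤ (sS).card * ∑ x ∈ sS, ‖gw p q z i j A x‖ ^ 2 := sq_sum_le_card_mul_sum_sq
        _ ≤ _ := mul_le_mul (a.S_card_le hij) (a.om.o3 i j hij) (Finset.sum_nonneg fun _ _ => by positivity) (by positivity)
    calc _ ≤ 1 / q ^ 2 * (2 * d * (2 * K * fF)) := mul_le_mul (a.zq i j) h1 (by positivity) (by positivity)
      _ = 4 * K * fF * (d / q ^ 2) := by ring
      _ ≤ 4 * K * fF * 2 := by gcongr; rw [div_le_iff₀ (by positivity)]; linarith
      _ = _ := by ring
  have t2 := a.diff_tr hij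
  have t2' : 2 * K * fF / q ^ 2 ≤ 2 * K * fF := by
    apply div_le_self (by positivity)
    have := a.Kd20
    have : (10:ℝ) ^ 6 ≤ K ^ 20 := hK.trans (le_self_pow₀ (by linarith) (by norm_num))
    linarith
  have t3 : ‖∑ x ∈ sS, GA x x‖ ≤ 12 * d := by
    calc _ ≤ ∑ x ∈ sS, (6 : ℝ) := norm_sum_le_of_le _ fun x _ => a.Gd x
      _ = (sS).card * 6 := by simp
      _ ≤ _ := by have := a.S_card_le hij; linarith
  refine (norm_sub_le _ _).trans ?_
  have := norm_sub_le (- (ze p q z i j A / (2 * q ^ 2)) * (∑ x ∈ sS, gw p q z i j A x) ^ 2) (∑ x ∈ sS, GB x x - ∑ x ∈ sS, GA x x)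
  linarith
lemma Ap.b1 : ‖Ms p q z i j A * wm / (2 * (q : ℂ) ^ 2) - Ms p q z i j A / (4 * (q : ℂ) ^ 4)‖ ≤ fF / q ^ 4 + 4 * K ^ 2 / d := by
  have hq := a.hq; have hK := a.K6; have hd := a.d1; have hF := F2_nn p q z i j A; have hlq := a.le_q
  have hqc : (q : ℂ) ≠ 0 := by exact_mod_cast hq.ne'
  obtain ⟨m2, -⟩ := a.m2 hij
  set m : ℝ := ((sS).card : ℝ)
  have e : Ms p q z i j A * wm / (2 * (q : ℂ) ^ 2) - Ms p q z i j A / (4 * (q : ℂ) ^ 4)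
      = Ms p q z i j A * (wm * ((2 * q ^ 2 - (m - 1) : ℝ) : ℂ)) / (4 * (q : ℂ) ^ 4) := by
    have h1 : wm * ((m - 1 : ℝ) : ℂ) = 1 := by
      rw [← Complex.ofReal_mul, one_div_mul_cancel (by linarith)]; simp
    rw [Complex.ofReal_sub (2 * q ^ 2), mul_sub, h1]; push_cast; field_simp; ring
  have s0 := Real.sqrt_nonneg fF
  have hm : |2 * q ^ 2 - (m - 1)| ≤ 3 * (K * √d) := by
    have h := a.S_card hij
    have := abs_le.mp (a.om.o1 i j hij); have := a.A01 i j
    have : 1 ≤ √(d : ℝ) := Real.one_le_sqrt.mpr hd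
    have : 10 ^ 6 ≤ K * √d := by nlinarith
    change m = _ at h
    rw [h, abs_le]; constructor <;> linarith
  have n4 : ‖(4 * (q : ℂ) ^ 4)‖ = 4 * q ^ 4 := by
    rw [norm_mul, norm_pow, Complex.norm_real, Real.norm_of_nonneg hq.le, Complex.norm_ofNat]
  rw [e, norm_div, norm_mul, norm_mul, n4, Complex.norm_real (2 * q ^ 2 - (m - 1)), Real.norm_eq_abs, div_le_iff₀ (by positivity)]
  have h2 := Ms_le (A := A) (p := p) (q := q) (z := z) i j
  have sF := Real.sq_sqrt hF
  have sd := Real.sq_sqrt (show 0 ≤ (d : ℝ) by linarith)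
  calc _ ≤ m * √fF * (‖wm‖ * (3 * (K * √d))) := by gcongr
    _ = (m * ‖wm‖) * (√fF * (3 * (K * √d))) := by ring
    _ ≤ 2 * (√fF * (3 * (K * √d))) := mul_le_mul_of_nonneg_right (a.mi hij) (by positivity)
    _ ≤ 4 * fF + 4 * (K ^ 2 * d) := by nlinarith [sq_nonneg (√fF - K * √d)]
    _ ≤ 4 * fF + 4 * (K ^ 2 * d) * (4 * q ^ 4 / d ^ 2) := by
      have : 1 ≤ 4 * q ^ 4 / (d : ℝ) ^ 2 := by rw [le_div_iff₀ (by positivity)]; have := a.le_q4; linarith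
      have : 0 ≤ 4 * (K ^ 2 * (d : ℝ)) := by positivity
      nlinarith
    _ = _ := by field_simp
lemma Ap.Tb : ‖Ms p q z i j A * wm / (2 * (q : ℂ) ^ 2) - (∑ x, ∑ y, ((Sp A i j x * Sp A i j y : ℝ) : ℂ) * GA x y) / (4 * (q : ℂ) ^ 4)‖
    ≤ 4 * K * (fF / q ^ 4) + 5 * K ^ 2 / d := by
  have hq := a.hq; have hK := a.K6; have hd := a.d1; have hF := F2_nn p q z i j A
  have h1 := a.b1 hij; have h2 := a.b23 hij; have h3 := a.b4 hij
  have n4 : ‖(4 * (q : ℂ) ^ 4)‖ = 4 * q ^ 4 := by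
    rw [norm_mul, norm_pow, Complex.norm_real, Real.norm_of_nonneg hq.le, Complex.norm_ofNat]
  have h4 := (norm_sub_le_norm_sub_add_norm_sub (Ms p q z i j A) (∑ x ∈ sS, ∑ y ∈ sS, GA x y) (∑ x, ∑ y, ((Sp A i j x * Sp A i j y : ℝ) : ℂ) * GA x y)).trans (add_le_add h2 h3)
  refine (norm_sub_le_norm_sub_add_norm_sub _ (Ms p q z i j A / (4 * (q : ℂ) ^ 4)) _).trans ((add_le_add_left h1 _).trans ?_)
  rw [← sub_div, norm_div, n4]
  have h5 : (10 * K * fF + 12 * d + 8 * d) / (4 * q ^ 4) ≤ 2.5 * K * (fF / q ^ 4) + 20 / d := by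
    have : 5 * d / q ^ 4 ≤ 20 / d := by rw [div_le_div_iff₀ (by positivity) (by linarith)]; have := a.le_q4; linarith
    calc _ = 2.5 * K * (fF / q ^ 4) + 5 * d / q ^ 4 := by field_simp; ring
      _ ≤ _ := by linarith
  have h6 : 20 / (d : ℝ) ≤ K ^ 2 / d := by gcongr; nlinarith
  have h7 : fF / q ^ 4 ≤ K * (fF / q ^ 4) := le_mul_of_one_le_left (by positivity) (by linarith)
  have h8 := div_le_div_of_nonneg_right h4 (show 0 ≤ 4 * q ^ 4 by positivity)
  have : 0 ≤ K * (fF / q ^ 4) := by positivity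
  have e5 : 5 * K ^ 2 / (d:ℝ) = 4 * K ^ 2 / d + K ^ 2 / d := by ring
  linarith
end
variable (a : Aq N d A p q z K k)
include a
lemma Aq.T1 : ‖fz z gA - z⁻¹ ^ 2 * av (fun i j => ZZ p q z i j A)‖ ≤ K ^ 4 * vA + √d / N := by
  have hq := a.hq; have hK := a.K6; have hd := a.d1; have hN := a.N4; have hdN := a.dN; have hV := a.V1; have hV0 := a.V0; have hz2 := a.hz2
  have hz0 := a.z0; have hlq := a.le_q
  have n4 : ‖(4 * (q : ℂ) ^ 4)‖ = 4 * q ^ 4 := by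
    rw [norm_mul, norm_pow, Complex.norm_real, Real.norm_of_nonneg hq.le, Complex.norm_ofNat]
  set Ta := av (fun i k => (∑ x ∈ SS i k (BB i k A), GG p q z (BB i k A) x x) / (2 * (q : ℂ) ^ 2)) - gA with hTa
  set Mw := fun i k => Ms p q z i k A * (((1 / ((Finset.card (SS i k (BB i k A)) : ℝ) - 1) : ℝ)) : ℂ) / (2 * (q : ℂ) ^ 2) with hMw
  set Sg := fun i k => ∑ x, ∑ y, ((Sp A i k x * Sp A i k y : ℝ) : ℂ) * GA x y with hSg
  have e : z ^ 2 * fz z gA = av (fun i j => ZZ p q z i j A) + (Ta - av Mw + ((d / (N - 1) / q : ℝ) : ℂ) + av (fun i k => ep p q z i k A ^ 2 * ze p q z i k A)) := by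
    have e1 : z ^ 2 * fz z gA = av (fun i k => ep p q z i k A + ep p q z i k A ^ 2 * ze p q z i k A) := by
      have h : z ^ 2 * fz z gA = (z + gA) * PP p q z A := by unfold fz PP; field_simp
      rw [h, a.P_eq, ← av_neg, ← av_smul_c]
      exact av_congr fun i j hij => by linear_combination (-ep p q z i j A) * a.ze_rel hij
    have e2 : av (fun i k => ((A i k / q : ℝ) : ℂ)) = ((d / (N - 1) / q : ℝ) : ℂ) := by
      have : av (fun i k => ((A i k / q : ℝ) : ℂ)) = ((av (fun i k => q⁻¹ * A i k) : ℝ) : ℂ) := by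
        simp only [av, Complex.real_smul, smul_eq_mul]; push_cast
        congr 1; exact Finset.sum_congr rfl fun _ _ => by rw [div_eq_inv_mul]
      rw [this, av_smul_r q⁻¹ (fun i k => A i k), a.av_A]; push_cast; ring
    have e3 : av (fun i k => ep p q z i k A) = av (fun i j => ZZ p q z i j A) + (Ta - av Mw + ((d / (N - 1) / q : ℝ) : ℂ)) := by
      rw [← e2, hTa]
      have : av (fun i k => ep p q z i k A) = av (fun i k => ZZ p q z i k A + ((∑ x ∈ SS i k (BB i k A), GG p q z (BB i k A) x x) / (2 * (q : ℂ) ^ 2) - Mw i k + ((A i k / q : ℝ) : ℂ)) - gA) :=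
        av_congr fun i j hij => by simp only [ep, a.Y_dec hij, hMw]; push_cast; ring
      rw [this, av_sub, av_add, av_add, av_sub, av_const a.hN]; ring
    rw [e1, av_add, e3]; ring
  have t1 : ‖Ta‖ ≤ (8000 * K + 13) * vA := a.Ta
  have t2 : ‖av Mw‖ ≤ 4 * K * (8000 * vA) + 5 * K ^ 2 * vA + (40 * K ^ 2 * vA + 4 * ‖z‖ / d) := by
    have h1 : ‖av Mw - av (fun i k => Sg i k / (4 * (q : ℂ) ^ 4))‖ ≤ 4 * K * (8000 * vA) + 5 * K ^ 2 * vA := by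
      rw [← av_sub]
      refine (av_norm a.hN _).trans ((av_mono a.hN fun i j hij => a.Tb hij).trans ?_)
      rw [av_add, av_smul_r, av_const a.hN]
      refine add_le_add (mul_le_mul_of_nonneg_left a.Fq_av (by positivity)) ?_
      rw [← mul_one_div]; gcongr
    have h2 : ‖av (fun i k => Sg i k / (4 * (q : ℂ) ^ 4))‖ ≤ 40 * K ^ 2 * vA + 4 * ‖z‖ / d := by
      have : av (fun i k => Sg i k / (4 * (q : ℂ) ^ 4)) = (4 * (q : ℂ) ^ 4)⁻¹ * av Sg := by
        rw [← av_smul_c]; exact av_congr fun i j _ => by ring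
      rw [this, norm_mul, norm_inv, n4, inv_mul_eq_div]
      have := a.P4; have := a.k1
      exact a.Tb5 (by linarith)
    have := norm_le_norm_sub_add (av Mw) (av (fun i k => Sg i k / (4 * (q : ℂ) ^ 4)))
    linarith
  have t3 : ‖((d / (N - 1) / q : ℝ) : ℂ)‖ ≤ 4 * (√d / N) := by
    have h1 : 0 < (N : ℝ) - 1 := by linarith
    rw [Complex.norm_real, Real.norm_of_nonneg (by positivity), div_div, ← mul_div_assoc, div_le_div_iff₀ (by positivity) (by linarith)]
    have sd := Real.mul_self_sqrt (show 0 ≤ (d : ℝ) by linarith)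
    have s0 : 0 < √(d : ℝ) := Real.sqrt_pos.mpr (by linarith)
    have h2 : √(d : ℝ) ≤ 2 * q := by
      rw [Real.sqrt_le_left (by positivity)]; linarith
    have h3 : (N : ℝ) ≤ 2 * (N - 1) := by linarith
    calc (d : ℝ) * N = √d * (√d * N) := by rw [← mul_assoc, sd]
      _ ≤ √d * ((2 * q) * (2 * (N - 1))) := by gcongr
      _ = _ := by ring
  have t4 : ‖av (fun i k => ep p q z i k A ^ 2 * ze p q z i k A)‖ ≤ 1.5 * (2 * K ^ 3 * vA) := by
    refine (av_norm a.hN _).trans (le_trans ?_ (mul_le_mul_of_nonneg_left a.stab.2.1 (by norm_num)))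
    rw [← av_smul_r]
    exact av_mono a.hN fun i j hij => by
      rw [norm_mul, norm_pow, mul_comm]
      exact mul_le_mul_of_nonneg_right (a.ze16 hij) (by positivity)
  have e5 : fz z gA - z⁻¹ ^ 2 * av (fun i j => ZZ p q z i j A) = z⁻¹ ^ 2 * (Ta - av Mw + ((d / (N - 1) / q : ℝ) : ℂ) + av (fun i k => ep p q z i k A ^ 2 * ze p q z i k A)) := by
    rw [show fz z gA = z⁻¹ ^ 2 * (z ^ 2 * fz z gA) by field_simp, e]; ring
  have h1 := (norm_add₃_le (a := Ta - av Mw) (b := ((d / (N - 1) / q : ℝ) : ℂ)) (c := av (fun i k => ep p q z i k A ^ 2 * ze p q z i k A)))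
  have h2 := norm_sub_le Ta (av Mw)
  have h3 : 4 * ‖z‖ / d ≤ 4 * ‖z‖ * vA := by rw [← mul_one_div]; gcongr
  have h4 : ‖Ta - av Mw + ((d / (N - 1) / q : ℝ) : ℂ) + av (fun i k => ep p q z i k A ^ 2 * ze p q z i k A)‖ ≤ ‖z‖ ^ 2 * (K ^ 4 * vA + √d / N) := by
    refine h1.trans ((add_le_add (add_le_add (h2.trans (add_le_add t1 (t2.trans (add_le_add_right (add_le_add_right h3 _) _)))) t3) t4).trans ?_)
    have k1 : 40013 * K + 45 * K ^ 2 + 3 * K ^ 3 + 2 ≤ K ^ 4 := by nlinarith [mul_nonneg (sub_nonneg.mpr hK) (sq_nonneg K), mul_nonneg (sub_nonneg.mpr hK) (pow_nonneg a.K0.le 3), sq_nonneg K]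
    have k2 := mul_le_mul_of_nonneg_right k1 hV0.le
    have k3 : 0 ≤ K ^ 4 * vA := by positivity
    have z4 : 4 ≤ ‖z‖ ^ 2 := by nlinarith
    have k4 : 4 * (√d / N) ≤ ‖z‖ ^ 2 * (√d / N) := by gcongr
    have k5 : ‖z‖ * vA * 4 ≤ 2 * vA * ‖z‖ ^ 2 := by
      have := mul_le_mul_of_nonneg_right hz2 (show 0 ≤ vA * ‖z‖ by positivity)
      linarith
    have k6 : 13 * vA ≤ K * vA := by nlinarith
    have k7 := mul_le_mul_of_nonneg_left k2 (show 0 ≤ ‖z‖ ^ 2 by positivity)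
    have k8 : 0 ≤ (40013 * K + 45 * K ^ 2 + 3 * K ^ 3) * vA := by positivity
    have k9 := mul_le_mul_of_nonneg_right (show 1 ≤ ‖z‖ ^ 2 by linarith) k8
    linarith
  rw [e5, norm_mul, norm_pow, norm_inv]
  calc _ ≤ ‖z‖⁻¹ ^ 2 * (‖z‖ ^ 2 * (K ^ 4 * vA + √d / N)) := by gcongr
    _ = _ := by have : ‖z‖ ≠ 0 := by linarith
                field_simp
variable (hz4 : ‖z ^ 2 - 4‖ ≤ 3 * k * ‖z‖ ^ 2) (hV : VV d p q z A ≤ √k / 8) (hη : 1 ≤ N * z.im * √k)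
include hz4 hV hη
lemma Aq.T2 {i j : Fin N} (hij : i ≠ j) : ‖fz z gA - fz z (g0 p q z (BB i j A))‖ ≤ 12 * √k * (vA + ‖ep p q z i j A‖ / (N * z.im)) := by
  have hh := a.h_le hij
  have he := a.ep1 hij; have hz := a.hz; have hN := a.N4
  have h1 : ‖ep p q z i j A‖ / (N * z.im) ≤ √k / 1000000 := by
    rw [div_le_iff₀ (by positivity)]; linarith
  have h2 := a.fz_le hz4 (gA - g0 p q z (BB i j A)) (by linarith [Real.sqrt_nonneg k])
  rw [sub_sub_cancel] at h2
  refine h2.trans ?_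
  calc _ ≤ 6 * √k * (2 * (vA + ‖ep p q z i j A‖ / (N * z.im))) := by gcongr
    _ = _ := by ring
lemma Aq.T3 : av (fun i j => ‖ZZ p q z i j A‖ * ‖fz z gA - fz z (g0 p q z (BB i j A))‖) ≤ √k * K ^ 4 * (vA * √vA + vA / (N * z.im)) := by
  have hq := a.hq; have hK := a.K6; have hV0 := a.V0; have hz := a.hz; have hN := a.N4
  have sV := Real.sq_sqrt hV0.le
  set s := fun i j => √(F2 p q z i j A) / q ^ 2 with hs
  have s2 : av (fun i j => s i j ^ 2) ≤ 8000 * vA := by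
    refine le_trans (le_of_eq (av_congr fun i j _ => ?_)) a.Fq_av
    rw [hs]; beta_reduce; rw [div_pow, Real.sq_sqrt (F2_nn p q z i j A)]; ring
  have m1 : av s ≤ 90 * √vA := by
    refine (abs_le_of_sq_le_sq' ((av_sq a.hN s).trans (s2.trans ?_)) (by positivity)).2
    rw [mul_pow, sV]; nlinarith
  have m2 : av (fun i j => s i j * ‖ep p q z i j A‖) ≤ K ^ 2 * vA := by
    refine (abs_le_of_sq_le_sq' ((av_cs a.hN s _).trans ((mul_le_mul s2 a.stab.2.1 (av_nonneg a.hN fun _ _ _ => by positivity) (by positivity)).trans ?_)) (by positivity)).2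
    have : 16000 * K ^ 3 ≤ K ^ 4 := by nlinarith [pow_nonneg a.K0.le 3]
    nlinarith [mul_le_mul_of_nonneg_right this (sq_nonneg vA)]
  have h : ∀ i j, i ≠ j → ‖ZZ p q z i j A‖ * ‖fz z gA - fz z (g0 p q z (BB i j A))‖
      ≤ 12 * √k * K * (vA * s i j + (N * z.im)⁻¹ * (s i j * ‖ep p q z i j A‖)) := fun i j hij => by
    calc _ ≤ (K * √(F2 p q z i j A) / q ^ 2) * (12 * √k * (vA + ‖ep p q z i j A‖ / (N * z.im))) :=
          mul_le_mul (a.ZZ_le hij) (a.T2 hz4 hV hη hij) (norm_nonneg _) (by have := a.K0; positivity)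
      _ = _ := by simp only [hs]; ring
  refine (av_mono a.hN h).trans ?_
  rw [av_smul_r, av_add, av_smul_r, av_smul_r]
  have hK0 := a.K0
  have c1 : 1080 * K ≤ K ^ 4 := by nlinarith [pow_nonneg hK0.le 2, mul_nonneg (sub_nonneg.mpr hK) (pow_nonneg hK0.le 3), mul_nonneg (sub_nonneg.mpr hK) (pow_nonneg hK0.le 2)]
  have c2 : 12 * K ^ 3 ≤ K ^ 4 := by nlinarith [pow_nonneg hK0.le 3]
  calc _ ≤ 12 * √k * K * (vA * (90 * √vA) + (N * z.im)⁻¹ * (K ^ 2 * vA)) := by gcongr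
    _ = √k * ((1080 * K) * (vA * √vA) + (12 * K ^ 3) * (vA / (N * z.im))) := by ring
    _ ≤ √k * (K ^ 4 * (vA * √vA) + K ^ 4 * (vA / (N * z.im))) := by gcongr
    _ = _ := by ring
end
end RR
namespace RR
variable {N : ℕ}
lemma pow_lip {a b : ℂ} {D M : ℝ} (ha : ‖a‖ ≤ M) (hb : ‖b‖ ≤ M) (h : ‖a - b‖ ≤ D) (n : ℕ) : ‖a ^ n - b ^ n‖ * M ≤ n * D * M ^ n := by
  have hM := (norm_nonneg a).trans ha
  have hD := (norm_nonneg _).trans h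
  induction n with
  | zero => simp
  | succ n ih =>
    have e : a ^ (n + 1) - b ^ (n + 1) = (a ^ n - b ^ n) * a + b ^ n * (a - b) := by ring
    have h1 : ‖a ^ (n + 1) - b ^ (n + 1)‖ ≤ ‖a ^ n - b ^ n‖ * M + M ^ n * D := by
      rw [e]; refine (norm_add_le _ _).trans ?_
      rw [norm_mul, norm_mul, norm_pow]; gcongr
    calc _ ≤ (‖a ^ n - b ^ n‖ * M + M ^ n * D) * M := by gcongr
      _ ≤ (n * D * M ^ n + M ^ n * D) * M := by gcongr
      _ = _ := by push_cast; ring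
/-- test function -/
def Qq (r : ℕ) (a : ℂ) : ℂ := a ^ r * (starRingEnd ℂ a) ^ (r + 1)
lemma Qq_norm (r : ℕ) (a : ℂ) : ‖Qq r a‖ = ‖a‖ ^ (2 * r + 1) := by
  rw [Qq, norm_mul, norm_pow, norm_pow, RCLike.norm_conj]; ring
lemma Qq_self (r : ℕ) (a : ℂ) : a * Qq r a = ((‖a‖ ^ (2 * (r + 1)) : ℝ) : ℂ) := by
  have : a * Qq r a = (a * starRingEnd ℂ a) ^ (r + 1) := by rw [Qq]; ring
  rw [this, Complex.mul_conj, Complex.normSq_eq_norm_sq]; push_cast; ring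
lemma Qq_lip (r : ℕ) {a b : ℂ} {M : ℝ} (ha : ‖a‖ ≤ M) (hb : ‖b‖ ≤ M) : ‖Qq r a - Qq r b‖ * M ≤ (2 * r + 1) * ‖a - b‖ * M ^ (2 * r + 1) := by
  have hM := (norm_nonneg a).trans ha
  have h1 := pow_lip ha hb le_rfl r
  have h2 := pow_lip (a := starRingEnd ℂ a) (b := starRingEnd ℂ b) (D := ‖a - b‖) (M := M) (by rwa [RCLike.norm_conj]) (by rwa [RCLike.norm_conj])
    (by rw [← map_sub, RCLike.norm_conj]) (r + 1)
  have e : Qq r a - Qq r b = (a ^ r - b ^ r) * starRingEnd ℂ a ^ (r + 1) + b ^ r * (starRingEnd ℂ a ^ (r + 1) - starRingEnd ℂ b ^ (r + 1)) := by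
    unfold Qq; ring
  have h3 : ‖Qq r a - Qq r b‖ ≤ ‖a ^ r - b ^ r‖ * M ^ (r + 1) + M ^ r * ‖starRingEnd ℂ a ^ (r + 1) - starRingEnd ℂ b ^ (r + 1)‖ := by
    rw [e]; refine (norm_add_le _ _).trans ?_
    rw [norm_mul, norm_mul, norm_pow b, norm_pow (starRingEnd ℂ a), RCLike.norm_conj]; gcongr
  calc _ ≤ _ * M := mul_le_mul_of_nonneg_right h3 hM
    _ = (‖a ^ r - b ^ r‖ * M) * M ^ (r + 1) + M ^ r * (‖starRingEnd ℂ a ^ (r + 1) - starRingEnd ℂ b ^ (r + 1)‖ * M) := by ring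
    _ ≤ (r * ‖a - b‖ * M ^ r) * M ^ (r + 1) + M ^ r * ((r + 1 : ℕ) * ‖a - b‖ * M ^ (r + 1)) := by gcongr
    _ = _ := by push_cast; ring
lemma young (r : ℕ) {x t : ℝ} (hx : 0 ≤ x) (ht : 0 < t) : (2 * r + 2) * t * (x + t) ^ (2 * r + 1) ≤
    x ^ (2 * (r + 1)) / 2 + (2 * r + 2) * (4 ^ (r + 2) * (r + 1) + 1) ^ (2 * r + 1) * t ^ (2 * (r + 1)) := by
  set l : ℝ := 4 ^ (r + 2) * (r + 1)
  have hl : 1 ≤ l := by have : (1:ℝ) ≤ 4 ^ (r + 2) := one_le_pow₀ (by norm_num); simp only [l]; nlinarith [(Nat.cast_nonneg r : (0:ℝ) ≤ r)]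
  rcases le_total (l * t) x with h | h
  · have h1 : x + t ≤ 2 * x := by nlinarith
    calc _ ≤ (2 * r + 2) * t * (2 * x) ^ (2 * r + 1) := by gcongr
      _ = (l * t) * x ^ (2 * r + 1) / 4 := by
        simp only [l]; rw [mul_pow, pow_succ (2:ℝ), pow_mul (2:ℝ), pow_add (4:ℝ)]; norm_num; ring
      _ ≤ x * x ^ (2 * r + 1) / 4 := by gcongr
      _ = x ^ (2 * (r + 1)) / 4 := by ring
      _ ≤ _ := by have : 0 ≤ x ^ (2 * (r + 1)) := by positivity
                  have : 0 ≤ (2 * r + 2) * (l + 1) ^ (2 * r + 1) * t ^ (2 * (r + 1)) := by positivity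
                  linarith
  · calc _ ≤ (2 * r + 2) * t * ((l + 1) * t) ^ (2 * r + 1) := by gcongr; linarith
      _ = (2 * r + 2) * (l + 1) ^ (2 * r + 1) * t ^ (2 * (r + 1)) := by rw [mul_pow]; ring
      _ ≤ _ := by have : 0 ≤ x ^ (2 * (r + 1)) := by positivity
                  linarith
open Classical in
lemma mom (r : ℕ) : ∃ C : ℝ, 0 < C ∧ ∀ {Ω : Type} (G : Finset Ω) (E : Ω → Prop) {N : ℕ} (f : Ω → ℂ) (Z f0 : Fin N → Fin N → Ω → ℂ) (t B s : ℝ),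
    4 ≤ N → 0 < t → 0 < s → 0 ≤ B → (∀ i k, i ≠ k → ∑ A ∈ G, Z i k A * Qq r (f0 i k A) = 0) →
    (∀ A ∈ G, E A → ‖f A - av fun i k => Z i k A‖ ≤ t ∧ (∀ i k, i ≠ k → ‖f A - f0 i k A‖ ≤ t) ∧ (av fun i k => ‖Z i k A‖ * ‖f A - f0 i k A‖) ≤ t ^ 2) →
    (∀ A ∈ G, ‖f A‖ ≤ B ∧ ∀ i k, i ≠ k → ‖f0 i k A‖ ≤ B ∧ ‖Z i k A‖ ≤ B) →
    (G.filter fun A => s < ‖f A‖).card * s ^ (2 * (r + 1)) ≤ C * t ^ (2 * (r + 1)) * G.card + 4 * B ^ (2 * (r + 1)) * (G.filter fun A => ¬ E A).card := by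
  refine ⟨2 * ((2 * r + 2) * (4 ^ (r + 2) * (r + 1) + 1) ^ (2 * r + 1)), by positivity, ?_⟩
  intro Ω G E N f Z f0 t B s hN ht hs hB hz hg hb
  set C : ℝ := (2 * r + 2) * (4 ^ (r + 2) * (r + 1) + 1) ^ (2 * r + 1)
  have hC : 0 ≤ C := by positivity
  set h : Ω → ℂ := fun A => f A * Qq r (f A) - av fun i k => Z i k A * Qq r (f0 i k A)
  have h0 : ∑ A ∈ G, (av fun i k => Z i k A * Qq r (f0 i k A)) = 0 := by
    simp only [av]
    rw [← Finset.smul_sum, Finset.sum_comm, Finset.sum_eq_zero, smul_zero]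
    intro e he
    exact hz _ _ (by simpa using he)
  have h1 : ∑ A ∈ G, ‖f A‖ ^ (2 * (r + 1)) ≤ ∑ A ∈ G, ‖h A‖ := by
    refine le_trans ?_ (norm_sum_le _ _)
    rw [Finset.sum_sub_distrib, h0, sub_zero, Finset.sum_congr rfl fun A _ => Qq_self r (f A), ← Complex.ofReal_sum, Complex.norm_real]
    exact le_abs_self _
  have h2 : ∀ A ∈ G, ‖h A‖ ≤ ‖f A‖ ^ (2 * (r + 1)) / 2 + C * t ^ (2 * (r + 1)) + if E A then 0 else 2 * B ^ (2 * (r + 1)) := by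
    intro A hA
    split_ifs with hE
    · obtain ⟨g1, g2, g3⟩ := hg A hA hE
      rw [add_zero]
      refine le_trans ?_ (young r (norm_nonneg (f A)) ht)
      set M := ‖f A‖ + t
      have hM : 0 < M := by positivity
      have ha : ‖f A‖ ≤ M := by simp only [M]; linarith
      have e : h A = (f A - av fun i k => Z i k A) * Qq r (f A) + av fun i k => Z i k A * (Qq r (f A) - Qq r (f0 i k A)) := by
        simp only [h, mul_sub]
        rw [av_sub, show (av fun i k => Z i k A * Qq r (f A)) = (av fun i k => Z i k A) * Qq r (f A) by
          rw [mul_comm, ← av_smul_c]; exact av_congr fun _ _ _ => mul_comm _ _]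
        ring
      have e2 : (av fun i k => ‖Z i k A‖ * ‖Qq r (f A) - Qq r (f0 i k A)‖) * M ≤ ((2 * r + 1) * t * M ^ (2 * r + 1)) * M := by
        rw [mul_comm, ← av_smul_r]
        calc _ ≤ av fun i k => ((2 * r + 1) * M ^ (2 * r + 1)) * (‖Z i k A‖ * ‖f A - f0 i k A‖) := by
              refine av_mono hN fun i k hik => ?_
              have := Qq_lip r ha (b := f0 i k A) (by
                have := norm_sub_norm_le (f0 i k A) (f A)
                rw [norm_sub_rev] at this
                have := g2 i k hik
                simp only [M]; linarith)
              nlinarith [mul_le_mul_of_nonneg_left this (norm_nonneg (Z i k A))]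
          _ = ((2 * r + 1) * M ^ (2 * r + 1)) * _ := av_smul_r _ _
          _ ≤ ((2 * r + 1) * M ^ (2 * r + 1)) * (t * M) := by
              gcongr; refine g3.trans ?_; rw [sq]; gcongr; simp only [M]; linarith [norm_nonneg (f A)]
          _ = _ := by ring
      have e3 := le_of_mul_le_mul_right e2 hM
      rw [e]
      refine (norm_add_le _ _).trans ?_
      have e4 := av_norm hN fun i k => Z i k A * (Qq r (f A) - Qq r (f0 i k A))
      simp only [norm_mul] at e4 ⊢
      rw [Qq_norm]
      have e5 : ‖f A - av fun i k => Z i k A‖ * ‖f A‖ ^ (2 * r + 1) ≤ t * M ^ (2 * r + 1) := by gcongr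
      linarith
    · obtain ⟨b1, b2⟩ := hb A hA
      have e1 : ‖f A * Qq r (f A)‖ ≤ B ^ (2 * (r + 1)) := by
        rw [norm_mul, Qq_norm, ← pow_succ']; exact pow_le_pow_left₀ (norm_nonneg _) b1 _
      have e2 : ‖av fun i k => Z i k A * Qq r (f0 i k A)‖ ≤ B ^ (2 * (r + 1)) := by
        refine (av_norm hN _).trans ?_
        rw [← av_const hN (B ^ (2 * (r + 1)))]
        refine av_mono hN fun i k hik => ?_
        rw [norm_mul, Qq_norm, show 2 * (r + 1) = (2 * r + 1) + 1 by ring, pow_succ' B]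
        have := b2 i k hik
        gcongr <;> tauto
      have := norm_sub_le (f A * Qq r (f A)) (av fun i k => Z i k A * Qq r (f0 i k A))
      have : 0 ≤ ‖f A‖ ^ (2 * (r + 1)) / 2 + C * t ^ (2 * (r + 1)) := by positivity
      simp only [h]; linarith
  have h3 := h1.trans (Finset.sum_le_sum h2)
  rw [Finset.sum_add_distrib, Finset.sum_add_distrib, ← Finset.sum_div, Finset.sum_const, Finset.sum_ite, Finset.sum_const_zero, Finset.sum_const, zero_add, nsmul_eq_mul, nsmul_eq_mul] at h3
  have h4 : (G.filter fun A => s < ‖f A‖).card * s ^ (2 * (r + 1)) ≤ ∑ A ∈ G, ‖f A‖ ^ (2 * (r + 1)) := by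
    rw [← nsmul_eq_mul, ← Finset.sum_const]
    refine (Finset.sum_le_sum fun A hA => ?_).trans (Finset.sum_le_sum_of_subset_of_nonneg (Finset.filter_subset _ _) fun _ _ _ => by positivity)
    have := (Finset.mem_filter.1 hA).2
    gcongr
  linarith
end RR
namespace RR
variable {N : ℕ}
/-- large deviation event -/
def Hw (i k : Fin N) (K : ℝ) (M : Matrix (Fin N) (Fin N) ℝ → Fin N → Fin N → ℂ) (A : Matrix (Fin N) (Fin N) ℝ) : Prop :=
  ‖Qc (SS i k (BB i k A)) (M (BB i k A)) (ww A i k)‖ ^ 2 ≤ K ^ 2 * Fs (SS i k (BB i k A)) (M (BB i k A))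
open Classical in
lemma hwU {κ : ℝ} (hκ : 0 < κ) (D : ℕ) : ∃ N0 : ℕ, ∀ N ≥ N0, ∀ d, ∀ M : Fin N → Fin N → Fin N → Matrix (Fin N) (Fin N) ℝ → Fin N → Fin N → ℂ,
    (∀ i k v B x, M i k v B x x = 0) → (((Gr N d).filter fun A => ¬ ∀ i k v, i ≠ k → Hw i k ((N : ℝ) ^ κ) (M i k v) A).card : ℝ) * (N : ℝ) ^ D ≤ (Gr N d).card := by
  obtain ⟨j, hj⟩ := exists_nat_gt ((D + 6) / κ)
  obtain ⟨C, hC, h⟩ := hw_complex j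
  obtain ⟨n, hn⟩ := exists_nat_gt C
  refine ⟨n + 2, fun N hN d M hM => ?_⟩
  have hN2 : (n : ℝ) + 2 ≤ N := by exact_mod_cast hN
  have hN1 : (1 : ℝ) ≤ N := by linarith [(Nat.cast_nonneg n : (0 : ℝ) ≤ n)]
  set K := (N : ℝ) ^ κ with hK
  have hK0 : 0 < K := by positivity
  have hKj : (N : ℝ) ^ (D + 6) ≤ K ^ (2 ^ (j + 1)) := by
    rw [hK, ← Real.rpow_natCast, ← Real.rpow_natCast, ← Real.rpow_mul (by positivity)]
    apply Real.rpow_le_rpow_of_exponent_le hN1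
    have h1 : (j : ℝ) ≤ (2 ^ (j + 1) : ℕ) := by
      exact_mod_cast (Nat.lt_two_pow_self (n := j)).le.trans (Nat.pow_le_pow_right (by norm_num) (by omega))
    rw [div_lt_iff₀ hκ] at hj
    push_cast at h1 ⊢
    nlinarith
  set c : ℝ := ((Gr N d).card : ℝ)
  have h1 : (((Gr N d).filter fun A => ¬ ∀ i k v, i ≠ k → Hw i k K (M i k v) A).card : ℝ) ≤
      ∑ i : Fin N, ∑ k : Fin N, ∑ v : Fin N, (((Gr N d).filter fun A => i ≠ k ∧ ¬ Hw i k K (M i k v) A).card : ℝ) := by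
    have : ((Gr N d).filter fun A => ¬ ∀ i k v, i ≠ k → Hw i k K (M i k v) A) ⊆
        Finset.univ.biUnion fun i : Fin N => Finset.univ.biUnion fun k : Fin N => Finset.univ.biUnion fun v : Fin N => (Gr N d).filter fun A => i ≠ k ∧ ¬ Hw i k K (M i k v) A := by
      intro A hA
      simp only [Finset.mem_filter, not_forall] at hA
      obtain ⟨hA, i, k, v, hik, hw⟩ := hA
      simp only [Finset.mem_biUnion, Finset.mem_univ, true_and, Finset.mem_filter]
      exact ⟨i, k, v, hA, hik, hw⟩
    have h2 := (Finset.card_le_card this).trans (Finset.card_biUnion_le.trans (Finset.sum_le_sum fun i _ => Finset.card_biUnion_le.trans (Finset.sum_le_sum fun k _ => Finset.card_biUnion_le)))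
    exact_mod_cast h2
  have h2 : ∀ i k v, (((Gr N d).filter fun A => i ≠ k ∧ ¬ Hw i k K (M i k v) A).card : ℝ) * (N : ℝ) ^ (D + 6) ≤ N * N ^ 2 * c := by
    intro i k v
    by_cases hik : i = k
    · simp [hik]; positivity
    · have h3 := h N d i k hik (M i k v) (hM i k v) K hK0
      have h4 : ((Gr N d).filter fun A => i ≠ k ∧ ¬ Hw i k K (M i k v) A) = ((Gr N d).filter fun A => K ^ 2 * Fs (SS i k (BB i k A)) (M i k v (BB i k A))
          < ‖Qc (SS i k (BB i k A)) (M i k v (BB i k A)) (ww A i k)‖ ^ 2) := by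
        apply Finset.filter_congr; intro A _; simp [hik, Hw]
      rw [h4]
      refine (mul_le_mul_of_nonneg_left hKj (by positivity)).trans (h3.trans ?_)
      have : (N : ℝ) + 1 ≤ N ^ 2 := by nlinarith [(Nat.cast_nonneg n : (0 : ℝ) ≤ n)]
      gcongr
      linarith
  have hp : (0 : ℝ) < (N : ℝ) ^ 6 := by positivity
  refine le_of_mul_le_mul_right ?_ hp
  calc _ = (((Gr N d).filter fun A => ¬ ∀ i k v, i ≠ k → Hw i k K (M i k v) A).card : ℝ) * (N : ℝ) ^ (D + 6) := by ring
    _ ≤ _ * (N : ℝ) ^ (D + 6) := mul_le_mul_of_nonneg_right h1 (by positivity)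
    _ ≤ ∑ i : Fin N, ∑ k : Fin N, ∑ v : Fin N, N * (N : ℝ) ^ 2 * c := by
      simp only [Finset.sum_mul]
      exact Finset.sum_le_sum fun i _ => Finset.sum_le_sum fun k _ => Finset.sum_le_sum fun v _ => h2 i k v
    _ = _ := by simp; ring
lemma Qc_off (S : Finset (Fin N)) (M : Fin N → Fin N → ℂ) {w : Fin N → ℝ} (hw : ∀ x ∈ S, w x = 1 ∨ w x = -1) :
    Qc S M w = Qc S (fun x y => if x = y then 0 else M x y) w + ∑ x ∈ S, M x x := by
  unfold Qc
  rw [← Finset.sum_add_distrib]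
  refine Finset.sum_congr rfl fun x hx => ?_
  have h : M x x = ∑ y ∈ S, if x = y then M x y else 0 := by rw [Finset.sum_ite_eq]; simp [hx]
  rw [h, ← Finset.sum_add_distrib]
  refine Finset.sum_congr rfl fun y _ => ?_
  by_cases e : x = y
  · subst e; rcases hw x hx with h | h <;> simp [h]
  · simp [e]
lemma Fs_off (S : Finset (Fin N)) (M : Fin N → Fin N → ℂ) : Fs S (fun x y => if x = y then 0 else M x y) ≤ Fs S M := by
  unfold Fs
  refine Finset.sum_le_sum fun x _ => Finset.sum_le_sum fun y _ => ?_
  beta_reduce; split_ifs <;> simp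
section
variable {d : ℕ} {A : Matrix (Fin N) (Fin N) ℝ} {p q : ℝ} {z : ℂ} (c : Ctx N d A p q z) {K : ℝ} (hK : 10 ^ 6 ≤ K) {i k : Fin N} (hik : i ≠ k)
local notation "sS" => SS i k (BB i k A)
include c hK hik
lemma Ctx.o2 (h : Hw i k K (Mo p q z) A) : ‖cc (ww A i k) ⬝ᵥ gw p q z i k A - ∑ x ∈ sS, GG p q z (BB i k A) x x‖ ≤ K * √(F2 p q z i k A) := by
  rw [c.Qc_eq hik]
  have h1 := h.trans (mul_le_mul_of_nonneg_left (Fs_off _ _) (sq_nonneg K))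
  apply abs_le_of_sq_le_sq' _ (by positivity) |>.2
  rw [mul_pow, Real.sq_sqrt (F2_nn ..)]; exact h1
lemma hw_sq (h : Hw i k K (fun B x y => if x = y then 0 else ∑ v ∈ SS i k B, GG p q z B v x * starRingEnd ℂ (GG p q z B v y)) A) :
    ∑ x ∈ sS, ‖gw p q z i k A x‖ ^ 2 ≤ 2 * K * F2 p q z i k A := by
  set G := GG p q z (BB i k A)
  have hF := F2_nn p q z i k A
  have hgw : ∀ v, gw p q z i k A v = ∑ x ∈ sS, G v x * ww A i k x := fun v => by
    simp only [gw, mulVec, dotProduct, cc]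
    exact (Finset.sum_subset (Finset.subset_univ sS) fun x _ hx => by simp [ww_nS c.adj hik hx]).symm
  have e1 : ((∑ v ∈ sS, ‖gw p q z i k A v‖ ^ 2 : ℝ) : ℂ) = Qc sS (fun x y => ∑ v ∈ sS, G v x * starRingEnd ℂ (G v y)) (ww A i k) := by
    push_cast
    simp only [Qc, Finset.sum_mul]
    rw [Finset.sum_congr rfl fun x _ => Finset.sum_comm, Finset.sum_comm]
    refine Finset.sum_congr rfl fun v _ => ?_
    rw [← Complex.mul_conj', hgw, map_sum, Finset.sum_mul_sum]
    refine Finset.sum_congr rfl fun x _ => Finset.sum_congr rfl fun y _ => ?_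
    simp; ring
  rw [Qc_off _ _ fun x hx => ww_S c.adj hik hx] at e1
  have e2 : ∑ x ∈ sS, ∑ v ∈ sS, G v x * starRingEnd ℂ (G v x) = ((F2 p q z i k A : ℝ) : ℂ) := by
    simp only [F2, Fs]; push_cast; rw [Finset.sum_comm]; simp only [Complex.mul_conj', G]
  have e3 : Fs sS (fun x y => ∑ v ∈ sS, G v x * starRingEnd ℂ (G v y)) ≤ F2 p q z i k A ^ 2 := by
    have : F2 p q z i k A = ∑ x ∈ sS, ∑ v ∈ sS, ‖G v x‖ ^ 2 := by simp only [F2, Fs]; rw [Finset.sum_comm]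
    rw [this, sq, Finset.sum_mul_sum]
    refine Finset.sum_le_sum fun x _ => Finset.sum_le_sum fun y _ => ?_
    refine le_trans ?_ (Finset.sum_mul_sq_le_sq_mul_sq sS (fun v => ‖G v x‖) (fun v => ‖G v y‖))
    gcongr
    refine (norm_sum_le _ _).trans (le_of_eq (Finset.sum_congr rfl fun v _ => ?_))
    rw [norm_mul, RCLike.norm_conj]
  have h1 := h.trans (mul_le_mul_of_nonneg_left ((Fs_off _ _).trans e3) (sq_nonneg K))
  rw [← mul_pow] at h1
  have h2 := (abs_le_of_sq_le_sq' h1 (by positivity)).2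
  rw [e2] at e1
  have h3 := congrArg norm e1
  rw [Complex.norm_real, Real.norm_of_nonneg (by positivity)] at h3
  rw [h3]
  refine (norm_add_le _ _).trans ?_
  rw [Complex.norm_real, Real.norm_of_nonneg hF]
  nlinarith
lemma Ctx.o1a {v : Fin N} (h1 : v ≠ i) (h2 : v ≠ k) (h : Hw i k K (fun B x y => if x = y then 0 else ((B x v * B y v : ℝ) : ℂ)) A) :
    |X2 d A i v - X2 d A k v| ≤ K * √d / 2 := by
  have hd := c.d1
  have e0 : ∀ x ∈ sS, BB i k A x v = A x v := fun x hx => by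
    obtain ⟨a, b, -⟩ := (mem_SS c.adj).1 hx
    simp [BB, uu_ne a b, uu_ne h1 h2]
  have e1 : X2 d A i v - X2 d A k v = ∑ x ∈ sS, ww A i k x * A x v - A i k * (A i v - A k v) := by
    rw [Finset.sum_subset (Finset.subset_univ sS) fun x _ hx => by simp [ww_nS c.adj hik hx]]
    have : ∑ x, uu i k x * A x v = A i v - A k v := by simp [uu, sub_mul]
    rw [← this]
    have e : ∀ j, X2 d A j v = ∑ x, A x j * A x v - d ^ 2 / N := fun j => by simp only [X2, c.As j, c.As v]
    simp only [e, ww, add_mul, sub_mul, Finset.sum_add_distrib, Finset.sum_sub_distrib, mul_assoc, ← Finset.mul_sum]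
    ring
  have e2 : (((∑ x ∈ sS, ww A i k x * A x v) ^ 2 : ℝ) : ℂ) = Qc sS (fun x y => ((BB i k A x v * BB i k A y v : ℝ) : ℂ)) (ww A i k) := by
    rw [sq, Finset.sum_mul_sum]; simp only [Qc]; push_cast
    refine Finset.sum_congr rfl fun x hx => Finset.sum_congr rfl fun y hy => ?_
    rw [e0 x hx, e0 y hy]; ring
  have e3 : ∑ x ∈ sS, BB i k A x v ^ 2 ≤ d := by
    rw [← c.Acol v]
    refine (Finset.sum_le_sum fun x hx => ?_).trans (Finset.sum_le_sum_of_subset_of_nonneg (Finset.subset_univ sS) fun x _ _ => (c.A01 x v).1)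
    rw [e0 x hx, c.Asq]
  have e4 : Fs sS (fun x y => ((BB i k A x v * BB i k A y v : ℝ) : ℂ)) ≤ (d : ℝ) ^ 2 := by
    have : Fs sS (fun x y => ((BB i k A x v * BB i k A y v : ℝ) : ℂ)) = (∑ x ∈ sS, BB i k A x v ^ 2) ^ 2 := by
      rw [sq, Finset.sum_mul_sum]; simp only [Fs, Complex.norm_real, Real.norm_eq_abs, sq_abs, mul_pow]
    rw [this]; gcongr
  rw [Qc_off _ _ fun x hx => ww_S c.adj hik hx] at e2
  have h3 := h.trans (mul_le_mul_of_nonneg_left ((Fs_off _ _).trans e4) (sq_nonneg K))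
  rw [← mul_pow] at h3
  have h4 := (abs_le_of_sq_le_sq' h3 (by positivity)).2
  have h5 := congrArg norm e2
  rw [Complex.norm_real, Real.norm_of_nonneg (by positivity)] at h5
  have h6 := h5.le.trans (norm_add_le _ _)
  rw [← Complex.ofReal_sum, Complex.norm_real, Real.norm_of_nonneg (by simp only [← sq]; positivity)] at h6
  simp only [← sq] at h6
  have h7 : (∑ x ∈ sS, ww A i k x * A x v) ^ 2 ≤ (K * √d / 4) ^ 2 := by
    rw [div_pow, mul_pow, Real.sq_sqrt (by linarith)]; nlinarith
  have h8 := abs_le_of_sq_le_sq h7 (by positivity)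
  have h9 : |A i k * (A i v - A k v)| ≤ 1 := by
    have := c.A01 i k; have := c.A01 i v; have := c.A01 k v
    rw [abs_le]; constructor <;> nlinarith
  have h10 : 1 ≤ √(d : ℝ) := Real.one_le_sqrt.2 hd
  rw [e1]
  refine (abs_sub _ _).trans ?_
  nlinarith
end
lemma Ctx.o1 {d : ℕ} {A : Matrix (Fin N) (Fin N) ℝ} {p q : ℝ} {z : ℂ} (c : Ctx N d A p q z) {K : ℝ} (hK : 10 ^ 6 ≤ K)
    (h : ∀ i k v, i ≠ k → Hw i k K (fun B x y => if x = y then 0 else ((B x v * B y v : ℝ) : ℂ)) A) {i v : Fin N} (hiv : i ≠ v) : |X2 d A i v| ≤ K * √d := by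
  have hd := c.d1; have hN := c.N4
  have h10 : 1 ≤ √(d : ℝ) := Real.one_le_sqrt.2 hd
  have s0 : ∑ k, X2 d A k v = 0 := by
    simp only [X2, Finset.sum_sub_distrib]
    rw [Finset.sum_comm]
    simp only [← Finset.sum_mul, c.Acol, ← Finset.mul_sum, c.adj.2.2.2]
    simp; field_simp; ring
  have s1 : ∑ k ∈ Finset.univ.erase v, (X2 d A i v - X2 d A k v) = (N - 1) * X2 d A i v + q ^ 2 := by
    rw [Finset.sum_sub_distrib, Finset.sum_const, Finset.card_erase_of_mem (Finset.mem_univ v), Finset.card_univ, Fintype.card_fin, nsmul_eq_mul,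
      Nat.cast_sub (by have := c.hN; omega), Finset.sum_erase_eq_sub (Finset.mem_univ v), s0, c.X2_diag]
    push_cast; ring
  have s2 : |∑ k ∈ Finset.univ.erase v, (X2 d A i v - X2 d A k v)| ≤ (N - 1) * (K * √d / 2) := by
    refine (Finset.abs_sum_le_sum_abs _ _).trans ?_
    have : ((N : ℝ) - 1) * (K * √d / 2) = ∑ k ∈ Finset.univ.erase v, K * √d / 2 := by
      rw [Finset.sum_const, Finset.card_erase_of_mem (Finset.mem_univ v), Finset.card_univ, Fintype.card_fin, nsmul_eq_mul, Nat.cast_sub (by have := c.hN; omega)]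
      push_cast; ring
    rw [this]
    refine Finset.sum_le_sum fun k hk => ?_
    by_cases e : i = k
    · subst e; simp; positivity
    · exact c.o1a hK e hiv.symm (Finset.ne_of_mem_erase hk).symm (h i k v e)
  rw [s1] at s2
  have := c.q_le; have := c.dN
  have s3 := abs_le.1 s2
  rw [abs_le]; constructor <;> by_contra hh <;> push Not at hh <;> nlinarith [sq_nonneg q, mul_le_mul hK h10 (by norm_num) (by linarith)]
open Classical in
lemma Om_sm {κ : ℝ} (hκ : 0 < κ) (D : ℕ) : ∃ N0 : ℕ, ∀ N ≥ N0, ∀ d (p q : ℝ) (z : ℂ), (∀ A ∈ Gr N d, Ctx N d A p q z) →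
    (((Gr N d).filter fun A => ¬ Om N d A p q z ((N : ℝ) ^ κ)).card : ℝ) * (N : ℝ) ^ D ≤ (Gr N d).card := by
  obtain ⟨n1, h1⟩ := hwU hκ (D + 1)
  have : ∀ᶠ n : ℕ in atTop, (10 : ℝ) ^ 6 ≤ (n : ℝ) ^ κ := ((tendsto_rpow_atTop hκ).comp tendsto_natCast_atTop_atTop).eventually_ge_atTop _
  obtain ⟨n2, h2⟩ := eventually_atTop.1 this
  refine ⟨n1 + n2 + 3, fun N hN d p q z hc => ?_⟩
  have hK := h2 N (by omega)
  have hN3 : (3 : ℝ) ≤ N := by exact_mod_cast (by omega : 3 ≤ N)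
  have key : ∀ M : Fin N → Fin N → Fin N → Matrix (Fin N) (Fin N) ℝ → Fin N → Fin N → ℂ, (∀ i k v B x, M i k v B x x = 0) → ∃ E : Matrix (Fin N) (Fin N) ℝ → Prop,
      (∀ A, E A → ∀ i k v, i ≠ k → Hw i k ((N : ℝ) ^ κ) (M i k v) A) ∧ (((Gr N d).filter fun A => ¬ E A).card : ℝ) * (N : ℝ) ^ (D + 1) ≤ (Gr N d).card :=
    fun M hM => ⟨_, fun A h => h, by convert h1 N (by omega) d M hM⟩
  obtain ⟨E1, e1, a1⟩ := key (fun _ _ v B x y => if x = y then 0 else ((B x v * B y v : ℝ) : ℂ)) (by simp)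
  obtain ⟨E2, e2, a2⟩ := key (fun _ _ _ => Mo p q z) (by simp [Mo])
  obtain ⟨E3, e3, a3⟩ := key (fun i k _ B x y => if x = y then 0 else ∑ v ∈ SS i k B, GG p q z B v x * starRingEnd ℂ (GG p q z B v y)) (by simp)
  have hs : ((Gr N d).filter fun A => ¬ Om N d A p q z ((N : ℝ) ^ κ)) ⊆ ((Gr N d).filter fun A => ¬ E1 A) ∪ (((Gr N d).filter fun A => ¬ E2 A) ∪ ((Gr N d).filter fun A => ¬ E3 A)) := by
    intro A hA
    simp only [Finset.mem_union, Finset.mem_filter] at hA ⊢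
    obtain ⟨hA, hn⟩ := hA
    by_contra hh
    have c := hc A hA
    have t1 := e1 A (by tauto); have t2 := e2 A (by tauto); have t3 := e3 A (by tauto)
    exact hn ⟨fun x y hxy => c.o1 hK t1 hxy, fun i k hik => c.o2 hK hik (t2 i k i hik), fun i k hik => hw_sq c hK hik (t3 i k i hik)⟩
  have hcard := (Finset.card_le_card hs).trans ((Finset.card_union_le _ _).trans (Nat.add_le_add_left (Finset.card_union_le _ _) _))
  have hcard : (((Gr N d).filter fun A => ¬ Om N d A p q z ((N : ℝ) ^ κ)).card : ℝ) ≤ ((Gr N d).filter fun A => ¬ E1 A).card + (((Gr N d).filter fun A => ¬ E2 A).card + ((Gr N d).filter fun A => ¬ E3 A).card) := by exact_mod_cast hcard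
  refine le_of_mul_le_mul_right ?_ (by linarith : (0:ℝ) < N)
  rw [mul_assoc, ← pow_succ]
  have hc0 : (0 : ℝ) ≤ (Gr N d).card := by positivity
  have := mul_le_mul_of_nonneg_right hcard (by positivity : (0:ℝ) ≤ (N : ℝ) ^ (D + 1))
  nlinarith
end RR
namespace RR
variable {N : ℕ}
/-- bounds at `z` -/
structure Cb (A : Matrix (Fin N) (Fin N) ℝ) (p q : ℝ) (z : ℂ) (a b c e : ℝ) : Prop where
  ze : ∀ i k, ‖ze p q z i k A‖ ≤ a
  g : ‖gg p q z A‖ ≤ b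
  P : ‖PP p q z A‖ ≤ c
  W : WW p q z A ≤ e
lemma ns_u {i k : Fin N} (h : i ≠ k) : ns (cc (uu i k)) = 2 := by
  have : ns (cc (uu i k)) = ∑ x, uu i k x ^ 2 := by simp [ns, cc]
  rw [this]
  have e : ∀ x, uu i k x ^ 2 = (if x = i then 1 else 0) + (if x = k then 1 else 0) := fun x => by
    by_cases h1 : x = i
    · subst h1; simp [uu, h]
    · by_cases h2 : x = k
      · subst h2; simp [uu, h1]
      · simp [uu, h1, h2]
  simp [e, Finset.sum_add_distrib]; norm_num
lemma ns_single (x : Fin N) : ns (Pi.single x (1 : ℂ)) = 1 := by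
  simp [ns, Pi.single_apply, apply_ite norm, ite_pow]
lemma single_dot (M : Matrix (Fin N) (Fin N) ℂ) (x : Fin N) : Pi.single x (1:ℂ) ⬝ᵥ (M *ᵥ Pi.single x 1) = M x x := by simp
section
variable {d : ℕ} {A : Matrix (Fin N) (Fin N) ℝ} {p q : ℝ} {z z' : ℂ} (c : Ctx N d A p q z)
include c
lemma Ctx.ze_le (i k : Fin N) : ‖ze p q z i k A‖ ≤ 1 / z.im := by
  have := c.hz
  by_cases h : i = k
  · rw [h, c.ze_diag]; simp; positivity
  · have := R_quad c.sH c.hz (cc (uu i k))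
    rw [ns_u h] at this
    rw [ze, norm_div, GG, Complex.norm_ofNat, div_le_iff₀ (by norm_num)]
    refine this.trans (le_of_eq ?_); ring
lemma Ctx.g_le : ‖gg p q z A‖ ≤ 1 / z.im := by
  rw [← c.av_ze]
  refine (av_norm c.hN _).trans ?_
  rw [← av_const c.hN (1 / z.im)]
  exact av_mono c.hN fun i k _ => c.ze_le i k
lemma Ctx.top : Cb A p q z (1 / z.im) (1 / z.im) (5 / z.im + 4 / z.im ^ 2) (4 / z.im ^ 2) := by
  have hz := c.hz
  have hg := c.g_le
  refine ⟨c.ze_le, hg, ?_, ?_⟩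
  · have h1 : 1 + z * gg p q z A = av fun i k => 1 + z * ze p q z i k A := by
      rw [av_add, av_const c.hN, av_smul_c, c.av_ze]
    have h2 : ‖1 + z * gg p q z A‖ ≤ 5 / z.im + 3 / z.im ^ 2 := by
      rw [h1]
      refine (av_norm c.hN _).trans ?_
      rw [← av_const c.hN (5 / z.im + 3 / z.im ^ 2)]
      refine av_mono c.hN fun i k hik => ?_
      have e := schur_z c.adj.1 c.adj.2.1 hik c.hq.ne' c.hz (p := p)
      have e1 : 1 + z * ze p q z i k A = - ze p q z i k A * (YY p q z i k A + A i k / q) := by linear_combination -e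
      have hd := c.d1; have hq := c.le_q; have hq0 := c.hq
      have e2 : ‖YY p q z i k A‖ ≤ 2 / z.im := by
        have := R_quad (HH_symm p q (BB_symm i k c.adj.1)) c.hz (cc (ww A i k))
        have e3 : ns (cc (ww A i k)) ≤ 2 * d := by
          refine le_trans (le_of_eq ?_) (c.S_card_le hik)
          simp only [ns, cc, Complex.norm_real, Real.norm_eq_abs, sq_abs]
          rw [← Finset.sum_subset (Finset.subset_univ (SS i k (BB i k A))) fun x _ hx => by simp [ww_nS c.adj hik hx]]
          rw [Finset.card_eq_sum_ones]; push_cast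
          exact Finset.sum_congr rfl fun x hx => by rcases ww_S c.adj hik hx with h | h <;> simp [h]
        rw [YY, norm_div, gw, GG, div_le_iff₀ (by simp; positivity)]
        refine this.trans ?_
        simp only [norm_mul, norm_pow, Complex.norm_real, Real.norm_eq_abs, sq_abs, Complex.norm_ofNat]
        rw [div_mul_eq_mul_div]; gcongr; nlinarith
      have e4 : ‖(A i k : ℂ) / q‖ ≤ 2 := by
        rw [← Complex.ofReal_div, Complex.norm_real, Real.norm_eq_abs, abs_of_nonneg (div_nonneg (c.A01 i k).1 hq0.le), div_le_iff₀ hq0]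
        have := (c.A01 i k).2; nlinarith
      rw [e1, norm_mul, norm_neg]
      calc _ ≤ 1 / z.im * (2 / z.im + 2) := by
            gcongr
            · exact c.ze_le i k
            · exact (norm_add_le _ _).trans (add_le_add e2 e4)
        _ = 2 / z.im + 2 / z.im ^ 2 := by field_simp; ring
        _ ≤ _ := by gcongr <;> norm_num
    have h3 : ‖gg p q z A ^ 2‖ ≤ 1 / z.im ^ 2 := by rw [norm_pow]; calc _ ≤ (1 / z.im) ^ 2 := by gcongr
                                                                        _ = _ := by ring
    refine (norm_add_le _ _).trans ((add_le_add h2 h3).trans (le_of_eq ?_)); ring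
  · have hN := c.N4
    rw [WW, div_le_iff₀ (by linarith)]
    calc _ ≤ ∑ x : Fin N, 4 / z.im ^ 2 := Finset.sum_le_sum fun x _ => by
          have h1 : ‖DD p q z A x‖ ≤ 2 / z.im := (norm_sub_le _ _).trans ((add_le_add (R_entry c.sH c.hz x x) hg).trans (le_of_eq (by ring)))
          calc _ ≤ (2 / z.im) ^ 2 := by gcongr
            _ = _ := by ring
      _ = _ := by simp; ring
lemma Ctx.lip (c' : Ctx N d A p q z') {e a b cc' w : ℝ} (he : ‖z' - z‖ / (z'.im * z.im) ≤ e) (e1 : e ≤ 1) (hb : b ≤ 1) (hw : w ≤ 1) (h : Cb A p q z a b cc' w) :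
    Cb A p q z' (a + e) (b + e) (cc' + (‖z'‖ + 3) * e + ‖z' - z‖) (w + 8 * e) := by
  have hz := c.hz; have hz' := c'.hz
  have e0 : 0 ≤ e := le_trans (by positivity) he
  have l1 : ∀ i k, ‖RR.ze p q z' i k A - RR.ze p q z i k A‖ ≤ e := fun i k => by
    by_cases hh : i = k
    · rw [hh, c.ze_diag, c'.ze_diag]; simpa
    · have := R_lip c'.sH c'.hz c.hz (cc (uu i k))
      rw [ns_u hh] at this
      rw [RR.ze, RR.ze, ← sub_div, norm_div, GG, GG, Complex.norm_ofNat, div_le_iff₀ (by norm_num)]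
      exact this.trans (by gcongr)
  have l2 : ‖gg p q z' A - gg p q z A‖ ≤ e := by
    rw [← c.av_ze, ← c'.av_ze, ← av_sub]
    refine (av_norm c.hN _).trans ?_
    rw [← av_const c.hN e]
    exact av_mono c.hN fun i k _ => l1 i k
  have g2 : ‖gg p q z' A‖ ≤ b + e := by
    have := norm_sub_norm_le (gg p q z' A) (gg p q z A); have := h.g; linarith
  refine ⟨fun i k => ?_, g2, ?_, ?_⟩
  · have := norm_sub_norm_le (RR.ze p q z' i k A) (RR.ze p q z i k A); have := h.ze i k; have := l1 i k; linarith
  · have : PP p q z' A = PP p q z A + z' * (gg p q z' A - gg p q z A) + (z' - z) * gg p q z A + (gg p q z' A - gg p q z A) * (gg p q z' A + gg p q z A) := by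
      unfold PP; ring
    rw [this]
    have hg := h.g
    have t1 : ‖z' * (gg p q z' A - gg p q z A)‖ ≤ ‖z'‖ * e := by rw [norm_mul]; gcongr
    have t2 : ‖(z' - z) * gg p q z A‖ ≤ ‖z' - z‖ * 1 := by rw [norm_mul]; gcongr; linarith
    have t3 : ‖(gg p q z' A - gg p q z A) * (gg p q z' A + gg p q z A)‖ ≤ e * 3 := by
      rw [norm_mul]; gcongr; refine (norm_add_le _ _).trans ?_; linarith
    have := h.P
    linarith [norm_add_le (PP p q z A + z' * (gg p q z' A - gg p q z A) + (z' - z) * gg p q z A) ((gg p q z' A - gg p q z A) * (gg p q z' A + gg p q z A)),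
      norm_add_le (PP p q z A + z' * (gg p q z' A - gg p q z A)) ((z' - z) * gg p q z A), norm_add_le (PP p q z A) (z' * (gg p q z' A - gg p q z A))]
  · have hN := c.N4
    have l3 : ∀ x, ‖DD p q z' A x‖ ^ 2 ≤ (1 + 2 * e) * ‖DD p q z A x‖ ^ 2 + (2 * e + 4 * e ^ 2) := fun x => by
      have t := R_lip c'.sH c'.hz c.hz (Pi.single x 1)
      rw [ns_single, single_dot, single_dot, mul_one] at t
      have t1 : ‖DD p q z' A x - DD p q z A x‖ ≤ 2 * e := by
        have e3 : DD p q z' A x - DD p q z A x = (GG p q z' A x x - GG p q z A x x) - (gg p q z' A - gg p q z A) := by unfold DD; ring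
        rw [e3]
        refine (norm_sub_le _ _).trans ?_
        have := t.trans he
        simp only [GG] at this ⊢
        linarith
      have t2 : ‖DD p q z' A x‖ ≤ ‖DD p q z A x‖ + 2 * e := by linarith [norm_sub_norm_le (DD p q z' A x) (DD p q z A x)]
      have t3 := pow_le_pow_left₀ (norm_nonneg _) t2 2
      nlinarith [mul_nonneg e0 (sq_nonneg (‖DD p q z A x‖ - 1))]
    have l4 : WW p q z' A ≤ (1 + 2 * e) * WW p q z A + (2 * e + 4 * e ^ 2) := by
      rw [WW, WW, div_le_iff₀ (by linarith), add_mul, mul_assoc, div_mul_cancel₀ _ (by linarith : (N:ℝ) ≠ 0)]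
      refine (Finset.sum_le_sum fun x _ => l3 x).trans (le_of_eq ?_)
      rw [Finset.sum_add_distrib, ← Finset.mul_sum]; simp; ring
    have := h.W
    nlinarith
end
/-- parameters -/
structure Par (N d : ℕ) (K L : ℝ) : Prop where
  K6 : 10 ^ 6 ≤ K
  KL : K ^ 100 ≤ L
  LN : L ^ 12 = N
  dL : K ^ 60 * L ^ 8 ≤ d
  h2d : 2 * d ≤ N
end RR
namespace RR
variable {N : ℕ}
open Classical in
/-- number of bad graphs -/
def bd (N d : ℕ) (E : Matrix (Fin N) (Fin N) ℝ → Prop) : ℝ := ((Gr N d).filter fun A => ¬ E A).card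
lemma bd_mono {d : ℕ} {E F : Matrix (Fin N) (Fin N) ℝ → Prop} (h : ∀ A ∈ Gr N d, E A → F A) : bd N d F ≤ bd N d E := by
  unfold bd
  exact_mod_cast Finset.card_le_card fun A hA => by
    simp only [Finset.mem_filter] at hA ⊢
    exact ⟨hA.1, fun he => hA.2 (h A hA.1 he)⟩
lemma bd_and {d : ℕ} {E F : Matrix (Fin N) (Fin N) ℝ → Prop} : bd N d (fun A => E A ∧ F A) ≤ bd N d E + bd N d F := by
  classical
  unfold bd
  have : ((Gr N d).filter fun A => ¬ (E A ∧ F A)) ⊆ ((Gr N d).filter fun A => ¬ E A) ∪ ((Gr N d).filter fun A => ¬ F A) := fun A hA => by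
    simp only [Finset.mem_filter, Finset.mem_union] at hA ⊢; tauto
  rw [← Nat.cast_add, Nat.cast_le]
  refine le_trans (le_of_eq ?_) ((Finset.card_le_card this).trans (Finset.card_union_le _ _))
  congr!
lemma bd_all {d : ℕ} (n : ℕ) {E : ℕ → Matrix (Fin N) (Fin N) ℝ → Prop} {b : ℝ} (h : ∀ j < n, bd N d (E j) ≤ b) :
    bd N d (fun A => ∀ j < n, E j A) ≤ n * b := by
  induction n with
  | zero => simp [bd]
  | succ n ih =>
    have h1 := ih fun j hj => h j (by omega)
    have h2 := h n (by omega)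
    have h3 := bd_and (d := d) (E := fun A => ∀ j < n, E j A) (F := E n)
    have h4 : bd N d (fun A => ∀ j < n + 1, E j A) ≤ bd N d (fun A => (∀ j < n, E j A) ∧ E n A) := bd_mono fun A _ hA j hj => by
      rcases Nat.lt_succ_iff_lt_or_eq.mp hj with h | rfl
      · exact hA.1 j h
      · exact hA.2
    push_cast; linarith
lemma bd_nn {d : ℕ} {E : Matrix (Fin N) (Fin N) ℝ → Prop} : 0 ≤ bd N d E := by unfold bd; positivity
/-- data -/
structure Dt where
  (x p q k K L : ℝ)
/-- standing assumptions on the data -/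
structure T (κ : ℝ) (N d : ℕ) (s : Dt) : Prop where
  K6 : 10 ^ 6 ≤ s.K
  hK : s.K = (N : ℝ) ^ κ
  KL : s.K ^ 100 ≤ s.L
  LN : s.L ^ 12 = N
  dL : s.K ^ 60 * s.L ^ 8 ≤ d
  h2d : 2 * d ≤ N
  hp : s.p = d / N
  hq : 0 < s.q
  hq2 : s.q ^ 2 = d * (1 - s.p)
  hx : 2 + s.p / 8 ≤ |s.x|
  hxN : |s.x| ≤ N
  hk : s.k = min (|s.x| - 2) 1
/-- family of events -/
abbrev Ev := ∀ N : ℕ, ℕ → Dt → Matrix (Fin N) (Fin N) ℝ → Prop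
/-- holds with overwhelming probability -/
def Sm (κ : ℝ) (E : Ev) : Prop := ∀ D : ℕ, ∃ N0 : ℕ, ∀ N ≥ N0, ∀ d s, T κ N d s → bd N d (E N d s) * (N : ℝ) ^ D ≤ (Gr N d).card
lemma Sm.and {κ : ℝ} {E F : Ev} (hE : Sm κ E) (hF : Sm κ F) : Sm κ (fun N d s A => E N d s A ∧ F N d s A) := fun D => by
  obtain ⟨n, hn⟩ := hE (D + 1)
  obtain ⟨m, hm⟩ := hF (D + 1)
  refine ⟨n + m + 2, fun N hN d s h => ?_⟩
  have h1 := hn N (by omega) d s h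
  have h2 := hm N (by omega) d s h
  have h3 := bd_and (d := d) (E := E N d s) (F := F N d s)
  have h4 : (2 : ℝ) ≤ N := by exact_mod_cast (by omega : 2 ≤ N)
  rw [pow_succ, ← mul_assoc] at h1 h2
  have h5 := mul_le_mul_of_nonneg_right h3 (by positivity : (0:ℝ) ≤ (N : ℝ) ^ D)
  have h6 : 0 ≤ bd N d (E N d s) * (N : ℝ) ^ D := mul_nonneg bd_nn (by positivity)
  have h7 : 0 ≤ bd N d (F N d s) * (N : ℝ) ^ D := mul_nonneg bd_nn (by positivity)
  nlinarith
lemma Sm.mono {κ : ℝ} {E F : Ev} (hE : Sm κ E) (h : ∀ N d s A, T κ N d s → IsAdjMat N d A → E N d s A → F N d s A) : Sm κ F := fun D => by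
  obtain ⟨n, hn⟩ := hE D
  refine ⟨n, fun N hN d s hs => le_trans ?_ (hn N hN d s hs)⟩
  gcongr
  exact bd_mono fun A hA => h N d s A hs (mem_Gr.1 hA)
/-- path -/
def pth (N : ℕ) (a b : ℝ) (j : ℕ) : ℝ := b - (b - a) * (j / (N : ℝ) ^ 6)
lemma pth_ge {a b : ℝ} (hab : a ≤ b) {j : ℕ} (hj : j < N ^ 6 + 1) : a ≤ pth N a b j ∧ pth N a b j ≤ b := by
  have h : (j : ℝ) / (N : ℝ) ^ 6 ≤ 1 := div_le_one_of_le₀ (by exact_mod_cast Nat.lt_succ_iff.1 hj) (by positivity)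
  have h0 : 0 ≤ (j : ℝ) / (N : ℝ) ^ 6 := by positivity
  unfold pth; constructor <;> nlinarith
section
variable {κ : ℝ} {d : ℕ} {s : Dt} (h : T κ N d s)
include h
lemma T.LK : (10:ℝ) ^ 600 ≤ s.L := le_trans (by
  have := pow_le_pow_left₀ (by norm_num) h.K6 100
  rw [← pow_mul] at this; exact this) h.KL
lemma T.L6 : (10:ℝ) ^ 6 ≤ s.L := le_trans (by gcongr <;> norm_num) h.LK
lemma T.NL : s.L ^ 12 = N := h.LN
lemma T.N6 : (10:ℝ) ^ 6 ≤ N := by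
  have := h.L6; rw [← h.LN]; calc _ ≤ s.L := this
    _ ≤ _ := le_self_pow₀ (by linarith) (by norm_num)
lemma T.N4 : 4 ≤ N := by have := h.N6; have : (4:ℝ) ≤ N := by linarith
                         exact_mod_cast this
lemma T.d1 : (1:ℝ) ≤ d := by
  have := h.K6; have := h.L6
  refine le_trans (one_le_mul_of_one_le_of_one_le (one_le_pow₀ (by linarith)) (one_le_pow₀ (by linarith))) h.dL
lemma T.x2 : 2 ≤ |s.x| := by
  have := h.hx; have h1 := h.hp; have : 0 ≤ s.p := by rw [h1]; positivity
  linarith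
lemma T.ctx {A : Matrix (Fin N) (Fin N) ℝ} (hA : IsAdjMat N d A) {η : ℝ} (hη : 0 < η) : Ctx N d A s.p s.q ⟨s.x, η⟩ :=
  ⟨hA, h.N4, by exact_mod_cast h.d1, h.h2d, h.hp, h.hq, h.hq2, hη, h.x2.trans (Complex.abs_re_le_norm ⟨s.x, η⟩)⟩
/-- `k` is not small -/
lemma T.kp : s.p / 8 ≤ s.k := by
  have := h.hx; have h1 := h.hp; have h2 := h.h2d; have h3 := h.N6
  have : s.p ≤ 1 := by rw [h1]; refine div_le_one_of_le₀ ?_ (by positivity); exact_mod_cast (by omega)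
  rw [h.hk]; apply le_min <;> linarith
lemma T.k1 : s.k ≤ 1 := by rw [h.hk]; exact min_le_right _ _
lemma T.kx : 2 + s.k ≤ |s.x| := by rw [h.hk]; linarith [min_le_left (|s.x| - 2) 1]
lemma T.kz (η : ℝ) : 2 + s.k ≤ ‖(⟨s.x, η⟩ : ℂ)‖ := h.kx.trans (Complex.abs_re_le_norm ⟨s.x, η⟩)
/-- lower bound on `√k` -/
lemma T.sk : s.K ^ 29 ≤ √s.k * s.L ^ 2 := by
  have h1 := h.kp; have h2 := h.dL; have h3 := h.hp; have hL := h.L6; have hK := h.K6; have hN := h.LN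
  have e : s.K ^ 60 ≤ s.p * s.L ^ 4 := by
    rw [h3, ← hN, div_mul_eq_mul_div, le_div_iff₀ (by positivity)]
    calc _ = s.K ^ 60 * s.L ^ 8 * s.L ^ 4 := by ring
      _ ≤ _ := by gcongr
  have k0 : 0 ≤ s.k := by
    have : 0 ≤ s.p := by rw [h3]; positivity
    linarith
  refine (abs_le_of_sq_le_sq' ?_ (by positivity)).2
  rw [mul_pow, Real.sq_sqrt k0, ← pow_mul, ← pow_mul]
  have : s.K ^ 60 = s.K ^ 58 * s.K ^ 2 := by ring
  have : 8 ≤ s.K ^ 2 := by nlinarith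
  have : 0 ≤ s.K ^ 58 := by positivity
  have : s.p * s.L ^ 4 / 8 ≤ s.k * s.L ^ 4 := by nlinarith [(by positivity : 0 ≤ s.L ^ 4)]
  norm_num; nlinarith
lemma T.k0 : 0 < s.k := by
  have := h.sk; have hK := h.K6; have : 0 < s.K ^ 29 := by positivity
  by_contra h0
  rw [Real.sqrt_eq_zero_of_nonpos (not_lt.1 h0)] at *; linarith
/-- second lower bound -/
lemma T.dk : √d / N * s.L ^ 6 ≤ 3 * √s.k := by
  have h1 := h.kp; have h3 := h.hp; have hL := h.L6; have hN := h.LN; have k0 := h.k0; have hN6 := h.N6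
  refine (abs_le_of_sq_le_sq' ?_ (by positivity)).2
  rw [mul_pow, mul_pow, div_pow, Real.sq_sqrt k0.le, Real.sq_sqrt (by positivity), ← pow_mul]
  norm_num; rw [hN]
  have : (d:ℝ) / N ^ 2 * N = s.p := by rw [h3]; field_simp
  rw [this]; linarith
lemma T.aq {A : Matrix (Fin N) (Fin N) ℝ} (hA : IsAdjMat N d A) {η : ℝ} (hη : 1 ≤ η * s.L ^ 7) (om : Om N d A s.p s.q ⟨s.x, η⟩ s.K)
    (hc : Cb A s.p s.q ⟨s.x, η⟩ 2 1 (s.k / 4) (1 / s.L ^ 5)) : Aq N d A s.p s.q ⟨s.x, η⟩ s.K s.k := by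
  have hL := h.L6; have hK := h.K6; have hN := h.LN; have dL := h.dL; have kl := h.KL
  have η0 : 0 < η := (pos_iff_pos_of_mul_pos (lt_of_lt_of_le one_pos hη)).2 (by positivity)
  have w := hc.W
  refine { toCtx := h.ctx hA η0, om := om, ze2 := hc.ze, g1 := hc.g, K6 := hK, Kη20 := ?_, KN := ?_, k0 := h.k0, k1 := h.k1, kz := h.kz η, P4 := hc.P, NW := ?_ }
  · show _ ≤ d * η
    calc s.K ^ 20 ≤ s.K ^ 60 := by gcongr <;> [linarith; norm_num]
      _ ≤ s.K ^ 60 * s.L * (η * s.L ^ 7) := by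
        rw [mul_assoc]; refine le_mul_of_one_le_right (by positivity) (one_le_mul_of_one_le_of_one_le (by linarith) hη)
      _ = s.K ^ 60 * s.L ^ 8 * η := by ring
      _ ≤ _ := by gcongr
  · have : s.K ^ 30 * s.L ^ 4 ≤ √d := by
      refine Real.le_sqrt_of_sq_le (le_trans (le_of_eq (by ring)) dL)
    calc _ = s.K ^ 10 * s.L ^ 12 := by rw [hN]; ring
      _ ≤ s.K ^ 90 * s.L ^ 12 := by gcongr <;> [linarith; norm_num]
      _ = s.K ^ 60 * s.L ^ 8 * (s.K ^ 30 * s.L ^ 4) := by ring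
      _ ≤ _ := by gcongr
  · calc _ ≤ s.L ^ 12 * (1 / s.L ^ 5) * s.K ^ 20 := by rw [hN]; gcongr
      _ = s.L ^ 7 * s.K ^ 20 := by field_simp
      _ ≤ s.L ^ 8 * s.K ^ 60 := by gcongr <;> linarith
      _ ≤ _ := by linarith
omit h in
lemma T.step {A : Matrix (Fin N) (Fin N) ℝ} {η : ℝ} (a : Aq N d A s.p s.q ⟨s.x, η⟩ s.K s.k)
    (hV1 : s.K ^ 4 * VV d s.p s.q ⟨s.x, η⟩ A ≤ s.k ^ 2 / 64) (hV2 : s.K ^ 4 * VV d s.p s.q ⟨s.x, η⟩ A ≤ 1 / s.L ^ 5 / 2) :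
    Cb A s.p s.q ⟨s.x, η⟩ 1.5 (1 - s.k / 2) (s.k / 8) (1 / s.L ^ 5 / 2) := by
  have k0 := a.k0; have k1 := a.k1
  obtain ⟨w, -, P⟩ := a.stab
  refine ⟨fun i k => ?_, ?_, ?_, w.trans hV2⟩
  · by_cases hik : i = k
    · rw [hik, a.ze_diag]; norm_num
    · exact a.ze16 hik
  · have : s.k ≤ √s.k := Real.le_sqrt_of_sq_le (by nlinarith)
    linarith [a.g_le]
  · exact (abs_le_of_sq_le_sq' (by nlinarith) (by positivity)).2
lemma T.kN : 1000 ≤ s.k * N := by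
  have hL := h.L6; have hK := h.K6; have hN := h.LN; have k0 := h.k0
  have h1 := h.sk
  have h2 : √s.k * s.L ^ 2 ≤ s.k * N := by
    have : s.K ^ 29 ≥ 1 := one_le_pow₀ (by linarith)
    calc _ ≤ (√s.k * s.L ^ 2) * (√s.k * s.L ^ 2) := le_mul_of_one_le_left (by positivity) (by linarith)
      _ = s.k * s.L ^ 4 := by rw [← Real.sq_sqrt k0.le, Real.sqrt_sq (by positivity)]; ring
      _ ≤ _ := by rw [← hN]; gcongr <;> [linarith; norm_num]
  have : s.K ≤ s.K ^ 29 := le_self_pow₀ (by linarith) (by norm_num)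
  linarith
lemma T.L5 : 1000 * s.L ^ 5 ≤ N := by
  have hL := h.L6; have hK := h.K6; have hN := h.LN; have k0 := h.k0
  rw [← hN]
  calc _ ≤ s.L * s.L ^ 5 := by gcongr; linarith
    _ = s.L ^ 6 := by ring
    _ ≤ _ := by gcongr <;> [linarith; norm_num]
lemma T.path {A : Matrix (Fin N) (Fin N) ℝ} (hA : IsAdjMat N d A) {a b : ℝ} (ha : 1 ≤ a * s.L ^ 7) (hab : a ≤ b) (hb : b ≤ N)
    (om : ∀ j < N ^ 6 + 1, Om N d A s.p s.q ⟨s.x, pth N a b j⟩ s.K)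
    (h0 : Cb A s.p s.q ⟨s.x, b⟩ 1.5 (1 - s.k / 2) (s.k / 8) (1 / s.L ^ 5 / 2))
    (hV : ∀ η, a ≤ η → η ≤ b → Aq N d A s.p s.q ⟨s.x, η⟩ s.K s.k → s.K ^ 4 * VV d s.p s.q ⟨s.x, η⟩ A ≤ s.k ^ 2 / 64 ∧ s.K ^ 4 * VV d s.p s.q ⟨s.x, η⟩ A ≤ 1 / s.L ^ 5 / 2) :
    Aq N d A s.p s.q ⟨s.x, a⟩ s.K s.k := by
  have hL := h.L6; have hK := h.K6; have hN := h.LN; have N6 := h.N6; have k0 := h.k0; have k1 := h.k1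
  have a0 : 0 < a := (pos_iff_pos_of_mul_pos (lt_of_lt_of_le one_pos ha)).2 (by positivity)
  have pos : ∀ j < N ^ 6 + 1, 0 < pth N a b j := fun j hj => a0.trans_le (pth_ge hab hj).1
  have aN : 1 ≤ a * N := by
    rw [← hN]; refine ha.trans ?_; gcongr <;> [linarith; norm_num]
  have kN := h.kN; have LN := h.L5
  have n0 : (0:ℝ) < N := by linarith
  set e : ℝ := 1 / (N : ℝ) ^ 3 with he
  have l1 : ∀ j < N ^ 6, Cb A s.p s.q ⟨s.x, pth N a b j⟩ 1.5 (1 - s.k / 2) (s.k / 8) (1 / s.L ^ 5 / 2) →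
      Cb A s.p s.q ⟨s.x, pth N a b (j + 1)⟩ 2 1 (s.k / 4) (1 / s.L ^ 5) := fun j hj hc => by
    have c := h.ctx hA (pos j (by omega)); have c' := h.ctx hA (pos (j + 1) (by omega))
    have hd : ‖(⟨s.x, pth N a b (j + 1)⟩ : ℂ) - ⟨s.x, pth N a b j⟩‖ ≤ 1 / (N : ℝ) ^ 5 := by
      have : (⟨s.x, pth N a b (j + 1)⟩ : ℂ) - ⟨s.x, pth N a b j⟩ = ((-(b - a) / (N : ℝ) ^ 6 : ℝ) : ℂ) * Complex.I := by
        apply Complex.ext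
        · rw [Complex.re_ofReal_mul]; simp
        · rw [Complex.im_ofReal_mul]; simp [pth]; ring
      rw [this, norm_mul, Complex.norm_I, Complex.norm_real, mul_one, Real.norm_eq_abs, neg_div, abs_neg, abs_of_nonneg (div_nonneg (by linarith) (by positivity)), div_le_div_iff₀ (by positivity) (by positivity)]
      calc _ ≤ (N:ℝ) * N ^ 5 := by gcongr; linarith
        _ = _ := by ring
    have hee : ‖(⟨s.x, pth N a b (j + 1)⟩ : ℂ) - ⟨s.x, pth N a b j⟩‖ / (pth N a b (j + 1) * pth N a b j) ≤ e := by
      have h1 := (pth_ge hab (show j < N ^ 6 + 1 by omega)).1; have h2 := (pth_ge hab (show j + 1 < N ^ 6 + 1 by omega)).1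
      have h3 : 1 ≤ pth N a b (j + 1) * pth N a b j * N ^ 2 := by
        calc 1 ≤ (a * N) * (a * N) := one_le_mul_of_one_le_of_one_le aN aN
          _ = a * a * N ^ 2 := by ring
          _ ≤ _ := by gcongr; linarith
      rw [div_le_iff₀ (mul_pos (pos _ (by omega)) (pos _ (by omega)))]
      refine hd.trans ?_
      rw [he, div_le_iff₀ (by positivity)]
      calc 1 ≤ _ := h3
        _ = _ := by field_simp
    have e1 : e ≤ 1 / (N : ℝ) ^ 2 / 10 ^ 6:= by rw [he, div_div]; gcongr; nlinarith [sq_nonneg (N : ℝ)]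
    have e2 : 1 / (N : ℝ) ^ 2 ≤ 1 / N := by gcongr; nlinarith
    have e3 : 1 / (N : ℝ) ≤ s.k / 1000 := by rw [div_le_div_iff₀ n0 (by norm_num)]; linarith
    have e4 : 1 / (N : ℝ) ≤ 1 / s.L ^ 5 / 1000 := by rw [div_div]; gcongr; linarith
    have e5 : ‖(⟨s.x, pth N a b (j + 1)⟩ : ℂ)‖ ≤ 2 * N := by
      refine (Complex.norm_le_abs_re_add_abs_im _).trans ?_
      have := (pth_ge hab (show j + 1 < N ^ 6 + 1 by omega)).2; have := h.hxN
      simp only [abs_of_pos (pos (j + 1) (by omega))]; linarith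
    have e6 : (‖(⟨s.x, pth N a b (j + 1)⟩ : ℂ)‖ + 3) * e ≤ 1 / N := by
      have e0 : 0 ≤ e := by positivity
      calc _ ≤ (3 * N) * e := by gcongr; linarith
        _ ≤ 3 * N * (1 / (N : ℝ) ^ 2 / 10 ^ 6) := by gcongr
        _ = 1 / N * (3 / 10 ^ 6) := by field_simp
        _ ≤ 1 / N * 1 := by gcongr; norm_num
        _ = _ := by ring
    have e7 : 1 / (N : ℝ) ^ 5 ≤ 1 / N := by gcongr; exact le_self_pow₀ (by linarith) (by norm_num)
    have l5 : 1 / s.L ^ 5 ≤ 1 := div_le_one_of_le₀ (one_le_pow₀ (by linarith)) (by positivity)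
    have := c.lip c' hee (by linarith) (by linarith) (by linarith) hc
    have n1 : 0 < 1 / (N:ℝ) := by positivity
    exact ⟨fun i k => (this.ze i k).trans (by linarith), this.g.trans (by linarith), this.P.trans (by linarith), this.W.trans (by linarith)⟩
  have l2 : ∀ j < N ^ 6 + 1, Cb A s.p s.q ⟨s.x, pth N a b j⟩ 2 1 (s.k / 4) (1 / s.L ^ 5) := fun j => by
    induction j with
    | zero => intro _; simp only [pth, Nat.cast_zero, zero_div, mul_zero, sub_zero]; 
              have : 0 < 1 / s.L ^ 5 := by positivity
              exact ⟨fun i k => (h0.ze i k).trans (by norm_num), h0.g.trans (by linarith), h0.P.trans (by linarith), h0.W.trans (by linarith)⟩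
    | succ j ih =>
      intro hj
      have hj' := pth_ge hab (show j < N ^ 6 + 1 by omega)
      have aq := h.aq hA (ha.trans (by gcongr; exact hj'.1)) (om j (by omega)) (ih (by omega))
      obtain ⟨v1, v2⟩ := hV _ hj'.1 hj'.2 aq
      exact l1 j (by omega) (T.step aq v1 v2)
  have e : pth N a b (N ^ 6) = a := by
    unfold pth; push_cast; rw [div_self (by positivity)]; ring
  have h3 := l2 (N ^ 6) (by omega); have h4 := om (N ^ 6) (by omega)
  rw [e] at h3 h4
  exact h.aq hA ha h4 h3
end
end RR
namespace RR
variable {N : ℕ}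
lemma Om_path {κ : ℝ} (hκ : 0 < κ) (a b : ℕ → Dt → ℝ) (hab : ∀ N d s, T κ N d s → 0 < a N s ∧ a N s ≤ b N s) :
    Sm κ (fun N d s A => ∀ j < N ^ 6 + 1, Om N d A s.p s.q ⟨s.x, pth N (a N s) (b N s) j⟩ s.K) := fun D => by
  obtain ⟨n, hn⟩ := Om_sm hκ (D + 7)
  refine ⟨n + 2, fun N hN d s h => ?_⟩
  have N2 : (2:ℝ) ≤ N := by exact_mod_cast (by omega : 2 ≤ N)
  obtain ⟨a0, hab⟩ := hab N d s h
  have h1 : bd N d (fun A => ∀ j < N ^ 6 + 1, Om N d A s.p s.q ⟨s.x, pth N (a N s) (b N s) j⟩ s.K) ≤ ((N ^ 6 + 1 : ℕ) : ℝ) * ((Gr N d).card / (N : ℝ) ^ (D + 7)) :=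
    bd_all _ fun j hj => by
      rw [le_div_iff₀ (by positivity), h.hK, bd]
      convert hn N (by omega) d s.p s.q ⟨s.x, pth N (a N s) (b N s) j⟩ fun A hA => h.ctx (mem_Gr.1 hA) (a0.trans_le (pth_ge hab hj).1)
  calc _ ≤ ((N ^ 6 + 1 : ℕ) : ℝ) * ((Gr N d).card / (N : ℝ) ^ (D + 7)) * (N : ℝ) ^ D := by gcongr
    _ = (Gr N d).card * (((N : ℝ) ^ 6 + 1) / N ^ 7) := by push_cast; rw [pow_add]; field_simp
    _ ≤ (Gr N d).card * 1 := by
      gcongr; refine div_le_one_of_le₀ ?_ (by positivity)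
      nlinarith [one_le_pow₀ (by linarith : (1:ℝ) ≤ N) (n := 6)]
    _ = _ := mul_one _
lemma fz_crude {z u : ℂ} {n : ℝ} (hn : 10 ^ 6 ≤ n) (hz2 : 2 ≤ ‖z‖) (hz : ‖z‖ ≤ n ^ 2) (hu : ‖u‖ ≤ n ^ 3) : ‖fz z u‖ ≤ n ^ 10 := by
  have h1 : ‖z + u‖ ≤ 2 * n ^ 3 := by
    have : n ^ 2 ≤ n ^ 3 := by gcongr <;> [linarith; norm_num]
    linarith [norm_add_le z u]
  have h2 : ‖1 + z * u + u ^ 2‖ ≤ 3 * n ^ 6 := by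
    have e1 : ‖z * u‖ ≤ n ^ 2 * n ^ 3 := by rw [norm_mul]; gcongr
    have e2 : ‖u ^ 2‖ ≤ (n ^ 3) ^ 2 := by rw [norm_pow]; gcongr
    have e3 : n ^ 5 ≤ n ^ 6 := by gcongr <;> [linarith; norm_num]
    have e4 : 1 ≤ n ^ 6 := one_le_pow₀ (by linarith)
    have := norm_add_le (1 + z * u) (u ^ 2); have := norm_add_le 1 (z * u)
    rw [norm_one] at this
    linarith [(by ring : n ^ 2 * n ^ 3 = n ^ 5), (by ring : (n ^ 3) ^ 2 = n ^ 6)]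
  rw [fz, norm_div, norm_mul, norm_pow, div_le_iff₀ (by positivity)]
  calc _ ≤ 2 * n ^ 3 * (3 * n ^ 6) := by gcongr
    _ = 6 * n ^ 9 := by ring
    _ ≤ n * n ^ 9 := by gcongr; linarith
    _ = n ^ 10 * 1 := by ring
    _ ≤ _ := by gcongr; nlinarith
section
variable {d : ℕ} {A : Matrix (Fin N) (Fin N) ℝ} {p q : ℝ} {z : ℂ} (c : Ctx N d A p q z)
include c
lemma Ctx.g0_crude (i k : Fin N) (hN : 10 ^ 6 ≤ (N:ℝ)) (hη : 1 ≤ z.im * N) : ‖g0 p q z (BB i k A)‖ ≤ (N:ℝ) ^ 3 := by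
  have hz := c.hz
  have h1 : ‖(GG p q z (BB i k A)).trace‖ ≤ (N:ℝ) ^ 2 := by
    refine (norm_sum_le _ _).trans ?_
    calc _ ≤ ∑ x : Fin N, (N:ℝ) := Finset.sum_le_sum fun x _ => (R_entry (HH_symm p q (BB_symm i k c.adj.1)) c.hz x x).trans (by
          rw [div_le_iff₀ hz]; linarith)
      _ = _ := by simp; ring
  have h2 := c.zi
  have h3 : ‖(N : ℂ) - 1‖ = N - 1 := by
    rw [← Complex.ofReal_natCast, ← Complex.ofReal_one, ← Complex.ofReal_sub, Complex.norm_real, Real.norm_of_nonneg (by linarith)]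
  rw [g0, norm_div, h3, div_le_iff₀ (by linarith)]
  have h4 : ‖2 * z⁻¹‖ ≤ 1 := by rw [norm_mul, Complex.norm_ofNat]; linarith
  have := norm_add_le (GG p q z (BB i k A)).trace (2 * z⁻¹)
  have : 1 ≤ (N:ℝ) ^ 2 := one_le_pow₀ (by linarith)
  have : 2 * (N:ℝ) ^ 2 ≤ N ^ 3 := by nlinarith
  nlinarith
lemma Ctx.ZZ_crude {i k : Fin N} (hik : i ≠ k) (hN : 10 ^ 6 ≤ (N:ℝ)) (hη : 1 ≤ z.im * N) : ‖ZZ p q z i k A‖ ≤ (N:ℝ) ^ 10 := by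
  have hz := c.hz
  set S := SS i k (BB i k A)
  have hm : ∀ x y, ‖Mo p q z (BB i k A) x y‖ ≤ N := fun x y => by
    unfold Mo; split
    · simp
    · exact (R_entry (HH_symm p q (BB_symm i k c.adj.1)) c.hz x y).trans (by rw [div_le_iff₀ hz]; linarith)
  have hS : (S.card : ℝ) ≤ N := by
    have := Finset.card_le_univ S; rw [Fintype.card_fin] at this; exact_mod_cast this
  have ds : ∀ f : Fin N → Fin N → ℂ, (∀ x ∈ S, ∀ y ∈ S, ‖f x y‖ ≤ N) → ‖∑ x ∈ S, ∑ y ∈ S, f x y‖ ≤ (N:ℝ) ^ 3 := fun f hf => by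
    refine (norm_sum_le _ _).trans ?_
    calc _ ≤ ∑ x ∈ S, ∑ y ∈ S, (N:ℝ) := Finset.sum_le_sum fun x hx => (norm_sum_le _ _).trans (Finset.sum_le_sum fun y hy => hf x hx y hy)
      _ = S.card * (S.card * N) := by simp
      _ ≤ (N:ℝ) * (N * N) := by gcongr
      _ = _ := by ring
  have h1 : ‖Qc S (Mo p q z (BB i k A)) (ww A i k)‖ ≤ (N:ℝ) ^ 3 := ds _ fun x hx y hy => by
    rw [norm_mul, Complex.norm_real]
    have : ‖ww A i k x * ww A i k y‖ = 1 := by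
      rcases ww_S c.adj hik hx with h | h <;> rcases ww_S c.adj hik hy with h' | h' <;> rw [h, h'] <;> norm_num
    rw [this, mul_one]; exact hm x y
  have h2 : ‖Ms p q z i k A‖ ≤ (N:ℝ) ^ 3 := ds _ fun x _ y _ => hm x y
  have h3 : ‖((1 / ((S.card : ℝ) - 1) : ℝ) : ℂ)‖ ≤ 1 := by
    rw [Complex.norm_real, Real.norm_eq_abs, abs_div, abs_one]
    rcases Nat.lt_or_ge S.card 2 with hs | hs
    · interval_cases S.card <;> norm_num
    · have : (2:ℝ) ≤ S.card := by exact_mod_cast hs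
      exact div_le_one_of_le₀ (by rw [abs_of_pos (by linarith)]; linarith) (abs_nonneg _)
  have h4 : ‖(2 * (q:ℂ) ^ 2)‖ = 2 * q ^ 2 := by
    rw [norm_mul, norm_pow, Complex.norm_real, Complex.norm_ofNat, Real.norm_eq_abs, sq_abs]
  have hq := c.le_q; have hd := c.d1
  rw [ZZ, norm_div, h4, div_le_iff₀ (by linarith)]
  calc _ ≤ (N:ℝ) ^ 3 + N ^ 3 * 1 := (norm_add_le _ _).trans (by rw [norm_mul]; gcongr)
    _ = 2 * N ^ 3 := by ring
    _ ≤ N * N ^ 3 := by gcongr; linarith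
    _ = N ^ 4 := by ring
    _ ≤ N ^ 10 * 1 := by rw [mul_one]; gcongr <;> [linarith; norm_num]
    _ ≤ _ := by gcongr; linarith
end
lemma mom_Sm {κ : ℝ} (hκ : 0 < κ) {E : Ev} (hE : Sm κ E) (η t : Dt → ℝ)
    (hη : ∀ N d s, T κ N d s → 1 ≤ η s * s.L ^ 7 ∧ η s ≤ 1 ∧ 1 ≤ t s * N)
    (H : ∀ N d s A, T κ N d s → IsAdjMat N d A → E N d s A → ‖fz ⟨s.x, η s⟩ (gg s.p s.q ⟨s.x, η s⟩ A) - (⟨s.x, η s⟩ : ℂ)⁻¹ ^ 2 * av (fun i j => ZZ s.p s.q ⟨s.x, η s⟩ i j A)‖ ≤ t s ∧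
      (∀ i j, i ≠ j → ‖fz ⟨s.x, η s⟩ (gg s.p s.q ⟨s.x, η s⟩ A) - fz ⟨s.x, η s⟩ (g0 s.p s.q ⟨s.x, η s⟩ (BB i j A))‖ ≤ t s) ∧
      av (fun i j => ‖ZZ s.p s.q ⟨s.x, η s⟩ i j A‖ * ‖fz ⟨s.x, η s⟩ (gg s.p s.q ⟨s.x, η s⟩ A) - fz ⟨s.x, η s⟩ (g0 s.p s.q ⟨s.x, η s⟩ (BB i j A))‖) ≤ t s ^ 2) :
    Sm κ (fun N d s A => ‖fz ⟨s.x, η s⟩ (gg s.p s.q ⟨s.x, η s⟩ A)‖ ≤ s.K * t s) := fun D => by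
  obtain ⟨r, hr⟩ := exists_nat_ge ((D + 1 : ℝ) / κ)
  obtain ⟨C, C0, hC⟩ := mom r
  obtain ⟨m, hm⟩ : ∃ m, m = 2 * (r + 1) := ⟨_, rfl⟩
  obtain ⟨n, hn⟩ := hE (11 * m)
  obtain ⟨n', hn'⟩ := exists_nat_ge (C + 4)
  refine ⟨n + n', fun N hN d s h => ?_⟩
  have hNC : C + 4 ≤ N := hn'.trans (by exact_mod_cast (by omega))
  have N6 := h.N6; have K6 := h.K6
  obtain ⟨hη1, hη2, ht⟩ := hη N d s h
  have n0 : (0:ℝ) < N := by linarith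
  have t0 : 0 < t s := (pos_iff_pos_of_mul_pos (lt_of_lt_of_le one_pos ht)).2 n0
  have η0 : 0 < η s := (pos_iff_pos_of_mul_pos (lt_of_lt_of_le one_pos hη1)).2 (by have := h.L6; positivity)
  have ηN : 1 ≤ η s * N := by
    rw [← h.LN]; refine hη1.trans ?_; have := h.L6; gcongr <;> [linarith; norm_num]
  set z : ℂ := ⟨s.x, η s⟩ with hz
  have cx : ∀ A, IsAdjMat N d A → Ctx N d A s.p s.q z := fun A hA => h.ctx hA η0
  have z2 : 2 ≤ ‖z‖ := h.x2.trans (Complex.abs_re_le_norm z)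
  have zi : ‖z⁻¹ ^ 2‖ ≤ 1 := by
    rw [norm_pow, norm_inv]; exact pow_le_one₀ (by positivity) (inv_le_one_of_one_le₀ (by linarith))
  have zN : ‖z‖ ≤ (N:ℝ) ^ 2 := by
    refine (Complex.norm_le_abs_re_add_abs_im _).trans ?_
    have := h.hxN
    simp only [hz, abs_of_pos η0]; nlinarith
  have key := hC (Gr N d) (E N d s) (N := N) (fun A => fz z (gg s.p s.q z A)) (fun i k A => z⁻¹ ^ 2 * ZZ s.p s.q z i k A) (fun i k A => fz z (g0 s.p s.q z (BB i k A)))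
    (t s) ((N:ℝ) ^ 10) (s.K * t s) h.N4 t0 (by positivity) (by positivity) (fun i k hik => by
      have := zero_mean d hik (Mo s.p s.q z) (fun B x => by simp [Mo]) fun B => z⁻¹ ^ 2 * Qq r (fz z (g0 s.p s.q z B)) / (2 * (s.q:ℂ) ^ 2)
      rw [← this]
      refine Finset.sum_congr rfl fun A _ => ?_
      unfold ZZ Ms; ring) (fun A hA he => by
      obtain ⟨h1, h2, h3⟩ := H N d s A h (mem_Gr.1 hA) he
      refine ⟨?_, h2, le_trans (av_mono h.N4 fun i k _ => ?_) h3⟩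
      · rw [av_smul_c]; exact h1
      · rw [norm_mul]; gcongr; exact mul_le_of_le_one_left (norm_nonneg _) zi) (fun A hA => by
      have c := cx A (mem_Gr.1 hA)
      refine ⟨fz_crude N6 z2 zN ?_, fun i k hik => ⟨fz_crude N6 z2 zN (c.g0_crude i k N6 ηN), ?_⟩⟩
      · refine c.g_le.trans ?_
        rw [div_le_iff₀ c.hz]
        calc 1 ≤ (N:ℝ) * η s := by linarith
          _ ≤ (N:ℝ) ^ 3 * η s := by gcongr; exact le_self_pow₀ (by linarith) (by norm_num)
      · rw [norm_mul]; refine (mul_le_of_le_one_left (norm_nonneg _) zi).trans (c.ZZ_crude hik N6 ηN))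
  have h5 := hn N (by omega) d s h
  have e1 : bd N d (fun A => ‖fz z (gg s.p s.q z A)‖ ≤ s.K * t s) * (s.K * t s) ^ m ≤ C * t s ^ m * (Gr N d).card + 4 * ((N:ℝ) ^ 10) ^ m * bd N d (E N d s) := by
    simp only [bd, not_le, hm]
    convert key
  have e2 : (N:ℝ) ^ (D + 1) ≤ s.K ^ m := by
    rw [h.hK, ← Real.rpow_natCast, ← Real.rpow_natCast, ← Real.rpow_mul n0.le]
    refine Real.rpow_le_rpow_of_exponent_le (by linarith) ?_
    rw [div_le_iff₀ hκ] at hr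
    rw [hm]; push_cast; nlinarith
  have e3 : 1 ≤ t s ^ m * N ^ m := by rw [← mul_pow]; exact one_le_pow₀ ht
  generalize bd N d (fun A => ‖fz z (gg s.p s.q z A)‖ ≤ s.K * t s) = X at *
  by_cases hX : X ≤ 0
  · exact (mul_nonpos_of_nonpos_of_nonneg hX (by positivity)).trans (by positivity)
  have e4 : (N:ℝ) ^ (D + 1) * X * t s ^ m ≤ (C + 4) * (Gr N d).card * t s ^ m := by
    calc _ ≤ s.K ^ m * X * t s ^ m := by gcongr; exact (not_le.1 hX).le
      _ = X * (s.K * t s) ^ m := by ring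
      _ ≤ _ := e1
      _ ≤ C * t s ^ m * (Gr N d).card + 4 * ((N:ℝ) ^ 10) ^ m * bd N d (E N d s) * (t s ^ m * N ^ m) := by
        have := bd_nn (d := d) (E := E N d s)
        linarith [le_mul_of_one_le_right (by positivity : 0 ≤ 4 * ((N:ℝ) ^ 10) ^ m * bd N d (E N d s)) e3]
      _ = C * t s ^ m * (Gr N d).card + 4 * t s ^ m * (bd N d (E N d s) * (N:ℝ) ^ (11 * m)) := by
        rw [pow_mul, (by ring : (N:ℝ) ^ 11 = N ^ 10 * N), mul_pow]; ring
      _ ≤ C * t s ^ m * (Gr N d).card + 4 * t s ^ m * (Gr N d).card := by gcongr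
      _ = _ := by ring
  have e5 := le_of_mul_le_mul_right e4 (by positivity)
  have e6 : (C + 4) * ((Gr N d).card : ℝ) ≤ N * (Gr N d).card := by gcongr
  have e7 : (N:ℝ) * (X * N ^ D) ≤ N * (Gr N d).card := by
    calc _ = (N:ℝ) ^ (D + 1) * X := by ring
      _ ≤ _ := e5.trans e6
  exact le_of_mul_le_mul_left e7 n0
end RR
namespace RR
variable {N : ℕ}
section num
variable {K L σ : ℝ} (K6 : 10 ^ 6 ≤ K) (KL : K ^ 100 ≤ L) (sk : K ^ 29 ≤ σ * L ^ 2) (σ0 : 0 < σ)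
include K6 KL
lemma Kn {n : ℕ} (hn : n ≤ 99) : 10 ^ 6 * K ^ n ≤ L := by
  calc _ ≤ K * K ^ n := by gcongr
    _ = K ^ (n + 1) := by ring
    _ ≤ K ^ 100 := by gcongr <;> [linarith; omega]
    _ ≤ L := KL
lemma Ll : 10 ^ 6 ≤ L := by simpa using Kn K6 KL (n := 0) (by norm_num)
include sk σ0
lemma num1 : 2 / (L ^ 12 * σ) ≤ σ / (8 * L ^ 6) ∧ 1 / (K ^ 60 * L ^ 8) ≤ σ / (8 * L ^ 6) ∧ K ^ 4 * (σ / L ^ 6) ≤ σ ^ 4 / 64 ∧ K ^ 4 * (1 / (L ^ 8 * K ^ 20)) ≤ σ ^ 4 / 64 := by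
  have hL := Ll K6 KL
  have e : 64 * K ^ 4 ≤ K ^ 29 := by
    calc _ ≤ K ^ 25 * K ^ 4 := by gcongr; linarith [le_self_pow₀ (by linarith : 1 ≤ K) (by norm_num : 25 ≠ 0)]
      _ = _ := by ring
  have k4 : 1 ≤ K ^ 4 := one_le_pow₀ (by linarith)
  have u1 : 64 * K ^ 4 ≤ σ * L ^ 2 := e.trans sk
  have u2 : 1 ≤ σ * L ^ 2 := by linarith
  refine ⟨?_, ?_, ?_, ?_⟩
  · rw [div_le_div_iff₀ (by positivity) (by positivity)]
    calc _ = 16 * L ^ 6 * 1 := by ring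
      _ ≤ L ^ 2 * L ^ 6 * (σ * L ^ 2) ^ 2 := by gcongr <;> [nlinarith; exact one_le_pow₀ u2]
      _ = _ := by ring
  · rw [div_le_div_iff₀ (by positivity) (by positivity)]
    calc _ = 8 * L ^ 6 * 1 := by ring
      _ ≤ K ^ 60 * L ^ 6 * (σ * L ^ 2) := by gcongr; linarith [le_self_pow₀ (by linarith : 1 ≤ K) (by norm_num : 60 ≠ 0)]
      _ = _ := by ring
  · rw [mul_div_assoc', div_le_div_iff₀ (by positivity) (by norm_num)]
    calc _ = σ * (64 * K ^ 4) := by ring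
      _ ≤ σ * (σ * L ^ 2) ^ 3 := by gcongr; exact u1.trans (le_self_pow₀ u2 (by norm_num))
      _ = _ := by ring
  · rw [mul_div_assoc', div_le_div_iff₀ (by positivity) (by norm_num)]
    calc _ = 64 * K ^ 4 * 1 := by ring
      _ ≤ (σ * L ^ 2) ^ 4 * K ^ 20 := by gcongr; exacts [u1.trans (le_self_pow₀ u2 (by norm_num)), one_le_pow₀ (by linarith)]
      _ = _ := by ring
lemma num2 (σ1 : σ ≤ 1) : K ^ 4 * (σ / L ^ 6) ≤ 1 / L ^ 5 / 2 ∧ K ^ 4 * (1 / (L ^ 8 * K ^ 20)) ≤ 1 / L ^ 5 / 2 ∧ σ / L ^ 6 ≤ σ / 8 ∧ 1 / (L ^ 8 * K ^ 20) ≤ σ / 8 ∧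
    1 ≤ L ^ 5 * σ := by
  have hL := Ll K6 KL
  have h4 := Kn K6 KL (n := 4) (by norm_num)
  have k0 : 1 ≤ K ^ 29 := one_le_pow₀ (by linarith)
  refine ⟨?_, ?_, ?_, ?_, ?_⟩
  · rw [mul_div_assoc', div_div, div_le_div_iff₀ (by positivity) (by positivity)]
    calc _ ≤ K ^ 4 * 1 * (L ^ 5 * 2) := by gcongr
      _ = L ^ 5 * (2 * K ^ 4) := by ring
      _ ≤ L ^ 5 * L := by gcongr; nlinarith [pow_pos (by linarith : 0 < K) 4]
      _ = _ := by ring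
  · rw [mul_div_assoc', div_div, div_le_div_iff₀ (by positivity) (by positivity)]
    calc _ = L ^ 5 * K ^ 4 * 2 := by ring
      _ ≤ L ^ 8 * K ^ 20 := by
        have : L ^ 5 * 2 ≤ L ^ 8 := by
          calc _ ≤ L ^ 5 * L ^ 3 := by gcongr; linarith [le_self_pow₀ (by linarith : 1 ≤ L) (by norm_num : 3 ≠ 0)]
            _ = _ := by ring
        calc _ = L ^ 5 * 2 * K ^ 4 := by ring
          _ ≤ L ^ 8 * K ^ 20 := by gcongr <;> [linarith; norm_num]
      _ = _ := by ring
  · gcongr; linarith [le_self_pow₀ (by linarith : 1 ≤ L) (by norm_num : 6 ≠ 0)]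
  · rw [div_le_div_iff₀ (by positivity) (by positivity)]
    have : 8 ≤ L ^ 6 := by linarith [le_self_pow₀ (by linarith : 1 ≤ L) (by norm_num : 6 ≠ 0)]
    calc _ ≤ L ^ 6 * 1 * 1 := by linarith
      _ ≤ L ^ 6 * (σ * L ^ 2) * K ^ 20 := by gcongr; exacts [by linarith, one_le_pow₀ (by linarith)]
      _ = _ := by ring
  · calc 1 ≤ σ * L ^ 2 := by linarith
      _ ≤ σ * L ^ 5 := by gcongr <;> [linarith; norm_num]
      _ = _ := by ring
lemma num3 (σ1 : σ ≤ 1) {V : ℝ} (V0 : 0 ≤ V) (hV : V ≤ σ / L ^ 6) : K ^ 4 * V + 3 * σ / L ^ 6 ≤ σ / (L ^ 4 * K ^ 23) ∧ 12 * σ * (V + 1 / K ^ 8 / L ^ 6) ≤ σ / (L ^ 4 * K ^ 23) ∧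
    σ * K ^ 4 * (V * √V + V / L ^ 6) ≤ (σ / (L ^ 4 * K ^ 23)) ^ 2 ∧ 1 ≤ σ / (L ^ 4 * K ^ 23) * L ^ 12 ∧ 2 * (1 / L ^ 6 + 6 * (K * (σ / (L ^ 4 * K ^ 23)))) ≤ 1 / (L ^ 4 * K ^ 21) / 2 * σ := by
  have hL := Ll K6 KL
  have k4 : 1 ≤ K ^ 4 := one_le_pow₀ (by linarith)
  have h27 := Kn K6 KL (n := 27) (by norm_num)
  have h50 := Kn K6 KL (n := 50) (by norm_num)
  have main : σ / L ^ 6 * (100 * K ^ 4) ≤ σ / (L ^ 4 * K ^ 23) := by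
    rw [div_mul_eq_mul_div, div_le_div_iff₀ (by positivity) (by positivity)]
    calc _ = σ * L ^ 4 * (100 * K ^ 27) := by ring
      _ ≤ σ * L ^ 4 * (L * L) := by gcongr <;> nlinarith [pow_pos (by linarith : 0 < K) 27]
      _ = _ := by ring
  have s6 : 0 < σ / L ^ 6 := by positivity
  refine ⟨?_, ?_, ?_, ?_, ?_⟩
  · refine le_trans ?_ main
    calc _ ≤ K ^ 4 * (σ / L ^ 6) + 3 * (σ / L ^ 6) := by gcongr; exact le_of_eq (by ring)
      _ ≤ _ := by nlinarith
  · refine le_trans ?_ main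
    have : 1 / K ^ 8 / L ^ 6 ≤ 1 / L ^ 6 := by gcongr; exact div_le_one_of_le₀ (one_le_pow₀ (by linarith)) (by positivity)
    calc _ ≤ 12 * σ * (1 / L ^ 6 + 1 / L ^ 6) := by gcongr; exact hV.trans (by gcongr)
      _ = σ / L ^ 6 * 24 := by ring
      _ ≤ _ := by gcongr; linarith
  · have sV : √V ≤ 1 / L ^ 3 := by
      rw [Real.sqrt_le_left (by positivity)]; refine hV.trans ?_
      calc _ ≤ 1 / L ^ 6 := by gcongr
        _ = _ := by ring
    have l3 : 1 / L ^ 6 ≤ 1 / L ^ 3 := by gcongr <;> [linarith; norm_num]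
    calc _ = σ * K ^ 4 * (V * (√V + 1 / L ^ 6)) := by ring
      _ ≤ σ * K ^ 4 * (σ / L ^ 6 * (1 / L ^ 3 + 1 / L ^ 3)) := by gcongr
      _ = σ ^ 2 / (L ^ 9 * K ^ 46) * (2 * K ^ 50) := by field_simp; ring
      _ ≤ σ ^ 2 / (L ^ 9 * K ^ 46) * L := by gcongr; nlinarith [pow_pos (by linarith : 0 < K) 50]
      _ = _ := by field_simp
  · rw [div_mul_eq_mul_div, le_div_iff₀ (by positivity), one_mul]
    have : 1 ≤ L ^ 6 := one_le_pow₀ (by linarith)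
    calc _ ≤ L ^ 4 * K ^ 29 * 1 := by rw [mul_one]; gcongr <;> [linarith; norm_num]
      _ ≤ L ^ 4 * (σ * L ^ 2) * L ^ 6 := by gcongr
      _ = _ := by ring
  · have e1 : 2 * (1 / L ^ 6) ≤ σ / (L ^ 4 * K ^ 21) / 4 := by
      rw [mul_one_div, div_div, div_le_div_iff₀ (by positivity) (by positivity)]
      calc _ = L ^ 4 * (8 * K ^ 21) := by ring
        _ ≤ L ^ 4 * (K ^ 8 * K ^ 21) := by gcongr; linarith [le_self_pow₀ (by linarith : 1 ≤ K) (by norm_num : 8 ≠ 0)]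
        _ = L ^ 4 * K ^ 29 := by ring
        _ ≤ L ^ 4 * (σ * L ^ 2) := by gcongr
        _ = _ := by ring
    have e2 : 12 * (K * (σ / (L ^ 4 * K ^ 23))) ≤ σ / (L ^ 4 * K ^ 21) / 4 := by
      calc _ = σ / (L ^ 4 * K ^ 21) * (12 / K) := by field_simp
        _ ≤ σ / (L ^ 4 * K ^ 21) * (1 / 4) := by gcongr ?_ * ?_; rw [div_le_div_iff₀ (by positivity) (by norm_num)]; linarith
        _ = _ := by ring
    calc _ = 2 * (1 / L ^ 6) + 12 * (K * (σ / (L ^ 4 * K ^ 23))) := by ring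
      _ ≤ _ := add_le_add e1 e2
      _ = _ := by ring
lemma num4 {V : ℝ} (V0 : 0 ≤ V) (hV : V ≤ 1 / (L ^ 8 * K ^ 20)) : K ^ 4 * V + 3 * σ / L ^ 6 ≤ σ / (L ^ 5 * K ^ 2) ∧ 12 * σ * (V + 1 / K ^ 8 / L ^ 5) ≤ σ / (L ^ 5 * K ^ 2) ∧
    σ * K ^ 4 * (V * √V + V / L ^ 5) ≤ (σ / (L ^ 5 * K ^ 2)) ^ 2 ∧ 1 ≤ σ / (L ^ 5 * K ^ 2) * L ^ 12 ∧ 2 * (1 / L ^ 7 + 6 * (K * (σ / (L ^ 5 * K ^ 2)))) ≤ 1 / (8 * L ^ 5) * σ := by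
  have hL := Ll K6 KL
  have k16 : 1 ≤ K ^ 16 := one_le_pow₀ (by linarith)
  have u : 1 ≤ σ * L ^ 2 := le_trans (one_le_pow₀ (by linarith)) sk
  have h2 := Kn K6 KL (n := 2) (by norm_num)
  have s6 : 0 < σ / L ^ 6 := by positivity
  refine ⟨?_, ?_, ?_, ?_, ?_⟩
  · have e1 : K ^ 4 * V ≤ σ / L ^ 6 := by
      calc _ ≤ K ^ 4 * (1 / (L ^ 8 * K ^ 20)) := by gcongr
        _ = 1 / (L ^ 8 * K ^ 16) := by field_simp
        _ ≤ _ := by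
          rw [div_le_div_iff₀ (by positivity) (by positivity)]
          calc _ = L ^ 6 * 1 * 1 := by ring
            _ ≤ L ^ 6 * (σ * L ^ 2) * K ^ 16 := by gcongr
            _ = _ := by ring
    calc _ ≤ σ / L ^ 6 * 4 := by rw [mul_div_assoc]; linarith
      _ ≤ _ := by
        rw [div_mul_eq_mul_div, div_le_div_iff₀ (by positivity) (by positivity)]
        calc _ = σ * L ^ 5 * (4 * K ^ 2) := by ring
          _ ≤ σ * L ^ 5 * L := by gcongr; nlinarith
          _ = _ := by ring
  · have e1 : V ≤ 1 / K ^ 8 / L ^ 5 := by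
      refine hV.trans ?_; rw [div_div, mul_comm]; gcongr <;> linarith
    calc _ ≤ 12 * σ * (1 / K ^ 8 / L ^ 5 + 1 / K ^ 8 / L ^ 5) := by gcongr
      _ = σ / (L ^ 5 * K ^ 2) * (24 / K ^ 6) := by field_simp; ring
      _ ≤ σ / (L ^ 5 * K ^ 2) * 1 := by
        gcongr; refine div_le_one_of_le₀ ?_ (by positivity); linarith [le_self_pow₀ (by linarith : 1 ≤ K) (by norm_num : 6 ≠ 0)]
      _ = _ := mul_one _
  · have sV : √V ≤ 1 / L ^ 4 := by
      rw [Real.sqrt_le_left (by positivity)]; refine hV.trans ?_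
      calc _ ≤ 1 / (L ^ 8 * 1) := by gcongr; exact one_le_pow₀ (by linarith)
        _ = _ := by ring
    have l3 : 1 / L ^ 5 ≤ 1 / L ^ 4 := by gcongr <;> [linarith; norm_num]
    calc _ = σ * K ^ 4 * (V * (√V + 1 / L ^ 5)) := by ring
      _ ≤ σ * K ^ 4 * (1 / (L ^ 8 * K ^ 20) * (1 / L ^ 4 + 1 / L ^ 4)) := by gcongr
      _ = σ / (L ^ 12 * K ^ 4) * (2 / K ^ 12) := by field_simp; ring
      _ ≤ σ / (L ^ 12 * K ^ 4) * (σ * L ^ 2) := by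
        gcongr; refine le_trans (div_le_one_of_le₀ ?_ (by positivity)) u; linarith [le_self_pow₀ (by linarith : 1 ≤ K) (by norm_num : 12 ≠ 0)]
      _ = _ := by field_simp
  · rw [div_mul_eq_mul_div, le_div_iff₀ (by positivity), one_mul]
    calc _ ≤ L ^ 5 * (L * 1) * 1 := by rw [mul_one, mul_one]; gcongr; nlinarith
      _ ≤ L ^ 5 * (L * L ^ 4) * (σ * L ^ 2) := by gcongr; exact one_le_pow₀ (by linarith)
      _ = _ := by ring
  · have e1 : 2 * (1 / L ^ 7) ≤ σ / (16 * L ^ 5) := by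
      rw [mul_one_div, div_le_div_iff₀ (by positivity) (by positivity)]
      calc _ = L ^ 5 * 32 := by ring
        _ ≤ L ^ 5 * (σ * L ^ 2) := by gcongr; linarith [le_self_pow₀ (by linarith : 1 ≤ K) (by norm_num : 29 ≠ 0)]
        _ = _ := by ring
    have e2 : 12 * (K * (σ / (L ^ 5 * K ^ 2))) ≤ σ / (16 * L ^ 5) := by
      calc _ = σ / L ^ 5 * (12 / K) := by field_simp
        _ ≤ σ / L ^ 5 * (1 / 16) := by gcongr ?_ * ?_; rw [div_le_div_iff₀ (by positivity) (by norm_num)]; linarith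
        _ = _ := by ring
    calc _ = 2 * (1 / L ^ 7) + 12 * (K * (σ / (L ^ 5 * K ^ 2))) := by ring
      _ ≤ _ := add_le_add e1 e2
      _ = _ := by ring
end num
end RR
namespace RR
variable {N : ℕ}
lemma Aq.imf {d : ℕ} {A : Matrix (Fin N) (Fin N) ℝ} {p q K k : ℝ} {z : ℂ} (a : Aq N d A p q z K k) :
    (gg p q z A).im * √k ≤ 2 * (z.im + 6 * ‖fz z (gg p q z A)‖) := by
  suffices ‖gg p q z A‖ * ‖PP p q z A‖ ≤ 6 * ‖fz z (gg p q z A)‖ by linarith [a.im_g]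
  have hP := a.P4; have k1 := a.k1; have g1 := a.g1; have z2 := a.hz2
  set g := gg p q z A
  have h1 : ‖z‖ * ‖g‖ ≤ 2.25 := by
    rw [← norm_mul, (by unfold PP; ring : z * g = PP p q z A - 1 - g ^ 2)]
    refine (norm_sub_le _ _).trans ?_
    have := norm_sub_le (PP p q z A) 1
    have : ‖g ^ 2‖ ≤ 1 := by rw [norm_pow]; exact pow_le_one₀ (norm_nonneg _) g1
    rw [norm_one] at *; linarith
  have h2 : ‖z‖ / 2 ≤ ‖z + g‖ := by
    have := norm_sub_le (z + g) g
    rw [add_sub_cancel_right] at this; linarith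
  have h3 : ‖fz z g‖ = ‖z + g‖ * ‖PP p q z A‖ / ‖z‖ ^ 2 := by rw [fz, norm_div, norm_mul, norm_pow]; rfl
  rw [h3, mul_div_assoc', le_div_iff₀ (by positivity)]
  calc _ = (‖z‖ * ‖g‖) * (‖z‖ * ‖PP p q z A‖) := by ring
    _ ≤ 2.25 * (‖z‖ * ‖PP p q z A‖) := by gcongr
    _ ≤ 6 * ((‖z‖ / 2) * ‖PP p q z A‖) := by nlinarith [mul_nonneg (norm_nonneg z) (norm_nonneg (PP p q z A))]
    _ ≤ _ := by gcongr
section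
variable {κ : ℝ} {d : ℕ} {s : Dt} (h : T κ N d s)
include h
lemma T.sk0 : 0 < √s.k := Real.sqrt_pos.2 h.k0
lemma T.sk1 : √s.k ≤ 1 := (Real.sqrt_le_sqrt h.k1).trans (by simp)
lemma T.dd : 1 / (d:ℝ) ≤ 1 / (s.K ^ 60 * s.L ^ 8) := by
  have := h.K6; have := h.L6; have := h.dL
  gcongr
lemma T.V1 {A : Matrix (Fin N) (Fin N) ℝ} {η : ℝ} (hη : 1 / s.L ^ 6 ≤ η) (a : Aq N d A s.p s.q ⟨s.x, η⟩ s.K s.k) :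
    VV d s.p s.q ⟨s.x, η⟩ A ≤ √s.k / s.L ^ 6 := by
  have hL := h.L6; have s0 := h.sk0; have k0 := h.k0; have n0 := h.N6
  obtain ⟨h1, h2, -⟩ := num1 h.K6 h.KL h.sk h.sk0
  have h3 := h.dd
  have η0 : 0 < η := a.hz
  have h4 : (gg s.p s.q ⟨s.x, η⟩ A).im ≤ 2 * η / √s.k + √s.k / 2 := by
    have e := a.im_g; have e1 := a.g1; have e2 := a.P4
    have e3 : ‖gg s.p s.q ⟨s.x, η⟩ A‖ * ‖PP s.p s.q ⟨s.x, η⟩ A‖ ≤ 1 * (s.k / 4) := by gcongr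
    rw [← mul_le_mul_iff_left₀ s0]
    refine e.trans ?_
    rw [add_mul, div_mul_cancel₀ _ s0.ne', div_mul_eq_mul_div, Real.mul_self_sqrt k0.le]
    simp only; linarith
  have h5 : (gg s.p s.q ⟨s.x, η⟩ A).im / (N * η) ≤ 2 / (s.L ^ 12 * √s.k) + √s.k / (2 * s.L ^ 6) := by
    calc _ ≤ (2 * η / √s.k + √s.k / 2) / (N * η) := by gcongr
      _ = 2 / (s.L ^ 12 * √s.k) + √s.k / (2 * (s.L ^ 12 * η)) := by rw [h.LN]; field_simp
      _ ≤ _ := by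
        gcongr
        calc s.L ^ 6 = s.L ^ 12 * (1 / s.L ^ 6) := by field_simp
          _ ≤ _ := by gcongr
  have h6 : √s.k / (8 * s.L ^ 6) = √s.k / s.L ^ 6 / 8 := by ring
  have h7 : √s.k / (2 * s.L ^ 6) = √s.k / s.L ^ 6 / 2 := by ring
  have : 0 < √s.k / s.L ^ 6 := by positivity
  unfold VV; simp only; linarith
lemma T.k4 : s.k ^ 2 / 64 = √s.k ^ 4 / 64 := by
  rw [(by ring : √s.k ^ 4 = (√s.k ^ 2) ^ 2), Real.sq_sqrt h.k0.le]
lemma T.l67 : 1 / s.L ^ 7 ≤ 1 / s.L ^ 6 := by have := h.L6; gcongr <;> [linarith; norm_num]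
lemma T.l61 : 1 / s.L ^ 6 ≤ 1 := by have := h.L6; exact div_le_one_of_le₀ (one_le_pow₀ (by linarith)) (by positivity)
lemma T.hz4 {η : ℝ} (η0 : 0 < η) (hη : η ≤ 1 / s.L ^ 6) : ‖(⟨s.x, η⟩ : ℂ) ^ 2 - 4‖ ≤ 3 * s.k * ‖(⟨s.x, η⟩ : ℂ)‖ ^ 2 := by
  have hk := h.hk; have kN := h.kN; have k0 := h.k0; have hx := h.x2
  have z2 : 2 ≤ ‖(⟨s.x, η⟩ : ℂ)‖ := h.x2.trans (Complex.abs_re_le_norm ⟨s.x, η⟩)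
  have ηk : η ≤ s.k := by
    have hL := h.L6
    have h1 : 1 ≤ √s.k * s.L ^ 2 := le_trans (one_le_pow₀ (by linarith [h.K6])) h.sk
    refine hη.trans ?_
    rw [div_le_iff₀ (by positivity)]
    calc 1 ≤ (√s.k * s.L ^ 2) ^ 2 := one_le_pow₀ h1
      _ = s.k * s.L ^ 4 := by rw [mul_pow, Real.sq_sqrt k0.le]; ring
      _ ≤ _ := by gcongr <;> [linarith; norm_num]
  set z : ℂ := ⟨s.x, η⟩ with hz
  rcases le_total (|s.x| - 2) 1 with hc | hc
  · rw [min_eq_left hc] at hk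
    have key : ∀ u v : ℂ, ‖u‖ ≤ s.k + η → ‖v‖ ≤ ‖z‖ + 2 → ‖u * v‖ ≤ 3 * s.k * ‖z‖ ^ 2 := fun u v hu hv => by
      rw [norm_mul]
      calc _ ≤ (s.k + s.k) * (‖z‖ + ‖z‖) := by gcongr <;> linarith
        _ = 4 * s.k * ‖z‖ := by ring
        _ ≤ _ := by nlinarith [mul_pos k0 (by linarith : 0 < ‖z‖)]
    have hs : ∀ t : ℝ, |s.x - t| ≤ s.k → ‖z - t‖ ≤ s.k + η := fun t ht => by
      refine (Complex.norm_le_abs_re_add_abs_im _).trans ?_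
      simp [hz, abs_of_pos η0]; exact ht
    have n2 : ∀ t : ℂ, ‖t‖ = 2 → ‖z + t‖ ≤ ‖z‖ + 2 := fun t ht => (norm_add_le _ _).trans (by rw [ht])
    rcases abs_cases s.x with ⟨e, _⟩ | ⟨e, _⟩
    · have := key (z - (2:ℝ)) (z + 2) (hs 2 (by rw [hk, e, abs_of_nonneg (by linarith)])) (n2 _ (by simp))
      convert this using 2; push_cast; ring
    · have := key (z - (-2:ℝ)) (z + (-2)) (hs (-2) (by rw [hk, e, abs_of_nonpos (by linarith)]; linarith)) (n2 _ (by simp))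
      convert this using 2; push_cast; ring
  · rw [min_eq_right hc] at hk
    refine (norm_sub_le _ _).trans ?_
    rw [norm_pow, hk]; norm_num; nlinarith
/-- consequences of stage 2 bounds -/
lemma T.TT {A : Matrix (Fin N) (Fin N) ℝ} {η t m : ℝ} (hη : η ≤ 1 / s.L ^ 6) (a : Aq N d A s.p s.q ⟨s.x, η⟩ s.K s.k)
    (hm : N * η = m) (hV : VV d s.p s.q ⟨s.x, η⟩ A ≤ √s.k / 8) (hm1 : 1 ≤ m * √s.k)
    (h1 : s.K ^ 4 * VV d s.p s.q ⟨s.x, η⟩ A + 3 * √s.k / s.L ^ 6 ≤ t)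
    (h2 : 12 * √s.k * (VV d s.p s.q ⟨s.x, η⟩ A + 1 / s.K ^ 8 / m) ≤ t)
    (h3 : √s.k * s.K ^ 4 * (VV d s.p s.q ⟨s.x, η⟩ A * √(VV d s.p s.q ⟨s.x, η⟩ A) + VV d s.p s.q ⟨s.x, η⟩ A / m) ≤ t ^ 2) :
    ‖fz ⟨s.x, η⟩ (gg s.p s.q ⟨s.x, η⟩ A) - (⟨s.x, η⟩ : ℂ)⁻¹ ^ 2 * av (fun i j => ZZ s.p s.q ⟨s.x, η⟩ i j A)‖ ≤ t ∧
      (∀ i j, i ≠ j → ‖fz ⟨s.x, η⟩ (gg s.p s.q ⟨s.x, η⟩ A) - fz ⟨s.x, η⟩ (g0 s.p s.q ⟨s.x, η⟩ (BB i j A))‖ ≤ t) ∧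
      av (fun i j => ‖ZZ s.p s.q ⟨s.x, η⟩ i j A‖ * ‖fz ⟨s.x, η⟩ (gg s.p s.q ⟨s.x, η⟩ A) - fz ⟨s.x, η⟩ (g0 s.p s.q ⟨s.x, η⟩ (BB i j A))‖) ≤ t ^ 2 := by
  have η0 : 0 < η := a.hz
  have K6 := h.K6
  have z4 := h.hz4 η0 hη
  have hη' : 1 ≤ N * (⟨s.x, η⟩ : ℂ).im * √s.k := by show 1 ≤ N * η * √s.k; rw [hm]; exact hm1
  have m0 : 0 < m := by rw [← hm]; have := h.N6; positivity
  refine ⟨a.T1.trans (le_trans ?_ h1), fun i j hij => (a.T2 z4 hV hη' hij).trans (le_trans ?_ h2), (a.T3 z4 hV hη').trans (le_trans ?_ h3)⟩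
  · have := h.L6
    refine add_le_add le_rfl ?_
    rw [le_div_iff₀ (by positivity)]; exact h.dk
  · simp only; rw [hm]; gcongr
    rw [le_div_iff₀ (by positivity)]; exact a.ep_le hij
  · simp only; rw [hm]
end
end RR
namespace RR
variable {N : ℕ}
lemma R_eig {M : Matrix (Fin N) (Fin N) ℝ} (hM : M.IsSymm) {z : ℂ} (hz : 0 < z.im) {μ : ℝ} {v : Fin N → ℂ} (hv : v ≠ 0)
    (h : M.map Complex.ofReal *ᵥ v = (μ : ℂ) • v) : z.im ≤ ‖μ - z‖ ^ 2 * (R M z).trace.im := by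
  have e : R M z *ᵥ (((μ : ℂ) - z) • v) = v := R_of_eq hM hz (by rw [sub_mulVec, h, sub_smul]; simp [smul_mulVec])
  rw [mulVec_smul] at e
  have n0 : 0 < nm v := by
    refine lt_of_le_of_ne (nm_nonneg v) fun h0 => hv ?_
    have := norm_eq_zero.1 (show ‖WithLp.toLp 2 v‖ = 0 from h0.symm)
    simpa using this
  have c : ∀ x, ‖v x‖ ^ 2 ≤ ‖μ - z‖ ^ 2 * ((∑ y, ‖R M z x y‖ ^ 2) * nm v ^ 2) := fun x => by
    have e1 : v x = ((μ : ℂ) - z) * (R M z x ⬝ᵥ v) := by conv_lhs => rw [← e]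
                                                         rfl
    have e2 := nm_dot (R M z x) v
    have e3 : nm (R M z x) ^ 2 = ∑ y, ‖R M z x y‖ ^ 2 := nm_sq _
    rw [← e3, e1, norm_mul, mul_pow, ← mul_pow (nm _)]
    gcongr
  have s := Finset.sum_le_sum fun x (_ : x ∈ Finset.univ) => c x
  rw [← Finset.mul_sum, ← Finset.sum_mul] at s
  have t : nm v ^ 2 * 1 ≤ nm v ^ 2 * (‖μ - z‖ ^ 2 * ∑ x, ∑ y, ‖R M z x y‖ ^ 2) := by
    rw [mul_one, nm_sq]; refine s.trans (le_of_eq ?_); rw [nm_sq]; ring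
  have := le_of_mul_le_mul_left t (by positivity)
  rw [← R_ward_tr hM hz]
  calc z.im = z.im * 1 := by ring
    _ ≤ z.im * (‖μ - z‖ ^ 2 * ∑ x, ∑ y, ‖R M z x y‖ ^ 2) := by gcongr
    _ = _ := by ring
section
variable {κ : ℝ} {d : ℕ} {s : Dt} {A : Matrix (Fin N) (Fin N) ℝ} (h : T κ N d s)
include h
lemma T.top (hA : IsAdjMat N d A) : Cb A s.p s.q ⟨s.x, N⟩ 1.5 (1 - s.k / 2) (s.k / 8) (1 / s.L ^ 5 / 2) := by
  have n6 := h.N6; have hL := h.L6; have k1 := h.k1; have kN := h.kN; have L5 := h.L5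
  have c := (h.ctx hA (η := N) (by linarith)).top
  have n0 : (0:ℝ) < N := by linarith
  have e1 : 1 / (N:ℝ) ≤ 1 / 10 ^ 6 := by gcongr
  have e2 : 1 / (N:ℝ) ≤ s.k / 1000 := by rw [div_le_div_iff₀ n0 (by norm_num)]; linarith
  have e3 : 1 / (N:ℝ) ≤ 1 / s.L ^ 5 / 1000 := by rw [div_div]; gcongr; linarith
  have e4 : 5 / (N:ℝ) = 5 * (1 / N) := by ring
  have e5 : 4 / (N:ℝ) ^ 2 ≤ 4 * (1 / N) := by
    rw [mul_one_div]; gcongr; nlinarith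
  have p1 : 0 < 1 / (N:ℝ) := by positivity
  exact ⟨fun i k => (c.ze i k).trans (by simp only; linarith), c.g.trans (by simp only; linarith), c.P.trans (by simp only; linarith), c.W.trans (by simp only; linarith)⟩
lemma T.v1 {η : ℝ} (hη : 1 / s.L ^ 6 ≤ η) (a : Aq N d A s.p s.q ⟨s.x, η⟩ s.K s.k) :
    s.K ^ 4 * VV d s.p s.q ⟨s.x, η⟩ A ≤ s.k ^ 2 / 64 ∧ s.K ^ 4 * VV d s.p s.q ⟨s.x, η⟩ A ≤ 1 / s.L ^ 5 / 2 := by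
  have := h.K6
  have e : s.K ^ 4 * VV d s.p s.q ⟨s.x, η⟩ A ≤ s.K ^ 4 * (√s.k / s.L ^ 6) := by gcongr; exact h.V1 hη a
  rw [h.k4]
  exact ⟨e.trans (num1 h.K6 h.KL h.sk h.sk0).2.2.1, e.trans (num2 h.K6 h.KL h.sk h.sk0 h.sk1).1⟩
lemma T.l7 : 1 ≤ 1 / s.L ^ 7 * s.L ^ 7 := by have := h.L6; rw [div_mul_cancel₀ _ (by positivity)]
lemma T.l6 : 1 ≤ 1 / s.L ^ 6 * s.L ^ 7 := by have := h.L6; rw [show 1 / s.L ^ 6 * s.L ^ 7 = s.L by field_simp]; linarith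
lemma T.aq1 (hA : IsAdjMat N d A) (om : ∀ j < N ^ 6 + 1, Om N d A s.p s.q ⟨s.x, pth N (1 / s.L ^ 6) N j⟩ s.K) :
    Aq N d A s.p s.q ⟨s.x, 1 / s.L ^ 6⟩ s.K s.k :=
  h.path hA h.l6 (h.l61.trans (by linarith [h.N6])) le_rfl om (h.top hA) fun _ h1 _ h3 => h.v1 h1 h3
lemma T.im1 (a : Aq N d A s.p s.q ⟨s.x, 1 / s.L ^ 6⟩ s.K s.k) (f : ‖fz ⟨s.x, 1 / s.L ^ 6⟩ (gg s.p s.q ⟨s.x, 1 / s.L ^ 6⟩ A)‖ ≤ s.K * (√s.k / (s.L ^ 4 * s.K ^ 23))) :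
    (gg s.p s.q ⟨s.x, 1 / s.L ^ 6⟩ A).im ≤ 1 / (s.L ^ 4 * s.K ^ 21) / 2 := by
  refine le_of_mul_le_mul_right (a.imf.trans (le_trans ?_ (num3 h.K6 h.KL h.sk h.sk0 h.sk1 a.V0.le (h.V1 le_rfl a)).2.2.2.2)) h.sk0
  simp only; linarith
lemma T.v2 (hA : IsAdjMat N d A) (g1 : (gg s.p s.q ⟨s.x, 1 / s.L ^ 6⟩ A).im ≤ 1 / (s.L ^ 4 * s.K ^ 21) / 2) {η : ℝ} (hη : 1 / s.L ^ 7 ≤ η) (hη1 : η ≤ 1 / s.L ^ 6) :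
    VV d s.p s.q ⟨s.x, η⟩ A ≤ 1 / (s.L ^ 8 * s.K ^ 20) := by
  have hL := h.L6; have hK := h.K6; have hN := h.LN; have N6 := h.N6; have dd := h.dd
  have η0 : 0 < η := lt_of_lt_of_le (by positivity) hη
  have c := h.ctx hA η0; have c1 := h.ctx hA (lt_of_lt_of_le η0 hη1)
  have m := R_mono c.sH (x := s.x) η0 hη1
  have e := congrArg Complex.im c.tr; have e1 := congrArg Complex.im c1.tr
  have nn : ∀ w : ℂ, (((N:ℂ) - 1) * w).im = ((N:ℝ) - 1) * w.im := fun w => by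
    rw [← Complex.im_ofReal_mul]; push_cast; rfl
  have i1 : ((⟨s.x, 1 / s.L ^ 6⟩ : ℂ)⁻¹).im ≥ -(1 / s.L ^ 6) := by
    have := (Complex.abs_im_le_norm (⟨s.x, 1 / s.L ^ 6⟩ : ℂ)⁻¹)
    rw [Complex.inv_im]
    have n4 : 1 ≤ Complex.normSq ⟨s.x, 1 / s.L ^ 6⟩ := by
      rw [Complex.normSq_eq_norm_sq]; nlinarith [c1.hz2]
    rw [neg_div]; exact neg_le_neg (div_le_self (by positivity) n4)
  have i0 : ((⟨s.x, η⟩ : ℂ)⁻¹).im ≤ 0 := by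
    rw [Complex.inv_im, neg_div]; simp only [neg_nonpos]; have := Complex.normSq_nonneg ⟨s.x, η⟩; positivity
  simp only [GG, Complex.sub_im, nn] at e e1
  rw [e, e1] at m
  set g := (gg s.p s.q ⟨s.x, η⟩ A).im
  set G := (gg s.p s.q ⟨s.x, 1 / s.L ^ 6⟩ A).im
  have m2 : η * (((N:ℝ) - 1) * g) ≤ 1 / s.L ^ 6 * (((N:ℝ) - 1) * G + 1 / s.L ^ 6) := by
    refine le_trans ?_ (m.trans ?_)
    · gcongr; linarith
    · gcongr; linarith
  have l1 : 1 / s.L ^ 6 ≤ 1 / (s.L ^ 4 * s.K ^ 21) / 2 := by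
    rw [div_div]; gcongr
    have := Kn h.K6 h.KL (n := 21) (by norm_num)
    calc _ = s.L ^ 4 * (2 * s.K ^ 21) := by ring
      _ ≤ s.L ^ 4 * s.L ^ 2 := by gcongr; nlinarith
      _ = _ := by ring
  have m3 : η * g ≤ 1 / s.L ^ 6 * (1 / (s.L ^ 4 * s.K ^ 21)) := by
    refine le_of_mul_le_mul_left ?_ (by linarith : (0:ℝ) < N - 1)
    calc _ = η * (((N:ℝ) - 1) * g) := by ring
      _ ≤ _ := m2
      _ ≤ 1 / s.L ^ 6 * (((N:ℝ) - 1) * (1 / (s.L ^ 4 * s.K ^ 21) / 2) + ((N:ℝ) - 1) * (1 / (s.L ^ 4 * s.K ^ 21) / 2)) := by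
        gcongr
        · linarith
        · exact l1.trans (le_mul_of_one_le_left (by positivity) (by linarith))
      _ = _ := by ring
  have m4 : g / (N * η) ≤ 1 / (s.L ^ 8 * s.K ^ 21) := by
    have : g / (N * η) = η * g / (s.L ^ 12 * η ^ 2) := by rw [hN]; field_simp
    rw [this]
    calc _ ≤ 1 / s.L ^ 6 * (1 / (s.L ^ 4 * s.K ^ 21)) / (s.L ^ 12 * (1 / s.L ^ 7) ^ 2) := by gcongr
      _ = _ := by field_simp
  have m5 : 1 / (s.L ^ 8 * s.K ^ 21) ≤ 1 / (s.L ^ 8 * s.K ^ 20) / 2 := by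
    rw [div_div, div_le_div_iff₀ (by positivity) (by positivity), one_mul, one_mul]
    calc _ = s.L ^ 8 * s.K ^ 20 * 2 := by ring
      _ ≤ s.L ^ 8 * s.K ^ 20 * s.K := by gcongr; linarith
      _ = _ := by ring
  have m6 : 1 / (s.K ^ 60 * s.L ^ 8) ≤ 1 / (s.L ^ 8 * s.K ^ 21) := by
    rw [mul_comm]; gcongr <;> [linarith; norm_num]
  unfold VV; simp only; linarith
lemma T.aq2 (hA : IsAdjMat N d A) (a : Aq N d A s.p s.q ⟨s.x, 1 / s.L ^ 6⟩ s.K s.k) (g1 : (gg s.p s.q ⟨s.x, 1 / s.L ^ 6⟩ A).im ≤ 1 / (s.L ^ 4 * s.K ^ 21) / 2)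
    (om : ∀ j < N ^ 6 + 1, Om N d A s.p s.q ⟨s.x, pth N (1 / s.L ^ 7) (1 / s.L ^ 6) j⟩ s.K) : Aq N d A s.p s.q ⟨s.x, 1 / s.L ^ 7⟩ s.K s.k := by
  have := h.K6
  refine h.path hA h.l7 h.l67 (h.l61.trans (by linarith [h.N6])) om (T.step a (h.v1 le_rfl a).1 (h.v1 le_rfl a).2) fun η h1 h2 _ => ?_
  have e : s.K ^ 4 * VV d s.p s.q ⟨s.x, η⟩ A ≤ s.K ^ 4 * (1 / (s.L ^ 8 * s.K ^ 20)) := by gcongr; exact h.v2 hA g1 h1 h2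
  rw [h.k4]
  exact ⟨e.trans (num1 h.K6 h.KL h.sk h.sk0).2.2.2, e.trans (num2 h.K6 h.KL h.sk h.sk0 h.sk1).2.1⟩
lemma T.ne (hA : IsAdjMat N d A) (g2 : (gg s.p s.q ⟨s.x, 1 / s.L ^ 7⟩ A).im ≤ 1 / (8 * s.L ^ 5)) (μ : ℝ) (hμ : |μ - s.x| ≤ 1 / s.L ^ 7)
    (v : Fin N → ℂ) (hv : v ≠ 0) : (HH s.p s.q A).map Complex.ofReal *ᵥ v ≠ (μ : ℂ) • v := fun he => by
  have hL := h.L6; have N6 := h.N6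
  have l0 : 0 < 1 / s.L ^ 7 := by positivity
  have c := h.ctx hA l0
  have e := R_eig c.sH c.hz hv he
  have e1 := congrArg Complex.im c.tr
  have nn : ∀ w : ℂ, (((N:ℂ) - 1) * w).im = ((N:ℝ) - 1) * w.im := fun w => by
    rw [← Complex.im_ofReal_mul]; push_cast; rfl
  have i1 : ((⟨s.x, 1 / s.L ^ 7⟩ : ℂ)⁻¹).im ≥ -1 := by
    refine (abs_le.1 ((Complex.abs_im_le_norm _).trans ?_)).1
    rw [norm_inv]; exact inv_le_one_of_one_le₀ (by linarith [c.hz2])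
  simp only [GG, Complex.sub_im, nn] at e1
  rw [e1] at e
  have n2 : ‖(μ:ℂ) - ⟨s.x, 1 / s.L ^ 7⟩‖ ^ 2 ≤ 2 * (1 / s.L ^ 7) ^ 2 := by
    rw [← Complex.normSq_eq_norm_sq, Complex.normSq_apply]
    have := sq_le_sq' (abs_le.1 hμ).1 (abs_le.1 hμ).2
    simp only [Complex.sub_re, Complex.sub_im, Complex.ofReal_re, Complex.ofReal_im]; nlinarith
  have t : ((N:ℝ) - 1) * (gg s.p s.q ⟨s.x, 1 / s.L ^ 7⟩ A).im - ((⟨s.x, 1 / s.L ^ 7⟩ : ℂ)⁻¹).im ≤ s.L ^ 7 / 4 := by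
    have : ((N:ℝ) - 1) * (gg s.p s.q ⟨s.x, 1 / s.L ^ 7⟩ A).im ≤ N * (1 / (8 * s.L ^ 5)) := by
      have := c.g_im; gcongr; linarith
    have e2 : (N:ℝ) * (1 / (8 * s.L ^ 5)) = s.L ^ 7 / 8 := by rw [← h.LN]; field_simp
    have : s.L ≤ s.L ^ 7 := le_self_pow₀ (by linarith) (by norm_num)
    linarith
  have : ‖(μ:ℂ) - ⟨s.x, 1 / s.L ^ 7⟩‖ ^ 2 * (((N:ℝ) - 1) * (gg s.p s.q ⟨s.x, 1 / s.L ^ 7⟩ A).im - ((⟨s.x, 1 / s.L ^ 7⟩ : ℂ)⁻¹).im) ≤ 2 * (1 / s.L ^ 7) ^ 2 * (s.L ^ 7 / 4) := by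
    calc _ ≤ ‖(μ:ℂ) - ⟨s.x, 1 / s.L ^ 7⟩‖ ^ 2 * (s.L ^ 7 / 4) := by gcongr
      _ ≤ _ := by gcongr
  have e3 : 2 * (1 / s.L ^ 7) ^ 2 * (s.L ^ 7 / 4) = 1 / s.L ^ 7 / 2 := by field_simp; norm_num
  simp only at e
  linarith
end
/-- no eigenvalue near `x` -/
def NE (N : ℕ) (s : Dt) (A : Matrix (Fin N) (Fin N) ℝ) : Prop := ∀ μ : ℝ, |μ - s.x| ≤ 1 / s.L ^ 7 → ∀ v : Fin N → ℂ, v ≠ 0 → (HH s.p s.q A).map Complex.ofReal *ᵥ v ≠ (μ : ℂ) • v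
theorem NE_Sm {κ : ℝ} (hκ : 0 < κ) : Sm κ (fun N _ s A => NE N s A) := by
  have E1 := Om_path hκ (fun _ s => 1 / s.L ^ 6) (fun N _ => N) fun N d s h => ⟨by have := h.L6; positivity, h.l61.trans (by linarith [h.N6])⟩
  have F1 := mom_Sm hκ E1 (fun s => 1 / s.L ^ 6) (fun s => √s.k / (s.L ^ 4 * s.K ^ 23))
    (fun N d s h => ⟨h.l6, h.l61, by rw [← h.LN]; exact (num3 h.K6 h.KL h.sk h.sk0 h.sk1 (V := 0) le_rfl (by have := h.L6; positivity)).2.2.2.1⟩)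
    (fun N d s A h hA e => by
      have a := h.aq1 hA e
      have V := h.V1 le_rfl a
      obtain ⟨n1, n2, n3, -⟩ := num3 h.K6 h.KL h.sk h.sk0 h.sk1 a.V0.le V
      have m := num2 h.K6 h.KL h.sk h.sk0 h.sk1
      have hL := h.L6
      refine h.TT (m := s.L ^ 6) le_rfl a (by rw [← h.LN]; field_simp) (V.trans m.2.2.1) (m.2.2.2.2.trans ?_) n1 n2 n3
      have := h.sk0; gcongr <;> [linarith; norm_num])
  have E2 := (E1.and F1).and (Om_path hκ (fun _ s => 1 / s.L ^ 7) (fun _ s => 1 / s.L ^ 6) fun N d s h => ⟨by have := h.L6; positivity, h.l67⟩)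
  have F2 := mom_Sm hκ E2 (fun s => 1 / s.L ^ 7) (fun s => √s.k / (s.L ^ 5 * s.K ^ 2))
    (fun N d s h => ⟨h.l7, h.l67.trans h.l61, by rw [← h.LN]; exact (num4 h.K6 h.KL h.sk h.sk0 (V := 0) le_rfl (by have := h.L6; have := h.K6; positivity)).2.2.2.1⟩)
    (fun N d s A h hA e => by
      have a := h.aq1 hA e.1.1
      have g1 := h.im1 a e.1.2
      have V := h.v2 hA g1 le_rfl h.l67
      have a := h.aq2 hA a g1 e.2
      obtain ⟨n1, n2, n3, -⟩ := num4 h.K6 h.KL h.sk h.sk0 a.V0.le V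
      have m := num2 h.K6 h.KL h.sk h.sk0 h.sk1
      have hL := h.L6
      exact h.TT (m := s.L ^ 5) h.l67 a (by rw [← h.LN]; field_simp) (V.trans m.2.2.2.1) m.2.2.2.2 n1 n2 n3)
  refine (E2.and F2).mono fun N d s A h hA e => ?_
  have a := h.aq1 hA e.1.1.1
  have g1 := h.im1 a e.1.1.2
  have V := h.v2 hA g1 le_rfl h.l67
  have a := h.aq2 hA a g1 e.1.2
  refine h.ne hA (le_of_mul_le_mul_right (a.imf.trans (le_trans ?_ (num4 h.K6 h.KL h.sk h.sk0 a.V0.le V).2.2.2.2)) h.sk0)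
  have := e.2
  simp only at this ⊢; linarith
end RR
namespace RR
variable {N : ℕ}
/-- no large eigenvalue -/
def NL (N : ℕ) (p q : ℝ) (A : Matrix (Fin N) (Fin N) ℝ) : Prop :=
  ∀ μ : ℝ, 2 + p / 8 ≤ |μ| → |μ| ≤ N → ∀ v : Fin N → ℂ, v ≠ 0 → (HH p q A).map Complex.ofReal *ᵥ v ≠ (μ : ℂ) • v
theorem grid {κ : ℝ} (hκ : 0 < κ) (D : ℕ) : ∃ N0 : ℕ, ∀ N ≥ N0, ∀ d s, T κ N d s → bd N d (NL N s.p s.q) * (N : ℝ) ^ D ≤ (Gr N d).card := by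
  have S : Sm κ (fun N _ s A => NE N s A ∧ NE N { s with x := -s.x } A) := (NE_Sm hκ).and fun D => by
    obtain ⟨n, hn⟩ := NE_Sm hκ D
    refine ⟨n, fun N hN d s h => hn N hN d { s with x := -s.x } ?_⟩
    exact { h with hx := by simpa using h.hx, hxN := by simpa using h.hxN, hk := by simpa using h.hk }
  obtain ⟨n, hn⟩ := S (D + 2)
  refine ⟨n, fun N hN d s h => ?_⟩
  have hL := h.L6; have N6 := h.N6
  have p0 : 0 ≤ s.p := by rw [h.hp]; positivity
  let x : ℕ → ℝ := fun j => 2 + s.p / 8 + j / s.L ^ 7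
  let t : ℕ → Dt := fun j => { s with x := x j, k := min (|x j| - 2) 1 }
  have x0 : ∀ j, |x j| = x j := fun j => abs_of_nonneg (by positivity)
  have b : bd N d (fun A => ∀ j < N ^ 2, x j ≤ N → NE N (t j) A ∧ NE N { t j with x := - x j } A) ≤ (N ^ 2 : ℕ) * ((Gr N d).card / (N : ℝ) ^ (D + 2)) := by
    refine bd_all _ fun j _ => ?_
    by_cases hx : x j ≤ N
    · rw [le_div_iff₀ (by positivity)]
      refine le_trans ?_ (hn N hN d (t j) ?_)
      · gcongr; exact bd_mono fun A _ hA _ => hA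
      · exact { h with hx := by rw [x0]; show 2 + s.p / 8 ≤ 2 + s.p / 8 + j / s.L ^ 7
                                have : 0 ≤ j / s.L ^ 7 := by positivity
                                linarith
                       hxN := by rw [x0]; exact hx
                       hk := rfl }
    · simp only [hx, false_imp_iff, bd]; simp; positivity
  calc _ ≤ ((N ^ 2 : ℕ) * ((Gr N d).card / (N : ℝ) ^ (D + 2))) * (N : ℝ) ^ D := by
        refine mul_le_mul_of_nonneg_right (le_trans (bd_mono fun A _ hA μ h1 h2 v hv => ?_) b) (by positivity)
        set j := ⌊(|μ| - (2 + s.p / 8)) * s.L ^ 7⌋₊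
        have f1 : (j:ℝ) ≤ (|μ| - (2 + s.p / 8)) * s.L ^ 7 := Nat.floor_le (mul_nonneg (by linarith) (by positivity))
        have f2 := Nat.lt_floor_add_one ((|μ| - (2 + s.p / 8)) * s.L ^ 7)
        have f3 : j / s.L ^ 7 ≤ |μ| - (2 + s.p / 8) := by rwa [div_le_iff₀ (by positivity)]
        have f4 : |μ| - (2 + s.p / 8) ≤ j / s.L ^ 7 + 1 / s.L ^ 7 := by rw [← add_div, le_div_iff₀ (by positivity)]; exact f2.le
        have f5 : j < N ^ 2 := by
          have : (j:ℝ) < N ^ 2 := by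
            calc (j:ℝ) ≤ _ := f1
              _ < N * s.L ^ 7 := by gcongr; linarith
              _ ≤ N * s.L ^ 12 := by gcongr <;> [linarith; norm_num]
              _ = _ := by rw [h.LN]; ring
          exact_mod_cast this
        obtain ⟨g1, g2⟩ := hA j f5 (by show 2 + s.p / 8 + j / s.L ^ 7 ≤ N; linarith)
        rcases abs_cases μ with ⟨e, -⟩ | ⟨e, -⟩
        · refine g1 μ ?_ v hv
          show |μ - (2 + s.p / 8 + j / s.L ^ 7)| ≤ 1 / s.L ^ 7
          rw [e] at f3 f4; rw [abs_le]; constructor <;> linarith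
        · refine g2 μ ?_ v hv
          show |μ - -(2 + s.p / 8 + j / s.L ^ 7)| ≤ 1 / s.L ^ 7
          rw [e] at f3 f4; rw [abs_le]; constructor <;> linarith
    _ = _ := by push_cast; rw [pow_add]; field_simp
/-- circulant row -/
def cr (N d x : ℕ) : ℝ := if (N + 1 - d) / 2 ≤ x ∧ x ≤ N - (N + 1 - d) / 2 ∧ (2 ∣ N → 2 ∣ d → 2 * x ≠ N) then 1 else 0
lemma cr_sum {d : ℕ} (hd : 2 * d ≤ N) (d0 : 0 < d) (he : 2 ∣ d * N) : ∑ x ∈ Finset.range N, cr N d x = d := by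
  unfold cr
  rw [Finset.sum_boole]
  norm_cast
  by_cases h : 2 ∣ N ∧ 2 ∣ d
  · have : (Finset.range N).filter (fun x => (N + 1 - d) / 2 ≤ x ∧ x ≤ N - (N + 1 - d) / 2 ∧ (2 ∣ N → 2 ∣ d → 2 * x ≠ N)) = (Finset.Icc ((N + 1 - d) / 2) (N - (N + 1 - d) / 2)).erase (N / 2) := by
      ext x; simp only [Finset.mem_filter, Finset.mem_range, Finset.mem_erase, Finset.mem_Icc, h.1, h.2, true_imp_iff]; omega
    rw [this, Finset.card_erase_of_mem (by rw [Finset.mem_Icc]; omega), Nat.card_Icc]; omega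
  · have h2 : 2 ∣ d ∨ 2 ∣ N := (Nat.prime_two.dvd_mul).1 he
    have : (Finset.range N).filter (fun x => (N + 1 - d) / 2 ≤ x ∧ x ≤ N - (N + 1 - d) / 2 ∧ (2 ∣ N → 2 ∣ d → 2 * x ≠ N)) = Finset.Icc ((N + 1 - d) / 2) (N - (N + 1 - d) / 2) := by
      ext x; simp only [Finset.mem_filter, Finset.mem_range, Finset.mem_Icc]; constructor
      · omega
      · intro hx; exact ⟨by omega, hx.1, hx.2, fun a b => (h ⟨a, b⟩).elim⟩
    rw [this, Nat.card_Icc]; omega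
lemma Gr_ne {d : ℕ} (hd : 2 * d ≤ N) (d0 : 0 < d) (he : 2 ∣ d * N) : ∃ A, IsAdjMat N d A := by
  have : NeZero N := ⟨by omega⟩
  refine ⟨Matrix.of fun i j => cr N d (j - i : Fin N).val, ?_, fun i => ?_, fun i j => ?_, fun i => ?_⟩
  · ext i j
    simp only [transpose_apply, of_apply]
    rw [← neg_sub j i, Fin.val_neg']
    obtain ⟨x, hx⟩ : ∃ x, x = j - i := ⟨_, rfl⟩
    rw [← hx]
    have := x.isLt
    by_cases h0 : x.val = 0
    · rw [h0]; simp
    · rw [Nat.mod_eq_of_lt (by omega)]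
      unfold cr
      congr 1
      apply propext
      constructor <;> rintro ⟨a, b, c⟩ <;> refine ⟨by omega, by omega, fun u v => ?_⟩ <;> have := c u v <;> omega
  · simp only [of_apply, sub_self, Fin.val_zero]
    unfold cr; rw [if_neg]; omega
  · simp only [of_apply, cr]; split_ifs <;> simp
  · simp only [of_apply]
    rw [← cr_sum hd d0 he, ← Fin.sum_univ_eq_sum_range]
    exact Fintype.sum_equiv (Equiv.subRight i) _ _ fun j => rfl
end RR
namespace RR
variable {N : ℕ}
section
variable {d : ℕ} {A : Matrix (Fin N) (Fin N) ℝ} (hA : IsAdjMat N d A)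
include hA
lemma ad_sum (v : Fin N → ℝ) : ∑ x, (A *ᵥ v) x = d * ∑ x, v x := by
  simp only [mulVec, dotProduct]
  rw [Finset.sum_comm, Finset.mul_sum]
  refine Finset.sum_congr rfl fun y _ => ?_
  rw [← Finset.sum_mul, ← hA.2.2.2 y]
  congr 1; refine Finset.sum_congr rfl fun x _ => hA.1.apply y x
lemma ad_perp {v : Fin N → ℝ} {l : ℝ} (h : A *ᵥ v = l • v) (hl : l ≠ d) : ∑ x, v x = 0 := by
  have := ad_sum hA v
  rw [h] at this
  simp only [Pi.smul_apply, smul_eq_mul, ← Finset.mul_sum] at this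
  by_contra h0
  exact hl (mul_right_cancel₀ h0 this)
lemma ad_le {v : Fin N → ℝ} {l : ℝ} (h : A *ᵥ v = l • v) (hv : v ≠ 0) : |l| ≤ d := by
  obtain ⟨y, hy⟩ := Function.ne_iff.1 hv
  have : Nonempty (Fin N) := ⟨y⟩
  obtain ⟨x, hx⟩ := Finite.exists_max fun x => |v x|
  have x0 : 0 < |v x| := lt_of_lt_of_le (abs_pos.2 hy) (hx y)
  refine le_of_mul_le_mul_right ?_ x0
  have e := congrFun h x
  simp only [Pi.smul_apply, smul_eq_mul, mulVec, dotProduct] at e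
  rw [← abs_mul, ← e, ← hA.2.2.2 x, Finset.sum_mul]
  refine (Finset.abs_sum_le_sum_abs _ _).trans (Finset.sum_le_sum fun z _ => ?_)
  have a0 : 0 ≤ A x z := by rcases hA.2.2.1 x z with e | e <;> rw [e]; norm_num
  rw [abs_mul, abs_of_nonneg a0]; exact mul_le_mul_of_nonneg_left (hx z) a0
variable {κ : ℝ} {s : Dt} (h : T κ N d s) (hn : NL N s.p s.q A)
include h hn
lemma low {v : Fin N → ℝ} {l : ℝ} (he : A *ᵥ v = l • v) (hv : v ≠ 0) (h0 : ∑ x, v x = 0) : |l| < 2 * √((d:ℝ) - 1) := by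
  have hL := h.L6; have hK := h.K6; have N6 := h.N6; have hp := h.hp; have q0 := h.hq; have q2 := h.hq2; have d1 := h.d1
  have h2d : 2 * (d:ℝ) ≤ N := by exact_mod_cast h.h2d
  have p0 : 0 ≤ s.p := by rw [hp]; positivity
  have p1 : s.p ≤ 1 / 2 := by rw [hp, div_le_iff₀ (by linarith)]; linarith
  by_contra hc
  push Not at hc
  have dL : (s.L) ^ 8 ≤ d := le_trans (le_mul_of_one_le_left (by positivity) (one_le_pow₀ (by linarith))) h.dL
  have d2 : 2 * (N:ℝ) ≤ d ^ 2 := by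
    rw [← h.LN]
    calc _ ≤ s.L ^ 4 * s.L ^ 12 := by gcongr; linarith [le_self_pow₀ (by linarith : 1 ≤ s.L) (by norm_num : 4 ≠ 0)]
      _ = (s.L ^ 8) ^ 2 := by ring
      _ ≤ _ := by gcongr
  have pd : 2 ≤ s.p * d := by rw [hp, div_mul_eq_mul_div, le_div_iff₀ (by linarith)]; linarith
  have m1 : (2 + s.p / 8) * s.q ≤ 2 * √((d:ℝ) - 1) := by
    refine (abs_le_of_sq_le_sq' ?_ (by positivity)).2
    rw [mul_pow, mul_pow, Real.sq_sqrt (by linarith), q2]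
    have : (2 + s.p / 8) ^ 2 * (1 - s.p) ≤ 4 - 2 * s.p := by nlinarith [mul_nonneg p0 p0, mul_nonneg p0 (mul_nonneg p0 p0)]
    nlinarith
  have qh : 1 / 2 ≤ s.q := by nlinarith
  refine hn (l / s.q) ?_ ?_ (cc v) ?_ ?_
  · rw [abs_div, abs_of_pos q0, le_div_iff₀ q0]; linarith
  · rw [abs_div, abs_of_pos q0, div_le_iff₀ q0]
    have := ad_le hA he hv; nlinarith
  · intro e; apply hv; ext x; have := congrFun e x; simpa [cc] using this
  · ext x
    have e := congrFun he x
    simp only [Pi.smul_apply, smul_eq_mul, mulVec, dotProduct] at e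
    have e2 : ∑ y, HH s.p s.q A x y * v y = l / s.q * v x := by
      have : ∀ y, HH s.p s.q A x y * v y = (A x y * v y - s.p * v y) / s.q := fun y => by simp only [HH, of_apply]; ring
      simp only [this]
      rw [← Finset.sum_div, Finset.sum_sub_distrib, ← Finset.mul_sum, h0, e]; ring
    simp only [Pi.smul_apply, smul_eq_mul, mulVec, dotProduct, map_apply, cc]
    exact_mod_cast e2
theorem ram : max |eigval A N| (eigval A 2) < 2 * √((d:ℝ) - 1) := by
  have hH : A.IsHermitian := by rw [IsHermitian, conjTranspose_eq_transpose_of_trivial]; exact hA.1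
  have N4 := h.N4
  have ev := fun i => hH.mulVec_eigenvectorBasis i
  have nz : ∀ i, (hH.eigenvectorBasis i : Fin N → ℝ) ≠ 0 := fun i e => hH.eigenvectorBasis.orthonormal.ne_zero i (by ext x; exact congrFun e x)
  have key : ∀ i j, i ≠ j → hH.eigenvalues i ≤ hH.eigenvalues j → hH.eigenvalues i < 2 * √((d:ℝ) - 1) := fun i j hij hle => by
    by_cases hi : ∑ x, hH.eigenvectorBasis i x = 0
    · exact (le_abs_self _).trans_lt (low hA h hn (ev i) (nz i) hi)
    by_cases hj : ∑ x, hH.eigenvectorBasis j x = 0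
    · exact hle.trans_lt ((le_abs_self _).trans_lt (low hA h hn (ev j) (nz j) hj))
    have ei : hH.eigenvalues i = d := by by_contra hc; exact hi (ad_perp hA (ev i) hc)
    have ej : hH.eigenvalues j = d := by by_contra hc; exact hj (ad_perp hA (ev j) hc)
    set a := ∑ x, hH.eigenvectorBasis i x
    set b := ∑ x, hH.eigenvectorBasis j x
    refine (le_abs_self _).trans_lt (low hA h hn (v := b • (hH.eigenvectorBasis i : Fin N → ℝ) - a • (hH.eigenvectorBasis j : Fin N → ℝ)) ?_ ?_ ?_)
    · rw [mulVec_sub, mulVec_smul, mulVec_smul, ev, ev, ei, ej, smul_sub, smul_comm b, smul_comm a]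
    · intro e
      have e' : b • hH.eigenvectorBasis i - a • hH.eigenvectorBasis j = 0 := by ext x; exact congrFun e x
      have := congrArg (inner ℝ (hH.eigenvectorBasis i)) e'
      rw [inner_sub_right, inner_smul_right, inner_smul_right, hH.eigenvectorBasis.inner_eq_zero hij, real_inner_self_eq_norm_sq, hH.eigenvectorBasis.norm_eq_one] at this
      simp at this; exact hj this
    · simp only [Pi.sub_apply, Pi.smul_apply, smul_eq_mul, Finset.sum_sub_distrib, ← Finset.mul_sum]
      change b * a - a * b = 0; ring
  have mono := Tuple.monotone_sort hH.eigenvalues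
  have h2 : eigval A 2 < 2 * √((d:ℝ) - 1) := by
    rw [eigval, dif_pos hH, dif_pos (by omega)]
    refine key _ (Tuple.sort hH.eigenvalues (Fin.rev ⟨0, by omega⟩)) ?_ ?_
    · rw [Ne, (Tuple.sort hH.eigenvalues).injective.eq_iff, Fin.rev_inj]; simp
    · exact mono (Fin.rev_le_rev.2 (by simp))
  refine max_lt ?_ h2
  have hl : eigval A N ≤ eigval A 2 := by
    rw [eigval, eigval, dif_pos hH, dif_pos hH, dif_pos (by omega), dif_pos (by omega)]
    exact mono (Fin.rev_le_rev.2 (by rw [Fin.le_def]; simp; omega))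
  rcases le_or_gt 0 (eigval A N) with h0 | h0
  · rw [abs_of_nonneg h0]; exact hl.trans_lt h2
  · rw [eigval, dif_pos hH, dif_pos (by omega)] at h0 ⊢
    exact low hA h hn (ev _) (nz _) (ad_perp hA (ev _) (by have : (0:ℝ) ≤ d := by positivity
                                                           linarith))
end
end RR
namespace RR
variable {N : ℕ}
lemma mkT {τ : ℝ} (hτ : 0 < τ) : ∃ κ : ℝ, 0 < κ ∧ ∃ n : ℕ, ∀ d N : ℕ, n ≤ d → 2 * d ≤ N → (N:ℝ) ≤ (d:ℝ) ^ (3 / 2 - τ : ℝ) → ∃ s, T κ N d s := by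
  obtain ⟨e, he⟩ : ∃ e, e = min τ (1 / 2) := ⟨_, rfl⟩
  have e0 : 0 < e := by rw [he]; positivity
  have e1 : e ≤ τ := by rw [he]; exact min_le_left _ _
  have e2 : e ≤ 1 / 2 := by rw [he]; exact min_le_right _ _
  obtain ⟨κ, hκ⟩ : ∃ κ, κ = e / 1000 := ⟨_, rfl⟩
  have k0 : 0 < κ := by rw [hκ]; positivity
  obtain ⟨n, hn⟩ := exists_nat_ge (((10:ℝ) ^ 6) ^ (1 / κ))
  refine ⟨κ, k0, n + 1, fun d N hd h2 hN => ?_⟩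
  have d1 : (1:ℝ) ≤ d := by exact_mod_cast (by omega : 1 ≤ d)
  have hdN : (d:ℝ) ≤ N := by exact_mod_cast (by omega : d ≤ N)
  have h2' : 2 * (d:ℝ) ≤ N := by exact_mod_cast h2
  have N0 : (0:ℝ) < N := by linarith
  have hnd : (n:ℝ) ≤ d := by exact_mod_cast (by omega : n ≤ d)
  have K6 : (10:ℝ) ^ 6 ≤ (N:ℝ) ^ κ := by
    have := Real.rpow_le_rpow (by positivity) (hn.trans (hnd.trans hdN)) k0.le
    rwa [← Real.rpow_mul (by positivity), one_div_mul_cancel k0.ne', Real.rpow_one] at this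
  have pw : ∀ (a : ℝ) (m : ℕ), ((N:ℝ) ^ a) ^ m = (N:ℝ) ^ (a * m) := fun a m => by rw [Real.rpow_mul N0.le, Real.rpow_natCast]
  have hN' : (N:ℝ) ≤ (d:ℝ) ^ (3 / 2 - e : ℝ) := hN.trans (Real.rpow_le_rpow_of_exponent_le d1 (by linarith))
  have p0 : (0:ℝ) ≤ d / N := by positivity
  have p1 : (d:ℝ) / N ≤ 1 / 2 := by rw [div_le_iff₀ N0]; linarith
  have q0 : 0 < (d:ℝ) * (1 - d / N) := mul_pos (by linarith) (by linarith)
  refine ⟨⟨2 + d / N / 8, d / N, √(d * (1 - d / N)), min (|2 + (d:ℝ) / N / 8| - 2) 1, (N:ℝ) ^ κ, (N:ℝ) ^ (1 / 12 : ℝ)⟩, ⟨K6, rfl, ?_, ?_, ?_, h2, rfl, Real.sqrt_pos.2 q0, Real.sq_sqrt q0.le, le_abs_self _, ?_, rfl⟩⟩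
  · rw [pw]; exact Real.rpow_le_rpow_of_exponent_le (by linarith) (by rw [hκ]; push_cast; linarith)
  · simp only; rw [pw]; norm_num
  · simp only; rw [pw, pw, ← Real.rpow_add N0]
    calc _ ≤ ((d:ℝ) ^ (3 / 2 - e : ℝ)) ^ (κ * (60:ℕ) + 1 / 12 * (8:ℕ)) := by gcongr
      _ = (d:ℝ) ^ ((3 / 2 - e) * (κ * (60:ℕ) + 1 / 12 * (8:ℕ))) := by rw [← Real.rpow_mul (by linarith)]
      _ ≤ (d:ℝ) ^ (1:ℝ) := Real.rpow_le_rpow_of_exponent_le d1 (by rw [hκ]; push_cast; nlinarith)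
      _ = _ := Real.rpow_one _
  · simp only; rw [abs_of_nonneg (by positivity)]
    have : (N:ℝ) ^ κ ≤ N ^ (1:ℝ) := Real.rpow_le_rpow_of_exponent_le (by linarith) (by rw [hκ]; linarith)
    rw [Real.rpow_one] at this; linarith
theorem fin {D τ : ℝ} (hD : 0 < D) (hτ : 0 < τ) :
    ∃ d₀ : ℕ, 0 < d₀ ∧ ∀ d : ℕ, d₀ ≤ d → ∀ N : ℕ,
      2 * d ≤ N → (N : ℝ) ≤ (d : ℝ) ^ (3 / 2 - τ : ℝ) → Even (d * N) →
      1 - (N : ℝ) ^ (-D) ≤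
        PrReg N d (fun A =>
          max |eigval A N| (eigval A 2) < 2 * Real.sqrt ((d : ℝ) - 1)) := by
  classical
  obtain ⟨κ, k0, n, hn⟩ := mkT hτ
  obtain ⟨m, hm⟩ := grid k0 ⌈D⌉₊
  refine ⟨n + m + 1, by omega, fun d hd N h2 hN he => ?_⟩
  obtain ⟨s, h⟩ := hn d N (by omega) h2 hN
  have g := hm N (by omega) d s h
  have N1 : (1:ℝ) ≤ N := by linarith [h.N6]
  set E := fun A : Matrix (Fin N) (Fin N) ℝ => max |eigval A N| (eigval A 2) < 2 * √((d:ℝ) - 1)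
  have b : bd N d E ≤ bd N d (NL N s.p s.q) := bd_mono fun A hA e => ram (mem_Gr.1 hA) h e
  obtain ⟨A0, hA0⟩ := Gr_ne h2 (by omega) he.two_dvd
  have c0 : (0:ℝ) < (Gr N d).card := by exact_mod_cast Finset.card_pos.2 ⟨A0, mem_Gr.2 hA0⟩
  have c1 : (Nat.card {A : Matrix (Fin N) (Fin N) ℝ // IsAdjMat N d A} : ℝ) = (Gr N d).card := by
    rw [Nat.subtype_card (Gr N d) fun A => mem_Gr]
  have c2 : (Nat.card {A : Matrix (Fin N) (Fin N) ℝ // IsAdjMat N d A ∧ E A} : ℝ) = ((Gr N d).filter E).card := by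
    rw [Nat.subtype_card ((Gr N d).filter E) fun A => by rw [Finset.mem_filter, mem_Gr]]
  have c3 : (((Gr N d).filter E).card : ℝ) + bd N d E = (Gr N d).card := by
    have := Finset.card_filter_add_card_filter_not (s := Gr N d) E
    rw [← this, Nat.cast_add, bd]
  rw [PrReg, c1, c2, le_div_iff₀ c0]
  have p : (N:ℝ) ^ (-(⌈D⌉₊:ℝ)) ≤ (N:ℝ) ^ (-D) := Real.rpow_le_rpow_of_exponent_le N1 (neg_le_neg (Nat.le_ceil D))
  rw [Real.rpow_neg (by linarith), Real.rpow_natCast] at p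
  have n0 : (0:ℝ) < N := by linarith
  have : bd N d E ≤ (N:ℝ) ^ (-D) * (Gr N d).card := by
    calc _ ≤ _ := b
      _ ≤ ((N:ℝ) ^ ⌈D⌉₊)⁻¹ * (Gr N d).card := by rw [inv_mul_eq_div, le_div_iff₀ (by positivity)]; exact g
      _ ≤ _ := by gcongr
  linarith
end RR

/-- For `d` large and `2d ≤ N ≤ d^{3/2-τ}`, a random `d`-regular graph is Ramanujan
with probability at least `1 - N^{-D}`. -/
theorem almost_all_dense_regular_graphs_are_Ramanujan
    (D τ : ℝ) (hD : 0 < D) (hτ : 0 < τ) :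
    ∃ d₀ : ℕ, 0 < d₀ ∧ ∀ d : ℕ, d₀ ≤ d → ∀ N : ℕ,
      2 * d ≤ N → (N : ℝ) ≤ (d : ℝ) ^ (3 / 2 - τ : ℝ) → Even (d * N) →
      1 - (N : ℝ) ^ (-D) ≤
        PrReg N d (fun A =>
          max |eigval A N| (eigval A 2) < 2 * Real.sqrt ((d : ℝ) - 1)) := by
  exact RR.fin hD hτ

end
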